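/- Let χ be a primitive Dirichlet character of conductor m whose order does not divide 6 (extended to ℤ by χ(n) = 0 when gcd(n, m) > 1). Then for every ε > 0 there is a constant C(ε), independent of χ and m, such that for both signs ± and all X ≥ 1: |Σ χ(Disc(K))| ≤ C(ε)·X^{18/23+ε}·m^{20/23+ε}, where the sum runs over isomorphism classes of cubic fields K with 0 < ±Disc(K) < X whose discriminant Disc(K) is a fundamental discriminant (equivalently, no prime is totally ramified in K). -/

import Mathlib

open scoped Classical

noncomputable section

/-- Discriminant of a subfield of `ℂ` (as a number field); junk value `0` if the
subfield is not finite-dimensional over `ℚ`. -/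
noncomputable def subDisc (K : Subfield ℂ) : ℤ :=
  if h : FiniteDimensional ℚ K then
    letI := h
    haveI : NumberField K := ⟨⟩
    NumberField.discr K
  else 0

/-- The number of isomorphism classes of number fields (as subfields of `ℂ`)
satisfying a predicate `P`. -/
noncomputable def countFields (P : Subfield ℂ → Prop) : ℕ :=
  Nat.card (Quot (fun K L : {K : Subfield ℂ // P K} => Nonempty (K.1 ≃+* L.1)))

/-- `D` is a fundamental discriminant: the discriminant of (the ring of integers of)
a quadratic field, or `1`. -/
def IsFundDisc (D : ℤ) : Prop :=
  (∃ K : Subfield ℂ, Module.finrank ℚ K = 2 ∧ subDisc K = D) ∨ D = 1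

/-- The number of isomorphism classes of cubic fields of discriminant exactly `D`. -/
noncomputable def cubicCountDisc (D : ℤ) : ℕ :=
  countFields (fun K => Module.finrank ℚ K = 3 ∧ subDisc K = D)

namespace CF

/-- Integral binary cubic forms `a x³ + b x² y + c x y² + d y³`. -/
@[ext] structure V where
  a : ℤ
  b : ℤ
  c : ℤ
  d : ℤ

namespace V
/-- Value of the form. -/
def ev (f : V) (x y : ℤ) : ℤ := f.a * x^3 + f.b * x^2 * y + f.c * x * y^2 + f.d * y^3
/-- The discriminant. -/
def disc (f : V) : ℤ :=
  f.b^2 * f.c^2 - 4 * f.a * f.c^3 - 4 * f.b^3 * f.d - 27 * f.a^2 * f.d^2 + 18 * f.a * f.b * f.c * f.d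
/-- Hessian coefficients. -/
def hP (f : V) : ℤ := f.b^2 - 3 * f.a * f.c
def hQ (f : V) : ℤ := f.b * f.c - 9 * f.a * f.d
def hR (f : V) : ℤ := f.c^2 - 3 * f.b * f.d
/-- Substitution `f(px+qy, rx+sy)`. -/
def sub (f : V) (p q r s : ℤ) : V where
  a := f.a * p^3 + f.b * p^2 * r + f.c * p * r^2 + f.d * r^3
  b := 3 * f.a * p^2 * q + f.b * (p^2 * s + 2 * p * q * r) + f.c * (2 * p * r * s + q * r^2) + 3 * f.d * r^2 * s
  c := 3 * f.a * p * q^2 + f.b * (2 * p * q * s + q^2 * r) + f.c * (p * s^2 + 2 * q * r * s) + 3 * f.d * r * s^2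
  d := f.a * q^3 + f.b * q^2 * s + f.c * q * s^2 + f.d * s^3
/-- Substitution by a matrix. -/
def act (f : V) (M : Matrix (Fin 2) (Fin 2) ℤ) : V := f.sub (M 0 0) (M 0 1) (M 1 0) (M 1 1)
/-- Scaling. -/
def smul (k : ℤ) (f : V) : V := ⟨k * f.a, k * f.b, k * f.c, k * f.d⟩
/-- Irreducibility over `ℚ`. -/
def irr (f : V) : Prop := ∀ x y : ℤ, f.ev x y = 0 → x = 0 ∧ y = 0

theorem disc_sub (f : V) (p q r s : ℤ) : (f.sub p q r s).disc = (p*s-q*r)^6 * f.disc := by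
  simp only [disc, sub]; ring
theorem disc_act (f : V) (M : Matrix (Fin 2) (Fin 2) ℤ) : (f.act M).disc = M.det^6 * f.disc := by
  rw [act, disc_sub, Matrix.det_fin_two]
theorem act_one (f : V) : f.act 1 = f := by
  ext <;> simp [act, sub]
theorem act_mul (f : V) (M N : Matrix (Fin 2) (Fin 2) ℤ) : f.act (M * N) = (f.act M).act N := by
  ext <;> simp only [act, sub, Matrix.mul_apply, Fin.sum_univ_two] <;> ring
theorem disc_smul (k : ℤ) (f : V) : (f.smul k).disc = k^4 * f.disc := by
  simp only [disc, smul]; ring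
theorem smul_act (k : ℤ) (f : V) (M : Matrix (Fin 2) (Fin 2) ℤ) : (f.smul k).act M = (f.act M).smul k := by
  ext <;> simp only [act, sub, smul] <;> ring
theorem act_scalar (f : V) (k : ℤ) : f.sub k 0 0 k = f.smul (k^3) := by
  ext <;> simp only [sub, smul] <;> ring
theorem smul_smul (k l : ℤ) (f : V) : (f.smul k).smul l = f.smul (k * l) := by
  ext <;> simp only [smul] <;> ring
theorem smul_one (f : V) : f.smul 1 = f := by
  ext <;> simp [smul]
theorem smul_inj {k : ℤ} (hk : k ≠ 0) {f g : V} (h : f.smul k = g.smul k) : f = g := by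
  have h1 := congrArg V.a h; have h2 := congrArg V.b h
  have h3 := congrArg V.c h; have h4 := congrArg V.d h
  simp only [smul] at h1 h2 h3 h4
  ext
  · exact mul_left_cancel₀ hk h1
  · exact mul_left_cancel₀ hk h2
  · exact mul_left_cancel₀ hk h3
  · exact mul_left_cancel₀ hk h4
theorem ev_sub (f : V) (p q r s x y : ℤ) : (f.sub p q r s).ev x y = f.ev (p*x+q*y) (r*x+s*y) := by
  simp only [ev, sub]; ring
theorem ev_smul (k : ℤ) (f : V) (x y : ℤ) : (f.smul k).ev x y = k * f.ev x y := by
  simp only [ev, smul]; ring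
theorem hess (f : V) : 4 * f.hP * f.hR - f.hQ^2 = 3 * f.disc := by
  simp only [hP, hQ, hR, disc]; ring
theorem hP_sub (f : V) (p q r s : ℤ) :
    (f.sub p q r s).hP = (p*s-q*r)^2 * (f.hP * p^2 + f.hQ * p * r + f.hR * r^2) := by
  simp only [hP, hQ, hR, sub]; ring
theorem hQ_sub (f : V) (p q r s : ℤ) :
    (f.sub p q r s).hQ = (p*s-q*r)^2 * (2 * f.hP * p * q + f.hQ * (p * s + q * r) + 2 * f.hR * r * s) := by
  simp only [hP, hQ, hR, sub]; ring
theorem hR_sub (f : V) (p q r s : ℤ) :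
    (f.sub p q r s).hR = (p*s-q*r)^2 * (f.hP * q^2 + f.hQ * q * s + f.hR * s^2) := by
  simp only [hP, hQ, hR, sub]; ring
theorem irr.a_ne {f : V} (h : f.irr) : f.a ≠ 0 := by
  intro h0
  have := h 1 0 (by simp [ev, h0])
  simp at this
theorem irr.d_ne {f : V} (h : f.irr) : f.d ≠ 0 := by
  intro h0
  have := h 0 1 (by simp [ev, h0])
  simp at this
theorem irr.act {f : V} (h : f.irr) {M : Matrix (Fin 2) (Fin 2) ℤ} (hM : M.det ≠ 0) : (f.act M).irr := by
  intro x y hxy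
  rw [V.act, ev_sub] at hxy
  obtain ⟨h1, h2⟩ := h _ _ hxy
  rw [Matrix.det_fin_two] at hM
  constructor
  · refine (mul_eq_zero.mp (?_ : (M 0 0 * M 1 1 - M 0 1 * M 1 0) * x = 0)).resolve_left hM
    linear_combination M 1 1 * h1 - M 0 1 * h2
  · refine (mul_eq_zero.mp (?_ : (M 0 0 * M 1 1 - M 0 1 * M 1 0) * y = 0)).resolve_left hM
    linear_combination M 0 0 * h2 - M 1 0 * h1
theorem irr.of_smul {f : V} {k : ℤ} (h : (f.smul k).irr) : f.irr := by
  intro x y hxy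
  exact h x y (by rw [ev_smul, hxy, mul_zero])
theorem irr.smul {f : V} {k : ℤ} (h : f.irr) (hk : k ≠ 0) : (f.smul k).irr := by
  intro x y hxy
  rw [ev_smul] at hxy
  exact h x y ((mul_eq_zero.mp hxy).resolve_left hk)
theorem disc_mod4 (f : V) : f.disc % 4 = 0 ∨ f.disc % 4 = 1 := by
  have : f.disc = (f.b * f.c + f.a * f.d)^2 + 4 * (- f.a * f.c^3 - f.b^3 * f.d - 7 * f.a^2 * f.d^2 + 4 * f.a * f.b * f.c * f.d) := by
    simp only [disc]; ring
  rw [this]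
  rcases Int.even_or_odd' (f.b * f.c + f.a * f.d) with ⟨k, hk | hk⟩
  · left; rw [hk]; ring_nf; omega
  · right; rw [hk]; ring_nf; omega
end V
end CF

namespace CF
open NumberField

/-- `D` is a fundamental discriminant, elementary version. -/
def Fund (D : ℤ) : Prop :=
  (D % 4 = 0 ∨ D % 4 = 1) ∧ ∀ p : ℕ, p.Prime → ∀ E : ℤ, D = p^2 * E → ¬ (E % 4 = 0 ∨ E % 4 = 1)

theorem sq_mul_mod4 (k E : ℤ) (h : E % 4 = 0 ∨ E % 4 = 1) : (k^2*E) % 4 = 0 ∨ (k^2*E) % 4 = 1 := by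
  have h2 : k^2 % 4 = 0 ∨ k^2 % 4 = 1 := by
    rcases Int.even_or_odd' k with ⟨j, hj | hj⟩
    · left; rw [hj]; ring_nf; omega
    · right; rw [hj]; ring_nf; omega
  rw [Int.mul_emod]
  rcases h with h | h <;> rcases h2 with h2 | h2 <;> simp [h, h2]

theorem Fund.sq_eq {D k E : ℤ} (hD : Fund D) (h : D = k^2 * E) (hE : E % 4 = 0 ∨ E % 4 = 1) :
    k^2 = 1 := by
  by_contra hk
  have h1 : k.natAbs ≠ 1 := by
    intro h1; apply hk
    rw [← Int.natAbs_sq, h1]; norm_num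
  obtain ⟨p, hp, hpk⟩ := Nat.exists_prime_and_dvd h1
  obtain ⟨j, hj⟩ := Int.natCast_dvd.mpr hpk
  exact hD.2 p hp (j^2*E) (by rw [h, hj]; ring) (sq_mul_mod4 _ _ hE)

theorem exists_dual_one (K : Type*) [Field K] [NumberField K] :
    ∃ l : 𝓞 K →ₗ[ℤ] ℤ, l 1 = 1 := by
  let ev : (𝓞 K →ₗ[ℤ] ℤ) →ₗ[ℤ] ℤ := LinearMap.applyₗ (1 : 𝓞 K)
  let I : Ideal ℤ := LinearMap.range ev
  obtain ⟨g, hg⟩ := (inferInstance : I.IsPrincipal)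
  have hI : ∀ l : 𝓞 K →ₗ[ℤ] ℤ, g ∣ l 1 := by
    intro l
    have : l 1 ∈ I := ⟨l, rfl⟩
    rw [hg] at this
    exact Ideal.mem_span_singleton.mp this
  let b := RingOfIntegers.basis K
  have h1 : ∃ x : 𝓞 K, (1 : 𝓞 K) = g • x := by
    have : ∀ i, ∃ y, b.repr 1 i = g * y := fun i => hI (b.coord i)
    choose y hy using this
    refine ⟨∑ i, y i • b i, ?_⟩
    rw [← b.sum_repr (1 : 𝓞 K), Finset.smul_sum]
    refine Finset.sum_congr rfl fun i _ => ?_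
    rw [hy, mul_smul]
  obtain ⟨x, hx⟩ := h1
  have hu : IsUnit (algebraMap ℤ (𝓞 K) g) := by
    refine IsUnit.of_mul_eq_one x ?_
    rw [hx, Algebra.smul_def]
  have hg1 : IsUnit g := by
    have h2 := hu.map (Algebra.norm ℤ (S := 𝓞 K))
    rw [Algebra.norm_algebraMap_of_basis b] at h2
    have : Nonempty (Module.Free.ChooseBasisIndex ℤ (𝓞 K)) := b.index_nonempty
    exact (isUnit_pow_iff Fintype.card_ne_zero).mp h2
  have : (1:ℤ) ∈ I := by
    rw [hg]
    exact Ideal.mem_span_singleton.mpr hg1.dvd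
  exact this

theorem exists_basis_one (K : Type*) [Field K] [NumberField K] {n : ℕ}
    (hn : Module.finrank ℚ K = n + 1) :
    ∃ b : Module.Basis (Fin (n+1)) ℤ (𝓞 K), b 0 = 1 := by
  obtain ⟨l, hl⟩ := exists_dual_one K
  let N := LinearMap.ker l
  have hli : ∀ (c : ℤ), ∀ x ∈ N, c • (1 : 𝓞 K) + x = 0 → c = 0 := by
    intro c x hx h
    have := congrArg l h
    rw [map_add, map_smul, hl, LinearMap.mem_ker.mp hx] at this
    simpa using this
  have hsp : ∀ z : 𝓞 K, ∃ c : ℤ, z + c • (1 : 𝓞 K) ∈ N := by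
    intro z
    refine ⟨- l z, ?_⟩
    rw [LinearMap.mem_ker, map_add, map_smul, hl]; simp
  let bN := Module.finBasis ℤ N
  let b0 := Module.Basis.mkFinCons (1 : 𝓞 K) bN hli hsp
  have hr : Module.finrank ℤ N + 1 = n + 1 := by
    have h1 := Module.finrank_eq_card_basis b0
    rw [RingOfIntegers.rank, hn, Fintype.card_fin] at h1
    exact h1.symm
  refine ⟨b0.reindex (finCongr hr), ?_⟩
  rw [Module.Basis.reindex_apply]
  have : (finCongr hr).symm 0 = 0 := by
    ext; simp
  rw [this]
  simp [b0, Module.Basis.coe_mkFinCons]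
end CF

namespace CF
open NumberField

theorem subDisc_eq (K : Subfield ℂ) [h : NumberField K] : subDisc K = NumberField.discr K := by
  unfold subDisc
  rw [dif_pos h.to_finiteDimensional]

theorem quad_basis {R : Type*} [CommRing R] (b : Module.Basis (Fin 2) ℤ R) (h0 : b 0 = 1) :
    ∃ t n : ℤ, b 1 * b 1 = (t:R) * b 1 - n ∧ Algebra.discr ℤ b = t^2 - 4*n := by
  obtain ⟨t, ht⟩ : ∃ t, t = b.repr (b 1 * b 1) 1 := ⟨_, rfl⟩
  obtain ⟨n, hn⟩ : ∃ n, n = - b.repr (b 1 * b 1) 0 := ⟨_, rfl⟩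
  have hm : b 1 * b 1 = (t:R) * b 1 - n := by
    have := b.sum_repr (b 1 * b 1)
    rw [Fin.sum_univ_two, ← ht, h0] at this
    rw [← this, hn]; simp; ring
  refine ⟨t, n, hm, ?_⟩
  have r1 : b.repr 1 = Finsupp.single 0 1 := by rw [← h0, b.repr_self]
  have tr : ∀ x : R, Algebra.trace ℤ R x = b.repr (x * b 0) 0 + b.repr (x * b 1) 1 := by
    intro x
    rw [Algebra.trace_eq_matrix_trace b, Matrix.trace, Fin.sum_univ_two]
    simp [Algebra.leftMulMatrix_eq_repr_mul]
  have t1 : Algebra.trace ℤ R 1 = 2 := by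
    rw [tr]; simp [h0, r1]
  have tθ : Algebra.trace ℤ R (b 1) = t := by
    rw [tr, ht]; simp [h0]
  have tθ2 : Algebra.trace ℤ R (b 1 * b 1) = t^2 - 2*n := by
    have : b 1 * b 1 = t • b 1 - n • (1:R) := by rw [hm]; simp
    rw [this, map_sub, map_smul, map_smul, t1, tθ]; simp; ring
  rw [Algebra.discr_def, Matrix.det_fin_two]
  simp only [Algebra.traceMatrix_apply, Algebra.traceForm_apply, h0, one_mul, mul_one, t1, tθ, tθ2]
  ring

theorem coords2 {R : Type*} [CommRing R] (b : Module.Basis (Fin 2) ℤ R) {x y : ℤ}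
    (h : x • b 0 + y • b 1 = 0) : x = 0 ∧ y = 0 := by
  have := (Fintype.linearIndependent_iff.mp b.linearIndependent) ![x, y] (by simpa [Fin.sum_univ_two] using h)
  exact ⟨by simpa using this 0, by simpa using this 1⟩

theorem sq_sub_four_mod (t n : ℤ) : (t^2-4*n) % 4 = 0 ∨ (t^2-4*n) % 4 = 1 := by
  rcases Int.even_or_odd' t with ⟨j, hj | hj⟩
  · left; rw [hj]; ring_nf; omega
  · right; rw [hj]; ring_nf; omega

theorem mod4_form {E : ℤ} (h : E % 4 = 0 ∨ E % 4 = 1) : ∃ e k : ℤ, E = e^2 - 4*k := by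
  rcases h with h | h
  · exact ⟨0, -(E/4), by omega⟩
  · exact ⟨1, -(E/4), by omega⟩

/-- If `β` in a quadratic field satisfies `β² = eβ - k` then `e² - 4 k = v² D_K`. -/
theorem quad_core {K : Type*} [Field K] [NumberField K] (b : Module.Basis (Fin 2) ℤ (𝓞 K)) (h0 : b 0 = 1)
    {t n : ℤ} (hm : b 1 * b 1 = (t:𝓞 K) * b 1 - n) {β : K} {e k : ℤ} (hβ : β^2 = e * β - k) :
    ∃ u v : ℤ, β = u + v * (b 1 : K) ∧ (v = 0 ∨ e^2 - 4*k = v^2 * (t^2 - 4*n)) := by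
  have hintg : IsIntegral ℤ β := by
    refine ⟨Polynomial.X^2 - Polynomial.C e * Polynomial.X + Polynomial.C k, by monicity!, ?_⟩
    rw [Polynomial.eval₂_add, Polynomial.eval₂_sub, Polynomial.eval₂_mul, Polynomial.eval₂_C, Polynomial.eval₂_C,
      Polynomial.eval₂_pow, Polynomial.eval₂_X, hβ]
    simp
  let B : 𝓞 K := ⟨β, hintg⟩
  have hB : B^2 = e * B - k := by
    apply RingOfIntegers.ext; push_cast; exact hβ
  obtain ⟨u, hu⟩ : ∃ u, u = b.repr B 0 := ⟨_, rfl⟩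
  obtain ⟨v, hv⟩ : ∃ v, v = b.repr B 1 := ⟨_, rfl⟩
  have hB' : B = u + v * b 1 := by
    have := b.sum_repr B
    rw [Fin.sum_univ_two, ← hu, ← hv, h0] at this
    rw [← this]; simp
  refine ⟨u, v, ?_, ?_⟩
  · have := congrArg (algebraMap (𝓞 K) K) hB'
    rw [map_add, map_mul, map_intCast, map_intCast] at this
    exact this
  · by_cases hv0 : v = 0
    · exact Or.inl hv0
    right
    have h1 : ((u^2 - v^2*n - e*u + k : ℤ)) • b 0 + ((2*u*v + v^2*t - e*v : ℤ)) • b 1 = 0 := by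
      rw [hB'] at hB
      rw [h0]; simp only [zsmul_eq_mul]; push_cast
      linear_combination hB - v^2 * hm
    obtain ⟨h3, h4⟩ := coords2 b h1
    have h5 : e = 2*u+v*t := by
      apply mul_left_cancel₀ hv0
      linear_combination -h4
    subst h5
    linear_combination -4 * h3

theorem fund_of_isFundDisc {D : ℤ} (h : IsFundDisc D) : Fund D := by
  rcases h with ⟨K, hK, hD⟩ | rfl
  · have : FiniteDimensional ℚ K := Module.finite_of_finrank_eq_succ hK
    haveI : NumberField K := ⟨⟩
    rw [subDisc_eq] at hD
    obtain ⟨b, hb⟩ := exists_basis_one K (n := 1) hK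
    obtain ⟨t, n, hm, hd⟩ := quad_basis b hb
    rw [discr_eq_discr, hD] at hd
    refine ⟨hd ▸ sq_sub_four_mod t n, ?_⟩
    intro p hp E hE hE4
    obtain ⟨e, k, hek⟩ := mod4_form hE4
    have hp0 : (p:K) ≠ 0 := by exact_mod_cast hp.ne_zero
    have hm' : (b 1 : K) * b 1 = t * b 1 - n := by
      have := congrArg (algebraMap (𝓞 K) K) hm
      simpa using this
    have hDK : ((t:K)^2 - 4*n) = p^2 * (e^2-4*k) := by
      have := congrArg (Int.cast : ℤ → K) (hd.symm.trans hE)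
      rw [hek] at this
      push_cast at this; exact this
    have hβ : ((e*p + 2 * (b 1:K) - t)/(2*p))^2 = e * ((e*p + 2 * (b 1:K) - t)/(2*p)) - k := by
      field_simp
      linear_combination 4 * hm' + hDK
    obtain ⟨u, v, h1, -⟩ := quad_core b hb hm hβ
    have h2 : (2*p*u - e*p + t : ℤ) • b 0 + (2*p*v - 2 : ℤ) • b 1 = 0 := by
      apply RingOfIntegers.ext
      rw [hb]; push_cast
      field_simp at h1
      simp only [zsmul_eq_mul, map_add, map_mul, map_intCast, map_one, map_zero]
      push_cast
      linear_combination -h1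
    obtain ⟨-, h4⟩ := coords2 b h2
    have h5 : (p:ℤ) * v = 1 := by linarith
    have := Int.isUnit_iff.mp (IsUnit.of_mul_eq_one _ h5)
    have := hp.two_le
    omega
  · refine ⟨by norm_num, ?_⟩
    intro p hp E hE _
    have h5 : (p:ℤ) * (p*E) = 1 := by linarith
    have := Int.isUnit_iff.mp (IsUnit.of_mul_eq_one _ h5)
    have := hp.two_le
    omega

theorem Fund.ne_zero {D : ℤ} (h : Fund D) : D ≠ 0 := by
  rintro rfl
  exact h.2 2 Nat.prime_two 0 (by simp) (by simp)

theorem Fund.not_sq {D : ℤ} (h : Fund D) (h1 : D ≠ 1) (k : ℤ) : D ≠ k^2 := by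
  intro hk
  have := h.sq_eq (k := k) (E := 1) (by rw [hk]; ring) (by norm_num)
  exact h1 (hk.trans this)

/-- Subfield of `ℂ` generated by a root of a monic irreducible polynomial. -/
theorem exists_subfield (P : Polynomial ℚ) (hm : P.Monic) (hP : Irreducible P) :
    ∃ (K : Subfield ℂ) (_ : NumberField K) (x : K), Module.finrank ℚ K = P.natDegree ∧ minpoly ℚ x = P := by
  obtain ⟨z, hz⟩ := IsAlgClosed.exists_aeval_eq_zero ℂ P (Polynomial.degree_pos_of_irreducible hP).ne'
  have hmin : minpoly ℚ z = P := (minpoly.eq_of_irreducible_of_monic hP hz hm).symm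
  have hintg : IsIntegral ℚ z := ⟨P, hm, hz⟩
  let F := IntermediateField.adjoin ℚ {z}
  haveI : FiniteDimensional ℚ F := IntermediateField.adjoin.finiteDimensional hintg
  have hfr : Module.finrank ℚ F = P.natDegree := by
    rw [IntermediateField.adjoin.finrank hintg, hmin]
  have hx : minpoly ℚ (IntermediateField.AdjoinSimple.gen ℚ z) = P := by
    have := IntermediateField.minpoly_gen ℚ z
    rw [hmin] at this
    exact this
  refine ⟨F.toSubfield, ?_, IntermediateField.AdjoinSimple.gen ℚ z, ?_, ?_⟩
  · have : FiniteDimensional ℚ F.toSubfield := ‹FiniteDimensional ℚ F›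
    exact {}
  · rw [← hfr]; rfl
  · rw [← hx]

theorem isFundDisc_of_fund {D : ℤ} (h : Fund D) : IsFundDisc D := by
  by_cases h1 : D = 1
  · exact Or.inr h1
  left
  let P : Polynomial ℚ := Polynomial.X^2 - Polynomial.C (D:ℚ)
  have hPm : P.Monic := by simp only [P]; monicity!
  have hPd : P.natDegree = 2 := by simp only [P]; compute_degree!
  have hPi : Irreducible P := by
    rw [Polynomial.irreducible_iff_roots_eq_zero_of_degree_le_three (by omega) (by omega)]
    rw [Multiset.eq_zero_iff_forall_notMem]
    intro x hx
    have hx' : x^2 = D := by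
      have := (Polynomial.mem_roots'.mp hx).2
      simp [P] at this
      linarith
    have : IsSquare (D : ℚ) := ⟨x, by rw [← hx']; ring⟩
    rw [Rat.isSquare_intCast_iff] at this
    obtain ⟨k, hk⟩ := this
    exact h.not_sq h1 k (by rw [hk]; ring)
  obtain ⟨K, _, s, hK, hs⟩ := exists_subfield P hPm hPi
  rw [hPd] at hK
  refine ⟨K, hK, ?_⟩
  rw [subDisc_eq]
  have hs2 : s^2 = D := by
    have := minpoly.aeval ℚ s
    rw [hs] at this
    simp [P] at this
    linear_combination this
  obtain ⟨b, hb⟩ := exists_basis_one K (n := 1) hK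
  obtain ⟨t, n, hm, hd⟩ := quad_basis b hb
  rw [discr_eq_discr] at hd
  obtain ⟨e, k, hek⟩ := mod4_form h.1
  have hβ : ((e + s)/2)^2 = e * ((e+s)/2) - k := by
    have h3 : s^2 = e^2 - 4*k := by rw [hs2, hek]; push_cast; ring
    linear_combination h3 / 4
  obtain ⟨u, v, h1', h2⟩ := quad_core b hb hm hβ
  have hv : v ≠ 0 := by
    rintro rfl
    have h3 : s = ((2*u-e : ℤ) : K) := by
      push_cast; push_cast at h1'
      linear_combination 2 * h1'
    rw [h3] at hs2
    exact h.not_sq h1 (2*u-e) (by exact_mod_cast hs2.symm)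
  have h3 := h2.resolve_left hv
  rw [← hek] at h3
  have h4 := h.sq_eq h3 (sq_sub_four_mod t n)
  rw [hd, h3, h4, one_mul]

theorem isFundDisc_iff {D : ℤ} : IsFundDisc D ↔ Fund D := ⟨fund_of_isFundDisc, isFundDisc_of_fund⟩
end CF

namespace CF
open NumberField

/-- Multiplication table of the cubic ring attached to `f`. -/
def Tab {R : Type*} [CommRing R] (f : V) (ω θ : R) : Prop :=
  ω * ω = -(f.a * f.c : ℤ) - f.b * ω + f.a * θ ∧ ω * θ = -(f.a * f.d : ℤ) ∧
  θ * θ = -(f.b * f.d : ℤ) - f.d * ω + f.c * θ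

/-- `1, ω, θ` is a `ℤ`-basis. -/
def IsB {R : Type*} [CommRing R] (ω θ : R) : Prop :=
  (∀ z : R, ∃ u v w : ℤ, z = u + v * ω + w * θ) ∧
  (∀ u v w : ℤ, (u:R) + v * ω + w * θ = 0 → u = 0 ∧ v = 0 ∧ w = 0)

def Rep (R : Type*) [CommRing R] (f : V) : Prop := ∃ ω θ : R, IsB ω θ ∧ Tab f ω θ

section ring
variable {R : Type*} [CommRing R]

theorem IsB.basis {ω θ : R} (h : IsB ω θ) : ∃ b : Module.Basis (Fin 3) ℤ R, b 0 = 1 ∧ b 1 = ω ∧ b 2 = θ := by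
  have hli : LinearIndependent ℤ ![(1:R), ω, θ] := by
    rw [Fintype.linearIndependent_iff]
    intro g hg
    rw [Fin.sum_univ_three] at hg
    obtain ⟨h0, h1, h2⟩ := h.2 (g 0) (g 1) (g 2) (by simpa using hg)
    intro i; fin_cases i <;> assumption
  have hsp : ⊤ ≤ Submodule.span ℤ (Set.range ![(1:R), ω, θ]) := by
    intro z _
    obtain ⟨u, v, w, rfl⟩ := h.1 z
    have h0 : (1:R) ∈ Submodule.span ℤ (Set.range ![(1:R), ω, θ]) := Submodule.subset_span ⟨0, rfl⟩
    have h1 : ω ∈ Submodule.span ℤ (Set.range ![(1:R), ω, θ]) := Submodule.subset_span ⟨1, rfl⟩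
    have h2 : θ ∈ Submodule.span ℤ (Set.range ![(1:R), ω, θ]) := Submodule.subset_span ⟨2, rfl⟩
    have := add_mem (add_mem (Submodule.smul_mem _ u h0) (Submodule.smul_mem _ v h1)) (Submodule.smul_mem _ w h2)
    simpa using this
  refine ⟨Module.Basis.mk hli hsp, ?_, ?_, ?_⟩ <;> simp

theorem IsB.of_basis (b : Module.Basis (Fin 3) ℤ R) (h0 : b 0 = 1) : IsB (b 1) (b 2) := by
  constructor
  · intro z
    refine ⟨b.repr z 0, b.repr z 1, b.repr z 2, ?_⟩
    have := b.sum_repr z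
    rw [Fin.sum_univ_three, h0] at this
    simpa using this.symm
  · intro u v w h
    have := (Fintype.linearIndependent_iff.mp b.linearIndependent) ![u, v, w]
      (by simpa [Fin.sum_univ_three, h0] using h)
    exact ⟨by simpa using this 0, by simpa using this 1, by simpa using this 2⟩

theorem IsB.translate {ω θ : R} (h : IsB ω θ) (m n : ℤ) : IsB (ω - m) (θ - n) := by
  constructor
  · intro z
    obtain ⟨u, v, w, rfl⟩ := h.1 z
    exact ⟨u + v*m + w*n, v, w, by push_cast; ring⟩
  · intro u v w hz
    obtain ⟨h1, h2, h3⟩ := h.2 (u - v*m - w*n) v w (by push_cast; linear_combination hz)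
    subst h2 h3
    simpa using h1

/-- Coordinates are unique. -/
theorem IsB.ext {ω θ : R} (h : IsB ω θ) {u v w u' v' w' : ℤ}
    (e : (u:R) + v * ω + w * θ = u' + v' * ω + w' * θ) : u = u' ∧ v = v' ∧ w = w' := by
  obtain ⟨h1, h2, h3⟩ := h.2 (u-u') (v-v') (w-w') (by push_cast; linear_combination e)
  exact ⟨by omega, by omega, by omega⟩

/-- Normalization: every basis can be translated to one with a cubic form table. -/
theorem IsB.normalize {ω θ : R} (h : IsB ω θ) : ∃ (f : V) (m n : ℤ), Tab f (ω - m) (θ - n) := by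
  obtain ⟨k, n, m, hnm⟩ := h.1 (ω * θ)
  have hB := h.translate m n
  set ω' := ω - m with hω'
  set θ' := θ - n with hθ'
  have h2 : ω' * θ' = ((k + m * n : ℤ) : R) := by
    rw [hω', hθ']; push_cast; linear_combination hnm
  set N := k + m * n
  obtain ⟨x, y, z, h1⟩ := hB.1 (ω' * ω')
  obtain ⟨x', y', z', h3⟩ := hB.1 (θ' * θ')
  -- associativity
  have e1 : ((y * N + z * x' : ℤ):R) + (z*y' : ℤ) * ω' + (x + z*z' : ℤ) * θ' = (0:ℤ) + (N:ℤ) * ω' + (0:ℤ) * θ' := by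
    push_cast
    linear_combination (-θ') * h1 - (z:R) * h3 + (ω' - y) * h2
  obtain ⟨a1, a2, a3⟩ := hB.ext e1
  have e2 : ((y' * x + z' * N : ℤ):R) + (x' + y'*y : ℤ) * ω' + (y'*z : ℤ) * θ' = (0:ℤ) + (0:ℤ) * ω' + (N:ℤ) * θ' := by
    push_cast
    linear_combination (-ω') * h3 - (y':R) * h1 + (θ' - z') * h2
  obtain ⟨b1, b2, b3⟩ := hB.ext e2
  refine ⟨⟨z, -y, z', -y'⟩, m, n, ?_, ?_, ?_⟩
  · rw [h1, show x = -(z*z') by omega]; push_cast; ring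
  · rw [h2, ← a2]; push_cast; ring
  · rw [h3, show x' = -(y'*y) by omega]; push_cast; ring

/-- The wedge formula. -/
theorem Tab.wedge {f : V} {ω θ : R} (h : Tab f ω θ) (x y : ℤ) : ∃ n A B : ℤ,
    ((x:R) * ω + y * θ) * (x * ω + y * θ) = n + A * ω + B * θ ∧ x * B - y * A = f.ev x y := by
  refine ⟨-x^2*(f.a*f.c) - 2*x*y*(f.a*f.d) - y^2*(f.b*f.d), -f.b*x^2 - f.d*y^2, f.a*x^2+f.c*y^2, ?_, ?_⟩
  · obtain ⟨h1, h2, h3⟩ := h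
    push_cast; push_cast at h1 h2 h3
    linear_combination (x:R)^2 * h1 + 2*x*y*h2 + (y:R)^2*h3
  · simp only [V.ev]; ring

theorem V_ext_of_ev {f g : V} (h : ∀ x y, f.ev x y = g.ev x y) : f = g := by
  have h1 := h 1 0; have h2 := h 0 1; have h3 := h 1 1; have h4 := h 1 (-1)
  simp only [V.ev] at h1 h2 h3 h4
  ext <;> linarith

/-- Core lemma. -/
theorem core {f f0 : V} {ω θ ω0 θ0 : R} (hB : IsB ω0 θ0) (h0 : Tab f0 ω0 θ0) (h : Tab f ω θ)
    {k l p q r s : ℤ} (hω : ω = k + p * ω0 + r * θ0) (hθ : θ = l + q * ω0 + s * θ0) :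
    f0.sub p q r s = f.smul (p*s-q*r) := by
  apply V_ext_of_ev
  intro x y
  rw [V.ev_sub, V.ev_smul]
  obtain ⟨n, A, B, h1, h2⟩ := h0.wedge (p*x+q*y) (r*x+s*y)
  obtain ⟨n', A', B', h1', h2'⟩ := h.wedge x y
  rw [← h2, ← h2']
  set t := x*k+y*l
  have e : ((n + t^2 : ℤ) : R) + (A + 2*t*(p*x+q*y) : ℤ) * ω0 + (B + 2*t*(r*x+s*y) : ℤ) * θ0
     = (n' + A'*k + B'*l : ℤ) + (A'*p+B'*q : ℤ) * ω0 + (A'*r + B'*s : ℤ) * θ0 := by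
    rw [hω, hθ] at h1'
    simp only [t]
    push_cast; push_cast at h1
    linear_combination h1' - h1
  obtain ⟨-, e1, e2⟩ := hB.ext e
  linear_combination (r*x+s*y) * (-e1) + (p*x+q*y) * e2

theorem rep_of_act {f f0 : V} (h : Rep R f0) {p q r s : ℤ} (hd : (p*s-q*r)^2 = 1)
    (he : f0.sub p q r s = f.smul (p*s-q*r)) : Rep R f := by
  obtain ⟨ω0, θ0, hB, h0⟩ := h
  have hB1 : IsB ((p:R) * ω0 + r * θ0) (q * ω0 + s * θ0) := by
    constructor
    · intro z
      obtain ⟨u, v, w, rfl⟩ := hB.1 z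
      have hdR : ((p:R)*s-q*r)^2 = 1 := by exact_mod_cast congrArg (Int.cast : ℤ → R) hd
      refine ⟨u, (p*s-q*r)*(s*v-q*w), (p*s-q*r)*(p*w-r*v), ?_⟩
      push_cast
      linear_combination (-v*ω0 - w * θ0) * hdR
    · intro u v w hz
      obtain ⟨h1, h2, h3⟩ := hB.2 u (v*p+w*q) (v*r+w*s) (by push_cast; linear_combination hz)
      have hne : p*s-q*r ≠ 0 := by rintro h; rw [h] at hd; norm_num at hd
      refine ⟨h1, ?_, ?_⟩
      · apply mul_left_cancel₀ hne; linear_combination s*h2 - q*h3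
      · apply mul_left_cancel₀ hne; linear_combination p*h3 - r*h2
  obtain ⟨f1, m, n, h1⟩ := hB1.normalize
  have h2 := core hB h0 h1 (k := -m) (p := p) (r := r) (l := -n) (q := q) (s := s) (by push_cast; ring) (by push_cast; ring)
  have h3 : f1 = f := V.smul_inj (by rintro h; rw [h] at hd; norm_num at hd) (h2.symm.trans he)
  exact ⟨_, _, hB1.translate m n, h3 ▸ h1⟩

theorem Tab.discr {f : V} {ω θ : R} (h : Tab f ω θ) (b : Module.Basis (Fin 3) ℤ R) (h0 : b 0 = 1)
    (h1 : b 1 = ω) (h2 : b 2 = θ) : Algebra.discr ℤ b = f.disc := by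
  have hB : IsB ω θ := by rw [← h1, ← h2]; exact IsB.of_basis b h0
  have rep : ∀ (z : R) (u v w : ℤ), z = u + v * ω + w * θ → b.repr z 0 = u ∧ b.repr z 1 = v ∧ b.repr z 2 = w := by
    intro z u v w hz
    apply hB.ext
    rw [← hz, ← h1, ← h2]
    conv_rhs => rw [← b.sum_repr z, Fin.sum_univ_three, h0]
    simp
  obtain ⟨t1, t2, t3⟩ := h
  have tr : ∀ x : R, Algebra.trace ℤ R x = b.repr x 0 + b.repr (x * ω) 1 + b.repr (x * θ) 2 := by
    intro x
    rw [Algebra.trace_eq_matrix_trace b, Matrix.trace, Fin.sum_univ_three]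
    simp [Algebra.leftMulMatrix_eq_repr_mul, h0, h1, h2]
  have T1 : Algebra.trace ℤ R 1 = 3 := by
    rw [tr, (rep 1 1 0 0 (by simp)).1, (rep (1*ω) 0 1 0 (by simp)).2.1, (rep (1*θ) 0 0 1 (by simp)).2.2]; norm_num
  have Tω : Algebra.trace ℤ R ω = -f.b := by
    rw [tr, (rep ω 0 1 0 (by simp)).1, (rep (ω*ω) (-(f.a*f.c)) (-f.b) f.a (by rw [t1]; push_cast; ring)).2.1,
      (rep (ω*θ) (-(f.a*f.d)) 0 0 (by rw [t2]; push_cast; ring)).2.2]; ring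
  have Tθ : Algebra.trace ℤ R θ = f.c := by
    rw [tr, (rep θ 0 0 1 (by simp)).1, (rep (θ*ω) (-(f.a*f.d)) 0 0 (by rw [mul_comm, t2]; push_cast; ring)).2.1,
      (rep (θ*θ) (-(f.b*f.d)) (-f.d) f.c (by rw [t3]; push_cast; ring)).2.2]; ring
  have T11 : Algebra.trace ℤ R (ω*ω) = f.b^2 - 2*f.a*f.c := by
    rw [show ω*ω = (-(f.a*f.c)) • (1:R) + (-f.b) • ω + f.a • θ by rw [t1]; simp; ring, map_add, map_add, map_smul, map_smul, map_smul,
      T1, Tω, Tθ]; simp; ring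
  have T12 : Algebra.trace ℤ R (ω*θ) = -3*(f.a*f.d) := by
    rw [show ω*θ = (-(f.a*f.d)) • (1:R) by rw [t2]; simp, map_smul, T1]; simp; ring
  have T22 : Algebra.trace ℤ R (θ*θ) = f.c^2 - 2*f.b*f.d := by
    rw [show θ*θ = (-(f.b*f.d)) • (1:R) + (-f.d) • ω + f.c • θ by rw [t3]; simp; ring, map_add, map_add, map_smul, map_smul, map_smul,
      T1, Tω, Tθ]; simp; ring
  rw [Algebra.discr_def, Matrix.det_fin_three]
  simp only [Algebra.traceMatrix_apply, Algebra.traceForm_apply, h0, h1, h2, one_mul, mul_one, T1, Tω, Tθ, T11, T12, T22,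
    mul_comm θ ω]
  simp only [V.disc]; ring
end ring
end CF

namespace CF
open NumberField

/-- Twisted `GL₂(ℤ)`-equivalence of forms. -/
def Eqv (f g : V) : Prop := ∃ p q r s : ℤ, (p*s-q*r)^2 = 1 ∧ f.sub p q r s = g.smul (p*s-q*r)

theorem Rep.map {R S : Type*} [CommRing R] [CommRing S] (e : R ≃+* S) {f : V} (h : Rep R f) : Rep S f := by
  obtain ⟨ω, θ, hB, h1, h2, h3⟩ := h
  refine ⟨e ω, e θ, ⟨?_, ?_⟩, ?_, ?_, ?_⟩
  · intro z
    obtain ⟨u, v, w, hz⟩ := hB.1 (e.symm z)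
    refine ⟨u, v, w, ?_⟩
    rw [← e.apply_symm_apply z, hz]; simp
  · intro u v w hz
    apply hB.2
    apply e.injective
    simpa using hz
  · rw [← map_mul, h1]; simp
  · rw [← map_mul, h2]; simp
  · rw [← map_mul, h3]; simp

section field
variable {K : Type*} [Field K] [NumberField K]

theorem Rep.discr {f : V} (h : Rep (𝓞 K) f) : NumberField.discr K = f.disc := by
  obtain ⟨ω, θ, hB, hT⟩ := h
  obtain ⟨b, b0, b1, b2⟩ := hB.basis
  rw [← discr_eq_discr K b, hT.discr b b0 b1 b2]

theorem exists_rep (hK : Module.finrank ℚ K = 3) : ∃ f : V, Rep (𝓞 K) f := by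
  obtain ⟨b, b0⟩ := exists_basis_one K (n := 2) hK
  obtain ⟨f, m, n, h⟩ := (IsB.of_basis b b0).normalize
  exact ⟨f, _, _, (IsB.of_basis b b0).translate m n, h⟩

theorem Rep.finrank {f : V} (h : Rep (𝓞 K) f) : Module.finrank ℚ K = 3 := by
  obtain ⟨ω, θ, hB, hT⟩ := h
  obtain ⟨b, -⟩ := hB.basis
  rw [← RingOfIntegers.rank, Module.finrank_eq_card_basis b]; simp

theorem rep_eqv {f g : V} (hf : Rep (𝓞 K) f) (hg : Rep (𝓞 K) g) : Eqv f g := by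
  have hd : f.disc = g.disc := by rw [← hf.discr, ← hg.discr]
  have hne : f.disc ≠ 0 := by rw [← hf.discr]; exact discr_ne_zero K
  obtain ⟨ω0, θ0, hB, h0⟩ := hf
  obtain ⟨ω, θ, hB', h⟩ := hg
  obtain ⟨k, p, r, h1⟩ := hB.1 ω
  obtain ⟨l, q, s, h2⟩ := hB.1 θ
  have hc := core hB h0 h h1 h2
  refine ⟨p, q, r, s, ?_, hc⟩
  have h3 := congrArg V.disc hc
  rw [V.disc_sub, V.disc_smul, hd] at h3
  rw [hd] at hne
  have hdet : p*s-q*r ≠ 0 := by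
    intro h0
    rw [h0] at hc
    -- then p r are killed: use the second basis
    obtain ⟨k', p', r', h1'⟩ := hB'.1 ω0
    obtain ⟨l', q', s', h2'⟩ := hB'.1 θ0
    have e1 : (k' + p'*k+r'*l : ℤ) + (p'*p+r'*q : ℤ) * ω0 + (p'*r+r'*s : ℤ)*θ0 = (0:ℤ) + (1:ℤ) * ω0 + (0:ℤ) * θ0 := by
      push_cast
      rw [h1, h2] at h1'
      linear_combination -h1'
    have e2 : (l' + q'*k+s'*l : ℤ) + (q'*p+s'*q : ℤ) * ω0 + (q'*r+s'*s : ℤ)*θ0 = (0:ℤ) + (0:ℤ) * ω0 + (1:ℤ) * θ0 := by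
      push_cast
      rw [h1, h2] at h2'
      linear_combination -h2'
    obtain ⟨-, a1, a2⟩ := hB.ext e1
    obtain ⟨-, a3, a4⟩ := hB.ext e2
    have : (1:ℤ) = (p*s-q*r)*(p'*s'-q'*r') := by
      linear_combination -1 * (a1 * 1) - (p'*p+r'*q)*a4 + (q'*p+s'*q) * a2 + a4 * 0 - 0 * a3
    rw [h0] at this; simp at this
  have h4 : (p*s-q*r)^2 * ((p*s-q*r)^4 * g.disc) = 1 * ((p*s-q*r)^4 * g.disc) := by
    linear_combination h3
  exact mul_right_cancel₀ (mul_ne_zero (pow_ne_zero _ hdet) hne) h4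

theorem Rep.irr {f : V} (h : Rep (𝓞 K) f) : f.irr := by
  have hK := h.finrank
  obtain ⟨ω, θ, hB, hT⟩ := h
  intro x y hxy
  obtain ⟨n, A, B, h1, h2⟩ := hT.wedge x y
  rw [hxy] at h2
  by_contra hne
  have key : ∃ c A' n' : ℤ, c ≠ 0 ∧ (c : 𝓞 K) * (x * ω + y * θ)^2 = A' * (x*ω+y*θ) + n' := by
    have h2R : (x:𝓞 K) * B - y * A = 0 := by exact_mod_cast congrArg (Int.cast : ℤ → 𝓞 K) h2
    by_cases hx : x = 0
    · have hy : y ≠ 0 := fun hy => hne ⟨hx, hy⟩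
      refine ⟨y, B, y * n, hy, ?_⟩
      push_cast; linear_combination (y:𝓞 K) * h1 - ω * h2R
    · refine ⟨x, A, x * n, hx, ?_⟩
      push_cast; linear_combination (x:𝓞 K) * h1 + θ * h2R
  obtain ⟨c, A', n', hc, hq⟩ := key
  set α : 𝓞 K := x * ω + y * θ with hα
  have hq' : (c:K) * (α:K)^2 = A' * α + n' := by
    have := congrArg (algebraMap (𝓞 K) K) hq
    simpa using this
  have hintg : IsIntegral ℚ (α:K) := Algebra.IsIntegral.isIntegral _
  have hdvd := minpoly.degree_dvd hintg
  rw [hK] at hdvd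
  have hle : (minpoly ℚ (α:K)).natDegree ≤ 2 := by
    let Q : Polynomial ℚ := Polynomial.C (c:ℚ) * Polynomial.X^2 + Polynomial.C (-A':ℚ) * Polynomial.X + Polynomial.C (-n':ℚ)
    have hQ : Q.natDegree ≤ 2 := by simp only [Q]; compute_degree
    have hQ2 : Q.coeff 2 = c := by
      simp only [Q, Polynomial.coeff_add, Polynomial.coeff_C_mul, Polynomial.coeff_X_pow, Polynomial.coeff_X, Polynomial.coeff_C]
      norm_num
    have hQ0 : Q ≠ 0 := by
      intro h; rw [h] at hQ2; simp only [Polynomial.coeff_zero] at hQ2; exact hc (by exact_mod_cast hQ2.symm)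
    refine le_trans ?_ hQ
    apply Polynomial.natDegree_le_of_dvd (minpoly.dvd _ _ ?_) hQ0
    simp [Q]; linear_combination hq'
  have h1 : (minpoly ℚ (α:K)).natDegree = 1 := by
    rcases (Nat.dvd_prime Nat.prime_three).mp hdvd with h | h
    · exact h
    · omega
  rw [minpoly.natDegree_eq_one_iff] at h1
  obtain ⟨ρ, hρ⟩ := h1
  -- clear denominators
  have e : ((-ρ.num : ℤ) : 𝓞 K) + (ρ.den * x : ℤ) * ω + (ρ.den * y : ℤ) * θ = 0 := by
    apply RingOfIntegers.coe_injective
    have hden : (ρ.den : K) ≠ 0 := by exact_mod_cast ρ.den_nz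
    have h3 : (ρ.den:K) * algebraMap ℚ K ρ = ρ.num := by
      rw [show (ρ.den:K) = algebraMap ℚ K ρ.den by simp, ← map_mul, Rat.den_mul_eq_num]; simp
    have h4 : (ρ.den:K) * α = ρ.num := by rw [← h3, hρ]
    have h5 : (α:K) = x * (ω:K) + y * θ := by rw [hα]; simp
    rw [h5] at h4
    simp only [map_add, map_mul, map_intCast, map_zero]
    push_cast
    linear_combination h4
  obtain ⟨-, h2, h3⟩ := hB.2 _ _ _ e
  have hden : (ρ.den : ℤ) ≠ 0 := by exact_mod_cast ρ.den_nz
  exact hne ⟨(mul_eq_zero.mp h2).resolve_left hden, (mul_eq_zero.mp h3).resolve_left hden⟩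

/-- The characteristic polynomial of `ω`. -/
def cpoly (f : V) : Polynomial ℚ :=
  Polynomial.X^3 + Polynomial.C (f.b:ℚ) * Polynomial.X^2 + Polynomial.C ((f.a*f.c : ℤ):ℚ) * Polynomial.X
    + Polynomial.C ((f.a^2*f.d : ℤ):ℚ)

theorem cpoly_monic (f : V) : (cpoly f).Monic := by unfold cpoly; monicity!
theorem cpoly_natDegree (f : V) : (cpoly f).natDegree = 3 := by unfold cpoly; compute_degree!
theorem cpoly_irreducible {f : V} (h : f.irr) : Irreducible (cpoly f) := by
  rw [Polynomial.irreducible_iff_roots_eq_zero_of_degree_le_three (by rw [cpoly_natDegree]; norm_num)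
    (by rw [cpoly_natDegree])]
  rw [Multiset.eq_zero_iff_forall_notMem]
  intro x hx
  have hx' : x^3 + f.b * x^2 + f.a*f.c*x + f.a^2*f.d = 0 := by
    have := (Polynomial.mem_roots'.mp hx).2
    simpa [cpoly] using this
  have hden : (x.den : ℚ) ≠ 0 := by exact_mod_cast x.den_nz
  have h2 : f.ev x.num (f.a * x.den) = 0 := by
    have : ((f.ev x.num (f.a * x.den) : ℤ) : ℚ) = 0 := by
      simp only [V.ev]; push_cast
      have hn : (x.num : ℚ) = x.den * x := (Rat.den_mul_eq_num x).symm
      rw [hn]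
      linear_combination (f.a * (x.den:ℚ)^3) * hx'
    exact_mod_cast this
  have h3 := (h _ _ h2).2
  have : (x.den : ℤ) ≠ 0 := by exact_mod_cast x.den_nz
  exact (mul_ne_zero h.a_ne this) h3

theorem Rep.minpoly {f : V} (h : Rep (𝓞 K) f) : ∃ x : K, minpoly ℚ x = cpoly f := by
  have hi := cpoly_irreducible h.irr
  obtain ⟨ω, θ, hB, h1, h2, h3⟩ := h
  refine ⟨ω, (minpoly.eq_of_irreducible_of_monic hi ?_ (cpoly_monic f)).symm⟩
  have : ω^3 + f.b * ω^2 + (f.a*f.c : ℤ) * ω + (f.a^2*f.d : ℤ) = 0 := by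
    push_cast; push_cast at h1 h2
    linear_combination ω * h1 + f.a * h2
  have := congrArg (algebraMap (𝓞 K) K) this
  simpa [cpoly] using this

theorem equiv_of_minpoly (hK : Module.finrank ℚ K = 3) {P : Polynomial ℚ} (hP : P.natDegree = 3) {x : K}
    (hx : _root_.minpoly ℚ x = P) : Nonempty (K ≃ₐ[ℚ] AdjoinRoot P) := by
  subst hx
  have htop := (Field.primitive_element_iff_minpoly_natDegree_eq ℚ x).mpr (hP.trans hK.symm)
  have hintg : IsIntegral ℚ x := Algebra.IsIntegral.isIntegral _
  exact ⟨((IntermediateField.adjoinRootEquivAdjoin ℚ hintg).trans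
    ((IntermediateField.equivOfEq htop).trans IntermediateField.topEquiv)).symm⟩

theorem rep_iso {L : Type*} [Field L] [NumberField L] {f : V} (h : Rep (𝓞 K) f) (h' : Rep (𝓞 L) f) :
    Nonempty (K ≃+* L) := by
  obtain ⟨x, hx⟩ := h.minpoly
  obtain ⟨y, hy⟩ := h'.minpoly
  obtain ⟨e⟩ := equiv_of_minpoly h.finrank (cpoly_natDegree f) hx
  obtain ⟨e'⟩ := equiv_of_minpoly h'.finrank (cpoly_natDegree f) hy
  exact ⟨(e.trans e'.symm).toRingEquiv⟩
end field

theorem exists_field {f : V} (hf : f.irr) (hF : Fund f.disc) :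
    ∃ (K : Subfield ℂ) (_ : NumberField K), Rep (𝓞 K) f := by
  obtain ⟨K, _, x, hK, hx⟩ := exists_subfield (cpoly f) (cpoly_monic f) (cpoly_irreducible hf)
  rw [cpoly_natDegree] at hK
  refine ⟨K, ‹_›, ?_⟩
  have hxe : x^3 + f.b * x^2 + f.a*f.c*x + f.a^2*f.d = 0 := by
    have := minpoly.aeval ℚ x
    rw [hx] at this
    simpa [cpoly] using this
  have ha : (f.a : K) ≠ 0 := by exact_mod_cast hf.a_ne
  have hd : (f.d : K) ≠ 0 := by exact_mod_cast hf.d_ne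
  have hx0 : x ≠ 0 := by
    rintro rfl
    simp at hxe
    exact hxe.elim hf.a_ne hf.d_ne
  obtain ⟨y, hy⟩ : ∃ y : K, f.a * y = x^2+f.b*x+f.a*f.c := ⟨(x^2+f.b*x+f.a*f.c)/f.a, by field_simp⟩
  have hxy : x * y = -(f.a*f.d) := by
    apply mul_left_cancel₀ ha
    linear_combination x * hy + hxe
  have hyy : y * y = -(f.b*f.d) - f.d * x + f.c * y := by
    apply mul_left_cancel₀ hx0
    linear_combination (y - f.c) * hxy - (f.d : K) * hy
  have ix : IsIntegral ℤ x := by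
    refine ⟨Polynomial.X^3 + Polynomial.C f.b * Polynomial.X^2 + Polynomial.C (f.a*f.c) * Polynomial.X + Polynomial.C (f.a^2*f.d),
      by monicity!, ?_⟩
    simp only [Polynomial.eval₂_add, Polynomial.eval₂_mul, Polynomial.eval₂_C, Polynomial.eval₂_pow, Polynomial.eval₂_X]
    simpa using hxe
  have iy : IsIntegral ℤ y := by
    refine ⟨Polynomial.X^3 + Polynomial.C (-f.c) * Polynomial.X^2 + Polynomial.C (f.b*f.d) * Polynomial.X + Polynomial.C (-(f.a*f.d^2)),
      by monicity!, ?_⟩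
    simp only [Polynomial.eval₂_add, Polynomial.eval₂_mul, Polynomial.eval₂_C, Polynomial.eval₂_pow, Polynomial.eval₂_X]
    simp
    linear_combination y * hyy - f.d * hxy
  let ω : 𝓞 K := ⟨x, ix⟩
  let θ : 𝓞 K := ⟨y, iy⟩
  have hT : Tab f ω θ := by
    refine ⟨?_, ?_, ?_⟩ <;> apply RingOfIntegers.coe_injective <;>
      simp only [map_add, map_mul, map_intCast, map_zero, map_neg, map_sub] <;> push_cast
    · show x * x = -(f.a*f.c) - f.b * x + f.a * y
      linear_combination -hy
    · exact hxy
    · exact hyy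
  obtain ⟨f0, h0⟩ := exists_rep hK
  have h00 := h0
  obtain ⟨ω0, θ0, hB, hT0⟩ := h00
  obtain ⟨k, p, r, e1⟩ := hB.1 ω
  obtain ⟨l, q, s, e2⟩ := hB.1 θ
  have hc := core hB hT0 hT e1 e2
  have hdet : p*s-q*r ≠ 0 := by
    intro hz
    rw [hz] at hc
    have h1 := congrArg V.a hc
    simp only [V.sub, V.smul, zero_mul] at h1
    obtain ⟨hp, hr⟩ := h0.irr p r h1
    rw [hp, hr] at e1
    have hxk : x = (k:K) := by
      have := congrArg (algebraMap (𝓞 K) K) e1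
      have h3 : algebraMap (𝓞 K) K ω = x := rfl
      rw [h3] at this
      simpa using this
    have h2 : f.ev k f.a = 0 := by
      have : ((f.ev k f.a : ℤ) : K) = 0 := by
        simp only [V.ev]; push_cast
        rw [hxk] at hxe
        linear_combination f.a * hxe
      exact_mod_cast this
    exact hf.a_ne (hf _ _ h2).2
  have hdd := congrArg V.disc hc
  rw [V.disc_sub, V.disc_smul] at hdd
  have hD : f.disc = (p*s-q*r)^2 * f0.disc := by
    apply mul_left_cancel₀ (pow_ne_zero 4 hdet)
    linear_combination -hdd
  have h1 := hF.sq_eq hD f0.disc_mod4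
  exact rep_of_act h0 h1 hc

/-- The isomorphism relation on cubic fields of discriminant `D`. -/
def isoRel (D : ℤ) : {K : Subfield ℂ // Module.finrank ℚ K = 3 ∧ subDisc K = D} →
    {K : Subfield ℂ // Module.finrank ℚ K = 3 ∧ subDisc K = D} → Prop :=
  fun K L => Nonempty (K.1 ≃+* L.1)

theorem isoRel_equiv (D : ℤ) : Equivalence (isoRel D) :=
  ⟨fun K => ⟨RingEquiv.refl _⟩, fun ⟨e⟩ => ⟨e.symm⟩, fun ⟨e⟩ ⟨e'⟩ => ⟨e.trans e'⟩⟩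

theorem cubic_param {D : ℤ} (hD : Fund D) :
    ∃ Φ : {f : V // f.irr ∧ f.disc = D} → Quot (isoRel D), Function.Surjective Φ ∧
      ∀ f g, Φ f = Φ g ↔ Eqv f.1 g.1 := by
  have hex : ∀ f : {f : V // f.irr ∧ f.disc = D}, ∃ (K : Subfield ℂ) (_ : NumberField K), Rep (𝓞 K) f.1 :=
    fun f => exists_field f.2.1 (by rw [f.2.2]; exact hD)
  choose K hN hR using hex
  have hK : ∀ f, Module.finrank ℚ (K f) = 3 ∧ subDisc (K f) = D := by
    intro f
    refine ⟨(hR f).finrank, ?_⟩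
    rw [subDisc_eq, (hR f).discr, f.2.2]
  refine ⟨fun f => Quot.mk _ ⟨K f, hK f⟩, ?_, ?_⟩
  · intro q
    obtain ⟨⟨L, hL, hLD⟩, rfl⟩ := Quot.exists_rep q
    have : FiniteDimensional ℚ L := Module.finite_of_finrank_eq_succ hL
    have : NumberField L := {}
    obtain ⟨f, hf⟩ := exists_rep hL
    refine ⟨⟨f, hf.irr, ?_⟩, ?_⟩
    · rw [← hf.discr, ← subDisc_eq, hLD]
    · apply Quot.sound
      exact rep_iso (hR _) hf
  · intro f g
    constructor
    · intro h
      have h1 := (isoRel_equiv D).eqvGen_iff.mp (Quot.eqvGen_exact h)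
      obtain ⟨e⟩ := h1
      have h2 := (hR f).map (RingOfIntegers.mapRingEquiv e)
      exact rep_eqv h2 (hR g)
    · rintro ⟨p, q, r, s, h1, h2⟩
      apply Quot.sound
      exact rep_iso (rep_of_act (hR f) h1 h2) (hR g)

theorem cubicCountDisc_eq (D : ℤ) : cubicCountDisc D = Nat.card (Quot (isoRel D)) := rfl
end CF

namespace CF

/-- One-dimensional cancellation. -/
theorem oneD {m : ℕ} [NeZero m] (φ : ZMod m → ℂ) (c : ℝ) (hφ : ∀ x, ‖φ x‖ ≤ c) (h0 : ∑ x, φ x = 0)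
    (B : Finset ℤ) (K : ℕ) (hB : {k : ℤ | ¬ (k ∈ B ↔ k + 1 ∈ B)}.ncard ≤ K) :
    ‖∑ k ∈ B, φ k‖ ≤ K * m * c := by
  have hc : 0 ≤ c := (norm_nonneg _).trans (hφ 0)
  have hm : (0:ℤ) < m := by exact_mod_cast Nat.pos_of_ne_zero (NeZero.ne m)
  set Ψ : ℤ → ℂ := fun k => ∑ j ∈ Finset.range (k % m).toNat, φ (j : ZMod m) with hΨ
  have hb : ∀ k, ‖Ψ k‖ ≤ m * c := by
    intro k
    refine (norm_sum_le _ _).trans ((Finset.sum_le_sum fun j _ => hφ _).trans ?_)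
    rw [Finset.sum_const, Finset.card_range, nsmul_eq_mul]
    gcongr
    have := Int.emod_lt_of_pos k hm
    have := Int.emod_nonneg k hm.ne'
    omega
  have hz : ∑ j ∈ Finset.range m, φ (j : ZMod m) = 0 := by
    rw [← h0, ← Fin.sum_univ_eq_sum_range (fun j => φ (j : ZMod m))]
    obtain ⟨m', rfl⟩ : ∃ m', m = m' + 1 := ⟨m - 1, by have := NeZero.ne m; omega⟩
    refine Finset.sum_congr rfl fun x _ => ?_
    congr 1
    exact Fin.cast_val_eq_self x
  have hd : ∀ k : ℤ, φ k = Ψ (k + 1) - Ψ k := by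
    intro k
    have h1 := Int.emod_lt_of_pos k hm
    have h2 := Int.emod_nonneg k hm.ne'
    have hk : (k : ZMod m) = (((k % m).toNat : ℕ) : ZMod m) := by
      have : ((((k % m).toNat : ℕ) : ℤ) : ZMod m) = (k : ZMod m) := by
        rw [Int.toNat_of_nonneg h2]; simp
      rw [← this]; exact Int.cast_natCast _
    by_cases h : k % m + 1 = m
    · have e : (k + 1) % m = 0 := by
        rw [Int.add_emod, show k % (m:ℤ) = m - 1 by omega]
        rcases eq_or_ne (m : ℤ) 1 with h | h
        · rw [h]; simp
        · rw [Int.emod_eq_of_lt (a := 1) (by norm_num) (by omega)]; simp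
      have e2 : (k % m).toNat + 1 = m := by omega
      simp only [hΨ, e]
      rw [hk]
      have : ∑ j ∈ Finset.range ((k % m).toNat + 1), φ (j : ZMod m) = 0 := by rw [e2]; exact hz
      rw [Finset.sum_range_succ] at this
      simp only [Int.toNat_zero, Finset.range_zero, Finset.sum_empty, zero_sub]
      linear_combination this
    · have e : (k + 1) % m = k % m + 1 := by
        rw [Int.add_emod, Int.emod_eq_of_lt (a := 1) (by norm_num) (by omega)]
        exact Int.emod_eq_of_lt (by omega) (by omega)
      simp only [hΨ, e]
      rw [show (k % (m:ℤ) + 1).toNat = (k % m).toNat + 1 by omega, Finset.sum_range_succ, hk]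
      ring
  set B' := B.image (· + 1) with hB'
  have e1 : ∑ k ∈ B, Ψ (k + 1) = ∑ k ∈ B', Ψ k := by
    rw [hB', Finset.sum_image]
    intro x _ y _ h; simpa using h
  have e2 : ∑ k ∈ B, φ k = ∑ k ∈ B' \ B, Ψ k - ∑ k ∈ B \ B', Ψ k := by
    rw [Finset.sum_congr rfl fun k _ => hd k, Finset.sum_sub_distrib, e1]
    rw [← Finset.sum_sdiff_sub_sum_sdiff]
  rw [e2]
  have e3 : ((B' \ B).card + (B \ B').card : ℕ) ≤ K := by
    refine le_trans ?_ hB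
    rw [← Finset.card_union_of_disjoint]
    swap
    · exact Finset.disjoint_left.2 fun x hx hx' => (Finset.mem_sdiff.1 hx).2 (Finset.mem_sdiff.1 hx').1
    rw [← Set.ncard_coe_finset]
    have key : ((B' \ B ∪ B \ B' : Finset ℤ) : Set ℤ) = Set.image (fun k : ℤ => k + 1) {k : ℤ | ¬ (k ∈ B ↔ k + 1 ∈ B)} := by
      ext x
      have hx : x ∈ B' ↔ x - 1 ∈ B := by
        simp only [hB', Finset.mem_image]
        constructor
        · rintro ⟨a, ha, rfl⟩; simpa using ha
        · intro h; exact ⟨_, h, by ring⟩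
      simp only [Finset.coe_union, Finset.coe_sdiff, Set.mem_union, Set.mem_diff, Finset.mem_coe, Set.mem_image, Set.mem_setOf_eq, hx]
      constructor
      · intro h
        refine ⟨x - 1, ?_, by ring⟩
        rw [sub_add_cancel]; tauto
      · rintro ⟨k, hk, rfl⟩
        rw [add_sub_cancel_right]; tauto
    rw [key, Set.ncard_image_of_injective]
    intro x y h; simpa using h
  calc _ ≤ ‖∑ k ∈ B' \ B, Ψ k‖ + ‖∑ k ∈ B \ B', Ψ k‖ := norm_sub_le _ _
    _ ≤ (B' \ B).card * (m * c) + (B \ B').card * (m * c) := by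
      gcongr <;>
      · refine (norm_sum_le _ _).trans ((Finset.sum_le_sum fun j _ => hb _).trans ?_)
        rw [Finset.sum_const, nsmul_eq_mul]
    _ = ((B' \ B).card + (B \ B').card : ℕ) * (m * c) := by push_cast; ring
    _ ≤ K * (m * c) := by gcongr
    _ = _ := by ring

/-- Two-dimensional cancellation in standard coordinates. -/
theorem twoD_std {m : ℕ} [NeZero m] (ψ : ZMod m → ZMod m → ℂ) (hψ : ∀ x y, ‖ψ x y‖ ≤ 1)
    (h0 : ∑ x, ∑ y, ψ x y = 0) (A : Finset (ℤ × ℤ)) (K : ℕ)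
    (hA1 : ∀ t, {s : ℤ | ¬ ((s, t) ∈ A ↔ (s + 1, t) ∈ A)}.ncard ≤ K)
    (hA2 : ∀ s, {t : ℤ | ¬ ((s, t) ∈ A ↔ (s, t + 1) ∈ A)}.ncard ≤ K) :
    ‖∑ x ∈ A, ψ x.1 x.2‖ ≤ 2 * m * K * ((A.image Prod.fst).card + (A.image Prod.snd).card) := by
  have hm : (0:ℝ) < m := by exact_mod_cast Nat.pos_of_ne_zero (NeZero.ne m)
  have hmc : (m : ℂ) ≠ 0 := by exact_mod_cast hm.ne'
  set ψ2 : ZMod m → ℂ := fun y => (∑ x, ψ x y) / m with h2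
  have b2 : ∀ y, ‖ψ2 y‖ ≤ 1 := by
    intro y
    rw [h2, norm_div, Complex.norm_natCast, div_le_one hm]
    refine (norm_sum_le _ _).trans ((Finset.sum_le_sum fun j _ => hψ _ _).trans ?_)
    simp [ZMod.card]
  have z2 : ∑ y, ψ2 y = 0 := by
    rw [h2, ← Finset.sum_div, Finset.sum_comm, h0, zero_div]
  have s1 : ‖∑ x ∈ A, (ψ x.1 x.2 - ψ2 x.2)‖ ≤ (A.image Prod.snd).card * (K * m * 2) := by
    rw [← Finset.sum_fiberwise_of_maps_to (g := Prod.snd) (t := A.image Prod.snd) (fun x hx => Finset.mem_image_of_mem _ hx)]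
    refine (norm_sum_le _ _).trans ?_
    rw [← nsmul_eq_mul]
    refine Finset.sum_le_card_nsmul _ _ _ fun t _ => ?_
    have := oneD (fun s => ψ s t - ψ2 t) 2 (fun s => (norm_sub_le _ _).trans (by linarith [hψ s t, b2 t]))
      (by simp [Finset.sum_sub_distrib, h2, ZMod.card, mul_div_cancel₀ _ hmc]) ((A.filter fun x => x.2 = t).image Prod.fst) K ?_
    · rw [Finset.sum_image] at this
      · refine le_of_eq_of_le ?_ this
        congr 1
        refine Finset.sum_congr rfl fun x hx => ?_
        rw [(Finset.mem_filter.1 hx).2]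
      · rintro ⟨x, x'⟩ hx ⟨y, y'⟩ hy h
        have := (Finset.mem_filter.1 hx).2; have := (Finset.mem_filter.1 hy).2
        simp_all
    · convert hA1 t using 5 <;>
      simp
  have s2 : ‖∑ x ∈ A, ψ2 x.2‖ ≤ (A.image Prod.fst).card * (K * m * 1) := by
    rw [← Finset.sum_fiberwise_of_maps_to (g := Prod.fst) (t := A.image Prod.fst) (fun x hx => Finset.mem_image_of_mem _ hx)]
    refine (norm_sum_le _ _).trans ?_
    rw [← nsmul_eq_mul]
    refine Finset.sum_le_card_nsmul _ _ _ fun t _ => ?_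
    have := oneD ψ2 1 b2 z2 ((A.filter fun x => x.1 = t).image Prod.snd) K ?_
    · rw [Finset.sum_image] at this
      · exact this
      · rintro ⟨x, x'⟩ hx ⟨y, y'⟩ hy h
        have := (Finset.mem_filter.1 hx).2; have := (Finset.mem_filter.1 hy).2
        simp_all
    · convert hA2 t using 5 <;>
      simp
  have : ∑ x ∈ A, ψ x.1 x.2 = ∑ x ∈ A, (ψ x.1 x.2 - ψ2 x.2) + ∑ x ∈ A, ψ2 x.2 := by
    rw [← Finset.sum_add_distrib]; simp
  rw [this]
  refine (norm_add_le _ _).trans ((add_le_add s1 s2).trans ?_)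
  have : (0:ℝ) ≤ (A.image Prod.fst).card * (K * m) := by positivity
  nlinarith

/-- Lagrange reduction. -/
theorem reduced_basis (e₁ e₂ : ℤ × ℤ) : ∃ α β γ δ : ℤ, α * δ - β * γ = 1 ∧
    ∀ v w : ℤ × ℤ, v = α • e₁ + β • e₂ → w = γ • e₁ + δ • e₂ →
      2 * |v.1*w.1+v.2*w.2| ≤ v.1^2+v.2^2 ∧ 2 * |v.1*w.1+v.2*w.2| ≤ w.1^2+w.2^2 := by
  let N : ℤ × ℤ → ℤ := fun v => v.1^2+v.2^2
  let S : Set ℕ := {n | ∃ α β γ δ : ℤ, α * δ - β * γ = 1 ∧ (n:ℤ) = N (α • e₁ + β • e₂) + N (γ • e₁ + δ • e₂)}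
  have hS : S.Nonempty := ⟨(N e₁ + N e₂).toNat, 1, 0, 0, 1, by norm_num, by
    simp [N]; positivity⟩
  obtain ⟨α, β, γ, δ, h1, hn⟩ := Nat.sInf_mem hS
  have hmin : ∀ α' β' γ' δ' : ℤ, α' * δ' - β' * γ' = 1 →
      N (α • e₁ + β • e₂) + N (γ • e₁ + δ • e₂) ≤ N (α' • e₁ + β' • e₂) + N (γ' • e₁ + δ' • e₂) := by
    intro α' β' γ' δ' h
    rw [← hn]
    have : (N (α' • e₁ + β' • e₂) + N (γ' • e₁ + δ' • e₂)).toNat ∈ S := ⟨α', β', γ', δ', h, by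
      rw [Int.toNat_of_nonneg]; simp only [N]; positivity⟩
    have := Nat.sInf_le this
    have h0 : 0 ≤ N (α' • e₁ + β' • e₂) + N (γ' • e₁ + δ' • e₂) := by simp only [N]; positivity
    omega
  refine ⟨α, β, γ, δ, h1, ?_⟩
  rintro v w hv hw
  have a1 := hmin α β (γ+α) (δ+β) (by linarith)
  have a2 := hmin α β (γ-α) (δ-β) (by linarith)
  have a3 := hmin (α+γ) (β+δ) γ δ (by linarith)
  have a4 := hmin (α-γ) (β-δ) γ δ (by linarith)
  have v1 : v.1 = α * e₁.1 + β * e₂.1 := by rw [hv]; simp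
  have v2 : v.2 = α * e₁.2 + β * e₂.2 := by rw [hv]; simp
  have w1 : w.1 = γ * e₁.1 + δ * e₂.1 := by rw [hw]; simp
  have w2 : w.2 = γ * e₁.2 + δ * e₂.2 := by rw [hw]; simp
  simp only [N, Prod.fst_add, Prod.snd_add, Prod.smul_fst, Prod.smul_snd, smul_eq_mul] at a1 a2 a3 a4
  rw [← v1, ← v2] at a1 a2 a3 a4
  rw [← w1, ← w2] at a1 a2 a3 a4
  rw [show (γ+α) * e₁.1 + (δ+β) * e₂.1 = w.1 + v.1 by rw [v1, w1]; ring, show (γ+α) * e₁.2 + (δ+β) * e₂.2 = w.2 + v.2 by rw [v2, w2]; ring] at a1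
  rw [show (γ-α) * e₁.1 + (δ-β) * e₂.1 = w.1 - v.1 by rw [v1, w1]; ring, show (γ-α) * e₁.2 + (δ-β) * e₂.2 = w.2 - v.2 by rw [v2, w2]; ring] at a2
  rw [show (α+γ) * e₁.1 + (β+δ) * e₂.1 = v.1 + w.1 by rw [v1, w1]; ring, show (α+γ) * e₁.2 + (β+δ) * e₂.2 = v.2 + w.2 by rw [v2, w2]; ring] at a3
  rw [show (α-γ) * e₁.1 + (β-δ) * e₂.1 = v.1 - w.1 by rw [v1, w1]; ring, show (α-γ) * e₁.2 + (β-δ) * e₂.2 = v.2 - w.2 by rw [v2, w2]; ring] at a4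
  constructor <;>
  · rw [← abs_two, ← abs_mul, abs_le]
    constructor <;> nlinarith

/-- Sup norm of an integer vector. -/
def nv (v : ℤ × ℤ) : ℕ := max v.1.natAbs v.2.natAbs

theorem nv_pos {v : ℤ × ℤ} (h : v ≠ 0) : 0 < nv v := by
  rw [nv, lt_max_iff]
  by_contra h'
  push Not at h'
  apply h
  ext <;> simp <;> omega

theorem nv_sq_le (v : ℤ × ℤ) : ((nv v : ℕ) : ℤ)^2 ≤ v.1^2+v.2^2 := by
  rcases max_choice v.1.natAbs v.2.natAbs with h | h <;> rw [nv, h] <;>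
  · rw [Int.natCast_natAbs, sq_abs]; nlinarith [sq_nonneg v.1, sq_nonneg v.2]

theorem abs_fst_le (v : ℤ × ℤ) : |v.1| ≤ (nv v : ℤ) := by
  rw [← Int.natCast_natAbs, nv]; exact_mod_cast le_max_left _ _
theorem abs_snd_le (v : ℤ × ℤ) : |v.2| ≤ (nv v : ℤ) := by
  rw [← Int.natCast_natAbs, nv]; exact_mod_cast le_max_right _ _

theorem nv_mul_le (v w : ℤ × ℤ) (h1 : 2 * |v.1*w.1+v.2*w.2| ≤ v.1^2+v.2^2) (h2 : 2 * |v.1*w.1+v.2*w.2| ≤ w.1^2+w.2^2) :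
    (nv v : ℤ) * nv w ≤ 2 * |v.1*w.2-v.2*w.1| := by
  apply le_of_sq_le_sq _ (by positivity)
  rw [mul_pow, mul_pow, sq_abs]
  have a := nv_sq_le v
  have b := nv_sq_le w
  have c : (2 * |v.1*w.1+v.2*w.2|)^2 ≤ (v.1^2+v.2^2)*(w.1^2+w.2^2) := by
    rw [sq]; exact mul_le_mul h1 h2 (by positivity) (by positivity)
  rw [mul_pow, sq_abs] at c
  have d : ((nv v : ℕ) : ℤ)^2 * ((nv w : ℕ) : ℤ)^2 ≤ (v.1^2+v.2^2)*(w.1^2+w.2^2) :=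
    mul_le_mul a b (by positivity) (by positivity)
  nlinarith

end CF

namespace CF

/-- Bounded variation along all lines. -/
def BV (Ω : Finset (ℤ × ℤ)) (K : ℕ) : Prop :=
  ∀ x v : ℤ × ℤ, v ≠ 0 → {k : ℤ | ¬ (x + k • v ∈ Ω ↔ x + (k + 1) • v ∈ Ω)}.ncard ≤ K

/-- A full sublattice with explicit basis, of index prime to `m`. -/
def LatB (Λ : AddSubgroup (ℤ × ℤ)) (m : ℕ) : Prop :=
  ∃ e f : ℤ × ℤ, e.1 * f.2 - e.2 * f.1 ≠ 0 ∧ IsCoprime (e.1 * f.2 - e.2 * f.1) (m : ℤ) ∧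
    ∀ x, x ∈ Λ ↔ ∃ s t : ℤ, x = s • e + t • f

theorem card_line (S : Finset ℤ) (D I : ℤ) (hI : I ≠ 0) (B : ℝ) (hB : 0 ≤ B) (h : ∀ t ∈ S, |((D + t * I : ℤ) : ℝ)| ≤ B) :
    (S.card : ℝ) ≤ 2 * B / |(I : ℝ)| + 1 := by
  have hI' : (0:ℝ) < |(I : ℝ)| := abs_pos.2 (by exact_mod_cast hI)
  rcases S.eq_empty_or_nonempty with rfl | hS
  · simp; positivity
  have h1 := h _ (S.min'_mem hS)
  have h2 := h _ (S.max'_mem hS)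
  have h3 : S ⊆ Finset.Icc (S.min' hS) (S.max' hS) := fun x hx =>
    Finset.mem_Icc.2 ⟨S.min'_le _ hx, S.le_max' _ hx⟩
  have h4 := Finset.card_le_card h3
  rw [Int.card_Icc] at h4
  have h5 : S.min' hS ≤ S.max' hS := S.min'_le _ (S.max'_mem hS)
  have h6 : (S.card : ℤ) ≤ S.max' hS - S.min' hS + 1 := by omega
  have h7 : (S.card : ℝ) ≤ S.max' hS - S.min' hS + 1 := by exact_mod_cast h6
  have h8 : ((S.max' hS : ℝ) - S.min' hS) * |(I : ℝ)| ≤ 2 * B := by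
    have : |((S.max' hS : ℝ) - S.min' hS) * I| ≤ 2 * B := by
      have e : ((S.max' hS : ℝ) - S.min' hS) * I = ((D + S.max' hS * I : ℤ) : ℝ) - ((D + S.min' hS * I : ℤ) : ℝ) := by
        push_cast; ring
      rw [e]
      exact (abs_sub _ _).trans (by linarith)
    rw [abs_mul, abs_of_nonneg] at this
    · exact this
    · have : ((S.min' hS : ℤ) : ℝ) ≤ S.max' hS := by exact_mod_cast h5
      linarith
  have := (le_div_iff₀ hI').2 h8
  linarith

theorem det_abs_le (v x : ℤ × ℤ) (M : ℝ) (h1 : |(x.1 : ℝ)| ≤ M) (h2 : |(x.2 : ℝ)| ≤ M) :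
    |((v.1 * x.2 - v.2 * x.1 : ℤ) : ℝ)| ≤ 2 * M * nv v := by
  have a : |(v.1 : ℝ)| ≤ nv v := by exact_mod_cast abs_fst_le v
  have b : |(v.2 : ℝ)| ≤ nv v := by exact_mod_cast abs_snd_le v
  push_cast
  refine (abs_sub _ _).trans ?_
  rw [abs_mul, abs_mul]
  have := mul_le_mul a h2 (abs_nonneg _) (by positivity)
  have := mul_le_mul b h1 (abs_nonneg _) (by positivity)
  linarith

theorem twoD {m : ℕ} [NeZero m] {Λ : AddSubgroup (ℤ × ℤ)} (hΛ : LatB Λ m) :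
    ∃ u ∈ Λ, u ≠ 0 ∧ ∀ (Ω : Finset (ℤ × ℤ)) (K : ℕ) (M : ℝ), 0 ≤ M →
      (∀ x ∈ Ω, |(x.1 : ℝ)| ≤ M ∧ |(x.2 : ℝ)| ≤ M) → BV Ω K →
      ∀ ψ : ZMod m → ZMod m → ℂ, (∀ x y, ‖ψ x y‖ ≤ 1) → (∑ x, ∑ y, ψ x y = 0) → ∀ x₀ : ℤ × ℤ,
      ‖∑ x ∈ Ω with x - x₀ ∈ Λ, ψ x.1 x.2‖ ≤ 2 * m * K * (16 * M / nv u + 2) := by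
  obtain ⟨e, f, hI0, hIc, hmem⟩ := hΛ
  obtain ⟨α, β, γ, δ, hdet, hred⟩ := reduced_basis e f
  obtain ⟨v, hv⟩ : ∃ v, v = α • e + β • f := ⟨_, rfl⟩
  obtain ⟨w, hw⟩ : ∃ w, w = γ • e + δ • f := ⟨_, rfl⟩
  obtain ⟨hr1, hr2⟩ := hred v w hv hw
  have hmem' : ∀ x, x ∈ Λ ↔ ∃ s t : ℤ, x = s • v + t • w := by
    intro x
    rw [hmem]
    constructor
    · rintro ⟨s, t, rfl⟩
      refine ⟨s * δ - t * γ, t * α - s * β, ?_⟩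
      rw [hv, hw]
      ext <;> simp
      · linear_combination (-(s * e.1 + t * f.1)) * hdet
      · linear_combination (-(s * e.2 + t * f.2)) * hdet
    · rintro ⟨s, t, rfl⟩
      refine ⟨s * α + t * γ, s * β + t * δ, ?_⟩
      rw [hv, hw]
      ext <;> simp <;> ring
  set I := v.1 * w.2 - v.2 * w.1 with hI
  have hII : I = e.1 * f.2 - e.2 * f.1 := by
    rw [hI, hv, hw]; simp
    linear_combination (e.1 * f.2 - e.2 * f.1) * hdet
  rw [← hII] at hI0 hIc
  have hnv := nv_mul_le v w hr1 hr2
  rw [← hI] at hnv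
  have hv0 : v ≠ 0 := by rintro h; apply hI0; simp [hI, h]
  have hw0 : w ≠ 0 := by rintro h; apply hI0; simp [hI, h]
  have hIr : (0:ℝ) < |(I:ℝ)| := abs_pos.2 (by exact_mod_cast hI0)
  have hvp : (0:ℝ) < nv v := by exact_mod_cast nv_pos hv0
  have hwp : (0:ℝ) < nv w := by exact_mod_cast nv_pos hw0
  have hnvr : (nv v : ℝ) * nv w ≤ 2 * |(I:ℝ)| := by exact_mod_cast hnv
  have main : ∀ (Ω : Finset (ℤ × ℤ)) (K : ℕ) (M : ℝ), 0 ≤ M →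
      (∀ x ∈ Ω, |(x.1 : ℝ)| ≤ M ∧ |(x.2 : ℝ)| ≤ M) → BV Ω K →
      ∀ ψ : ZMod m → ZMod m → ℂ, (∀ x y, ‖ψ x y‖ ≤ 1) → (∑ x, ∑ y, ψ x y = 0) → ∀ x₀ : ℤ × ℤ,
      ‖∑ x ∈ Ω with x - x₀ ∈ Λ, ψ x.1 x.2‖ ≤ 2 * m * K * ((8 * M / nv v + 1) + (8 * M / nv w + 1)) := by
    intro Ω K M hM hbox hBV ψ hψ h0 x₀
    set g : ℤ × ℤ → ℤ × ℤ := fun st => x₀ + st.1 • v + st.2 • w with hg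
    have ginj : Function.Injective g := by
      rintro ⟨s, t⟩ ⟨s', t'⟩ h
      have h1 := congrArg Prod.fst h; have h2 := congrArg Prod.snd h
      simp [hg] at h1 h2
      have a : (s - s') * I = 0 := by
        rw [hI]; linear_combination w.2 * h1 - w.1 * h2
      have b : (t - t') * I = 0 := by
        rw [hI]; linear_combination v.1 * h2 - v.2 * h1
      have a := (mul_eq_zero.1 a).resolve_right hI0
      have b := (mul_eq_zero.1 b).resolve_right hI0
      ext <;> simp <;> omega
    set A := Ω.preimage g ginj.injOn with hA
    have hAm : ∀ st, st ∈ A ↔ g st ∈ Ω := fun st => by simp [hA]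
    set ψ' : ZMod m → ZMod m → ℂ := fun s t => ψ ((x₀.1 : ZMod m) + s * v.1 + t * w.1) ((x₀.2 : ZMod m) + s * v.2 + t * w.2) with hψ'
    have hsum : ∑ x ∈ Ω with x - x₀ ∈ Λ, ψ x.1 x.2 = ∑ x ∈ A, ψ' x.1 x.2 := by
      have := Finset.sum_preimage' g Ω ginj.injOn (fun x => ψ (x.1 : ZMod m) (x.2 : ZMod m))
      rw [← hA] at this
      rw [show (∑ x ∈ A, ψ' x.1 x.2) = ∑ x ∈ A, (fun x : ℤ × ℤ => ψ (x.1 : ZMod m) (x.2 : ZMod m)) (g x) from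
        Finset.sum_congr rfl fun x _ => by simp [hg, hψ'], this]
      refine Finset.sum_congr ?_ fun _ _ => rfl
      ext x
      simp only [Finset.mem_filter, Set.mem_range, hmem', hg, Prod.exists]
      refine and_congr_right fun _ => exists_congr fun s => exists_congr fun t => ?_
      rw [sub_eq_iff_eq_add]
      constructor
      · intro h; rw [h]; abel
      · intro h; rw [← h]; abel
    have hmean : ∑ s, ∑ t, ψ' s t = 0 := by
      rw [← h0, ← Fintype.sum_prod_type' (f := ψ'), ← Fintype.sum_prod_type' (f := ψ)]
      have hu : IsUnit ((I : ℤ) : ZMod m) := by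
        obtain ⟨x, y, hxy⟩ := hIc
        refine IsUnit.of_mul_eq_one (x : ZMod m) ?_
        have := congrArg (Int.cast : ℤ → ZMod m) hxy
        push_cast at this
        rw [mul_comm]; simpa using this
      have hIz : ((I : ℤ) : ZMod m) = (v.1 : ZMod m) * w.2 - v.2 * w.1 := by rw [hI]; push_cast; ring
      rw [hIz] at hu
      have binj : Function.Injective (fun st : ZMod m × ZMod m =>
          ((x₀.1 : ZMod m) + st.1 * v.1 + st.2 * w.1, (x₀.2 : ZMod m) + st.1 * v.2 + st.2 * w.2)) := by
        rintro ⟨s, t⟩ ⟨s', t'⟩ h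
        have h1 := congrArg Prod.fst h; have h2 := congrArg Prod.snd h
        simp only at h1 h2
        ext
        · apply hu.mul_left_cancel
          simp only
          linear_combination (w.2 : ZMod m) * h1 - (w.1 : ZMod m) * h2
        · apply hu.mul_left_cancel
          simp only
          linear_combination (v.1 : ZMod m) * h2 - (v.2 : ZMod m) * h1
      have bbij := (Finite.injective_iff_bijective).1 binj
      exact bbij.sum_comp (fun x : ZMod m × ZMod m => ψ x.1 x.2)
    rw [hsum]
    refine (twoD_std ψ' (fun _ _ => hψ _ _) hmean A K ?_ ?_).trans ?_
    · intro t
      convert hBV (x₀ + t • w) v hv0 using 5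
      rw [hAm, hAm]; simp only [hg]; rw [add_right_comm, add_right_comm x₀ (_ • v)]
    · intro s
      convert hBV (x₀ + s • v) w hw0 using 5
      rw [hAm, hAm]
    · gcongr
      · refine (card_line _ (x₀.1 * w.2 - x₀.2 * w.1) I hI0 (2 * M * nv w) (by positivity) ?_).trans ?_
        · intro s hs
          obtain ⟨⟨s', t⟩, hst, rfl⟩ := Finset.mem_image.1 hs
          have hx := hbox _ ((hAm _).1 hst)
          have := det_abs_le w _ M hx.1 hx.2
          rw [← abs_neg] at this
          convert this using 2
          simp only [hg, hI]; push_cast; simp; ring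
        · refine add_le_add_left ?_ _
          rw [div_le_div_iff₀ hIr hvp]
          nlinarith
      · refine (card_line _ (v.1 * x₀.2 - v.2 * x₀.1) I hI0 (2 * M * nv v) (by positivity) ?_).trans ?_
        · intro s hs
          obtain ⟨⟨s', t⟩, hst, rfl⟩ := Finset.mem_image.1 hs
          have hx := hbox _ ((hAm _).1 hst)
          have := det_abs_le v _ M hx.1 hx.2
          convert this using 2
          simp only [hg, hI]; push_cast; simp; ring
        · refine add_le_add_left ?_ _
          rw [div_le_div_iff₀ hIr hwp]
          nlinarith
  have hvΛ : v ∈ Λ := (hmem' v).2 ⟨1, 0, by simp⟩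
  have hwΛ : w ∈ Λ := (hmem' w).2 ⟨0, 1, by simp⟩
  rcases le_total (nv v) (nv w) with h | h
  · refine ⟨v, hvΛ, hv0, ?_⟩
    intro Ω K M hM hbox hBV ψ hψ h0 x₀
    refine (main Ω K M hM hbox hBV ψ hψ h0 x₀).trans ?_
    have : 8 * M / nv w ≤ 8 * M / nv v := by gcongr
    refine mul_le_mul_of_nonneg_left ?_ (by positivity)
    rw [show 16 * M / nv v = 8 * M / nv v + 8 * M / nv v by ring]
    linarith
  · refine ⟨w, hwΛ, hw0, ?_⟩
    intro Ω K M hM hbox hBV ψ hψ h0 x₀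
    refine (main Ω K M hM hbox hBV ψ hψ h0 x₀).trans ?_
    have : 8 * M / nv v ≤ 8 * M / nv w := by gcongr
    refine mul_le_mul_of_nonneg_left ?_ (by positivity)
    rw [show 16 * M / nv w = 8 * M / nv w + 8 * M / nv w by ring]
    linarith

theorem LatB.top (m : ℕ) : LatB ⊤ m := by
  refine ⟨(1, 0), (0, 1), by norm_num, by norm_num; exact isCoprime_one_left, fun x => ?_⟩
  simp only [AddSubgroup.mem_top, true_iff]
  exact ⟨x.1, x.2, by ext <;> simp⟩

/-- The lattice of solutions of a linear congruence. -/
def congLat (p : ℕ) (α β : ℤ) : AddSubgroup (ℤ × ℤ) where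
  carrier := {x | (p : ℤ) ∣ α * x.1 + β * x.2}
  add_mem' := by
    intro x y hx hy
    simp only [Set.mem_setOf_eq, Prod.fst_add, Prod.snd_add] at *
    have := dvd_add hx hy
    rwa [show α * x.1 + β * x.2 + (α * y.1 + β * y.2) = α * (x.1 + y.1) + β * (x.2 + y.2) by ring] at this
  zero_mem' := by simp
  neg_mem' := by
    intro x hx
    simp only [Set.mem_setOf_eq, Prod.fst_neg, Prod.snd_neg] at *
    have := dvd_neg.2 hx
    rwa [show -(α * x.1 + β * x.2) = α * -x.1 + β * -x.2 by ring] at this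

theorem mem_congLat {p : ℕ} {α β : ℤ} {x : ℤ × ℤ} : x ∈ congLat p α β ↔ (p : ℤ) ∣ α * x.1 + β * x.2 := Iff.rfl

theorem LatB.inf_cong {Λ : AddSubgroup (ℤ × ℤ)} {m : ℕ} (h : LatB Λ m) {p : ℕ} (hp : p.Prime) (hpm : p.Coprime m) (α β : ℤ) :
    LatB (Λ ⊓ congLat p α β) m := by
  obtain ⟨e, f, hI0, hIc, hmem⟩ := h
  have hpI : Prime (p : ℤ) := Nat.prime_iff_prime_int.1 hp
  have hcop : IsCoprime (p : ℤ) (m : ℤ) := Nat.isCoprime_iff_coprime.2 hpm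
  have aux : ∀ e f : ℤ × ℤ, e.1 * f.2 - e.2 * f.1 ≠ 0 → IsCoprime (e.1 * f.2 - e.2 * f.1) (m : ℤ) →
      (∀ x, x ∈ Λ ↔ ∃ s t : ℤ, x = s • e + t • f) → ¬ (p:ℤ) ∣ α * e.1 + β * e.2 → LatB (Λ ⊓ congLat p α β) m := by
    intro e f hI0 hIc hmem h1
    obtain ⟨x, y, hxy⟩ := (hpI.coprime_iff_not_dvd.2 h1)
    set k := - y * (α * f.1 + β * f.2) with hk
    have hkk : (p:ℤ) ∣ α * f.1 + β * f.2 + k * (α * e.1 + β * e.2) :=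
      ⟨x * (α * f.1 + β * f.2), by rw [hk]; linear_combination (-(α * f.1 + β * f.2)) * hxy⟩
    refine ⟨(p : ℤ) • e, f + k • e, ?_, ?_, ?_⟩
    · have : ((p : ℤ) • e).1 * (f + k • e).2 - ((p : ℤ) • e).2 * (f + k • e).1 = p * (e.1 * f.2 - e.2 * f.1) := by
        simp; ring
      rw [this]
      exact mul_ne_zero hpI.ne_zero hI0
    · have : ((p : ℤ) • e).1 * (f + k • e).2 - ((p : ℤ) • e).2 * (f + k • e).1 = p * (e.1 * f.2 - e.2 * f.1) := by
        simp; ring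
      rw [this]
      exact hcop.mul_left hIc
    · intro z
      rw [AddSubgroup.mem_inf, hmem, mem_congLat]
      constructor
      · rintro ⟨⟨s, t, rfl⟩, h⟩
        have : (p:ℤ) ∣ (s - t * k) * (α * e.1 + β * e.2) := by
          have := dvd_sub h (hkk.mul_left t)
          refine this.trans (dvd_of_eq ?_)
          simp only [Prod.fst_add, Prod.snd_add, Prod.smul_fst, Prod.smul_snd, smul_eq_mul]; ring
        obtain ⟨c, hc⟩ := (hpI.dvd_or_dvd this).resolve_right h1
        refine ⟨c, t, ?_⟩
        have hs : s = p * c + t * k := by linarith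
        rw [hs]; ext <;> simp <;> ring
      · rintro ⟨s, t, rfl⟩
        refine ⟨⟨s * p + t * k, t, ?_⟩, ?_⟩
        · ext <;> simp <;> ring
        · obtain ⟨c, hc⟩ := hkk
          refine ⟨s * (α * e.1 + β * e.2) + t * c, ?_⟩
          simp
          linear_combination t * hc
  by_cases h1 : (p:ℤ) ∣ α * e.1 + β * e.2
  · by_cases h2 : (p:ℤ) ∣ α * f.1 + β * f.2
    · refine ⟨e, f, hI0, hIc, fun x => ?_⟩
      rw [AddSubgroup.mem_inf, hmem, and_iff_left_iff_imp]
      rintro ⟨s, t, rfl⟩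
      rw [mem_congLat]
      refine (dvd_add (h1.mul_left s) (h2.mul_left t)).trans (dvd_of_eq ?_)
      simp only [Prod.fst_add, Prod.snd_add, Prod.smul_fst, Prod.smul_snd, smul_eq_mul]; ring
    · refine aux f e ?_ ?_ ?_ h2
      · intro h; apply hI0; linarith
      · rw [show f.1 * e.2 - f.2 * e.1 = -(e.1 * f.2 - e.2 * f.1) by ring]; exact hIc.neg_left
      · intro x; rw [hmem, exists_comm]; simp only [add_comm]
  · exact aux e f hI0 hIc hmem h1

/-- Sign changes of a polynomial along the integers. -/
theorem poly_changes (P : Polynomial ℝ) :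
    {k : ℤ | ¬ (0 < P.eval (k : ℝ) ↔ 0 < P.eval ((k + 1 : ℤ) : ℝ))}.Finite ∧
    {k : ℤ | ¬ (0 < P.eval (k : ℝ) ↔ 0 < P.eval ((k + 1 : ℤ) : ℝ))}.ncard ≤ 2 * P.natDegree := by
  rcases eq_or_ne P 0 with rfl | hP
  · simp
  set R := P.roots.toFinset with hR
  have hsub : {k : ℤ | ¬ (0 < P.eval (k : ℝ) ↔ 0 < P.eval ((k + 1 : ℤ) : ℝ))} ⊆
      ((R.image (fun x => ⌊x⌋) ∪ R.image (fun x => ⌈x⌉ - 1) : Finset ℤ) : Set ℤ) := by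
    intro k hk
    simp only [Set.mem_setOf_eq] at hk
    obtain ⟨x, hx, hx0⟩ : ∃ x ∈ Set.Icc (k : ℝ) ((k + 1 : ℤ) : ℝ), P.eval x = 0 := by
      have hle : (k : ℝ) ≤ ((k + 1 : ℤ) : ℝ) := by push_cast; linarith
      have hc : ContinuousOn (fun x => P.eval x) (Set.Icc (k : ℝ) ((k + 1 : ℤ) : ℝ)) := P.continuous.continuousOn
      by_cases h : 0 < P.eval (k : ℝ)
      · have h' : P.eval ((k + 1 : ℤ) : ℝ) ≤ 0 := by
          by_contra h'; push Not at h'; tauto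
        exact intermediate_value_Icc' hle hc ⟨h', h.le⟩
      · have h' : 0 < P.eval ((k + 1 : ℤ) : ℝ) := by
          by_contra h'; tauto
        exact intermediate_value_Icc hle hc ⟨not_lt.1 h, h'.le⟩
    have hxR : x ∈ R := by
      rw [hR, Multiset.mem_toFinset, Polynomial.mem_roots hP]; exact hx0
    rw [Finset.coe_union, Set.mem_union, Finset.mem_coe, Finset.mem_coe, Finset.mem_image, Finset.mem_image]
    rcases hx.2.lt_or_eq with h | h
    · left
      refine ⟨x, hxR, ?_⟩
      rw [Int.floor_eq_iff]
      push_cast at h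
      exact ⟨hx.1, h⟩
    · right
      refine ⟨x, hxR, ?_⟩
      rw [h, Int.ceil_intCast]; ring
  refine ⟨(Finset.finite_toSet _).subset hsub, ?_⟩
  refine (Set.ncard_le_ncard hsub (Finset.finite_toSet _)).trans ?_
  rw [Set.ncard_coe_finset]
  refine (Finset.card_union_le _ _).trans ?_
  have h1 : R.card ≤ P.natDegree := (Multiset.toFinset_card_le _).trans (Polynomial.card_roots' P)
  have h2 := Finset.card_image_le (s := R) (f := fun x => ⌊x⌋)
  have h3 := Finset.card_image_le (s := R) (f := fun x => ⌈x⌉ - 1)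
  omega

end CF

namespace CF

/-- Discriminant over a ring. -/
def dsc {R : Type*} [CommRing R] (a b c d : R) : R :=
  b^2*c^2 - 4*a*c^3 - 4*b^3*d - 27*a^2*d^2 + 18*a*b*c*d

/-- Vanishing of the local character sums. -/
def Good (R : Type) [CommRing R] [Fintype R] : Prop :=
  ∀ χ : R →* ℂ, (∀ x, ¬ IsUnit x → χ x = 0) → (∃ l, IsUnit l ∧ χ l ^ 6 ≠ 1) →
    ∀ a b : R, ∑ c, ∑ d, χ (dsc a b c d) = 0

theorem Good.prod {R S : Type} [CommRing R] [Fintype R] [CommRing S] [Fintype S] (hR : Good R) (hS : Good S) :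
    Good (R × S) := by
  rintro χ h0 ⟨l, hl, hl6⟩ a b
  set χ1 : R →* ℂ := { toFun := fun x => χ (x, 1), map_one' := by rw [← Prod.one_eq_mk]; simp, map_mul' := fun x y => by rw [← map_mul]; simp } with h1
  set χ2 : S →* ℂ := { toFun := fun x => χ (1, x), map_one' := by rw [← Prod.one_eq_mk]; simp, map_mul' := fun x y => by rw [← map_mul]; simp } with h2
  have hχ : ∀ x y, χ (x, y) = χ1 x * χ2 y := by
    intro x y
    simp only [h1, h2, MonoidHom.coe_mk, OneHom.coe_mk]
    rw [← map_mul]; simp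
  have h10 : ∀ x, ¬ IsUnit x → χ1 x = 0 := fun x hx => h0 _ fun h => hx (Prod.isUnit_iff.1 h).1
  have h20 : ∀ x, ¬ IsUnit x → χ2 x = 0 := fun x hx => h0 _ fun h => hx (Prod.isUnit_iff.1 h).2
  have hsum : ∑ c, ∑ d, χ (dsc a b c d) = (∑ c, ∑ d, χ1 (dsc a.1 b.1 c d)) * (∑ c, ∑ d, χ2 (dsc a.2 b.2 c d)) := by
    have e : ∀ c d : R × S, χ (dsc a b c d) = χ1 (dsc a.1 b.1 c.1 d.1) * χ2 (dsc a.2 b.2 c.2 d.2) := by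
      intro c d
      rw [← hχ]; rfl
    simp only [e]
    rw [Fintype.sum_prod_type]
    simp only [Fintype.sum_prod_type]
    rw [Finset.sum_mul_sum]
    refine Finset.sum_congr rfl fun c _ => Finset.sum_congr rfl fun d _ => ?_
    rw [Finset.sum_mul_sum]
  rw [hsum]
  have hl' := Prod.isUnit_iff.1 hl
  by_cases h : χ1 l.1 ^ 6 = 1
  · rw [hS χ2 h20 ⟨l.2, hl'.2, ?_⟩, mul_zero]
    intro h'
    apply hl6
    rw [show l = (l.1, l.2) from rfl, hχ, mul_pow, h, h', one_mul]
  · rw [hR χ1 h10 ⟨l.1, hl'.1, h⟩, zero_mul]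

theorem Good.equiv {R S : Type} [CommRing R] [Fintype R] [CommRing S] [Fintype S] (e : R ≃+* S) (hS : Good S) : Good R := by
  rintro χ h0 ⟨l, hl, hl6⟩ a b
  have := hS (χ.comp (e.symm : S →* R)) (fun x hx => h0 _ (by simpa using hx)) ⟨e l, by simpa using hl, by simpa using hl6⟩ (e a) (e b)
  rw [← this, ← e.toEquiv.sum_comp]
  refine Finset.sum_congr rfl fun c _ => ?_
  rw [← e.toEquiv.sum_comp]
  refine Finset.sum_congr rfl fun d _ => ?_
  simp only [MonoidHom.comp_apply]
  congr 1
  have : dsc (e a) (e b) (e.toEquiv c) (e.toEquiv d) = e (dsc a b c d) := by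
    have h4 : e 4 = 4 := map_ofNat e 4
    have h27 : e 27 = 27 := map_ofNat e 27
    have h18 : e 18 = 18 := map_ofNat e 18
    simp [dsc, h4, h27, h18]
  rw [this]; simp

section loc
variable {R : Type} [CommRing R] [Fintype R]

theorem sum_chi_zero (χ : R →* ℂ) (l : R) (hl : IsUnit l) (h : χ l ^ 6 ≠ 1) : ∑ x, χ x = 0 := by
  have hb : Function.Bijective (fun x => l * x) :=
    (Finite.injective_iff_bijective).1 fun x y h => hl.mul_left_cancel h
  have e : ∑ x, χ x = χ l * ∑ x, χ x := by
    rw [Finset.mul_sum, ← hb.sum_comp]; simp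
  by_contra h0
  apply h
  have : χ l = 1 := by
    apply mul_right_cancel₀ h0; rw [← e, one_mul]
  rw [this, one_pow]

theorem good_local (p : ℕ) (hp : p.Prime) (hnu : ∀ x : R, ¬ IsUnit x ↔ (p : R) ∣ x)
    (hn : ∀ n : ℕ, n.Coprime p → IsUnit (n : R)) (htot : ∀ x y : R, x ∣ y ∨ y ∣ x)
    (hres : p = 2 → ∀ x : R, (2:R) ∣ x * (x - 1)) : Good R := by
  rintro χ h0 ⟨l, hl, hl6⟩ a b
  have hadd : ∀ x y : R, IsUnit x → (p : R) ∣ y → IsUnit (x + y) := by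
    intro x y hx hy
    by_contra h
    exact (hnu x).2 ((dvd_add_left hy).1 ((hnu _).1 h)) hx
  have hz : ∀ x, (p : R) ∣ x → χ x = 0 := fun x hx => h0 x ((hnu x).2 hx)
  by_cases hb3 : 3 * a ∣ b
  · obtain ⟨t, ht⟩ := hb3
    -- shift to `b = 0`
    have hshift : ∑ c, ∑ d, χ (dsc a b c d) = ∑ c, ∑ d, χ (dsc a 0 c d) := by
      rw [← Equiv.sum_comp (Equiv.addRight (-(3*a*t^2) + 2*b*t))]
      refine Finset.sum_congr rfl fun c _ => ?_
      rw [← Equiv.sum_comp (Equiv.addRight (a*t^3 - b*t^2 + t * (c + (-(3*a*t^2) + 2*b*t))))]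
      refine Finset.sum_congr rfl fun d _ => ?_
      congr 1
      simp only [dsc, Equiv.coe_addRight, ht]
      ring
    rw [hshift]
    have b2 : Function.Bijective (fun x : R => l^2 * x) :=
      (Finite.injective_iff_bijective).1 fun x y h => (hl.pow 2).mul_left_cancel h
    have b3 : Function.Bijective (fun x : R => l^3 * x) :=
      (Finite.injective_iff_bijective).1 fun x y h => (hl.pow 3).mul_left_cancel h
    have e : ∑ c, ∑ d, χ (dsc a 0 c d) = χ l ^ 6 * ∑ c, ∑ d, χ (dsc a 0 c d) := by
      conv_lhs => rw [← b2.sum_comp]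
      rw [Finset.mul_sum]
      refine Finset.sum_congr rfl fun c _ => ?_
      conv_lhs => rw [← b3.sum_comp]
      rw [Finset.mul_sum]
      refine Finset.sum_congr rfl fun d _ => ?_
      rw [← map_pow, ← map_mul]
      congr 1
      simp only [dsc]; ring
    by_contra h
    apply hl6
    apply mul_right_cancel₀ h
    rw [← e, one_mul]
  have hb3' := (htot (3 * a) b).resolve_left hb3
  obtain ⟨t, ht⟩ := hb3'
  have htn : (p : R) ∣ t := by
    rw [← hnu]; intro hu
    apply hb3
    rw [ht]
    obtain ⟨u, rfl⟩ := hu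
    exact ⟨((u⁻¹ : Rˣ) : R), by rw [mul_assoc]; simp⟩
  have h3a : (p : R) ∣ 3 * a := by rw [ht]; exact htn.mul_left b
  by_cases hbu : IsUnit b
  swap
  · have hbn := (hnu b).1 hbu
    have han : (p : R) ∣ a := by
      rw [← hnu]; intro ha
      rcases eq_or_ne p 3 with rfl | hp3
      · obtain ⟨b', hb'⟩ := hbn
        obtain ⟨t', ht'⟩ := htn
        have h1 : (3 : R) * (a + (3:ℕ) * (-(b' * t'))) = 0 := by
          push_cast at hb' ht' ⊢
          rw [hb', ht'] at ht
          linear_combination ht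
        have h2 := hadd a _ ha (dvd_mul_right ((3:ℕ) : R) (-(b' * t')))
        have h3 : (3 : R) = 0 := by
          apply h2.mul_right_cancel; rw [h1, zero_mul]
        apply hb3
        rw [hb']; push_cast; rw [h3, zero_mul, zero_mul]
      · have : IsUnit ((3 : ℕ) : R) := hn 3 ((Nat.coprime_primes Nat.prime_three hp).2 (Ne.symm hp3))
        push_cast at this
        exact (hnu _).2 h3a (this.mul ha)
    refine Finset.sum_eq_zero fun c _ => Finset.sum_eq_zero fun d _ => hz _ ?_
    have : dsc a b c d = b * (b*c^2 - 4*b^2*d + 18*a*c*d) + a * (- 4*c^3 - 27*a*d^2) := by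
      simp only [dsc]; ring
    rw [this]
    exact dvd_add (hbn.mul_right _) (han.mul_right _)
  rcases hp.eq_two_or_odd' with rfl | hodd
  swap
  · have h2 : IsUnit ((2 : ℕ) : R) := hn 2 ((Nat.coprime_two_left).2 hodd)
    push_cast at h2
    refine Finset.sum_eq_zero fun c _ => ?_
    have hbij : Function.Bijective (fun d => dsc a b c d) := by
      refine (Finite.injective_iff_bijective).1 fun d d' h => ?_
      simp only [dsc] at h
      have hu : IsUnit (-(2^2*b^3) + 3*a*(6*b*c-9*a*(d+d'))) :=
        hadd _ _ (((h2.pow 2).mul (hbu.pow 3)).neg) (h3a.mul_right _)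
      have : (-(2^2*b^3) + 3*a*(6*b*c-9*a*(d+d'))) * (d - d') = 0 := by linear_combination h
      have := hu.mul_left_cancel (this.trans (mul_zero _).symm)
      exact sub_eq_zero.1 this
    rw [hbij.sum_comp (fun x => χ x)]
    exact sum_chi_zero χ l hl hl6
  -- p = 2
  have h2a : (2 : R) ∣ a := by
    have h3 : IsUnit ((3 : ℕ) : R) := hn 3 (by norm_num)
    push_cast at h3 h3a
    exact (h3.dvd_mul_left).1 h3a
  push_cast at hz hadd hnu
  have hal : ∀ γ : R, ∃ α : R, 2 ∣ α ∧ α * (b - α * γ) = a := by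
    intro γ
    have inj : Function.Injective (fun x : {x : R // 2 ∣ x} => (⟨x.1 * (b - x.1 * γ), x.2.mul_right _⟩ : {x : R // 2 ∣ x})) := by
      rintro ⟨x, hx⟩ ⟨y, hy⟩ h
      simp only [Subtype.mk.injEq] at h ⊢
      have hu : IsUnit (b + (-(x + y) * γ)) := hadd _ _ hbu ((dvd_neg.2 (dvd_add hx hy)).mul_right _)
      have : (b + (-(x + y) * γ)) * (x - y) = 0 := by linear_combination h
      exact sub_eq_zero.1 (hu.mul_left_cancel (this.trans (mul_zero _).symm))
    obtain ⟨x, hx⟩ := (Finite.injective_iff_surjective.1 inj) ⟨a, h2a⟩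
    exact ⟨x.1, x.2, congrArg Subtype.val hx⟩
  choose α hα2 hα using hal
  rw [Finset.sum_comm]
  have e1 : ∀ δ, ∑ c, χ (dsc a b c δ) = ∑ γ, χ (dsc a b (γ + α γ * δ) δ) := by
    intro δ
    have hb : Function.Bijective (fun γ => γ + α γ * δ) := by
      refine (Finite.injective_iff_bijective).1 fun x y h => ?_
      have h : x + α x * δ = y + α y * δ := h
      have h1 : (α x - α y) * (b + (-(α x + α y) * y)) = α x ^ 2 * (x - y) := by
        linear_combination hα x - hα y
      have hu : IsUnit (b + (-(α x + α y) * y)) := hadd _ _ hbu ((dvd_neg.2 (dvd_add (hα2 x) (hα2 y))).mul_right _)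
      have hu2 : IsUnit (b + (-(α x + α y) * y) + α x * (α x * δ)) := hadd _ _ hu ((hα2 x).mul_right _)
      have : (b + (-(α x + α y) * y) + α x * (α x * δ)) * (x - y) = 0 := by
        linear_combination (b + (-(α x + α y) * y)) * h - δ * h1
      exact sub_eq_zero.1 (hu2.mul_left_cancel (this.trans (mul_zero _).symm))
    exact (hb.sum_comp (fun c => χ (dsc a b c δ))).symm
  simp only [e1]
  rw [Finset.sum_comm]
  refine Finset.sum_eq_zero fun γ _ => ?_
  obtain ⟨e, he⟩ := hα2 γ
  set β := b - α γ * γ with hβ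
  set u₀ := β - α γ * γ with hu₀
  have hD : ∀ δ, dsc a b (γ + α γ * δ) δ = (γ^2 - 4*β*δ) * (u₀ + α γ ^2 * δ)^2 := by
    intro δ
    have h1 : a = α γ * β := (hα γ).symm
    have h2 : b = β + α γ * γ := by rw [hβ]; ring
    rw [hu₀, h1]
    generalize β = β' at *
    rw [h2]; simp only [dsc]; ring
  by_cases hγ : IsUnit γ
  swap
  · refine Finset.sum_eq_zero fun δ _ => hz _ ?_
    rw [hD]
    obtain ⟨g, hg⟩ := (hnu γ).1 hγ
    exact ⟨(2 * g^2 - 2*β*δ) * (u₀ + α γ ^2 * δ)^2, by rw [hg]; ring⟩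
  have hβu : IsUnit β := by
    rw [hβ, sub_eq_add_neg]; exact hadd _ _ hbu (dvd_neg.2 ((hα2 γ).mul_right _))
  have hu0 : IsUnit u₀ := by
    rw [hu₀, sub_eq_add_neg]; exact hadd _ _ hβu (dvd_neg.2 ((hα2 γ).mul_right _))
  set u : R → R := fun δ => -β*u₀^2*δ + γ^2*(2*u₀*e^2*δ+4*e^4*δ^2) - 4*β*δ*(2*u₀*e^2*δ+4*e^4*δ^2) with hu
  have hDu : ∀ δ, dsc a b (γ + α γ * δ) δ = (γ*u₀)^2 + 4 * u δ := by
    intro δ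
    rw [hD, he, hu]; ring
  have hub : Function.Bijective u := by
    refine (Finite.injective_iff_bijective).1 fun x y h => ?_
    simp only [hu] at h
    have hU : IsUnit (-(β*u₀^2) + 2 * (γ^2*(u₀*e^2+2*e^4*(x+y)) - 2*β*(2*u₀*e^2*(x+y)+4*e^4*(x^2+x*y+y^2)))) :=
      hadd _ _ ((hβu.mul (hu0.pow 2)).neg) (dvd_mul_right _ _)
    have : (-(β*u₀^2) + 2 * (γ^2*(u₀*e^2+2*e^4*(x+y)) - 2*β*(2*u₀*e^2*(x+y)+4*e^4*(x^2+x*y+y^2)))) * (x - y) = 0 := by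
      linear_combination h
    exact sub_eq_zero.1 (hU.mul_left_cancel (this.trans (mul_zero _).symm))
  simp only [hDu]
  rw [hub.sum_comp (fun t => χ ((γ*u₀)^2 + 4 * t))]
  have hres := hres rfl
  obtain ⟨v, hv⟩ : ∃ v, l = 1 + 2 * v := by
    obtain ⟨v, hv⟩ := (hl.dvd_mul_left).1 (hres l)
    exact ⟨v, by rw [← hv]; ring⟩
  have hU : IsUnit ((γ*u₀)^2) := (hγ.mul hu0).pow 2
  have bU : Function.Bijective (fun x : R => (γ*u₀)^2 * x) :=
    (Finite.injective_iff_bijective).1 fun x y h => hU.mul_left_cancel h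
  rw [← bU.sum_comp]
  have bl : Function.Bijective (fun x : R => (v^2+v) + (l^2) * x) :=
    (Finite.injective_iff_bijective).1 fun x y h => (hl.pow 2).mul_left_cancel (add_left_cancel h)
  have e : ∑ t, χ ((γ*u₀)^2 + 4 * ((γ*u₀)^2 * t)) = χ l ^ 2 * ∑ t, χ ((γ*u₀)^2 + 4 * ((γ*u₀)^2 * t)) := by
    conv_lhs => rw [← bl.sum_comp]
    rw [Finset.mul_sum]
    refine Finset.sum_congr rfl fun t _ => ?_
    rw [← map_pow, ← map_mul, hv]
    congr 1; ring
  by_contra h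
  apply hl6
  have : χ l ^ 2 = 1 := by
    apply mul_right_cancel₀ h; rw [← e, one_mul]
  rw [show χ l ^ 6 = (χ l ^ 2)^3 by ring, this, one_pow]
end loc

theorem good_prime_pow (p k : ℕ) (hp : p.Prime) (hk : 0 < k) [NeZero (p^k)] : Good (ZMod (p^k)) := by
  have hcast : ∀ x : ZMod (p^k), ∃ n : ℕ, (n : ZMod (p^k)) = x := fun x => ⟨x.val, ZMod.natCast_zmod_val x⟩
  have hnu : ∀ x : ZMod (p^k), ¬ IsUnit x ↔ (p : ZMod (p^k)) ∣ x := by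
    intro x
    obtain ⟨n, rfl⟩ := hcast x
    rw [ZMod.isUnit_iff_coprime, Nat.coprime_pow_right_iff hk, Nat.coprime_comm, hp.coprime_iff_not_dvd, not_not]
    constructor
    · rintro ⟨t, rfl⟩; exact ⟨t, by push_cast; rfl⟩
    · rintro ⟨t, ht⟩
      obtain ⟨t, rfl⟩ := hcast t
      rw [← Nat.cast_mul, ZMod.natCast_eq_natCast_iff] at ht
      have := ht.of_dvd (dvd_pow_self p hk.ne')
      exact (Nat.modEq_zero_iff_dvd.1 (this.trans ((Nat.modEq_zero_iff_dvd.2 (dvd_mul_right _ _)))))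
  have hform : ∀ x : ZMod (p^k), ∃ i : ℕ, ∃ u, IsUnit u ∧ x = (p : ZMod (p^k))^i * u := by
    intro x
    by_cases hx : x = 0
    · refine ⟨k, 1, isUnit_one, ?_⟩
      rw [hx, mul_one, ← Nat.cast_pow, ZMod.natCast_self]
    obtain ⟨n, rfl⟩ := hcast x
    have hn0 : n ≠ 0 := by rintro rfl; simp at hx
    obtain ⟨i, t, ht, rfl⟩ := Nat.exists_eq_pow_mul_and_not_dvd hn0 p hp.ne_one
    refine ⟨i, t, ?_, by push_cast; rfl⟩
    rw [ZMod.isUnit_iff_coprime, Nat.coprime_pow_right_iff hk, Nat.coprime_comm, hp.coprime_iff_not_dvd]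
    exact ht
  refine good_local p hp hnu ?_ ?_ ?_
  · intro n hn
    rw [ZMod.isUnit_iff_coprime]; exact hn.pow_right k
  · intro x y
    obtain ⟨i, u, hu, rfl⟩ := hform x
    obtain ⟨j, w, hw, rfl⟩ := hform y
    rcases le_total i j with h | h
    · left; exact hu.mul_right_dvd.2 ((pow_dvd_pow _ h).mul_right _)
    · right; exact hw.mul_right_dvd.2 ((pow_dvd_pow _ h).mul_right _)
  · rintro rfl x
    obtain ⟨n, rfl⟩ := hcast x
    have h : ∀ i : ℤ, (2:ℤ) ∣ i * (i - 1) := fun i => (Int.even_mul_pred_self i).two_dvd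
    obtain ⟨t, ht⟩ := h n
    refine ⟨(t : ZMod (2^k)), ?_⟩
    have := congrArg (Int.cast : ℤ → ZMod (2^k)) ht
    push_cast at this
    exact this

theorem good_zmod (m : ℕ) (hm : m ≠ 0) : ∀ [NeZero m], Good (ZMod m) := by
  induction m using Nat.recOnPosPrimePosCoprime with
  | prime_pow p n hp hn => intro _; exact good_prime_pow p n hp hn
  | zero => exact absurd rfl hm
  | one =>
    intro _ χ _ h
    obtain ⟨l, _, h6⟩ := h
    exfalso; apply h6
    rw [show l = 1 from Subsingleton.elim _ _, map_one, one_pow]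
  | coprime a b ha hb hab iha ihb =>
    intro _
    haveI : NeZero a := ⟨by omega⟩
    haveI : NeZero b := ⟨by omega⟩
    exact Good.equiv (ZMod.chineseRemainder hab) (Good.prod (iha (by omega)) (ihb (by omega)))

theorem dsc_sum_zero (m : ℕ) [NeZero m] (χ : DirichletCharacter ℂ m) (h6 : χ ^ 6 ≠ 1) (a b : ZMod m) :
    ∑ c, ∑ d, χ (dsc a b c d) = 0 := by
  refine good_zmod m (NeZero.ne m) χ.toMonoidHom (fun x hx => χ.map_nonunit hx) ?_ a b
  by_contra! h
  apply h6
  ext u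
  have := h u u.isUnit
  rw [MulChar.pow_apply_coe]
  simpa using this
end CF

namespace CF

/-- The divisor bound. -/
theorem divisor_bound (ε : ℝ) (hε : 0 < ε) : ∃ C : ℝ, 1 ≤ C ∧ ∀ n : ℕ, 0 < n → (n.divisors.card : ℝ) ≤ C * (n : ℝ) ^ ε := by
  have hl2 : 0 < Real.log 2 := Real.log_pos (by norm_num)
  set A : ℝ := 1 + 1 / (ε * Real.log 2) with hA
  have hA1 : 1 ≤ A := by rw [hA]; have : 0 ≤ 1 / (ε * Real.log 2) := by positivity
                         linarith
  obtain ⟨P, hP⟩ : ∃ P : ℕ, (2:ℝ) ^ (1/ε) ≤ P := exists_nat_ge _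
  refine ⟨A ^ P, one_le_pow₀ hA1, fun n hn => ?_⟩
  rw [Nat.card_divisors hn.ne']
  have hfac : (n : ℝ) ^ ε = ∏ p ∈ n.primeFactors, ((p : ℝ) ^ ε) ^ (n.factorization p) := by
    conv_lhs => rw [← Nat.prod_factorization_pow_eq_self hn.ne', Finsupp.prod, Nat.support_factorization]
    push_cast
    rw [← Real.finsetProd_rpow _ _ (fun i _ => by positivity)]
    refine Finset.prod_congr rfl fun p _ => ?_
    rw [← Real.rpow_natCast, ← Real.rpow_natCast, ← Real.rpow_mul (by positivity), ← Real.rpow_mul (by positivity), mul_comm]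
  have key : ∀ p ∈ n.primeFactors, ((n.factorization p + 1 : ℕ) : ℝ) ≤ (if p < P then A else 1) * ((p : ℝ) ^ ε) ^ (n.factorization p) := by
    intro p hp
    have hp' := Nat.prime_of_mem_primeFactors hp
    set k := n.factorization p
    have hp2 : (2:ℝ) ≤ p := by exact_mod_cast hp'.two_le
    split_ifs with h
    · have h1 : (2:ℝ)^ε ≤ (p:ℝ)^ε := Real.rpow_le_rpow (by norm_num) hp2 hε.le
      have h2 : 1 + k * (ε * Real.log 2) ≤ ((2:ℝ)^ε)^k := by
        rw [← Real.rpow_natCast, ← Real.rpow_mul (by norm_num), Real.rpow_def_of_pos (by norm_num)]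
        have := Real.add_one_le_exp (Real.log 2 * (ε * k))
        linarith
      have h3 : ((2:ℝ)^ε)^k ≤ ((p:ℝ)^ε)^k := pow_le_pow_left₀ (by positivity) h1 k
      calc ((k+1:ℕ):ℝ) ≤ A * (1 + k * (ε * Real.log 2)) := by
            rw [hA]; push_cast
            have : (1 + 1 / (ε * Real.log 2)) * (1 + k * (ε * Real.log 2)) = 1 + k + k * (ε * Real.log 2) + 1 / (ε * Real.log 2) := by
              field_simp; ring
            rw [this]
            have : 0 ≤ k * (ε * Real.log 2) := by positivity
            have : 0 ≤ 1 / (ε * Real.log 2) := by positivity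
            linarith
        _ ≤ _ := by gcongr; linarith
    · rw [one_mul]
      have h1 : (2:ℝ) ≤ (p:ℝ)^ε := by
        have : (P:ℝ) ≤ p := by exact_mod_cast not_lt.1 h
        calc (2:ℝ) = ((2:ℝ)^(1/ε))^ε := by rw [← Real.rpow_mul (by norm_num)]; field_simp; simp
          _ ≤ _ := Real.rpow_le_rpow (by positivity) (hP.trans this) hε.le
      calc ((k+1:ℕ):ℝ) ≤ ((2^k : ℕ) : ℝ) := by exact_mod_cast Nat.lt_two_pow_self
        _ = (2:ℝ)^k := by push_cast; rfl
        _ ≤ _ := pow_le_pow_left₀ (by norm_num) h1 k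
  push_cast at key ⊢
  refine (Finset.prod_le_prod (fun p _ => by positivity) key).trans ?_
  rw [Finset.prod_mul_distrib, ← hfac]
  refine mul_le_mul_of_nonneg_right ?_ (by positivity)
  rw [Finset.prod_ite, Finset.prod_const, Finset.prod_const_one, mul_one]
  refine pow_le_pow_right₀ hA1 ?_
  calc _ ≤ (Finset.range P).card := Finset.card_le_card fun p hp => by simp at hp ⊢; exact hp.2
    _ = P := by simp

theorem sum_le_inj {ι κ : Type*} {s : Finset ι} {t : Finset κ} {h : ι → ℝ} {g : κ → ℝ} (f : ι → κ)
    (h1 : ∀ x ∈ s, f x ∈ t) (h2 : Set.InjOn f s) (h3 : ∀ y ∈ t, 0 ≤ g y) (h4 : ∀ x ∈ s, h x ≤ g (f x)) :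
    ∑ x ∈ s, h x ≤ ∑ y ∈ t, g y := by
  calc _ ≤ ∑ x ∈ s, g (f x) := Finset.sum_le_sum h4
    _ = ∑ y ∈ s.image f, g y := (Finset.sum_image h2).symm
    _ ≤ _ := Finset.sum_le_sum_of_subset_of_nonneg (Finset.image_subset_iff.2 h1) fun y hy _ => h3 y hy

/-- Box in `ℤ²` without the origin. -/
def box0 (U : ℕ) : Finset (ℤ × ℤ) := ((Finset.Icc (-(U:ℤ)) U) ×ˢ (Finset.Icc (-(U:ℤ)) U)).erase 0

theorem mem_box0 {U : ℕ} {u : ℤ × ℤ} : u ∈ box0 U ↔ u ≠ 0 ∧ nv u ≤ U := by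
  simp only [box0, Finset.mem_erase, Finset.mem_product, Finset.mem_Icc, nv]
  refine and_congr_right fun _ => ?_
  omega

theorem card_box0 (U : ℕ) : ((box0 U).card : ℤ) = (2 * U + 1)^2 - 1 := by
  rw [box0, Finset.card_erase_of_mem (by simp), Finset.card_product, Int.card_Icc]
  have : ((U:ℤ) + 1 - -(U:ℤ)).toNat = 2 * U + 1 := by omega
  rw [this, Nat.cast_sub (by nlinarith)]; push_cast; ring

theorem sum_box0 (U : ℕ) : ∑ u ∈ box0 U, (1:ℝ) / nv u ≤ 8 * U := by
  induction U with
  | zero =>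
    have : box0 0 = ∅ := by
      ext u; rw [mem_box0]; simp only [Finset.notMem_empty, iff_false, not_and, not_le]
      exact fun h => nv_pos h
    simp [this]
  | succ U ih =>
    have hsub : box0 U ⊆ box0 (U+1) := fun u hu => by rw [mem_box0] at hu ⊢; exact ⟨hu.1, by omega⟩
    rw [← Finset.sum_sdiff hsub]
    have : ∑ u ∈ box0 (U+1) \ box0 U, (1:ℝ) / nv u ≤ 8 := by
      have h1 : ∀ u ∈ box0 (U+1) \ box0 U, (1:ℝ) / nv u ≤ 1 / ((U:ℝ)+1) := by
        intro u hu
        rw [Finset.mem_sdiff, mem_box0, mem_box0] at hu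
        have h : U + 1 ≤ nv u := by
          by_contra h; exact hu.2 ⟨hu.1.1, by omega⟩
        have : ((U:ℝ)+1) ≤ nv u := by exact_mod_cast h
        exact one_div_le_one_div_of_le (by positivity) this
      refine (Finset.sum_le_card_nsmul _ _ _ h1).trans ?_
      rw [nsmul_eq_mul]
      have hc : (((box0 (U+1) \ box0 U).card : ℤ) : ℝ) = 8 * ((U:ℝ)+1) := by
        rw [Finset.card_sdiff_of_subset hsub, Nat.cast_sub (Finset.card_le_card hsub), card_box0, card_box0]
        push_cast; ring
      rw [Int.cast_natCast] at hc
      rw [hc]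
      have : (U:ℝ)+1 ≠ 0 := by positivity
      field_simp; norm_num
    push_cast
    linarith

theorem sum_box0_dvd (U E : ℕ) (hE : 0 < E) :
    ∑ u ∈ box0 U with E ∣ Int.gcd u.1 u.2, (1:ℝ) / nv u ≤ 8 * U / E := by
  have hE' : (0:ℝ) < E := by exact_mod_cast hE
  have hE'' : (E:ℤ) ≠ 0 := by exact_mod_cast hE.ne'
  have : ∑ u ∈ box0 U with E ∣ Int.gcd u.1 u.2, (1:ℝ) / nv u ≤ ∑ v ∈ box0 U, (1/E) * ((1:ℝ) / nv v) := by
    have hd : ∀ u : ℤ × ℤ, E ∣ Int.gcd u.1 u.2 → ∃ v : ℤ × ℤ, u = (E * v.1, E * v.2) := by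
      intro u hu
      have h1 : (E:ℤ) ∣ u.1 := (Int.natCast_dvd_natCast.2 hu).trans (Int.gcd_dvd_left ..)
      have h2 : (E:ℤ) ∣ u.2 := (Int.natCast_dvd_natCast.2 hu).trans (Int.gcd_dvd_right ..)
      obtain ⟨x, hx⟩ := h1; obtain ⟨y, hy⟩ := h2
      exact ⟨(x, y), Prod.ext hx hy⟩
    have hn : ∀ v : ℤ × ℤ, nv (E * v.1, E * v.2) = E * nv v := by
      intro v; simp only [nv, Int.natAbs_mul, Int.natAbs_natCast]
      rw [Nat.mul_max_mul_left]
    refine sum_le_inj (fun u => (u.1 / E, u.2 / E)) ?_ ?_ ?_ ?_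
    · intro u hu
      simp only [Finset.mem_filter] at hu
      obtain ⟨v, rfl⟩ := hd u hu.2
      have := mem_box0.1 hu.1
      rw [hn] at this
      simp only [Int.mul_ediv_cancel_left _ hE'']
      rw [mem_box0]
      refine ⟨fun h => this.1 ?_, le_trans (Nat.le_mul_of_pos_left _ hE) this.2⟩
      rw [Prod.ext_iff] at h ⊢; simp at h ⊢; simp [h]
    · intro u hu v hv h
      simp only [Finset.coe_filter, Set.mem_setOf_eq] at hu hv
      obtain ⟨u, rfl⟩ := hd u hu.2
      obtain ⟨v, rfl⟩ := hd v hv.2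
      simp only [Int.mul_ediv_cancel_left _ hE'', Prod.mk.injEq] at h
      rw [h.1, h.2]
    · intros; positivity
    · intro u hu
      simp only [Finset.mem_filter] at hu
      obtain ⟨v, rfl⟩ := hd u hu.2
      simp only [Int.mul_ediv_cancel_left _ hE'', hn]
      push_cast
      rw [one_div_mul_one_div]
  refine this.trans ?_
  rw [← Finset.mul_sum]
  have := mul_le_mul_of_nonneg_left (sum_box0 U) (by positivity : (0:ℝ) ≤ 1/E)
  calc _ ≤ _ := this
    _ = _ := by ring

/-- gcd-type weight. -/
def gw (s : Finset ℕ) (n : ℕ) : ℕ := ∏ p ∈ s, if p ∣ n then p else 1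

theorem gw_le (s : Finset ℕ) (hs : ∀ p ∈ s, p.Prime) (n : ℕ) :
    (gw s n : ℝ) ≤ ∑ e ∈ s.powerset, if (∏ p ∈ e, p) ∣ n then ((∏ p ∈ e, p : ℕ) : ℝ) else 0 := by
  have h1 : (gw s n : ℝ) ≤ ∏ p ∈ s, (1 + if p ∣ n then (p:ℝ) else 0) := by
    rw [gw]; push_cast
    refine Finset.prod_le_prod (fun p _ => by positivity) fun p _ => ?_
    split_ifs <;> simp
  refine h1.trans ?_
  rw [Finset.prod_one_add]
  refine Finset.sum_le_sum fun e he => ?_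
  rw [Finset.mem_powerset] at he
  split_ifs with h
  · push_cast
    refine Finset.prod_le_prod (fun p _ => by positivity) fun p _ => ?_
    split_ifs <;> simp
  · have : ∃ p ∈ e, ¬ p ∣ n := by
      by_contra! h'
      exact h (Finset.prod_primes_dvd n (fun p hp => (hs p (he hp)).prime) h')
    obtain ⟨p, hp, hpn⟩ := this
    rw [Finset.prod_eq_zero hp (by simp [hpn])]

/-- Weighted averaging of `gw`. -/
theorem gw_sum {ι : Type*} (s : Finset ℕ) (hs : ∀ p ∈ s, p.Prime) (I : Finset ι) (n : ι → ℕ) (w : ι → ℝ) (hw : ∀ i ∈ I, 0 ≤ w i) (B : ℝ)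
    (hB : ∀ E : ℕ, 0 < E → ∑ i ∈ I with E ∣ n i, w i ≤ B / E) :
    ∑ i ∈ I, (gw s (n i) : ℝ) * w i ≤ 2 ^ s.card * B := by
  calc ∑ i ∈ I, (gw s (n i) : ℝ) * w i
      ≤ ∑ i ∈ I, (∑ e ∈ s.powerset, if (∏ p ∈ e, p) ∣ n i then ((∏ p ∈ e, p : ℕ) : ℝ) else 0) * w i :=
        Finset.sum_le_sum fun i hi => mul_le_mul_of_nonneg_right (gw_le s hs _) (hw i hi)
    _ = ∑ e ∈ s.powerset, ((∏ p ∈ e, p : ℕ) : ℝ) * ∑ i ∈ I with (∏ p ∈ e, p) ∣ n i, w i := by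
        simp only [Finset.sum_mul]
        rw [Finset.sum_comm]
        refine Finset.sum_congr rfl fun e _ => ?_
        rw [Finset.sum_filter, Finset.mul_sum]
        refine Finset.sum_congr rfl fun i _ => ?_
        split_ifs <;> simp
    _ ≤ ∑ e ∈ s.powerset, B := by
        refine Finset.sum_le_sum fun e he => ?_
        have hpos : 0 < ∏ p ∈ e, p := Finset.prod_pos fun p hp => (hs p (Finset.mem_powerset.1 he hp)).pos
        have h0 : (0:ℝ) < ((∏ p ∈ e, p : ℕ) : ℝ) := by exact_mod_cast hpos
        have := mul_le_mul_of_nonneg_left (hB _ hpos) h0.le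
        rwa [mul_div_cancel₀ _ h0.ne'] at this
    _ = _ := by simp

theorem sum_gw_box (s : Finset ℕ) (hs : ∀ p ∈ s, p.Prime) (U : ℕ) :
    ∑ u ∈ box0 U, (gw s (Int.gcd u.1 u.2) : ℝ) * (1 / nv u) ≤ 2 ^ s.card * (8 * U) :=
  gw_sum s hs _ _ _ (fun _ _ => by positivity) _ fun E hE => sum_box0_dvd U E hE

theorem sum_inv_dvd (N E : ℕ) (hE : 0 < E) (H : ℝ) (hH : ∑ k ∈ Finset.Icc 1 N, (1:ℝ) / k ≤ H) :
    ∑ a ∈ Finset.Icc 1 N with E ∣ a, (1:ℝ) / a ≤ H / E := by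
  have : ∑ a ∈ Finset.Icc 1 N with E ∣ a, (1:ℝ) / a ≤ ∑ k ∈ Finset.Icc 1 N, (1/E) * ((1:ℝ) / k) := by
    refine sum_le_inj (fun a => a / E) ?_ ?_ ?_ ?_
    · intro a ha
      simp only [Finset.mem_filter, Finset.mem_Icc] at ha ⊢
      obtain ⟨k, rfl⟩ := ha.2
      rw [Nat.mul_div_cancel_left _ hE]
      refine ⟨Nat.pos_of_ne_zero fun h => ?_, le_trans (Nat.le_mul_of_pos_left _ hE) ha.1.2⟩
      rw [h] at ha; simp at ha
    · intro u hu v hv h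
      simp only [Finset.coe_filter, Set.mem_setOf_eq] at hu hv
      obtain ⟨u, rfl⟩ := hu.2
      obtain ⟨v, rfl⟩ := hv.2
      simp only [Nat.mul_div_cancel_left _ hE] at h
      rw [h]
    · intros; positivity
    · intro a ha
      simp only [Finset.mem_filter, Finset.mem_Icc] at ha
      obtain ⟨k, rfl⟩ := ha.2
      rw [Nat.mul_div_cancel_left _ hE]
      push_cast
      rw [one_div_mul_one_div]
  refine this.trans ?_
  rw [← Finset.mul_sum]
  have := mul_le_mul_of_nonneg_left hH (by positivity : (0:ℝ) ≤ 1/E)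
  calc _ ≤ _ := this
    _ = _ := by ring

theorem sum_gw_inv (s : Finset ℕ) (hs : ∀ p ∈ s, p.Prime) (N : ℕ) (H : ℝ) (hH : ∑ k ∈ Finset.Icc 1 N, (1:ℝ) / k ≤ H) :
    ∑ a ∈ Finset.Icc 1 N, (gw s a : ℝ) * (1 / a) ≤ 2 ^ s.card * H :=
  gw_sum s hs _ (fun a => a) _ (fun _ _ => by positivity) _ fun E hE => sum_inv_dvd N E hE H hH

theorem sum_gw (s : Finset ℕ) (hs : ∀ p ∈ s, p.Prime) (N : ℕ) :
    ∑ a ∈ Finset.Icc 1 N, (gw s a : ℝ) ≤ 2 ^ s.card * N := by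
  have := gw_sum s hs (Finset.Icc 1 N) (fun a => a) (fun _ => 1) (fun _ _ => by positivity) N fun E hE => by
    rw [Finset.sum_const, nsmul_eq_mul, mul_one]
    have : ((Finset.Icc 1 N).filter (fun a => E ∣ a)).card ≤ N / E := by
      rw [← Nat.Ioc_filter_dvd_card_eq_div]
      apply le_of_eq; congr 1
    exact (Nat.cast_le.2 this).trans Nat.cast_div_le
  simpa using this
end CF

namespace CF

/-- The option lattice. -/
def oL (p : ℕ) (k : (ℤ × ℤ) × (ℤ × ℤ)) : AddSubgroup (ℤ × ℤ) := congLat p k.1.1 k.1.2 ⊓ congLat p k.2.1 k.2.2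

theorem mem_oL {p : ℕ} {k : (ℤ × ℤ) × (ℤ × ℤ)} {x : ℤ × ℤ} :
    x ∈ oL p k ↔ (p : ℤ) ∣ k.1.1 * x.1 + k.1.2 * x.2 ∧ (p : ℤ) ∣ k.2.1 * x.1 + k.2.2 * x.2 := by
  rw [oL, AddSubgroup.mem_inf, mem_congLat, mem_congLat]

theorem latB_inter {ι : Type*} (m : ℕ) (pr : ι → ℕ) (hp : ∀ i, (pr i).Prime) (hpm : ∀ i, (pr i).Coprime m)
    (k : ι → (ℤ × ℤ) × (ℤ × ℤ)) (S : Finset ι) :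
    ∃ Λ, LatB Λ m ∧ ∀ x, x ∈ Λ ↔ ∀ i ∈ S, x ∈ oL (pr i) (k i) := by
  induction S using Finset.induction_on with
  | empty => exact ⟨⊤, LatB.top m, by simp⟩
  | insert i S hi ih =>
    obtain ⟨Λ, h1, h2⟩ := ih
    refine ⟨_, (h1.inf_cong (hp i) (hpm i) (k i).1.1 (k i).1.2).inf_cong (hp i) (hpm i) (k i).2.1 (k i).2.2, fun x => ?_⟩
    rw [Finset.forall_mem_insert, AddSubgroup.mem_inf, AddSubgroup.mem_inf, h2, oL, AddSubgroup.mem_inf]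
    tauto

section
variable {ι O : Type} [Fintype ι] [DecidableEq ι]

set_option maxHeartbeats 1000000 in
theorem expand_bound (m : ℕ) [NeZero m] (pr : ι → ℕ) (hinj : Function.Injective pr) (hp : ∀ i, (pr i).Prime)
    (hpm : ∀ i, (pr i).Coprime m) (t : Finset ι) (opts : ι → Finset O) (k : ι → O → (ℤ × ℤ) × (ℤ × ℤ))
    (sg : ι → O → ℂ) (hsg : ∀ i o, ‖sg i o‖ ≤ 1) (Cd : ι → O → ℤ × ℤ → Prop)
    (hC : ∀ i, ∀ o ∈ opts i, ∀ x₀ x, Cd i o x₀ → (Cd i o x ↔ x - x₀ ∈ oL (pr i) (k i o)))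
    (ht : ∀ i ∈ t, ∀ o ∈ opts i, ∀ x ∈ oL (pr i) (k i o), (pr i : ℤ) ∣ x.1 ∧ (pr i : ℤ) ∣ x.2)
    (hs : ∀ i ∉ t, ∀ u : ℤ × ℤ, ((opts i).filter (fun o => u ∈ oL (pr i) (k i o))).card ≤ 3 * (if pr i ∣ Int.gcd u.1 u.2 then pr i else 1))
    (n : ι → ℕ) (hn : ∀ i ∈ t, (opts i).card ≤ n i)
    (Ω : Finset (ℤ × ℤ)) (K : ℕ) (M : ℝ) (hM : 0 ≤ M) (hΩ : ∀ x ∈ Ω, |(x.1 : ℝ)| ≤ M ∧ |(x.2 : ℝ)| ≤ M) (hBV : BV Ω K)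
    (ψ : ZMod m → ZMod m → ℂ) (hψ : ∀ x y, ‖ψ x y‖ ≤ 1) (hψ0 : ∑ x, ∑ y, ψ x y = 0) :
    ‖∑ x ∈ Ω, (∏ i, ∑ o ∈ opts i, sg i o * if Cd i o x then 1 else 0) * ψ x.1 x.2‖ ≤
      2 * m * K * (∏ i ∈ t, (n i : ℝ)) * 3 ^ (tᶜ.card) * (16 * M * (2 ^ tᶜ.card * 8 + 1) * √(∏ i ∈ tᶜ, (pr i : ℝ)) / (∏ i ∈ t, (pr i : ℝ))
        + 2 * ∏ i ∈ tᶜ, (pr i : ℝ)) := by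
  set q : ℕ := ∏ i ∈ tᶜ, pr i with hq
  set q3 : ℕ := ∏ i ∈ t, pr i with hq3
  have hq0 : 0 < q := Finset.prod_pos fun i _ => (hp i).pos
  have hq30 : 0 < q3 := Finset.prod_pos fun i _ => (hp i).pos
  have eq1 : ∏ i ∈ tᶜ, (pr i : ℝ) = q := by rw [hq]; push_cast; rfl
  have eq2 : ∏ i ∈ t, (pr i : ℝ) = q3 := by rw [hq3]; push_cast; rfl
  rw [eq1, eq2]
  -- choose lattices and vectors
  have hex : ∀ φ : ι → O, ∃ u : ℤ × ℤ, (∀ i, u ∈ oL (pr i) (k i (φ i))) ∧ u ≠ 0 ∧ ∀ x₀ : ℤ × ℤ,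
      ‖∑ x ∈ Ω with ∀ i, x - x₀ ∈ oL (pr i) (k i (φ i)), ψ x.1 x.2‖ ≤ 2 * m * K * (16 * M / nv u + 2) := by
    intro φ
    obtain ⟨Λ, h1, h2⟩ := latB_inter m pr hp hpm (fun i => k i (φ i)) Finset.univ
    obtain ⟨u, hu, hu0, h⟩ := twoD h1
    refine ⟨u, fun i => (h2 u).1 hu i (Finset.mem_univ i), hu0, fun x₀ => ?_⟩
    have := h Ω K M hM hΩ hBV ψ hψ hψ0 x₀
    simpa only [h2, Finset.mem_univ, true_imp_iff] using this
  choose u hu hu0 hub using hex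
  -- expansion
  have hexp : ∑ x ∈ Ω, (∏ i, ∑ o ∈ opts i, sg i o * if Cd i o x then 1 else 0) * ψ x.1 x.2
      = ∑ φ ∈ Fintype.piFinset opts, (∏ i, sg i (φ i)) * ∑ x ∈ Ω with ∀ i, Cd i (φ i) x, ψ x.1 x.2 := by
    have h1 : ∀ x : ℤ × ℤ, (∏ i, ∑ o ∈ opts i, sg i o * if Cd i o x then 1 else 0) * ψ x.1 x.2
        = ∑ φ ∈ Fintype.piFinset opts, (∏ i, sg i (φ i)) * if ∀ i, Cd i (φ i) x then ψ x.1 x.2 else 0 := by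
      intro x
      rw [Finset.prod_univ_sum, Finset.sum_mul]
      refine Finset.sum_congr rfl fun φ _ => ?_
      rw [Finset.prod_mul_distrib, mul_assoc]
      congr 1
      rw [Fintype.prod_ite_zero]
      split_ifs <;> simp
    simp only [h1]
    rw [Finset.sum_comm]
    refine Finset.sum_congr rfl fun φ _ => ?_
    rw [← Finset.mul_sum, Finset.sum_filter]
  have hterm : ∀ φ ∈ Fintype.piFinset opts, ‖(∏ i, sg i (φ i)) * ∑ x ∈ Ω with ∀ i, Cd i (φ i) x, ψ x.1 x.2‖
      ≤ 2 * m * K * (16 * M / nv (u φ) + 2) := by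
    intro φ hφ
    rw [Fintype.mem_piFinset] at hφ
    rw [norm_mul, norm_prod]
    have h1 : ∏ i, ‖sg i (φ i)‖ ≤ 1 := Finset.prod_le_one (fun _ _ => norm_nonneg _) fun i _ => hsg _ _
    refine (mul_le_of_le_one_left (norm_nonneg _) h1).trans ?_
    by_cases hne : ∃ x₀, ∀ i, Cd i (φ i) x₀
    · obtain ⟨x₀, hx₀⟩ := hne
      have := hub φ x₀
      have e : ∀ x, (∀ i, Cd i (φ i) x) ↔ ∀ i, x - x₀ ∈ oL (pr i) (k i (φ i)) :=
        fun x => forall_congr' fun i => hC i _ (hφ i) x₀ x (hx₀ i)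
      simpa only [e] using this
    · rw [Finset.filter_false_of_mem (fun x _ h => hne ⟨x, h⟩)]
      simp; positivity
  rw [hexp]
  refine (norm_sum_le _ _).trans ((Finset.sum_le_sum hterm).trans ?_)
  rw [← Finset.mul_sum, Finset.sum_add_distrib]
  -- count of options
  have hcount : ∀ v : ℤ × ℤ, (((Fintype.piFinset opts).filter (fun φ => ∀ i ∉ t, v ∈ oL (pr i) (k i (φ i)))).card : ℝ)
      ≤ (∏ i ∈ t, (n i : ℝ)) * (3 ^ tᶜ.card * gw (tᶜ.image pr) (Int.gcd v.1 v.2)) := by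
    intro v
    have e : (Fintype.piFinset opts).filter (fun φ => ∀ i ∉ t, v ∈ oL (pr i) (k i (φ i)))
        = Fintype.piFinset (fun i => if i ∈ t then opts i else (opts i).filter (fun o => v ∈ oL (pr i) (k i o))) := by
      ext φ
      simp only [Finset.mem_filter, Fintype.mem_piFinset]
      constructor
      · rintro ⟨h1, h2⟩ i
        split_ifs with h
        · exact h1 i
        · exact Finset.mem_filter.2 ⟨h1 i, h2 i h⟩
      · intro h
        refine ⟨fun i => ?_, fun i hi => ?_⟩
        · have := h i; split_ifs at this
          · exact this
          · exact (Finset.mem_filter.1 this).1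
        · have := h i; rw [if_neg hi] at this; exact (Finset.mem_filter.1 this).2
    rw [e, Fintype.card_piFinset, ← Finset.prod_mul_prod_compl t]
    rw [Nat.cast_mul, Nat.cast_prod, Nat.cast_prod]
    refine mul_le_mul ?_ ?_ (Finset.prod_nonneg fun _ _ => Nat.cast_nonneg _) (Finset.prod_nonneg fun _ _ => Nat.cast_nonneg _)
    · refine Finset.prod_le_prod (fun _ _ => Nat.cast_nonneg _) fun i hi => ?_
      rw [if_pos hi]; exact_mod_cast hn i hi
    · rw [gw, Finset.prod_image fun a _ b _ h => hinj h]
      push_cast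
      rw [← Finset.prod_const, ← Finset.prod_mul_distrib]
      refine Finset.prod_le_prod (fun _ _ => Nat.cast_nonneg _) fun i hi => ?_
      rw [Finset.mem_compl] at hi
      rw [if_neg hi]; exact_mod_cast hs i hi v
  have hcard : ((Fintype.piFinset opts).card : ℝ) ≤ (∏ i ∈ t, (n i : ℝ)) * (3 ^ tᶜ.card * q) := by
    have := hcount 0
    rw [Finset.filter_true_of_mem (fun φ _ i _ => AddSubgroup.zero_mem _)] at this
    refine this.trans (le_of_eq ?_)
    rw [gw, hq, Finset.prod_image fun a _ b _ h => hinj h]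
    simp
  -- divide by q3
  have hdiv : ∀ φ ∈ Fintype.piFinset opts, ∃ v : ℤ × ℤ, v ≠ 0 ∧ (∀ i ∉ t, v ∈ oL (pr i) (k i (φ i))) ∧ nv (u φ) = q3 * nv v := by
    intro φ hφ
    rw [Fintype.mem_piFinset] at hφ
    have hd1 : (q3 : ℤ) ∣ (u φ).1 := by
      rw [hq3]; push_cast
      refine Finset.prod_dvd_of_coprime (fun i _ j _ hij => ?_) fun i hi => (ht i hi _ (hφ i) _ (hu φ i)).1
      exact Nat.isCoprime_iff_coprime.2 ((Nat.coprime_primes (hp i) (hp j)).2 fun h => hij (hinj h))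
    have hd2 : (q3 : ℤ) ∣ (u φ).2 := by
      rw [hq3]; push_cast
      refine Finset.prod_dvd_of_coprime (fun i _ j _ hij => ?_) fun i hi => (ht i hi _ (hφ i) _ (hu φ i)).2
      exact Nat.isCoprime_iff_coprime.2 ((Nat.coprime_primes (hp i) (hp j)).2 fun h => hij (hinj h))
    obtain ⟨x, hx⟩ := hd1
    obtain ⟨y, hy⟩ := hd2
    refine ⟨(x, y), fun h => hu0 φ ?_, fun i hi => ?_, ?_⟩
    · rw [Prod.ext_iff] at h ⊢; simp at h; rw [hx, hy, h.1, h.2]; simp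
    · have hcop : IsCoprime (pr i : ℤ) (q3 : ℤ) := by
        rw [Nat.isCoprime_iff_coprime, hq3]
        refine Nat.Coprime.prod_right fun j hj => ?_
        exact (Nat.coprime_primes (hp i) (hp j)).2 fun h => hi (hinj h ▸ hj)
      have := hu φ i
      rw [mem_oL, hx, hy] at this
      rw [mem_oL]
      refine ⟨hcop.dvd_of_dvd_mul_left (this.1.trans (dvd_of_eq ?_)), hcop.dvd_of_dvd_mul_left (this.2.trans (dvd_of_eq ?_))⟩ <;> ring
    · simp only [nv, hx, hy, Int.natAbs_mul, Int.natAbs_natCast]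
      rw [Nat.mul_max_mul_left]
  have hsq0 : 0 < √(q:ℝ) := Real.sqrt_pos.2 (by exact_mod_cast hq0)
  have hq3R : (0:ℝ) < q3 := by exact_mod_cast hq30
  set U := Nat.sqrt q with hU
  have hU1 : (U:ℝ) ≤ √(q:ℝ) := Real.nat_sqrt_le_real_sqrt
  have hU2 : √(q:ℝ) ≤ U + 1 := Real.real_sqrt_le_nat_sqrt_succ
  have hone : ∀ φ ∈ Fintype.piFinset opts, (1:ℝ) / nv (u φ) ≤ (1/q3) * (∑ v ∈ box0 U, (if ∀ i ∉ t, v ∈ oL (pr i) (k i (φ i)) then (1:ℝ) / nv v else 0) + 1 / √(q:ℝ)) := by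
    intro φ hφ
    obtain ⟨v, hv0, hv, hn⟩ := hdiv φ hφ
    rw [hn]; push_cast
    rw [← one_div_mul_one_div]
    refine mul_le_mul_of_nonneg_left ?_ (by positivity)
    have hnn : ∀ w ∈ box0 U, 0 ≤ (if ∀ i ∉ t, w ∈ oL (pr i) (k i (φ i)) then (1:ℝ) / nv w else 0) := by
      intro w _; split_ifs <;> positivity
    by_cases hvU : nv v ≤ U
    · have := Finset.single_le_sum hnn (mem_box0.2 ⟨hv0, hvU⟩)
      rw [if_pos hv] at this
      have : 0 ≤ 1 / √(q:ℝ) := by positivity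
      linarith
    · have h1 : √(q:ℝ) ≤ nv v := by
        refine hU2.trans ?_
        exact_mod_cast not_le.1 hvU
      have := one_div_le_one_div_of_le hsq0 h1
      have := Finset.sum_nonneg hnn
      linarith
  have hNt : (0:ℝ) ≤ ∏ i ∈ t, (n i : ℝ) := by positivity
  have hsum : ∑ φ ∈ Fintype.piFinset opts, (1:ℝ) / nv (u φ) ≤ (∏ i ∈ t, (n i : ℝ)) * 3 ^ tᶜ.card * ((2 ^ tᶜ.card * 8 + 1) * √(q:ℝ)) / q3 := by
    refine (Finset.sum_le_sum hone).trans ?_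
    rw [← Finset.mul_sum, Finset.sum_add_distrib, Finset.sum_comm]
    have h1 : ∑ v ∈ box0 U, ∑ φ ∈ Fintype.piFinset opts, (if ∀ i ∉ t, v ∈ oL (pr i) (k i (φ i)) then (1:ℝ) / nv v else 0)
        ≤ (∏ i ∈ t, (n i : ℝ)) * 3 ^ tᶜ.card * (2 ^ tᶜ.card * 8 * √(q:ℝ)) := by
      calc _ ≤ ∑ v ∈ box0 U, ((∏ i ∈ t, (n i : ℝ)) * 3 ^ tᶜ.card) * (gw (tᶜ.image pr) (Int.gcd v.1 v.2) * ((1:ℝ) / nv v)) := by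
            refine Finset.sum_le_sum fun v _ => ?_
            rw [← Finset.sum_filter, Finset.sum_const, nsmul_eq_mul]
            refine (mul_le_mul_of_nonneg_right (hcount v) (by positivity)).trans (le_of_eq (by ring))
        _ ≤ _ := by
            rw [← Finset.mul_sum]
            refine mul_le_mul_of_nonneg_left ?_ (by positivity)
            refine (sum_gw_box _ (fun p hp' => ?_) U).trans ?_
            · obtain ⟨i, _, rfl⟩ := Finset.mem_image.1 hp'; exact hp i
            · rw [Finset.card_image_of_injective _ hinj]
              have : (0:ℝ) ≤ 2 ^ tᶜ.card * 8 := by positivity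
              nlinarith
    have h2 : ∑ φ ∈ Fintype.piFinset opts, 1 / √(q:ℝ) ≤ (∏ i ∈ t, (n i : ℝ)) * 3 ^ tᶜ.card * √(q:ℝ) := by
      rw [Finset.sum_const, nsmul_eq_mul]
      refine (mul_le_mul_of_nonneg_right hcard (by positivity)).trans (le_of_eq ?_)
      have : (q:ℝ) = √(q:ℝ) * √(q:ℝ) := (Real.mul_self_sqrt (by positivity)).symm
      rw [mul_one_div, div_eq_iff hsq0.ne']
      conv_lhs => rw [this]
      ring
    refine (mul_le_mul_of_nonneg_left (add_le_add h1 h2) (by positivity)).trans (le_of_eq ?_)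
    ring
  have hfin : ∑ φ ∈ Fintype.piFinset opts, 16 * M / nv (u φ) + ∑ φ ∈ Fintype.piFinset opts, (2:ℝ) ≤
      (∏ i ∈ t, (n i : ℝ)) * 3 ^ tᶜ.card * (16 * M * (2 ^ tᶜ.card * 8 + 1) * √(q:ℝ) / q3 + 2 * q) := by
    have h1 : ∑ φ ∈ Fintype.piFinset opts, 16 * M / nv (u φ) = 16 * M * ∑ φ ∈ Fintype.piFinset opts, (1:ℝ) / nv (u φ) := by
      rw [Finset.mul_sum]; exact Finset.sum_congr rfl fun _ _ => by ring
    rw [h1, Finset.sum_const, nsmul_eq_mul]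
    have := mul_le_mul_of_nonneg_left hsum (by positivity : 0 ≤ 16 * M)
    refine (add_le_add this (mul_le_mul_of_nonneg_right hcard (by norm_num : (0:ℝ) ≤ 2))).trans (le_of_eq ?_)
    ring
  refine (mul_le_mul_of_nonneg_left hfin (by positivity)).trans (le_of_eq ?_)
  ring
end
end CF

namespace CF

/-- `p` divides the Hessian. -/
def Rp (p : ℕ) (f : V) : Prop := (p : ℤ) ∣ f.hP ∧ (p : ℤ) ∣ f.hQ ∧ (p : ℤ) ∣ f.hR
/-- derivative in `x` at `(r,1)`. -/
def V.dx (g : V) (r : ℤ) : ℤ := 3 * g.a * r^2 + 2 * g.b * r + g.c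
/-- number of simple roots in the projective line mod `p`. -/
def om (p : ℕ) (g : V) : ℕ := (if (p:ℤ) ∣ g.a ∧ ¬ (p:ℤ) ∣ g.b then 1 else 0) +
  ((Finset.range p).filter (fun r : ℕ => (p:ℤ) ∣ g.ev r 1 ∧ ¬ (p:ℤ) ∣ g.dx r)).card

abbrev Opt := ℕ ⊕ (ℕ ⊕ (ℕ ⊕ (ℕ × ℕ)))

def clR (a b : ℤ) (p : ℕ) : Finset (ℕ × ℕ) := (Finset.range p ×ˢ Finset.range p).filter (fun x => Rp p ⟨a, b, x.1, x.2⟩)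
def oS (p : ℕ) : Finset Opt := Finset.disjSum {0} (Finset.disjSum (Finset.range p) (Finset.disjSum (Finset.range p) ∅))
def oT (a b : ℤ) (p : ℕ) : Finset Opt := Finset.disjSum ∅ (Finset.disjSum ∅ (Finset.disjSum ∅ (clR a b p)))
def ok : Opt → (ℤ × ℤ) × (ℤ × ℤ)
  | Sum.inl _ => ((0,0),(0,0))
  | Sum.inr (Sum.inl r) => ((r,1),(0,0))
  | Sum.inr (Sum.inr _) => ((1,0),(0,1))
def osg : Opt → ℂ
  | Sum.inr (Sum.inr (Sum.inl _)) => -1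
  | _ => 1
def oC (a b : ℤ) (p : ℕ) : Opt → ℤ × ℤ → Prop
  | Sum.inl _ => fun _ => (p:ℤ) ∣ a ∧ ¬ (p:ℤ) ∣ b
  | Sum.inr (Sum.inl r) => fun x => (p:ℤ) ∣ V.ev ⟨a, b, x.1, x.2⟩ r 1
  | Sum.inr (Sum.inr (Sum.inl r)) => fun x => (p:ℤ) ∣ V.ev ⟨a, b, x.1, x.2⟩ r 1 ∧ (p:ℤ) ∣ V.dx ⟨a, b, x.1, x.2⟩ r
  | Sum.inr (Sum.inr (Sum.inr y)) => fun x => (p:ℤ) ∣ x.1 - y.1 ∧ (p:ℤ) ∣ x.2 - y.2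

theorem osg_norm (o : Opt) : ‖osg o‖ ≤ 1 := by
  rcases o with _ | _ | _ | _ <;> simp [osg]

theorem oC_iff (a b : ℤ) (p : ℕ) (o : Opt) (x₀ x : ℤ × ℤ) (h : oC a b p o x₀) : oC a b p o x ↔ x - x₀ ∈ oL p (ok o) := by
  rw [mem_oL]
  rcases o with _ | r | r | y
  · simp only [oC, ok] at h ⊢; simpa using h
  · simp only [oC, ok, V.ev, Prod.fst_sub, Prod.snd_sub] at h ⊢
    rw [← dvd_sub_left h]
    ring_nf
    simp
  · simp only [oC, ok, V.ev, V.dx, Prod.fst_sub, Prod.snd_sub] at h ⊢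
    constructor
    · rintro ⟨h1, h2⟩
      have h2' : (p:ℤ) ∣ x.1 - x₀.1 := (dvd_sub h2 h.2).trans (dvd_of_eq (by ring))
      refine ⟨h2'.trans (dvd_of_eq (by ring)), ?_⟩
      have := dvd_sub (dvd_sub h1 h.1) (h2'.mul_left (r:ℤ))
      exact this.trans (dvd_of_eq (by ring))
    · rintro ⟨h1, h2⟩
      have h1' : (p:ℤ) ∣ x.1 - x₀.1 := h1.trans (dvd_of_eq (by ring))
      have h2' : (p:ℤ) ∣ x.2 - x₀.2 := h2.trans (dvd_of_eq (by ring))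
      exact ⟨(dvd_add (dvd_add (h1'.mul_left (r:ℤ)) h2') h.1).trans (dvd_of_eq (by ring)), (dvd_add h1' h.2).trans (dvd_of_eq (by ring))⟩
  · simp only [oC, ok, Prod.fst_sub, Prod.snd_sub] at h ⊢
    refine and_congr ?_ ?_
    · rw [← dvd_sub_left h.1]; ring_nf
    · rw [← dvd_sub_left h.2]; ring_nf

theorem mem_clR {a b : ℤ} {p : ℕ} {x : ℕ × ℕ} : x ∈ clR a b p ↔ (x.1 < p ∧ x.2 < p) ∧ Rp p ⟨a, b, x.1, x.2⟩ := by
  rw [clR, Finset.mem_filter, Finset.mem_product, Finset.mem_range, Finset.mem_range]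

theorem oS_count (p : ℕ) (hp : p.Prime) (u : ℤ × ℤ) :
    ((oS p).filter (fun o => u ∈ oL p (ok o))).card ≤ 3 * (if p ∣ Int.gcd u.1 u.2 then p else 1) := by
  have hp1 := hp.one_lt
  split_ifs with h
  · refine (Finset.card_filter_le _ _).trans ?_
    simp only [oS, Finset.card_disjSum, Finset.card_singleton, Finset.card_range, Finset.card_empty]
    omega
  · rw [Finset.card_filter]
    simp only [oS, Finset.sum_disjSum, Finset.sum_singleton, Finset.sum_empty, add_zero, ok, mem_oL]
    have hg : ¬ ((p:ℤ) ∣ u.1 ∧ (p:ℤ) ∣ u.2) := fun h' => h (by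
      have := Int.dvd_coe_gcd h'.1 h'.2; exact_mod_cast this)
    have h1 : (∑ r ∈ Finset.range p, if (p:ℤ) ∣ (r:ℤ) * u.1 + 1 * u.2 ∧ (p:ℤ) ∣ 0 * u.1 + 0 * u.2 then 1 else 0) ≤ 1 := by
      rw [← Finset.card_filter, Finset.card_le_one]
      intro r hr s hs
      simp only [Finset.mem_filter, Finset.mem_range] at hr hs
      have hd : (p:ℤ) ∣ ((r:ℤ) - s) * u.1 := (dvd_sub hr.2.1 hs.2.1).trans (dvd_of_eq (by ring))
      rcases (Nat.prime_iff_prime_int.1 hp).dvd_or_dvd hd with h' | h'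
      · have := Int.eq_zero_of_abs_lt_dvd h' (by rw [abs_lt]; omega)
        omega
      · exfalso; apply hg ⟨h', ?_⟩
        have := dvd_sub hr.2.1 (h'.mul_left (r:ℤ))
        exact this.trans (dvd_of_eq (by ring))
    have h2 : (∑ r ∈ Finset.range p, if (p:ℤ) ∣ 1 * u.1 + 0 * u.2 ∧ (p:ℤ) ∣ 0 * u.1 + 1 * u.2 then 1 else 0) = 0 := by
      rw [if_neg (by simpa using hg)]; simp
    have h3 : (if (p:ℤ) ∣ 0 * u.1 + 0 * u.2 ∧ (p:ℤ) ∣ 0 * u.1 + 0 * u.2 then 1 else 0) = 1 := by simp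
    rw [h2, h3]
    omega

theorem clR_card (a b : ℤ) (p : ℕ) (hp : p.Prime) : (clR a b p).card ≤ if p ∣ (9 * a).natAbs then p else 1 := by
  have hpi := Nat.prime_iff_prime_int.1 hp
  split_ifs with h
  · have : clR a b p ⊆ {0} ×ˢ Finset.range p := by
      intro x hx
      simp only [mem_clR, Rp, V.hP, V.hQ, V.hR] at hx
      simp only [Finset.mem_product, Finset.mem_singleton, Finset.mem_range]
      refine ⟨?_, hx.1.2⟩
      have h9 : (p:ℤ) ∣ 3 * 3 * a := by rw [show (3:ℤ)*3*a = 9 * a by ring]; exact Int.natCast_dvd.2 h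
      have h3a : (p:ℤ) ∣ 3 * a := by
        rcases hpi.dvd_or_dvd h9 with h' | h'
        · rcases hpi.dvd_or_dvd h' with h' | h' <;> exact h'.mul_right _
        · exact h'.mul_left _
      have hb : (p:ℤ) ∣ b := by
        apply hpi.dvd_of_dvd_pow (n := 2)
        have := dvd_add hx.2.1 (h3a.mul_right (x.1:ℤ))
        exact this.trans (dvd_of_eq (by ring))
      have hc : (p:ℤ) ∣ (x.1:ℤ) := by
        apply hpi.dvd_of_dvd_pow (n := 2)
        have := dvd_add hx.2.2.2 (hb.mul_right (3 * (x.2:ℤ)))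
        exact this.trans (dvd_of_eq (by ring))
      exact Nat.eq_zero_of_dvd_of_lt (by exact_mod_cast hc) hx.1.1
    refine (Finset.card_le_card this).trans ?_
    simp
  · rw [Finset.card_le_one]
    intro x hx y hy
    simp only [mem_clR, Rp, V.hP, V.hQ, V.hR] at hx hy
    have h9 : ¬ (p:ℤ) ∣ 9 * a := fun h' => h (Int.natCast_dvd.1 h')
    have e1 : (p:ℤ) ∣ (x.1:ℤ) - y.1 := by
      have : (p:ℤ) ∣ 9 * a * ((x.1:ℤ) - y.1) := ((dvd_sub hy.2.1 hx.2.1).mul_left 3).trans (dvd_of_eq (by ring))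
      exact (hpi.dvd_or_dvd this).resolve_left h9
    have e2 : (p:ℤ) ∣ (x.2:ℤ) - y.2 := by
      have : (p:ℤ) ∣ 9 * a * ((x.2:ℤ) - y.2) :=
        (dvd_add (dvd_sub hy.2.2.1 hx.2.2.1) (e1.mul_left b)).trans (dvd_of_eq (by ring))
      exact (hpi.dvd_or_dvd this).resolve_left h9
    have e1 := Int.eq_zero_of_abs_lt_dvd e1 (by rw [abs_lt]; omega)
    have e2 := Int.eq_zero_of_abs_lt_dvd e2 (by rw [abs_lt]; omega)
    ext <;> omega

theorem oS_sum (a b : ℤ) (p : ℕ) (x : ℤ × ℤ) :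
    ∑ o ∈ oS p, osg o * (if oC a b p o x then 1 else 0) = (om p ⟨a, b, x.1, x.2⟩ : ℂ) := by
  have h0 : (if oC a b p (Sum.inl 0) x then 1 else 0 : ℂ) = if (p:ℤ) ∣ a ∧ ¬ (p:ℤ) ∣ b then 1 else 0 := if_congr Iff.rfl rfl rfl
  have h1 : ∀ r, (if oC a b p (Sum.inr (Sum.inl r)) x then 1 else 0 : ℂ) = if (p:ℤ) ∣ V.ev ⟨a, b, x.1, x.2⟩ r 1 then 1 else 0 :=
    fun r => if_congr Iff.rfl rfl rfl
  have h2 : ∀ r, (if oC a b p (Sum.inr (Sum.inr (Sum.inl r))) x then 1 else 0 : ℂ) =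
      if (p:ℤ) ∣ V.ev ⟨a, b, x.1, x.2⟩ r 1 ∧ (p:ℤ) ∣ V.dx ⟨a, b, x.1, x.2⟩ r then 1 else 0 :=
    fun r => if_congr Iff.rfl rfl rfl
  simp only [oS, Finset.sum_disjSum, Finset.sum_singleton, Finset.sum_empty, add_zero, osg, h0, h1, h2, om]
  push_cast
  rw [Finset.card_filter]
  push_cast
  rw [one_mul]
  congr 1
  rw [← Finset.sum_add_distrib]
  refine Finset.sum_congr rfl fun r _ => ?_
  by_cases h1 : (p:ℤ) ∣ V.ev ⟨a, b, x.1, x.2⟩ r 1 <;> by_cases h2 : (p:ℤ) ∣ V.dx ⟨a, b, x.1, x.2⟩ r <;> simp [h1, h2]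

theorem Rp_congr {p : ℕ} {a b c d c' d' : ℤ} (h1 : (p:ℤ) ∣ c - c') (h2 : (p:ℤ) ∣ d - d') (h : Rp p ⟨a, b, c, d⟩) : Rp p ⟨a, b, c', d'⟩ := by
  simp only [Rp, V.hP, V.hQ, V.hR] at h ⊢
  obtain ⟨p1, p2, p3⟩ := h
  refine ⟨(dvd_add p1 (h1.mul_left (3*a))).trans (dvd_of_eq (by ring)),
    (dvd_add (dvd_sub p2 (h1.mul_left b)) (h2.mul_left (9*a))).trans (dvd_of_eq (by ring)),
    (dvd_add (dvd_sub p3 (h1.mul_left (c+c'))) (h2.mul_left (3*b))).trans (dvd_of_eq (by ring))⟩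

theorem oT_sum (a b : ℤ) (p : ℕ) (hp : p.Prime) (x : ℤ × ℤ) :
    ∑ o ∈ oT a b p, osg o * (if oC a b p o x then 1 else 0) = (if Rp p ⟨a, b, x.1, x.2⟩ then 1 else 0 : ℂ) := by
  have h2 : ∀ y : ℕ × ℕ, (if oC a b p (Sum.inr (Sum.inr (Sum.inr y))) x then 1 else 0 : ℂ) =
      if (p:ℤ) ∣ x.1 - y.1 ∧ (p:ℤ) ∣ x.2 - y.2 then 1 else 0 :=
    fun r => if_congr Iff.rfl rfl rfl
  simp only [oT, Finset.sum_disjSum, Finset.sum_empty, zero_add, osg, h2, one_mul]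
  rw [Finset.sum_boole]
  have hp0 : (0:ℤ) < p := by exact_mod_cast hp.pos
  split_ifs with h
  · have : (clR a b p).filter (fun y => (p:ℤ) ∣ x.1 - y.1 ∧ (p:ℤ) ∣ x.2 - y.2) = {((x.1 % p).toNat, (x.2 % p).toNat)} := by
      have m1 := Int.emod_nonneg x.1 hp0.ne'
      have m2 := Int.emod_nonneg x.2 hp0.ne'
      have l1 := Int.emod_lt_of_pos x.1 hp0
      have l2 := Int.emod_lt_of_pos x.2 hp0
      ext y
      simp only [Finset.mem_filter, Finset.mem_singleton, mem_clR]
      constructor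
      · rintro ⟨⟨⟨k1, k2⟩, -⟩, h1, h2⟩
        have e1 : x.1 % p = y.1 := by
          rw [Int.emod_eq_emod_iff_emod_sub_eq_zero.2 (Int.emod_eq_zero_of_dvd h1)]
          exact Int.emod_eq_of_lt (by omega) (by omega)
        have e2 : x.2 % p = y.2 := by
          rw [Int.emod_eq_emod_iff_emod_sub_eq_zero.2 (Int.emod_eq_zero_of_dvd h2)]
          exact Int.emod_eq_of_lt (by omega) (by omega)
        ext <;> simp [e1, e2]
      · rintro rfl
        simp only [Int.toNat_of_nonneg m1, Int.toNat_of_nonneg m2]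
        have d1 := Int.dvd_self_sub_emod (x := x.1) (m := p)
        have d2 := Int.dvd_self_sub_emod (x := x.2) (m := p)
        exact ⟨⟨⟨by omega, by omega⟩, Rp_congr d1 d2 h⟩, d1, d2⟩
    rw [this]; simp
  · rw [Finset.filter_false_of_mem]
    · simp
    · rintro y hy ⟨h1, h2⟩
      simp only [mem_clR] at hy
      exact h (Rp_congr ((dvd_sub_comm).1 h1) ((dvd_sub_comm).1 h2) hy.2)

/-- Main estimate for fixed `(a,b)`. -/
theorem fixed_ab (m : ℕ) [NeZero m] (χ : DirichletCharacter ℂ m) (h6 : χ ^ 6 ≠ 1) (s t : Finset ℕ) (hst : Disjoint s t)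
    (hp : ∀ p ∈ s ∪ t, p.Prime) (hpm : ∀ p ∈ s ∪ t, p.Coprime m) (a b : ℤ)
    (Ω : Finset (ℤ × ℤ)) (K : ℕ) (M : ℝ) (hM : 0 ≤ M) (hΩ : ∀ x ∈ Ω, |(x.1 : ℝ)| ≤ M ∧ |(x.2 : ℝ)| ≤ M) (hBV : BV Ω K) :
    ‖∑ x ∈ Ω, (∏ p ∈ s, (om p ⟨a, b, x.1, x.2⟩ : ℂ)) * (∏ p ∈ t, if Rp p ⟨a, b, x.1, x.2⟩ then 1 else 0) * χ ((V.disc ⟨a, b, x.1, x.2⟩ : ℤ) : ZMod m)‖ ≤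
      2 * m * K * gw t (9 * a).natAbs * 3 ^ s.card * (16 * M * (2 ^ s.card * 8 + 1) * √((∏ p ∈ s, p : ℕ) : ℝ) / ((∏ p ∈ t, p : ℕ) : ℝ)
        + 2 * ((∏ p ∈ s, p : ℕ) : ℝ)) := by
  set ψ : ZMod m → ZMod m → ℂ := fun c d => χ (dsc (a : ZMod m) b c d) with hψ
  have key := expand_bound (ι := {p // p ∈ s ∪ t}) (O := Opt) m (fun i => i.1) Subtype.val_injective (fun i => hp i i.2) (fun i => hpm i i.2)
    (Finset.univ.filter fun i => i.1 ∈ t) (fun i => if i.1 ∈ t then oT a b i.1 else oS i.1) (fun _ o => ok o) (fun _ o => osg o)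
    (fun _ o => osg_norm o) (fun i o => oC a b i.1 o) (fun i o _ x₀ x h => oC_iff a b i.1 o x₀ x h)
    (by
      intro i hi o ho x hx
      simp only [Finset.mem_filter, Finset.mem_univ, true_and] at hi
      rw [if_pos hi, oT] at ho
      rw [mem_oL] at hx
      rcases o with _ | _ | _ | y <;> simp at ho
      simpa [ok] using hx)
    (by
      intro i hi u
      simp only [Finset.mem_filter, Finset.mem_univ, true_and] at hi
      rw [if_neg hi]
      exact oS_count i.1 (hp i i.2) u)
    (fun i => if i.1 ∣ (9 * a).natAbs then i.1 else 1)
    (by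
      intro i hi
      simp only [Finset.mem_filter, Finset.mem_univ, true_and] at hi
      rw [if_pos hi, oT]
      simpa using clR_card a b i.1 (hp i i.2))
    Ω K M hM hΩ hBV ψ (fun c d => χ.norm_le_one _) (dsc_sum_zero m χ h6 a b)
  have ht : ∀ {α : Type} [CommMonoid α] (F : ℕ → α), ∏ i ∈ (Finset.univ : Finset {p // p ∈ s ∪ t}) with i.1 ∈ t, F i.1 = ∏ p ∈ t, F p := by
    intro α _ F
    rw [Finset.prod_filter, Finset.prod_coe_sort (s ∪ t) (fun p => if p ∈ t then F p else 1), ← Finset.prod_filter]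
    congr 1
    ext p; simp
  have hcs : (Finset.univ.filter fun i : {p // p ∈ s ∪ t} => i.1 ∈ t)ᶜ = Finset.univ.filter fun i => i.1 ∈ s := by
    ext ⟨p, hp'⟩
    simp only [Finset.mem_compl, Finset.mem_filter, Finset.mem_univ, true_and]
    rw [Finset.mem_union] at hp'
    have := fun (h1 : p ∈ s) (h2 : p ∈ t) => Finset.disjoint_left.1 hst h1 h2
    tauto
  have hs : ∀ {α : Type} [CommMonoid α] (F : ℕ → α), ∏ i ∈ (Finset.univ : Finset {p // p ∈ s ∪ t}) with i.1 ∈ s, F i.1 = ∏ p ∈ s, F p := by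
    intro α _ F
    rw [Finset.prod_filter, Finset.prod_coe_sort (s ∪ t) (fun p => if p ∈ s then F p else 1), ← Finset.prod_filter]
    congr 1
    ext p; simp
  have hcard : ((Finset.univ : Finset {p // p ∈ s ∪ t}).filter fun i => i.1 ∈ s).card = s.card := by
    have := hs (α := Multiplicative ℕ) (fun _ => Multiplicative.ofAdd 1)
    rw [Finset.prod_const, Finset.prod_const, ← ofAdd_nsmul, ← ofAdd_nsmul] at this
    simpa using this
  rw [hcs, hcard, hs (fun p => (p:ℝ)), ht (fun p => (p:ℝ)), ht (fun p => ((if p ∣ (9 * a).natAbs then p else 1 : ℕ) : ℝ))] at key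
  have e1 : ∏ p ∈ t, ((if p ∣ (9 * a).natAbs then p else 1 : ℕ) : ℝ) = gw t (9 * a).natAbs := by
    rw [gw, Nat.cast_prod]
  rw [e1, ← Nat.cast_prod, ← Nat.cast_prod] at key
  refine le_of_eq_of_le (congrArg norm (Finset.sum_congr rfl fun x _ => ?_)) key
  rw [← Finset.prod_mul_prod_compl (Finset.univ.filter fun i : {p // p ∈ s ∪ t} => i.1 ∈ t), hcs]
  rw [mul_comm (∏ p ∈ s, _)]
  congr 1
  · rw [← ht, ← hs]
    congr 1
    · refine Finset.prod_congr rfl fun i hi => ?_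
      simp only [Finset.mem_filter, Finset.mem_univ, true_and] at hi
      rw [if_pos hi, oT_sum a b i.1 (hp i i.2)]
    · refine Finset.prod_congr rfl fun i hi => ?_
      simp only [Finset.mem_filter, Finset.mem_univ, true_and] at hi
      rw [if_neg (Finset.disjoint_left.1 hst hi), oS_sum]
  · rw [hψ]; congr 1; simp [V.disc, dsc]
end CF

namespace CF
open UpperHalfPlane ModularGroup
open scoped MatrixGroups Modular

/-- `z` is the covariant point of `f`. -/
def IsRt (f : V) (z : ℍ) : Prop :=
  if 0 < f.disc then (f.hP : ℂ) * (z:ℂ)^2 + f.hQ * (z:ℂ) + f.hR = 0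
  else (f.a : ℂ) * (z:ℂ)^3 + f.b * (z:ℂ)^2 + f.c * (z:ℂ) + f.d = 0

theorem V.syz (f : V) : 4 * f.hP^3 - 27 * f.disc * f.a^2 = (2 * f.b^3 - 9 * f.a * f.b * f.c + 27 * f.a^2 * f.d)^2 := by
  simp only [V.hP, V.disc]; ring
theorem V.syz' (f : V) : 4 * f.hR^3 - 27 * f.disc * f.d^2 = (2 * f.c^3 - 9 * f.d * f.c * f.b + 27 * f.d^2 * f.a)^2 := by
  simp only [V.hR, V.disc]; ring

theorem V.hP_pos {f : V} (h : 0 < f.disc) : 0 < f.hP := by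
  have h1 := f.syz
  have h2 := f.hess
  have h3 : 0 ≤ f.hP^3 := by nlinarith [sq_nonneg (2 * f.b^3 - 9 * f.a * f.b * f.c + 27 * f.a^2 * f.d), mul_nonneg h.le (sq_nonneg f.a)]
  have h4 : f.hP ≠ 0 := by
    intro h0; rw [h0] at h2; nlinarith [sq_nonneg f.hQ]
  have h5 : 0 ≤ f.hP := by
    by_contra hn; push Not at hn
    have := Odd.pow_neg (n := 3) (by decide) hn
    omega
  omega

theorem rt_pos {f : V} (h : 0 < f.disc) {z : ℍ} (hz : IsRt f z) :
    (f.hQ : ℝ) = -2 * f.hP * z.re ∧ (f.hR : ℝ) = f.hP * (z.re^2 + z.im^2) := by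
  rw [IsRt, if_pos h] at hz
  have hi := congrArg Complex.im hz
  have hr := congrArg Complex.re hz
  simp only [pow_two, Complex.add_im, Complex.mul_im, Complex.intCast_re, Complex.intCast_im, Complex.mul_re, Complex.add_re,
    Complex.zero_im, Complex.zero_re, coe_re, coe_im] at hi hr
  have e1 : (f.hQ : ℝ) = -2 * f.hP * z.re := by
    apply mul_right_cancel₀ z.im_pos.ne'
    linear_combination hi
  refine ⟨e1, ?_⟩
  rw [e1] at hr
  linear_combination hr

theorem rt_neg {f : V} (ha : f.a ≠ 0) (h : ¬ 0 < f.disc) {z : ℍ} (hz : IsRt f z) :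
    ∃ θ : ℝ, (f.b : ℝ) = -f.a * (2 * z.re + θ) ∧ (f.c : ℝ) = f.a * (z.re^2 + z.im^2 + 2 * z.re * θ) ∧
      (f.d : ℝ) = - f.a * θ * (z.re^2 + z.im^2) := by
  rw [IsRt, if_neg h] at hz
  have hi := congrArg Complex.im hz
  have hr := congrArg Complex.re hz
  have ha' : (f.a:ℝ) ≠ 0 := by exact_mod_cast ha
  simp only [pow_succ, pow_zero, one_mul, Complex.add_im, Complex.mul_im, Complex.intCast_re, Complex.intCast_im, Complex.mul_re, Complex.add_re,
    Complex.zero_im, Complex.zero_re, coe_re, coe_im] at hi hr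
  have h1 := z.im_pos.ne'
  have hi' : (f.c:ℝ) = - (f.a * (3 * z.re^2 - z.im^2) + 2 * f.b * z.re) := by
    apply mul_right_cancel₀ h1
    linear_combination hi
  refine ⟨-f.b / f.a - 2 * z.re, by field_simp; ring, ?_, ?_⟩
  · field_simp
    linear_combination hi'
  · field_simp
    rw [hi'] at hr
    linear_combination hr

theorem rt_exists {f : V} (ha : f.a ≠ 0) (hD : f.disc ≠ 0) : ∃ z : ℍ, IsRt f z := by
  by_cases h : 0 < f.disc
  · have hP := V.hP_pos h
    have hP' : (0:ℝ) < f.hP := by exact_mod_cast hP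
    have hD' : (0:ℝ) < f.disc := by exact_mod_cast h
    have hs : 0 < √(3 * f.disc) := Real.sqrt_pos.2 (by positivity)
    refine ⟨⟨⟨-f.hQ / (2 * f.hP), √(3 * f.disc) / (2 * f.hP)⟩, by simp only; positivity⟩, ?_⟩
    rw [IsRt, if_pos h]
    have e : (√(3 * (f.disc:ℝ)))^2 = 3 * f.disc := Real.sq_sqrt (by positivity)
    have e2 : (4 * f.hP * f.hR - f.hQ^2 : ℝ) = 3 * f.disc := by exact_mod_cast f.hess
    apply Complex.ext
    · simp only [pow_two, Complex.add_im, Complex.mul_im, Complex.intCast_re, Complex.intCast_im, Complex.mul_re, Complex.add_re,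
        Complex.zero_im, Complex.zero_re]
      field_simp
      linear_combination (-f.hP:ℝ) * e + (f.hP:ℝ) * e2
    · simp only [pow_two, Complex.add_im, Complex.mul_im, Complex.intCast_re, Complex.intCast_im, Complex.mul_re, Complex.add_re,
        Complex.zero_im, Complex.zero_re]
      field_simp
      ring
  · let P : Cubic ℝ := ⟨f.a, f.b, f.c, f.d⟩
    have haP : P.a ≠ 0 := by show (f.a:ℝ) ≠ 0; exact_mod_cast ha
    obtain ⟨x, y, w, hr⟩ := (Cubic.splits_iff_roots_eq_three (φ := algebraMap ℝ ℂ) haP).1 (IsAlgClosed.splits _)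
    have hdisc := Cubic.discr_eq_prod_three_roots haP hr
    have hmem : ∀ t ∈ ({x, y, w} : Multiset ℂ), (f.a : ℂ) * t^3 + f.b * t^2 + f.c * t + f.d = 0 := by
      intro t ht
      rw [← hr, Cubic.mem_roots_iff] at ht
      · simpa [P, Cubic.map] using ht
      · exact Cubic.ne_zero_of_a_ne_zero (by simpa [Cubic.map] using haP)
    have hex : ∃ t : ℂ, t.im ≠ 0 ∧ (f.a : ℂ) * t^3 + f.b * t^2 + f.c * t + f.d = 0 := by
      by_contra hn
      push Not at hn
      have him : ∀ t ∈ ({x, y, w} : Multiset ℂ), t = (t.re : ℂ) := by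
        intro t ht
        have : t.im = 0 := by
          by_contra h0; exact hn t h0 (hmem t ht)
        apply Complex.ext <;> simp [this]
      rw [him x (by simp), him y (by simp), him w (by simp)] at hdisc
      have : P.discr = (P.a * P.a * (x.re - y.re) * (x.re - w.re) * (y.re - w.re))^2 := by
        have h' : ((P.discr : ℝ) : ℂ) = (((P.a * P.a * (x.re - y.re) * (x.re - w.re) * (y.re - w.re))^2 : ℝ) : ℂ) := by
          push_cast; exact hdisc
        exact_mod_cast h'
      have h2 : P.discr = (f.disc : ℝ) := by simp [P, Cubic.discr, V.disc]
      have h3 : (0:ℝ) ≤ f.disc := by rw [← h2, this]; positivity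
      have h4 : 0 ≤ f.disc := by exact_mod_cast h3
      omega
    obtain ⟨t, ht, ht0⟩ := hex
    rcases lt_or_gt_of_ne ht with h1 | h1
    · refine ⟨⟨(starRingEnd ℂ) t, by simpa using h1⟩, ?_⟩
      rw [IsRt, if_neg h]
      have := congrArg (starRingEnd ℂ) ht0
      simpa using this
    · refine ⟨⟨t, h1⟩, ?_⟩
      rw [IsRt, if_neg h]; exact ht0

theorem rt_unique {f : V} (ha : f.a ≠ 0) (hD : f.disc ≠ 0) {z w : ℍ} (hz : IsRt f z) (hw : IsRt f w) : z = w := by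
  have key : z.re = w.re ∧ z.im = w.im := by
    have h1 := z.im_pos
    have h2 := w.im_pos
    by_cases h : 0 < f.disc
    · obtain ⟨a1, a2⟩ := rt_pos h hz
      obtain ⟨b1, b2⟩ := rt_pos h hw
      have hP : (0:ℝ) < f.hP := by exact_mod_cast V.hP_pos h
      have e1 : z.re = w.re := by
        apply mul_left_cancel₀ hP.ne'; linarith
      refine ⟨e1, ?_⟩
      have e2 : z.im^2 = w.im^2 := by
        apply mul_left_cancel₀ hP.ne'; rw [e1] at a2; linarith
      exact (sq_eq_sq₀ h1.le h2.le).1 e2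
    · obtain ⟨θ, a1, a2, a3⟩ := rt_neg ha h hz
      obtain ⟨τ, b1, b2, b3⟩ := rt_neg ha h hw
      have ha' : (f.a:ℝ) ≠ 0 := by exact_mod_cast ha
      -- θ is the real root
      have c1 : 2 * z.re + θ = 2 * w.re + τ := by
        apply mul_left_cancel₀ ha'; linarith
      have c2 : z.re^2 + z.im^2 + 2 * z.re * θ = w.re^2 + w.im^2 + 2 * w.re * τ := by
        apply mul_left_cancel₀ ha'; linarith
      have c3 : θ * (z.re^2 + z.im^2) = τ * (w.re^2 + w.im^2) := by
        apply mul_left_cancel₀ ha'; linarith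
      have c4 : (θ - τ) * ((θ - w.re)^2 + w.im^2) = 0 := by
        linear_combination c3 - θ * c2 + θ^2 * c1
      have c5 : θ = τ := by
        rcases mul_eq_zero.1 c4 with h' | h'
        · linarith
        · nlinarith [sq_nonneg (θ - w.re)]
      subst c5
      have e1 : z.re = w.re := by linarith
      refine ⟨e1, ?_⟩
      rw [e1] at c2
      have e2 : z.im^2 = w.im^2 := by linarith
      exact (sq_eq_sq₀ h1.le h2.le).1 e2
  apply UpperHalfPlane.ext
  apply Complex.ext
  · exact key.1
  · exact key.2

theorem rt_act {f : V} (γ : SL(2, ℤ)) {z : ℍ} : IsRt f (γ • z) ↔ IsRt (f.act γ.1) z := by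
  have hdet := γ.2
  rw [Matrix.det_fin_two] at hdet
  have hd : (f.act γ.1).disc = f.disc := by rw [V.disc_act, γ.2]; ring
  have hne : ((γ.1 1 0 : ℤ) : ℂ) * z + ((γ.1 1 1 : ℤ):ℂ) ≠ 0 := by
    have := UpperHalfPlane.denom_ne_zero (γ : GL (Fin 2) ℝ) z
    simpa [UpperHalfPlane.denom] using this
  have hz : ((γ • z : ℍ) : ℂ) = (((γ.1 0 0 : ℤ):ℂ) * z + ((γ.1 0 1 : ℤ):ℂ)) / (((γ.1 1 0 : ℤ):ℂ) * z + ((γ.1 1 1 : ℤ):ℂ)) := by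
    rw [coe_specialLinearGroup_apply]; simp
  rw [eq_div_iff hne] at hz
  simp only [IsRt, hd]
  generalize ((γ • z : ℍ) : ℂ) = t at hz
  split_ifs with h
  · simp only [V.act, V.hP_sub, V.hQ_sub, V.hR_sub, hdet]
    rw [← mul_left_inj' (pow_ne_zero 2 hne), zero_mul]
    refine Eq.congr ?_ rfl
    trans (f.hP : ℂ) * (t * (((γ.1 1 0 : ℤ):ℂ) * z + ((γ.1 1 1 : ℤ):ℂ)))^2
      + f.hQ * (t * (((γ.1 1 0 : ℤ):ℂ) * z + ((γ.1 1 1 : ℤ):ℂ))) * (((γ.1 1 0 : ℤ):ℂ) * z + ((γ.1 1 1 : ℤ):ℂ))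
      + f.hR * (((γ.1 1 0 : ℤ):ℂ) * z + ((γ.1 1 1 : ℤ):ℂ))^2
    · ring
    · rw [hz]; push_cast; ring
  · simp only [V.act, V.sub]
    rw [← mul_left_inj' (pow_ne_zero 3 hne), zero_mul]
    refine Eq.congr ?_ rfl
    trans (f.a : ℂ) * (t * (((γ.1 1 0 : ℤ):ℂ) * z + ((γ.1 1 1 : ℤ):ℂ)))^3
      + f.b * (t * (((γ.1 1 0 : ℤ):ℂ) * z + ((γ.1 1 1 : ℤ):ℂ)))^2 * (((γ.1 1 0 : ℤ):ℂ) * z + ((γ.1 1 1 : ℤ):ℂ))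
      + f.c * (t * (((γ.1 1 0 : ℤ):ℂ) * z + ((γ.1 1 1 : ℤ):ℂ))) * (((γ.1 1 0 : ℤ):ℂ) * z + ((γ.1 1 1 : ℤ):ℂ))^2
      + f.d * (((γ.1 1 0 : ℤ):ℂ) * z + ((γ.1 1 1 : ℤ):ℂ))^3
    · ring
    · rw [hz]; push_cast; ring
end CF

namespace CF
open UpperHalfPlane ModularGroup
open scoped MatrixGroups Modular

theorem le_of_sq' {a b : ℝ} (h : a^2 ≤ b^2) (hb : 0 ≤ b) : a ≤ b := le_of_abs_le (abs_le_of_sq_le_sq h hb)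

def V.e1 (f : V) : ℤ := if 0 < f.disc then f.hR - f.hP else f.d^2 - f.a^2 + f.a * f.c - f.b * f.d
def V.e2 (f : V) : ℤ := if 0 < f.disc then f.hP + f.hQ else (f.a + f.b)^2 + f.a * f.c + f.b * f.c - f.a * f.d
def V.e3 (f : V) : ℤ := if 0 < f.disc then f.hP - f.hQ else (f.a - f.b)^2 + f.a * f.c - f.b * f.c + f.a * f.d
/-- Reduced forms. -/
def V.Red (f : V) : Prop := 0 ≤ f.e1 ∧ 0 ≤ f.e2 ∧ 0 ≤ f.e3
/-- Strictly reduced forms. -/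
def V.RedO (f : V) : Prop := 0 < f.e1 ∧ 0 < f.e2 ∧ 0 < f.e3

theorem V.RedO.red {f : V} (h : f.RedO) : f.Red := ⟨h.1.le, h.2.1.le, h.2.2.le⟩

theorem e_fac {f : V} (ha : f.a ≠ 0) {z : ℍ} (hz : IsRt f z) :
    ∃ k1 k2 k3 : ℝ, 0 < k1 ∧ 0 < k2 ∧ 0 < k3 ∧ (f.e1 : ℝ) = k1 * (z.re^2 + z.im^2 - 1) ∧
      (f.e2 : ℝ) = k2 * (1 - 2 * z.re) ∧ (f.e3 : ℝ) = k3 * (1 + 2 * z.re) := by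
  have hv := z.im_pos
  by_cases h : 0 < f.disc
  · have hP : (0:ℝ) < f.hP := by exact_mod_cast V.hP_pos h
    obtain ⟨h1, h2⟩ := rt_pos h hz
    refine ⟨_, _, _, hP, hP, hP, ?_, ?_, ?_⟩
    · rw [V.e1, if_pos h]; push_cast; rw [h2]; ring
    · rw [V.e2, if_pos h]; push_cast; rw [h1]; ring
    · rw [V.e3, if_pos h]; push_cast; rw [h1]; ring
  · obtain ⟨θ, h1, h2, h3⟩ := rt_neg ha h hz
    have ha' : (0:ℝ) < (f.a:ℝ)^2 := by
      have : (f.a:ℝ) ≠ 0 := by exact_mod_cast ha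
      positivity
    refine ⟨(f.a:ℝ)^2 * ((θ * z.re - 1)^2 + θ^2 * z.im^2), (f.a:ℝ)^2 * ((z.re + θ - 1)^2 + z.im^2),
      (f.a:ℝ)^2 * ((z.re + θ + 1)^2 + z.im^2), ?_, by positivity, by positivity, ?_, ?_, ?_⟩
    · refine mul_pos ha' ?_
      rcases eq_or_ne θ 0 with h0 | h0
      · rw [h0]; norm_num
      · positivity
    · rw [V.e1, if_neg h]; push_cast; rw [h1, h2, h3]; ring
    · rw [V.e2, if_neg h]; push_cast; rw [h1, h2, h3]; ring
    · rw [V.e3, if_neg h]; push_cast; rw [h1, h2, h3]; ring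

theorem normSq_re_im (z : ℍ) : Complex.normSq (z:ℂ) = z.re^2 + z.im^2 := by
  rw [Complex.normSq_apply]; simp [pow_two]

theorem red_iff {f : V} (ha : f.a ≠ 0) {z : ℍ} (hz : IsRt f z) : f.Red ↔ z ∈ 𝒟 := by
  obtain ⟨k1, k2, k3, p1, p2, p3, q1, q2, q3⟩ := e_fac ha hz
  have i1 : 0 ≤ f.e1 ↔ (0:ℝ) ≤ f.e1 := by norm_cast
  have i2 : 0 ≤ f.e2 ↔ (0:ℝ) ≤ f.e2 := by norm_cast
  have i3 : 0 ≤ f.e3 ↔ (0:ℝ) ≤ f.e3 := by norm_cast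
  rw [V.Red, i1, i2, i3, q1, q2, q3, mul_nonneg_iff_of_pos_left p1, mul_nonneg_iff_of_pos_left p2, mul_nonneg_iff_of_pos_left p3]
  simp only [fd, Set.mem_setOf_eq, normSq_re_im, abs_le]
  constructor
  · rintro ⟨h1, h2, h3⟩; exact ⟨by linarith, by linarith, by linarith⟩
  · rintro ⟨h1, h2, h3⟩; exact ⟨by linarith, by linarith, by linarith⟩

theorem redO_iff {f : V} (ha : f.a ≠ 0) {z : ℍ} (hz : IsRt f z) : f.RedO ↔ z ∈ 𝒟ᵒ := by
  obtain ⟨k1, k2, k3, p1, p2, p3, q1, q2, q3⟩ := e_fac ha hz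
  have i1 : 0 < f.e1 ↔ (0:ℝ) < f.e1 := by norm_cast
  have i2 : 0 < f.e2 ↔ (0:ℝ) < f.e2 := by norm_cast
  have i3 : 0 < f.e3 ↔ (0:ℝ) < f.e3 := by norm_cast
  rw [V.RedO, i1, i2, i3, q1, q2, q3, mul_pos_iff_of_pos_left p1, mul_pos_iff_of_pos_left p2, mul_pos_iff_of_pos_left p3]
  simp only [fdo, Set.mem_setOf_eq, normSq_re_im, abs_lt]
  constructor
  · rintro ⟨h1, h2, h3⟩; exact ⟨by linarith, by linarith, by linarith⟩
  · rintro ⟨h1, h2, h3⟩; exact ⟨by linarith, by linarith, by linarith⟩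

/-- The box-like region containing all reduced forms. -/
def V.InB (f : V) (Y : ℝ) : Prop := |(f.a:ℝ)| ≤ Y ∧ |(f.b:ℝ)| ≤ Y ∧ |(f.a * f.c:ℝ)| ≤ Y^2 ∧ |(f.a * f.d:ℝ)| ≤ Y^2 ∧ |(f.b * f.c:ℝ)| ≤ Y^2

set_option maxHeartbeats 1000000 in
theorem inB_pos {f : V} (h : 0 < f.disc) (hr : f.Red) {Y : ℝ} (hY0 : 0 ≤ Y) (hY : 64 * (f.disc:ℝ) ≤ Y^4) : f.InB Y := by
  obtain ⟨r1, r2, r3⟩ := hr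
  rw [V.e1, if_pos h] at r1
  rw [V.e2, if_pos h] at r2
  rw [V.e3, if_pos h] at r3
  have hP : (0:ℝ) < f.hP := by exact_mod_cast V.hP_pos h
  have hD : (0:ℝ) < f.disc := by exact_mod_cast h
  have s1 : (f.hP:ℝ) ≤ f.hR := by have : f.hP ≤ f.hR := by omega
                                  exact_mod_cast this
  have s2 : -(f.hP:ℝ) ≤ f.hQ := by have : -f.hP ≤ f.hQ := by omega
                                   exact_mod_cast this
  have s3 : (f.hQ:ℝ) ≤ f.hP := by have : f.hQ ≤ f.hP := by omega
                                  exact_mod_cast this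
  have hh : (4 * f.hP * f.hR - f.hQ^2 : ℝ) = 3 * f.disc := by exact_mod_cast f.hess
  have y1 : (4 * f.hP^3 - 27 * f.disc * f.a^2:ℝ) = (2 * f.b^3 - 9 * f.a * f.b * f.c + 27 * f.a^2 * f.d)^2 := by exact_mod_cast f.syz
  have y2 : (4 * f.hR^3 - 27 * f.disc * f.d^2:ℝ) = (2 * f.c^3 - 9 * f.d * f.c * f.b + 27 * f.d^2 * f.a)^2 := by exact_mod_cast f.syz'
  have eP : (f.hP:ℝ) = f.b^2 - 3 * f.a * f.c := by simp [V.hP]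
  have eQ : (f.hQ:ℝ) = f.b * f.c - 9 * f.a * f.d := by simp [V.hQ]
  have hQ2 : (f.hQ:ℝ)^2 ≤ f.hP * f.hR := by nlinarith
  have hPR : (f.hP:ℝ) * f.hR ≤ f.disc := by linarith
  have hP2 : (f.hP:ℝ)^2 ≤ f.disc := by nlinarith
  have hPY : (f.hP:ℝ) ≤ Y^2 / 8 := by
    refine le_of_sq' ?_ (by positivity)
    linarith [show (Y^2/8)^2 = Y^4/64 by ring]
  have ha2 : (f.a:ℝ)^2 ≤ (Y/5)^2 := by
    have : 27 * (f.hP:ℝ)^2 * f.a^2 ≤ 4 * f.hP^3 := by linarith [mul_le_mul_of_nonneg_right hP2 (sq_nonneg (f.a:ℝ)), sq_nonneg (2 * f.b^3 - 9 * f.a * f.b * f.c + 27 * f.a^2 * f.d:ℝ)]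
    have h2 : 27 * (f.a:ℝ)^2 ≤ 4 * f.hP := by
      refine le_of_mul_le_mul_left (?_ : (f.hP:ℝ)^2 * _ ≤ f.hP^2 * _) (by positivity)
      linarith
    linarith [show (Y/5)^2 = Y^2/25 by ring, sq_nonneg Y]
  have ha : |(f.a:ℝ)| ≤ Y/5 := abs_le_of_sq_le_sq ha2 (by positivity)
  have had2 : ((f.a * f.d : ℝ))^2 ≤ (Y^2/27)^2 := by
    have t1 : 27 * (f.disc:ℝ) * f.a^2 ≤ 4 * f.hP^3 := by linarith [sq_nonneg (2 * f.b^3 - 9 * f.a * f.b * f.c + 27 * f.a^2 * f.d:ℝ)]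
    have t2 : 27 * (f.disc:ℝ) * f.d^2 ≤ 4 * f.hR^3 := by linarith [sq_nonneg (2 * f.c^3 - 9 * f.d * f.c * f.b + 27 * f.d^2 * f.a:ℝ)]
    have t3 := mul_le_mul t1 t2 (by positivity) (by positivity)
    have t4 : ((f.hP:ℝ) * f.hR)^3 ≤ f.disc^3 := by
      apply pow_le_pow_left₀ _ hPR
      exact mul_nonneg hP.le (hP.le.trans s1)
    have t5 : (f.disc:ℝ)^2 * (729 * (f.a * f.d)^2) ≤ f.disc^2 * (16 * f.disc) := by linarith
    have t6 := le_of_mul_le_mul_left t5 (by positivity)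
    linarith [show (Y^2/27)^2 = Y^4/729 by ring, hD]
  have had : |(f.a * f.d:ℝ)| ≤ Y^2/27 := abs_le_of_sq_le_sq had2 (by positivity)
  have hbc : |(f.b * f.c:ℝ)| ≤ Y^2/2 := by
    rw [abs_le] at had ⊢
    constructor <;> linarith [sq_nonneg Y]
  have hb : |(f.b:ℝ)| ≤ Y := by
    by_contra hn
    push Not at hn
    have e : (f.b:ℝ)^3 = f.b * f.hP + 3 * f.a * (f.b * f.c) := by rw [eP]; ring
    have e2 : |(f.b:ℝ)|^3 ≤ |(f.b:ℝ)| * (Y^2/8) + 3 * (Y/5) * (Y^2/2) := by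
      rw [← abs_pow, e]
      refine (abs_add_le _ _).trans (add_le_add ?_ ?_)
      · rw [abs_mul, abs_of_pos hP]; gcongr
      · rw [abs_mul, abs_mul]
        have : |(3:ℝ)| = 3 := by norm_num
        rw [this]; gcongr
    have p1 : |(f.b:ℝ)| * Y^2 ≤ |(f.b:ℝ)| * |(f.b:ℝ)|^2 := by gcongr
    have p2 : Y^3 < |(f.b:ℝ)|^3 := pow_lt_pow_left₀ hn hY0 (by norm_num)
    have p3 : 0 ≤ Y^3 := by positivity
    linarith
  have hac : |(f.a * f.c:ℝ)| ≤ Y^2 := by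
    have : (3 * (f.a * f.c):ℝ) = f.b^2 - f.hP := by rw [eP]; ring
    have hb2 : (f.b:ℝ)^2 ≤ Y^2 := sq_le_sq' (by linarith [abs_le.1 hb]) (abs_le.1 hb).2
    rw [abs_le]; constructor <;> linarith [sq_nonneg (f.b:ℝ), sq_nonneg Y]
  exact ⟨by linarith, hb, hac, by linarith [sq_nonneg Y], by linarith [sq_nonneg Y]⟩

set_option maxHeartbeats 1000000 in
theorem inB_neg {f : V} (ha : f.a ≠ 0) (h : f.disc < 0) (hr : f.Red) {Y : ℝ} (hY0 : 0 ≤ Y) (hY : 64 * (-(f.disc:ℝ)) ≤ Y^4) : f.InB Y := by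
  obtain ⟨z, hz⟩ := rt_exists ha h.ne
  have hfd := (red_iff ha hz).1 hr
  obtain ⟨θ, h1, h2, h3⟩ := rt_neg ha (by omega) hz
  have hv := z.im_pos
  have hv3 := three_le_four_mul_im_sq_of_mem_fd hfd
  have hu := hfd.2
  generalize z.re = u at *
  generalize z.im = v at *
  have hD : (f.disc : ℝ) = -4 * (f.a:ℝ)^4 * v^2 * ((θ-u)^2 + v^2)^2 := by
    rw [V.disc]; push_cast; rw [h1, h2, h3]; ring
  obtain ⟨e, he0, he⟩ : ∃ e : ℝ, 0 ≤ e ∧ e^2 = (θ-u)^2 + v^2 := ⟨√((θ-u)^2 + v^2), by positivity, Real.sq_sqrt (by positivity)⟩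
  rw [← he] at hD
  have hk : (f.a:ℝ)^2 * v * e^2 ≤ Y^2 / 16 := by
    refine le_of_sq' ?_ (by positivity)
    rw [hD] at hY
    linarith [show (Y^2/16)^2 = Y^4/256 by ring, show ((f.a:ℝ)^2 * v * e^2)^2 = (f.a:ℝ)^4 * v^2 * (e^2)^2 by ring]
  have hve : v ≤ e := le_of_sq' (by nlinarith [sq_nonneg (θ-u)]) he0
  have hte : |θ - u| ≤ e := abs_le_of_sq_le_sq (by nlinarith [sq_nonneg v]) he0
  have hv1 : 17/20 ≤ v := le_of_sq' (by nlinarith) hv.le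
  have he1 : 17/20 ≤ e := by linarith
  have hth : |θ| ≤ 27/17 * e := by
    rw [abs_le] at *; constructor <;> linarith
  have h2u : |2 * u + θ| ≤ 3 * e := by
    rw [abs_le] at *; constructor <;> linarith
  have hn : u^2 + v^2 ≤ 27/20 * v^2 := by
    have : u^2 ≤ (1/2)^2 := sq_le_sq' (by linarith [abs_le.1 hu]) (abs_le.1 hu).2
    nlinarith
  have hn0 : 0 ≤ u^2 + v^2 := by positivity
  have hutn : |u^2 + v^2 + 2 * u * θ| ≤ 17/5 * v * e := by
    refine (abs_add_le _ _).trans ?_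
    rw [abs_of_nonneg hn0, abs_mul, abs_mul]
    have : |(2:ℝ)| * |u| * |θ| ≤ 1 * (27/17 * e) := by
      gcongr
      rw [abs_two]; linarith
    linarith [mul_le_mul_of_nonneg_left hve hv.le, mul_le_mul_of_nonneg_right hv1 he0]
  have hA : (0:ℝ) ≤ (f.a:ℝ)^2 := sq_nonneg _
  have hve0 : 0 ≤ (f.a:ℝ)^2 * v * e^2 := by positivity
  -- basic comparision
  have big : ∀ t : ℝ, 0 ≤ t → t ≤ 16 * v * e^2 → (f.a:ℝ)^2 * t ≤ Y^2 := by
    intro t _ ht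
    linarith [mul_le_mul_of_nonneg_left ht hA]
  have e2v : v * e ≤ 20/17 * (v * e^2) := by linarith [mul_le_mul_of_nonneg_left he1 (mul_nonneg hv.le he0)]
  have e2 : e^2 ≤ 20/17 * (v * e^2) := by linarith [mul_le_mul_of_nonneg_right hv1 (sq_nonneg e)]
  have hw : 0 ≤ v * e^2 := by positivity
  have hw1 : (17/20) * (17/20)^2 ≤ v * e^2 := by gcongr
  clear hk hY hD he hve0 h
  refine ⟨?_, ?_, ?_, ?_, ?_⟩
  · apply abs_le_of_sq_le_sq _ hY0
    have := big 1 (by norm_num) (by linarith)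
    linarith
  · apply abs_le_of_sq_le_sq _ hY0
    rw [h1]
    have : (2 * u + θ)^2 ≤ (3 * e)^2 := sq_le_sq' (by linarith [abs_le.1 h2u]) (abs_le.1 h2u).2
    have := big ((2*u+θ)^2) (by positivity) (by linarith)
    linarith
  · rw [h2, show (f.a:ℝ) * (f.a * (u^2 + v^2 + 2 * u * θ)) = f.a^2 * (u^2 + v^2 + 2 * u * θ) by ring, abs_mul, abs_of_nonneg hA]
    exact big _ (abs_nonneg _) (by linarith)
  · rw [h3, show (f.a:ℝ) * (-f.a * θ * (u^2 + v^2)) = f.a^2 * (-(θ * (u^2 + v^2))) by ring, abs_mul, abs_of_nonneg hA, abs_neg, abs_mul, abs_of_nonneg hn0]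
    refine big _ (by positivity) ?_
    calc |θ| * (u^2+v^2) ≤ (27/17 * e) * (27/20 * v^2) := by gcongr
      _ ≤ 16 * v * e^2 := by linarith [mul_le_mul_of_nonneg_left hve (mul_nonneg hv.le he0)]
  · rw [h1, h2, show -(f.a:ℝ) * (2 * u + θ) * (f.a * (u^2 + v^2 + 2 * u * θ)) = f.a^2 * (-((2 * u + θ) * (u^2 + v^2 + 2 * u * θ))) by ring, abs_mul,
      abs_of_nonneg hA, abs_neg, abs_mul]
    refine big _ (by positivity) ?_
    calc |2 * u + θ| * |u^2 + v^2 + 2 * u * θ| ≤ (3 * e) * (17/5 * v * e) := by gcongr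
      _ ≤ 16 * v * e^2 := by linarith

theorem inB {f : V} (ha : f.a ≠ 0) (h : f.disc ≠ 0) (hr : f.Red) {Y : ℝ} (hY0 : 0 ≤ Y) (hY : 64 * |(f.disc:ℝ)| ≤ Y^4) : f.InB Y := by
  rcases lt_or_gt_of_ne h with h1 | h1
  · refine inB_neg ha h1 hr hY0 ?_
    rwa [abs_of_neg (by exact_mod_cast h1)] at hY
  · refine inB_pos h1 hr hY0 ?_
    rwa [abs_of_pos (by exact_mod_cast h1)] at hY
end CF

namespace CF
open UpperHalfPlane ModularGroup
open scoped MatrixGroups Modular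

theorem disc_actS (f : V) (γ : SL(2, ℤ)) : (f.act γ.1).disc = f.disc := by rw [V.disc_act, γ.2]; ring
theorem irr_actS {f : V} (h : f.irr) (γ : SL(2, ℤ)) : (f.act γ.1).irr := h.act (by rw [γ.2]; norm_num)
theorem actS_mul (f : V) (γ δ : SL(2, ℤ)) : f.act (γ * δ).1 = (f.act γ.1).act δ.1 := by
  rw [← V.act_mul]; rfl

theorem exists_red {f : V} (h : f.irr) (hD : f.disc ≠ 0) : ∃ γ : SL(2, ℤ), (f.act γ.1).Red := by
  obtain ⟨z, hz⟩ := rt_exists h.a_ne hD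
  obtain ⟨g, hg⟩ := exists_smul_mem_fd z
  refine ⟨g⁻¹, ?_⟩
  have h1 : IsRt (f.act (g⁻¹).1) (g • z) := by
    rw [← rt_act, inv_smul_smul]; exact hz
  exact (red_iff (irr_actS h _).a_ne h1).2 hg

theorem smul_mem_fd {f : V} (h : f.irr) {z : ℍ} (hz : IsRt f z) {γ : SL(2, ℤ)} (hr : (f.act γ.1).Red) :
    γ⁻¹ • z ∈ 𝒟 := by
  have h1 : IsRt (f.act γ.1) (γ⁻¹ • z) := by
    rw [← rt_act, smul_inv_smul]; exact hz
  exact (red_iff (irr_actS h _).a_ne h1).1 hr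

theorem redO_unique {f : V} (h : f.irr) (hD : f.disc ≠ 0) (ho : f.RedO) {γ : SL(2, ℤ)} (hr : (f.act γ.1).Red) : γ = 1 ∨ γ = -1 := by
  obtain ⟨z, hz⟩ := rt_exists h.a_ne hD
  have h1 := smul_mem_fd h hz hr
  have h2 := (redO_iff h.a_ne hz).1 ho
  rcases eq_one_or_neg_one_of_mem_fdo_mem_fd h2 h1 with h3 | h3
  · left; simpa using h3
  · right; rw [← inv_inv γ, h3]; simp

theorem act_neg_one (f : V) : f.act (-1 : SL(2, ℤ)).1 = f.smul (-1) := by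
  ext <;> simp [V.act, V.sub, V.smul]

theorem disc_smul_neg (f : V) : (f.smul (-1)).disc = f.disc := by rw [V.disc_smul]; norm_num
theorem e_smul_neg (f : V) : (f.smul (-1)).e1 = f.e1 ∧ (f.smul (-1)).e2 = f.e2 ∧ (f.smul (-1)).e3 = f.e3 := by
  simp only [V.e1, V.e2, V.e3, disc_smul_neg]
  simp only [V.smul, V.hP, V.hQ, V.hR]
  refine ⟨?_, ?_, ?_⟩ <;> split_ifs <;> ring
theorem red_smul_neg (f : V) : (f.smul (-1)).Red ↔ f.Red := by
  obtain ⟨h1, h2, h3⟩ := e_smul_neg f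
  rw [V.Red, V.Red, h1, h2, h3]
theorem redO_smul_neg (f : V) : (f.smul (-1)).RedO ↔ f.RedO := by
  obtain ⟨h1, h2, h3⟩ := e_smul_neg f
  rw [V.RedO, V.RedO, h1, h2, h3]

/-- the set of reducing substitutions -/
def rset (f : V) : Set SL(2, ℤ) := {γ | (f.act γ.1).Red}

theorem rset_act (f : V) (δ : SL(2, ℤ)) : rset (f.act δ.1) = (fun γ => δ * γ) ⁻¹' rset f := by
  ext γ; simp only [rset, Set.mem_setOf_eq, Set.mem_preimage, actS_mul]

theorem rset_finite {f : V} (h : f.irr) (hD : f.disc ≠ 0) : (rset f).Finite := by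
  obtain ⟨δ, hδ⟩ := exists_red h hD
  have key : (rset (f.act δ.1)).Finite := by
    set g := f.act δ.1 with hg
    have hgi : g.irr := irr_actS h δ
    have hgD : g.disc ≠ 0 := by rw [hg, disc_actS]; exact hD
    obtain ⟨z, hz⟩ := rt_exists hgi.a_ne hgD
    have hfd := (red_iff hgi.a_ne hz).1 hδ
    let L : Finset SL(2, ℤ) := {1, T, T⁻¹, S, T * S, T⁻¹ * S * T⁻¹, S * T⁻¹, S * T, T * S * T, T⁻¹ * S}
    refine Set.Finite.subset ((L ∪ L.image (fun x => -x)).image (fun x => x⁻¹)).finite_toSet ?_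
    intro γ hγ
    have h1 := smul_mem_fd hgi hz hγ
    have h2 := cases_of_mem_fd_smul_mem_fd hfd h1
    simp only [Finset.coe_image, Set.mem_image]
    refine ⟨γ⁻¹, ?_, inv_inv γ⟩
    simp only [L, Finset.coe_union, Finset.coe_image, Set.mem_union, Set.mem_image, Finset.mem_coe, Finset.mem_insert, Finset.mem_singleton, exists_eq_or_imp,
      exists_eq_left]
    rcases h2 with (h|h)|⟨h|h,_⟩|⟨h|h,_⟩|⟨h|h,_⟩|⟨h|h,_⟩|⟨h|h,_⟩|⟨h|h,_⟩|⟨h|h,_⟩|⟨h|h,_⟩|⟨h|h,_⟩ <;> rw [h] <;> simp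
  rw [rset_act] at key
  have := key.image (fun γ => δ * γ)
  rwa [Set.image_preimage_eq _ (Group.mulLeft_bijective δ).surjective] at this

/-- The weight. -/
def w (f : V) : ENNReal := if f.Red then ((rset f).ncard : ENNReal)⁻¹ else 0

theorem one_mem_rset {f : V} (h : f.Red) : (1 : SL(2, ℤ)) ∈ rset f := by
  rw [rset, Set.mem_setOf_eq]; simpa [V.act_one] using h

theorem w_le_one {f : V} (h : f.irr) (hD : f.disc ≠ 0) : w f ≤ 1 := by
  rw [w]; split_ifs with hr
  · have : 0 < (rset f).ncard := (Set.ncard_pos (rset_finite h hD)).2 ⟨1, one_mem_rset hr⟩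
    exact ENNReal.inv_le_one.2 (by exact_mod_cast this)
  · simp

theorem w_zero {f : V} (h : ¬ f.Red) : w f = 0 := by rw [w, if_neg h]

theorem w_redO {f : V} (h : f.irr) (hD : f.disc ≠ 0) (ho : f.RedO) : w f = 2⁻¹ := by
  have hr : f.Red := ho.red
  have : rset f = {1, -1} := by
    ext γ
    constructor
    · intro hγ; exact redO_unique h hD ho hγ
    · rintro (rfl | rfl)
      · exact one_mem_rset hr
      · rw [rset, Set.mem_setOf_eq, act_neg_one, red_smul_neg]; exact hr
  rw [w, if_pos hr, this, Set.ncard_pair]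
  · norm_num
  · intro h
    have := congrArg (fun g : SL(2, ℤ) => g.1 0 0) h
    simp at this

theorem w_tsum {f : V} (h : f.irr) (hD : f.disc ≠ 0) : ∑' γ : SL(2, ℤ), w (f.act γ.1) = 1 := by
  have hfin := rset_finite h hD
  obtain ⟨δ, hδ⟩ := exists_red h hD
  have hpos : 0 < (rset f).ncard := (Set.ncard_pos hfin).2 ⟨δ, hδ⟩
  have h1 : ∀ γ : SL(2, ℤ), w (f.act γ.1) = if γ ∈ hfin.toFinset then ((rset f).ncard : ENNReal)⁻¹ else 0 := by
    intro γ
    rw [w]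
    have hc : (rset (f.act γ.1)).ncard = (rset f).ncard := by
      rw [rset_act]
      exact Set.ncard_preimage_of_injective_subset_range (mul_right_injective γ)
        (by rw [(Group.mulLeft_bijective γ).surjective.range_eq]; exact Set.subset_univ _)
    rw [hc]
    simp only [Set.Finite.mem_toFinset]
    rfl
  simp_rw [h1]
  rw [tsum_eq_sum (s := hfin.toFinset)]
  · rw [Finset.sum_congr rfl (fun x hx => if_pos hx), Finset.sum_const, nsmul_eq_mul, ← Set.ncard_eq_toFinset_card _ hfin]
    exact ENNReal.mul_inv_cancel (by exact_mod_cast hpos.ne') (ENNReal.natCast_ne_top _)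
  · intro b hb; rw [if_neg hb]
end CF

namespace CF
open UpperHalfPlane ModularGroup
open scoped MatrixGroups Modular

/-- The finite box of forms. -/
def BF (T : ℕ) : Finset V :=
  (((Finset.Icc (-(T:ℤ)) T ×ˢ Finset.Icc (-(T:ℤ)) T) ×ˢ
    (Finset.Icc (-(T:ℤ)^2) (T^2) ×ˢ Finset.Icc (-(T:ℤ)^2) (T^2))).image
      (fun x => (⟨x.1.1, x.1.2, x.2.1, x.2.2⟩ : V))).filter
    (fun f => f.a ≠ 0 ∧ |f.a * f.c| ≤ T^2 ∧ |f.a * f.d| ≤ T^2 ∧ |f.b * f.c| ≤ T^2)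

theorem abs_le_of_mul {a c M : ℤ} (ha : a ≠ 0) (h : |a * c| ≤ M) : |c| ≤ M := by
  rw [abs_mul] at h
  have h1 : 1 ≤ |a| := Int.one_le_abs ha
  nlinarith [abs_nonneg c]

theorem mem_BF {T : ℕ} {f : V} : f ∈ BF T ↔ f.a ≠ 0 ∧ |f.a| ≤ T ∧ |f.b| ≤ T ∧ |f.a * f.c| ≤ T^2 ∧ |f.a * f.d| ≤ T^2 ∧ |f.b * f.c| ≤ T^2 := by
  rw [BF, Finset.mem_filter, Finset.mem_image]
  constructor
  · rintro ⟨⟨x, hx, rfl⟩, h⟩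
    simp only [Finset.mem_product, Finset.mem_Icc] at hx
    exact ⟨h.1, abs_le.2 hx.1.1, abs_le.2 hx.1.2, h.2.1, h.2.2.1, h.2.2.2⟩
  · rintro ⟨h0, h1, h2, h3, h4, h5⟩
    refine ⟨⟨((f.a, f.b), (f.c, f.d)), ?_, rfl⟩, h0, h3, h4, h5⟩
    simp only [Finset.mem_product, Finset.mem_Icc]
    exact ⟨⟨abs_le.1 h1, abs_le.1 h2⟩, abs_le.1 (abs_le_of_mul h0 h3), abs_le.1 (abs_le_of_mul h0 h4)⟩

theorem red_mem_BF {T : ℕ} {f : V} (ha : f.a ≠ 0) (hD : f.disc ≠ 0) (hr : f.Red) (hT : 64 * |f.disc| ≤ (T:ℤ)^4) : f ∈ BF T := by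
  have h := inB ha hD hr (Nat.cast_nonneg T) (by exact_mod_cast hT)
  obtain ⟨h1, h2, h3, h4, h5⟩ := h
  rw [mem_BF]
  exact ⟨ha, by exact_mod_cast h1, by exact_mod_cast h2, by exact_mod_cast h3, by exact_mod_cast h4, by exact_mod_cast h5⟩

/-- interior reduced forms of given discriminant -/
def RO (n : ℤ) : Finset V := (BF (64 * n.natAbs)).filter (fun f => f.irr ∧ f.disc = n ∧ f.RedO)
/-- boundary reduced forms of given discriminant -/
def RB (n : ℤ) : Finset V := (BF (64 * n.natAbs)).filter (fun f => f.irr ∧ f.disc = n ∧ f.Red ∧ ¬ f.RedO)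

theorem mem_box {n : ℤ} (hn : n ≠ 0) {f : V} (h : f.irr) (hd : f.disc = n) (hr : f.Red) : f ∈ BF (64 * n.natAbs) := by
  apply red_mem_BF h.a_ne (by rw [hd]; exact hn) hr
  rw [hd]; push_cast
  have h1 : 1 ≤ |n| := Int.one_le_abs hn
  have h2 : 1 ≤ 64 * |n| := by linarith
  calc 64 * |n| = (64 * |n|)^1 := (pow_one _).symm
    _ ≤ _ := pow_le_pow_right₀ h2 (by norm_num)

theorem mem_RO {n : ℤ} (hn : n ≠ 0) {f : V} : f ∈ RO n ↔ f.irr ∧ f.disc = n ∧ f.RedO := by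
  rw [RO, Finset.mem_filter]
  exact ⟨fun h => h.2, fun h => ⟨mem_box hn h.1 h.2.1 h.2.2.red, h⟩⟩
theorem mem_RB {n : ℤ} (hn : n ≠ 0) {f : V} : f ∈ RB n ↔ f.irr ∧ f.disc = n ∧ f.Red ∧ ¬ f.RedO := by
  rw [RB, Finset.mem_filter]
  exact ⟨fun h => h.2, fun h => ⟨mem_box hn h.1 h.2.1 h.2.2.1, h⟩⟩

/-- the reflected form -/
def V.J (f : V) : V := ⟨f.a, -f.b, f.c, -f.d⟩
theorem disc_J (f : V) : f.J.disc = f.disc := by simp only [V.J, V.disc]; ring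
theorem irr_J {f : V} (h : f.irr) : f.J.irr := by
  intro x y hxy
  have := h x (-y) (by rw [← hxy]; simp only [V.ev, V.J]; ring)
  simpa using this
theorem redO_J (f : V) : f.J.RedO ↔ f.RedO := by
  have h1 : f.J.e1 = f.e1 := by
    simp only [V.e1, disc_J]; simp only [V.J, V.hP, V.hR]; split_ifs <;> ring
  have h2 : f.J.e2 = f.e3 := by
    simp only [V.e2, V.e3, disc_J]; simp only [V.J, V.hP, V.hQ]; split_ifs <;> ring
  have h3 : f.J.e3 = f.e2 := by
    simp only [V.e2, V.e3, disc_J]; simp only [V.J, V.hP, V.hQ]; split_ifs <;> ring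
  rw [V.RedO, V.RedO, h1, h2, h3]; tauto

theorem sub_J (f : V) (p q r s : ℤ) : f.J.sub p q r s = f.sub p q (-r) (-s) := by
  ext <;> simp only [V.J, V.sub] <;> ring

theorem eqv_redO {f g : V} (h : f.irr) (hD : f.disc ≠ 0) (ho : f.RedO) (hg : g.Red) :
    Eqv f g ↔ g = f ∨ g = f.smul (-1) ∨ g = f.J ∨ g = f.J.smul (-1) := by
  have key : ∀ f : V, f.irr → f.disc ≠ 0 → f.RedO → ∀ p q r s : ℤ, p*s-q*r = 1 → (f.sub p q r s).Red → f.sub p q r s = f ∨ f.sub p q r s = f.smul (-1) := by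
    intro f h hD ho p q r s hdet hr
    let γ : SL(2, ℤ) := ⟨!![p, q; r, s], by rw [Matrix.det_fin_two]; simpa using hdet⟩
    have e : f.act γ.1 = f.sub p q r s := by simp [V.act, γ]
    rw [← e] at hr ⊢
    rcases redO_unique h hD ho hr with h1 | h1
    · left; rw [h1]; exact V.act_one f
    · right; rw [h1, act_neg_one]
  constructor
  · rintro ⟨p, q, r, s, h1, h2⟩
    rcases sq_eq_one_iff.mp h1 with h3 | h3
    · rw [h3, V.smul_one] at h2
      rcases key f h hD ho p q r s h3 (by rw [h2]; exact hg) with h4 | h4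
      · left; rw [← h2, h4]
      · right; left; rw [← h2, h4]
    · rw [h3] at h2
      have h5 : f.J.sub p q (-r) (-s) = g.smul (-1) := by rw [sub_J, neg_neg, neg_neg, h2]
      have hn : ∀ k : V, g.smul (-1) = k → g = k.smul (-1) := by
        rintro k rfl; rw [V.smul_smul]; norm_num; exact (V.smul_one g).symm
      rcases key f.J (irr_J h) (by rwa [disc_J]) ((redO_J f).2 ho) p q (-r) (-s) (by linarith)
        (by rw [h5, red_smul_neg]; exact hg) with h4 | h4
      · right; right; right; exact hn _ (h5.symm.trans h4)
      · right; right; left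
        rw [hn _ (h5.symm.trans h4), V.smul_smul]; norm_num; exact V.smul_one _
  · rintro (h1 | h1 | h1 | h1)
    · exact ⟨1, 0, 0, 1, by norm_num, by rw [h1]; ext <;> simp [V.sub, V.smul]⟩
    · exact ⟨-1, 0, 0, -1, by norm_num, by rw [h1]; ext <;> simp [V.sub, V.smul]⟩
    · exact ⟨-1, 0, 0, 1, by norm_num, by rw [h1]; ext <;> simp [V.sub, V.smul, V.J]⟩
    · exact ⟨1, 0, 0, -1, by norm_num, by rw [h1]; ext <;> simp [V.sub, V.smul, V.J]⟩

theorem four_card {f : V} (h : f.irr) : ({f, f.smul (-1), f.J, f.J.smul (-1)} : Finset V).card = 4 := by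
  have ha := h.a_ne
  have hd := h.d_ne
  have e : ∀ {u v : V}, u = v → u.a = v.a ∧ u.d = v.d := by rintro u v rfl; exact ⟨rfl, rfl⟩
  have q1 : f ≠ f.smul (-1) := by intro h1; have := e h1; simp only [V.smul] at this; omega
  have q2 : f ≠ f.J := by intro h1; have := e h1; simp only [V.J] at this; omega
  have q3 : f ≠ f.J.smul (-1) := by intro h1; have := e h1; simp only [V.J, V.smul] at this; omega
  have q4 : f.smul (-1) ≠ f.J := by intro h1; have := e h1; simp only [V.J, V.smul] at this; omega
  have q5 : f.smul (-1) ≠ f.J.smul (-1) := by intro h1; have := e h1; simp only [V.J, V.smul] at this; omega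
  have q6 : f.J ≠ f.J.smul (-1) := by intro h1; have := e h1; simp only [V.J, V.smul] at this; omega
  rw [Finset.card_insert_of_notMem (by simp [q1, q2, q3]), Finset.card_insert_of_notMem (by simp [q4, q5]), Finset.card_insert_of_notMem (by simp [q6]),
    Finset.card_singleton]

theorem n3_rel {n : ℤ} (hF : Fund n) : ∃ k : ℕ, (RO n).card = 4 * k ∧ k ≤ cubicCountDisc n ∧ cubicCountDisc n ≤ k + (RB n).card := by
  have hn : n ≠ 0 := by
    rintro rfl
    exact hF.2 2 Nat.prime_two 0 (by norm_num) (by norm_num)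
  obtain ⟨Φ, hs, hΦ⟩ := cubic_param hF
  rw [cubicCountDisc_eq]
  have pR : ∀ q, ∃ f : V, (f ∈ RO n ∨ f ∈ RB n) ∧ ∃ h : f.irr ∧ f.disc = n, Φ ⟨f, h⟩ = q := by
    intro q
    obtain ⟨⟨f, hf⟩, rfl⟩ := hs q
    obtain ⟨γ, hγ⟩ := exists_red hf.1 (by rw [hf.2]; exact hn)
    have h1 := irr_actS hf.1 γ
    have h2 : (f.act γ.1).disc = n := by rw [disc_actS, hf.2]
    refine ⟨f.act γ.1, ?_, ⟨h1, h2⟩, ?_⟩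
    · by_cases ho : (f.act γ.1).RedO
      · left; rw [mem_RO hn]; exact ⟨h1, h2, ho⟩
      · right; rw [mem_RB hn]; exact ⟨h1, h2, hγ, ho⟩
    · symm; rw [hΦ]
      have hdet := γ.2
      rw [Matrix.det_fin_two] at hdet
      exact ⟨γ.1 0 0, γ.1 0 1, γ.1 1 0, γ.1 1 1, by rw [hdet]; norm_num, by rw [hdet, V.smul_one]; rfl⟩
  have q0 : ∀ f ∈ RO n, f.irr ∧ f.disc = n := fun f hf => by
    rw [mem_RO hn] at hf; exact ⟨hf.1, hf.2.1⟩
  have q1 : ∀ f ∈ RB n, f.irr ∧ f.disc = n := fun f hf => by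
    rw [mem_RB hn] at hf; exact ⟨hf.1, hf.2.1⟩
  let A := (RO n).attach.image (fun f => Φ ⟨f.1, q0 f.1 f.2⟩)
  let B := (RB n).attach.image (fun f => Φ ⟨f.1, q1 f.1 f.2⟩)
  have hAB : ∀ q, q ∈ A ∪ B := by
    intro q
    obtain ⟨f, h1, h2, h3⟩ := pR q
    rw [Finset.mem_union]
    rcases h1 with h1 | h1
    · left; exact Finset.mem_image.2 ⟨⟨f, h1⟩, Finset.mem_attach _ _, h3⟩
    · right; exact Finset.mem_image.2 ⟨⟨f, h1⟩, Finset.mem_attach _ _, h3⟩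
  have hcard : Nat.card (Quot (isoRel n)) = (A ∪ B).card := by
    rw [← Nat.card_eq_finsetCard]
    exact Nat.card_congr ⟨fun q => ⟨q, hAB q⟩, fun q => q.1, fun _ => rfl, fun _ => rfl⟩
  refine ⟨A.card, ?_, ?_, ?_⟩
  · rw [← Finset.card_attach, Finset.card_eq_sum_card_image (fun f : {x // x ∈ RO n} => Φ ⟨f.1, q0 f.1 f.2⟩)]
    rw [Finset.sum_const_nat (m := 4), mul_comm]
    intro q hq
    obtain ⟨⟨f, hf⟩, -, rfl⟩ := Finset.mem_image.1 hq
    have hf' := (mem_RO hn).1 hf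
    rw [← four_card hf'.1, ← Finset.card_map (Function.Embedding.subtype _)]
    congr 1
    ext g
    simp only [Finset.mem_map, Finset.mem_filter, Finset.mem_attach, true_and, Function.Embedding.coe_subtype, Subtype.exists, exists_and_right,
      exists_eq_right, Finset.mem_insert, Finset.mem_singleton]
    have hD : f.disc ≠ 0 := by rw [hf'.2.1]; exact hn
    constructor
    · rintro ⟨hg, h1⟩
      have h2 := (hΦ _ _).1 h1.symm
      exact (eqv_redO hf'.1 hD hf'.2.2 ((mem_RO hn).1 hg).2.2.red).1 h2
    · intro hg
      have hgm : g ∈ RO n := by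
        rw [mem_RO hn]
        rcases hg with rfl | rfl | rfl | rfl
        · exact hf'
        · exact ⟨hf'.1.smul (by norm_num), by rw [disc_smul_neg]; exact hf'.2.1, (redO_smul_neg _).2 hf'.2.2⟩
        · exact ⟨irr_J hf'.1, by rw [disc_J]; exact hf'.2.1, (redO_J _).2 hf'.2.2⟩
        · exact ⟨(irr_J hf'.1).smul (by norm_num), by rw [disc_smul_neg, disc_J]; exact hf'.2.1,
            (redO_smul_neg _).2 ((redO_J _).2 hf'.2.2)⟩
      exact ⟨hgm, ((hΦ _ _).2 ((eqv_redO hf'.1 hD hf'.2.2 ((mem_RO hn).1 hgm).2.2.red).2 hg)).symm⟩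
  · rw [hcard]; exact Finset.card_le_card Finset.subset_union_left
  · rw [hcard]
    refine (Finset.card_union_le _ _).trans (Nat.add_le_add_left ?_ _)
    exact Finset.card_image_le.trans (by rw [Finset.card_attach])
end CF

namespace CF

/-- partial derivatives -/
def V.gx (f : V) (u v : ℤ) : ℤ := 3 * f.a * u^2 + 2 * f.b * u * v + f.c * v^2
def V.gy (f : V) (u v : ℤ) : ℤ := f.b * u^2 + 2 * f.c * u * v + 3 * f.d * v^2

/-- `p²`-divisible discriminant of the square type -/
def Ap (p : ℕ) (f : V) : Prop :=
  ∃ u v : ℤ, ¬ ((p:ℤ) ∣ u ∧ (p:ℤ) ∣ v) ∧ (p:ℤ)^2 ∣ f.ev u v ∧ (p:ℤ) ∣ f.gx u v ∧ (p:ℤ) ∣ f.gy u v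

def As (p : ℕ) (f : V) : ℕ := if Ap p f ∧ ¬ Rp p f then 1 else 0

theorem act_adj (f : V) (M : Matrix (Fin 2) (Fin 2) ℤ) : (f.act M).act M.adjugate = f.smul (M.det^3) := by
  rw [← V.act_mul, Matrix.mul_adjugate, ← V.act_scalar, V.act]
  simp [Matrix.smul_apply]

theorem pdvd {p : ℕ} (hp : p.Prime) {k x : ℤ} (hk : ¬ (p:ℤ) ∣ k) (h : (p:ℤ) ∣ k * x) : (p:ℤ) ∣ x :=
  ((Nat.prime_iff_prime_int.1 hp).dvd_or_dvd h).resolve_left hk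

theorem ppow {p : ℕ} (hp : p.Prime) {k : ℤ} (hk : ¬ (p:ℤ) ∣ k) (n : ℕ) : ¬ (p:ℤ) ∣ k^n := fun h =>
  hk ((Nat.prime_iff_prime_int.1 hp).dvd_of_dvd_pow h)

theorem psq {p : ℕ} (hp : p.Prime) {k x : ℤ} (hk : ¬ (p:ℤ) ∣ k) (h : (p:ℤ)^2 ∣ k * x) : (p:ℤ)^2 ∣ x := by
  have : IsCoprime ((p:ℤ)^2) k :=
    (((Nat.prime_iff_prime_int.1 hp).irreducible.coprime_iff_not_dvd).2 hk).pow_left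
  exact this.dvd_of_dvd_mul_left h

theorem Rp_smul {p : ℕ} (hp : p.Prime) {k : ℤ} (hk : ¬ (p:ℤ) ∣ k) (f : V) : Rp p (f.smul k) ↔ Rp p f := by
  have e1 : (f.smul k).hP = k^2 * f.hP := by simp only [V.smul, V.hP]; ring
  have e2 : (f.smul k).hQ = k^2 * f.hQ := by simp only [V.smul, V.hQ]; ring
  have e3 : (f.smul k).hR = k^2 * f.hR := by simp only [V.smul, V.hR]; ring
  rw [Rp, Rp, e1, e2, e3]
  have := ppow hp hk 2
  exact ⟨fun h => ⟨pdvd hp this h.1, pdvd hp this h.2.1, pdvd hp this h.2.2⟩, fun h => ⟨h.1.mul_left _, h.2.1.mul_left _, h.2.2.mul_left _⟩⟩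

theorem Rp_act_of {p : ℕ} {f : V} (h : Rp p f) (M : Matrix (Fin 2) (Fin 2) ℤ) : Rp p (f.act M) := by
  obtain ⟨h1, h2, h3⟩ := h
  rw [Rp, V.act, V.hP_sub, V.hQ_sub, V.hR_sub]
  refine ⟨Dvd.dvd.mul_left (dvd_add (dvd_add ?_ ?_) ?_) _, Dvd.dvd.mul_left (dvd_add (dvd_add ?_ ?_) ?_) _, Dvd.dvd.mul_left (dvd_add (dvd_add ?_ ?_) ?_) _⟩
  all_goals first
    | exact dvd_mul_of_dvd_left h1 _
    | exact (h2.mul_right _).mul_right _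
    | exact h2.mul_right _
    | exact h3.mul_right _
    | exact ((h1.mul_left _).mul_right _).mul_right _
    | exact ((h3.mul_left _).mul_right _).mul_right _

theorem Rp_act {p : ℕ} (hp : p.Prime) {M : Matrix (Fin 2) (Fin 2) ℤ} (hM : ¬ (p:ℤ) ∣ M.det) (f : V) : Rp p (f.act M) ↔ Rp p f := by
  refine ⟨fun h => ?_, fun h => Rp_act_of h M⟩
  have := Rp_act_of h M.adjugate
  rw [act_adj] at this
  exact (Rp_smul hp (ppow hp hM 3) f).1 this

theorem Ap_smul {p : ℕ} (hp : p.Prime) {k : ℤ} (hk : ¬ (p:ℤ) ∣ k) (f : V) : Ap p (f.smul k) ↔ Ap p f := by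
  have e1 : ∀ u v, (f.smul k).ev u v = k * f.ev u v := V.ev_smul k f
  have e2 : ∀ u v, (f.smul k).gx u v = k * f.gx u v := fun u v => by simp only [V.smul, V.gx]; ring
  have e3 : ∀ u v, (f.smul k).gy u v = k * f.gy u v := fun u v => by simp only [V.smul, V.gy]; ring
  constructor
  · rintro ⟨u, v, h0, h1, h2, h3⟩
    rw [e1] at h1; rw [e2] at h2; rw [e3] at h3
    exact ⟨u, v, h0, psq hp hk h1, pdvd hp hk h2, pdvd hp hk h3⟩
  · rintro ⟨u, v, h0, h1, h2, h3⟩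
    exact ⟨u, v, h0, by rw [e1]; exact h1.mul_left _, by rw [e2]; exact h2.mul_left _, by rw [e3]; exact h3.mul_left _⟩

theorem gx_sub (f : V) (p q r s u v : ℤ) : (f.sub p q r s).gx u v = p * f.gx (p*u+q*v) (r*u+s*v) + r * f.gy (p*u+q*v) (r*u+s*v) := by
  simp only [V.sub, V.gx, V.gy]; ring
theorem gy_sub (f : V) (p q r s u v : ℤ) : (f.sub p q r s).gy u v = q * f.gx (p*u+q*v) (r*u+s*v) + s * f.gy (p*u+q*v) (r*u+s*v) := by
  simp only [V.sub, V.gx, V.gy]; ring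

theorem pvec {p : ℕ} (hp : p.Prime) {a b c d u v : ℤ} (hM : ¬ (p:ℤ) ∣ (a*d-b*c)) (h1 : (p:ℤ) ∣ a*u+b*v) (h2 : (p:ℤ) ∣ c*u+d*v) : (p:ℤ) ∣ u ∧ (p:ℤ) ∣ v := by
  constructor
  · refine pdvd hp hM ?_
    have : (a*d-b*c)*u = d*(a*u+b*v) - b*(c*u+d*v) := by ring
    rw [this]; exact dvd_sub (h1.mul_left _) (h2.mul_left _)
  · refine pdvd hp hM ?_
    have : (a*d-b*c)*v = a*(c*u+d*v) - c*(a*u+b*v) := by ring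
    rw [this]; exact dvd_sub (h2.mul_left _) (h1.mul_left _)

theorem Ap_act_of {p : ℕ} (hp : p.Prime) {M : Matrix (Fin 2) (Fin 2) ℤ} (hM : ¬ (p:ℤ) ∣ M.det) {f : V} (h : Ap p (f.act M)) : Ap p f := by
  obtain ⟨u, v, h0, h1, h2, h3⟩ := h
  rw [Matrix.det_fin_two] at hM
  rw [V.act] at h1 h2 h3
  rw [V.ev_sub] at h1; rw [gx_sub] at h2; rw [gy_sub] at h3
  refine ⟨M 0 0 * u + M 0 1 * v, M 1 0 * u + M 1 1 * v, fun h => h0 (pvec hp hM h.1 h.2), h1, ?_⟩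
  exact pvec hp (a := M 0 0) (b := M 1 0) (c := M 0 1) (d := M 1 1) (by rwa [mul_comm (M 1 0)]) h2 h3

theorem Ap_act {p : ℕ} (hp : p.Prime) {M : Matrix (Fin 2) (Fin 2) ℤ} (hM : ¬ (p:ℤ) ∣ M.det) (f : V) : Ap p (f.act M) ↔ Ap p f := by
  refine ⟨fun h => Ap_act_of hp hM h, fun h => ?_⟩
  apply Ap_act_of hp (M := M.adjugate) (by rw [Matrix.det_adjugate]; simpa using hM)
  rw [act_adj, Ap_smul hp (ppow hp hM 3)]; exact h

/-- evaluation modulo `p` -/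
def evZ (p : ℕ) (f : V) (x : ZMod p × ZMod p) : ZMod p := f.a * x.1^3 + f.b * x.1^2 * x.2 + f.c * x.1 * x.2^2 + f.d * x.2^3
def gxZ (p : ℕ) (f : V) (x : ZMod p × ZMod p) : ZMod p := 3 * f.a * x.1^2 + 2 * f.b * x.1 * x.2 + f.c * x.2^2
def gyZ (p : ℕ) (f : V) (x : ZMod p × ZMod p) : ZMod p := f.b * x.1^2 + 2 * f.c * x.1 * x.2 + 3 * f.d * x.2^2
def omS (p : ℕ) (f : V) : Set (ZMod p × ZMod p) := {x | evZ p f x = 0 ∧ ¬ (gxZ p f x = 0 ∧ gyZ p f x = 0)}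

theorem omS_smul {p : ℕ} (hp : p.Prime) {k : ℤ} (hk : ¬ (p:ℤ) ∣ k) (f : V) : omS p (f.smul k) = omS p f := by
  haveI := Fact.mk hp
  have hk' : (k : ZMod p) ≠ 0 := by rwa [Ne, ZMod.intCast_zmod_eq_zero_iff_dvd]
  ext x
  have e1 : evZ p (f.smul k) x = k * evZ p f x := by simp only [evZ, V.smul]; push_cast; ring
  have e2 : gxZ p (f.smul k) x = k * gxZ p f x := by simp only [gxZ, V.smul]; push_cast; ring
  have e3 : gyZ p (f.smul k) x = k * gyZ p f x := by simp only [gyZ, V.smul]; push_cast; ring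
  simp only [omS, Set.mem_setOf_eq, e1, e2, e3, mul_eq_zero, hk', false_or]

theorem omS_act_le {p : ℕ} (hp : p.Prime) {M : Matrix (Fin 2) (Fin 2) ℤ} (hM : ¬ (p:ℤ) ∣ M.det) (f : V) :
    (omS p (f.act M)).ncard ≤ (omS p f).ncard := by
  haveI := Fact.mk hp
  rw [Matrix.det_fin_two] at hM
  have hk' : ((M 0 0 * M 1 1 - M 0 1 * M 1 0 : ℤ) : ZMod p) ≠ 0 := by rwa [Ne, ZMod.intCast_zmod_eq_zero_iff_dvd]
  push_cast at hk'
  refine Set.ncard_le_ncard_of_injOn (fun x => ((M 0 0 : ZMod p) * x.1 + M 0 1 * x.2, (M 1 0 : ZMod p) * x.1 + M 1 1 * x.2)) ?_ ?_ (Set.toFinite _)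
  · intro x hx
    have e1 : evZ p (f.act M) x = evZ p f ((M 0 0 : ZMod p) * x.1 + M 0 1 * x.2, (M 1 0 : ZMod p) * x.1 + M 1 1 * x.2) := by
      simp only [evZ, V.act, V.sub]; push_cast; ring
    have e2 : gxZ p (f.act M) x = M 0 0 * gxZ p f ((M 0 0 : ZMod p) * x.1 + M 0 1 * x.2, (M 1 0 : ZMod p) * x.1 + M 1 1 * x.2)
       + M 1 0 * gyZ p f ((M 0 0 : ZMod p) * x.1 + M 0 1 * x.2, (M 1 0 : ZMod p) * x.1 + M 1 1 * x.2) := by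
      simp only [gxZ, gyZ, V.act, V.sub]; push_cast; ring
    have e3 : gyZ p (f.act M) x = M 0 1 * gxZ p f ((M 0 0 : ZMod p) * x.1 + M 0 1 * x.2, (M 1 0 : ZMod p) * x.1 + M 1 1 * x.2)
       + M 1 1 * gyZ p f ((M 0 0 : ZMod p) * x.1 + M 0 1 * x.2, (M 1 0 : ZMod p) * x.1 + M 1 1 * x.2) := by
      simp only [gxZ, gyZ, V.act, V.sub]; push_cast; ring
    simp only [omS, Set.mem_setOf_eq] at hx ⊢
    refine ⟨by rw [← e1]; exact hx.1, fun h => hx.2 ?_⟩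
    rw [e2, e3, h.1, h.2]; simp
  · intro x _ y _ hxy
    simp only [Prod.mk.injEq] at hxy
    obtain ⟨h1, h2⟩ := hxy
    ext
    · exact mul_left_cancel₀ hk' (by linear_combination (M 1 1 : ZMod p) * h1 - (M 0 1 : ZMod p) * h2)
    · exact mul_left_cancel₀ hk' (by linear_combination (M 0 0 : ZMod p) * h2 - (M 1 0 : ZMod p) * h1)

theorem omS_act {p : ℕ} (hp : p.Prime) {M : Matrix (Fin 2) (Fin 2) ℤ} (hM : ¬ (p:ℤ) ∣ M.det) (f : V) :
    (omS p (f.act M)).ncard = (omS p f).ncard := by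
  apply le_antisymm (omS_act_le hp hM f)
  have := omS_act_le hp (M := M.adjugate) (by rw [Matrix.det_adjugate]; simpa using hM) (f.act M)
  rwa [act_adj, omS_smul hp (ppow hp hM 3)] at this

theorem cast_zero {p : ℕ} {z : ℤ} : (p:ℤ) ∣ z ↔ (z : ZMod p) = 0 := (ZMod.intCast_zmod_eq_zero_iff_dvd z p).symm

theorem omS_card {p : ℕ} (hp : p.Prime) (f : V) : (omS p f).ncard = (p - 1) * om p f := by
  haveI := Fact.mk hp
  set S : Finset (ZMod p) := Finset.univ.filter (fun r => evZ p f (r, 1) = 0 ∧ gxZ p f (r, 1) ≠ 0) with hS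
  set U : Finset (ZMod p) := Finset.univ.filter (fun y => y ≠ 0) with hU
  have hUc : U.card = p - 1 := by
    have : U = Finset.univ.erase 0 := by ext; simp [hU]
    rw [this, Finset.card_erase_of_mem (Finset.mem_univ _), Finset.card_univ, ZMod.card]
  set A : Finset (ZMod p × ZMod p) := (S ×ˢ U).image (fun x => (x.1 * x.2, x.2)) with hA
  set B : Finset (ZMod p × ZMod p) := if (p:ℤ) ∣ f.a ∧ ¬ (p:ℤ) ∣ f.b then U.image (fun x => (x, 0)) else ∅ with hB
  have hAB : omS p f = ((A ∪ B : Finset _) : Set _) := by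
    ext ⟨x, y⟩
    simp only [omS, Set.mem_setOf_eq, Finset.coe_union, Set.mem_union, Finset.mem_coe]
    by_cases hy : y = 0
    · subst hy
      have : (x, 0) ∉ A := by
        simp only [hA, hU, Finset.mem_image, Finset.mem_product, Finset.mem_filter, Prod.mk.injEq, Prod.exists]
        rintro ⟨a, b, ⟨_, _, hb⟩, _, h⟩; exact hb h
      simp only [this, false_or, hB]
      split_ifs with h <;> rw [cast_zero, cast_zero] at h
      · simp [evZ, gxZ, gyZ, h.1, h.2, hU]
      · simp only [evZ, gxZ, gyZ, Finset.notMem_empty, iff_false]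
        rintro ⟨h1, h2⟩
        simp at h1 h2
        rcases h1 with h1 | h1
        · exact h ⟨h1, (h2 (by simp [h1])).1⟩
        · simp [h1] at h2
    · have hB' : (x, y) ∉ B := by
        rw [hB]; split_ifs
        · simp [Ne.symm hy]
        · simp
      simp only [hB', or_false, hA, Finset.mem_image, Finset.mem_product, Prod.mk.injEq, Prod.exists]
      have e1 : ∀ r, evZ p f (r * y, y) = y^3 * evZ p f (r, 1) := fun r => by simp only [evZ]; ring
      have e2 : ∀ r, gxZ p f (r * y, y) = y^2 * gxZ p f (r, 1) := fun r => by simp only [gxZ]; ring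
      have e3 : ∀ r, gyZ p f (r * y, y) = y^2 * (3 * evZ p f (r, 1) - r * gxZ p f (r, 1)) := fun r => by simp only [gyZ, evZ, gxZ]; ring
      constructor
      · rintro ⟨h1, h2⟩
        refine ⟨x / y, y, ⟨?_, by simp [hU, hy]⟩, by field_simp, rfl⟩
        have hx : x = x / y * y := by field_simp
        rw [hx, e1] at h1
        rw [hx, e2, e3] at h2
        simp only [mul_eq_zero, pow_eq_zero_iff, ne_eq, OfNat.ofNat_ne_zero, not_false_iff, hy, false_or] at h1 h2
        rw [h1] at h2
        simp only [hS, Finset.mem_filter, Finset.mem_univ, true_and]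
        refine ⟨h1, fun h => h2 ⟨h, by rw [h]; ring⟩⟩
      · rintro ⟨r, y', ⟨h1, -⟩, rfl, rfl⟩
        simp only [hS, Finset.mem_filter, Finset.mem_univ, true_and] at h1
        refine ⟨by rw [e1, h1.1, mul_zero], fun h => ?_⟩
        rw [e2] at h
        rcases mul_eq_zero.1 h.1 with h3 | h3
        · exact hy (pow_eq_zero_iff (by norm_num) |>.1 h3)
        · exact h1.2 h3
  rw [hAB, Set.ncard_coe_finset, Finset.card_union_of_disjoint]
  · have hAc : A.card = S.card * (p - 1) := by
      rw [hA, Finset.card_image_of_injOn, Finset.card_product, hUc]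
      rintro ⟨x, y⟩ hx ⟨x', y'⟩ _ h
      simp only [Prod.mk.injEq] at h
      obtain ⟨h1, rfl⟩ := h
      simp only [Finset.coe_product, Set.mem_prod, hU, Finset.coe_filter, Set.mem_setOf_eq] at hx
      rw [mul_right_cancel₀ hx.2.2 h1]
    have hBc : B.card = (if (p:ℤ) ∣ f.a ∧ ¬ (p:ℤ) ∣ f.b then 1 else 0) * (p - 1) := by
      rw [hB]; split_ifs
      · rw [Finset.card_image_of_injective _ (fun x y h => (Prod.mk.inj h).1), hUc, one_mul]
      · simp
    have hSc : S.card = ((Finset.range p).filter (fun r : ℕ => (p:ℤ) ∣ f.ev r 1 ∧ ¬ (p:ℤ) ∣ f.dx r)).card := by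
      symm
      refine Finset.card_bij (fun r _ => (r : ZMod p)) ?_ ?_ ?_
      · intro r hr
        simp only [Finset.mem_filter, cast_zero, V.ev, V.dx] at hr
        simp only [hS, Finset.mem_filter, Finset.mem_univ, true_and, evZ, gxZ]
        have h2 := hr.2
        push_cast at h2
        simpa using h2
      · intro r hr r' hr' h
        simp only [Finset.mem_filter, Finset.mem_range] at hr hr'
        rw [ZMod.natCast_eq_natCast_iff] at h
        exact Nat.ModEq.eq_of_lt_of_lt h hr.1 hr'.1
      · intro z hz
        refine ⟨z.val, ?_, ZMod.natCast_zmod_val z⟩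
        simp only [hS, Finset.mem_filter, Finset.mem_univ, true_and, evZ, gxZ] at hz
        simp only [Finset.mem_filter, Finset.mem_range, cast_zero, V.ev, V.dx]
        refine ⟨ZMod.val_lt z, ?_⟩
        push_cast
        rw [ZMod.natCast_zmod_val]
        simpa using hz
    rw [hAc, hBc, hSc, om]; ring
  · rw [Finset.disjoint_left]
    rintro ⟨x, y⟩ h1 h2
    have hy : y ≠ 0 := by
      simp only [hA, hU, Finset.mem_image, Finset.mem_product, Finset.mem_filter, Prod.mk.injEq, Prod.exists] at h1
      obtain ⟨a, b, ⟨_, _, hb⟩, _, h⟩ := h1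
      rw [← h]; exact hb
    rw [hB] at h2; split_ifs at h2
    · simp [Ne.symm hy] at h2
    · simp at h2

theorem om_act {p : ℕ} (hp : p.Prime) {M : Matrix (Fin 2) (Fin 2) ℤ} (hM : ¬ (p:ℤ) ∣ M.det) (f : V) : om p (f.act M) = om p f := by
  have := omS_act hp hM f
  rw [omS_card hp, omS_card hp] at this
  exact Nat.eq_of_mul_eq_mul_left (by have := hp.two_le; omega) this
theorem om_smul {p : ℕ} (hp : p.Prime) {k : ℤ} (hk : ¬ (p:ℤ) ∣ k) (f : V) : om p (f.smul k) = om p f := by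
  have := congrArg Set.ncard (omS_smul hp hk f)
  rw [omS_card hp, omS_card hp] at this
  exact Nat.eq_of_mul_eq_mul_left (by have := hp.two_le; omega) this
theorem As_act {p : ℕ} (hp : p.Prime) {M : Matrix (Fin 2) (Fin 2) ℤ} (hM : ¬ (p:ℤ) ∣ M.det) (f : V) : As p (f.act M) = As p f := by
  rw [As, As, Ap_act hp hM, Rp_act hp hM]
theorem As_smul {p : ℕ} (hp : p.Prime) {k : ℤ} (hk : ¬ (p:ℤ) ∣ k) (f : V) : As p (f.smul k) = As p f := by
  rw [As, As, Ap_smul hp hk, Rp_smul hp hk]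
end CF

namespace CF
open scoped MatrixGroups

/-- Representatives of integral matrices of determinant `p`. -/
def Nm (p : ℕ) : Option (Fin p) → Matrix (Fin 2) (Fin 2) ℤ
  | none => !![1, 0; 0, (p:ℤ)]
  | some r => !![((r:ℕ):ℤ), -(p:ℤ); 1, 0]

theorem Nm_det (p : ℕ) (i : Option (Fin p)) : (Nm p i).det = p := by
  cases i <;> simp [Nm, Matrix.det_fin_two]

theorem dv_iff {k : ℤ} {f : V} : (∃ g : V, g.smul k = f) ↔ k ∣ f.a ∧ k ∣ f.b ∧ k ∣ f.c ∧ k ∣ f.d := by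
  constructor
  · rintro ⟨g, rfl⟩; exact ⟨⟨_, rfl⟩, ⟨_, rfl⟩, ⟨_, rfl⟩, ⟨_, rfl⟩⟩
  · rintro ⟨⟨a, ha⟩, ⟨b, hb⟩, ⟨c, hc⟩, ⟨d, hd⟩⟩
    exact ⟨⟨a, b, c, d⟩, by ext <;> simp [V.smul, ha, hb, hc, hd]⟩

theorem act_none (p : ℕ) (f : V) : f.act (Nm p none) = ⟨f.a, p * f.b, p^2 * f.c, p^3 * f.d⟩ := by
  ext <;> simp [V.act, V.sub, Nm] <;> ring
theorem act_some (p : ℕ) (f : V) (r : Fin p) : f.act (Nm p (some r)) = ⟨f.ev r 1, p * (- f.dx r), p^2 * (3 * f.a * (r:ℕ) + f.b), -(p^3 * f.a)⟩ := by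
  ext <;> simp [V.act, V.sub, Nm, V.ev, V.dx] <;> ring

theorem sq_dvd_mul {p : ℕ} (hp : p.Prime) {x : ℤ} : (p:ℤ)^2 ∣ p * x ↔ (p:ℤ) ∣ x := by
  have : (p:ℤ) ≠ 0 := by exact_mod_cast hp.ne_zero
  rw [pow_two, mul_dvd_mul_iff_left this]

theorem dv2_none {p : ℕ} (hp : p.Prime) (f : V) : (∃ g : V, g.smul (p^2) = f.act (Nm p none)) ↔ (p:ℤ)^2 ∣ f.a ∧ (p:ℤ) ∣ f.b := by
  rw [dv_iff, act_none, sq_dvd_mul hp]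
  exact ⟨fun h => ⟨h.1, h.2.1⟩, fun h => ⟨h.1, h.2, ⟨_, rfl⟩, ⟨p * f.d, by ring⟩⟩⟩
theorem dv2_some {p : ℕ} (hp : p.Prime) (f : V) (r : Fin p) : (∃ g : V, g.smul (p^2) = f.act (Nm p (some r))) ↔ (p:ℤ)^2 ∣ f.ev r 1 ∧ (p:ℤ) ∣ f.dx r := by
  rw [dv_iff, act_some, sq_dvd_mul hp, dvd_neg]
  exact ⟨fun h => ⟨h.1, h.2.1⟩, fun h => ⟨h.1, h.2, ⟨_, rfl⟩, ⟨-(p * f.a), by ring⟩⟩⟩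

theorem Ap_index {p : ℕ} (hp : p.Prime) (f : V) : Ap p f ↔ ∃ i, ∃ g : V, g.smul (p^2) = f.act (Nm p i) := by
  have hpi := Nat.prime_iff_prime_int.1 hp
  constructor
  · rintro ⟨u, v, h0, h1, h2, h3⟩
    by_cases hv : (p:ℤ) ∣ v
    · have hu : ¬ (p:ℤ) ∣ u := fun h => h0 ⟨h, hv⟩
      refine ⟨none, (dv2_none hp f).2 ?_⟩
      obtain ⟨k, rfl⟩ := hv
      have hb : (p:ℤ) ∣ f.b := by
        apply pdvd hp (ppow hp hu 2)
        have : u^2 * f.b = f.gy u (p*k) - p * (2 * f.c * u * k + 3 * f.d * p * k^2) := by simp only [V.gy]; ring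
        rw [this]; exact dvd_sub h3 ⟨_, rfl⟩
      refine ⟨?_, hb⟩
      obtain ⟨b, hb⟩ := hb
      apply psq hp (ppow hp hu 3)
      have : u^3 * f.a = f.ev u (p*k) - p^2 * (b * u^2 * k + f.c * u * k^2 + f.d * p * k^3) := by simp only [V.ev, hb]; ring
      rw [this]; exact dvd_sub h1 ⟨_, rfl⟩
    · have hco : IsCoprime v (p:ℤ) := ((hpi.irreducible.coprime_iff_not_dvd).2 hv).symm
      obtain ⟨x, y, hxy⟩ := hco
      have hp0 : (0:ℤ) < p := by exact_mod_cast hp.pos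
      have hr0 := Int.emod_nonneg (u * x) hp0.ne'
      have hr1 := Int.emod_lt_of_pos (u * x) hp0
      obtain ⟨r, hr⟩ := Int.eq_ofNat_of_zero_le hr0
      have hrp : r < p := by rw [hr] at hr1; exact_mod_cast hr1
      refine ⟨some ⟨r, hrp⟩, (dv2_some hp f _).2 ?_⟩
      obtain ⟨k, hk⟩ : ∃ k, u = r * v + p * k := by
        have := Int.emod_add_mul_ediv (u * x) p
        rw [hr] at this
        refine ⟨u * x / p * v + u * y, ?_⟩
        linear_combination (-u) * hxy - v * this
      have h4 : (p:ℤ) ∣ f.dx r := by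
        apply pdvd hp (ppow hp hv 2)
        have : v^2 * f.dx r = f.gx u v - p * (6 * f.a * r * v * k + 3 * f.a * p * k^2 + 2 * f.b * k * v) := by
          rw [hk]; simp only [V.gx, V.dx]; ring
        rw [this]; exact dvd_sub h2 ⟨_, rfl⟩
      refine ⟨?_, h4⟩
      obtain ⟨e, he⟩ := h4
      apply psq hp (ppow hp hv 3)
      have : v^3 * f.ev r 1 = f.ev u v - p * k * v^2 * f.dx r - p^2 * ((3 * f.a * r + f.b) * v * k^2 + f.a * p * k^3) := by
        rw [hk]; simp only [V.ev, V.dx]; ring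
      show (p:ℤ)^2 ∣ v^3 * f.ev r 1
      rw [this, he]; exact dvd_sub (dvd_sub h1 ⟨k * v^2 * e, by ring⟩) ⟨_, rfl⟩
  · rintro ⟨i, h⟩
    have hp1 : ¬ (p:ℤ) ∣ 1 := hpi.not_dvd_one
    cases i with
    | none =>
      rw [dv2_none hp] at h
      have h1 := (Dvd.intro_left ((p:ℤ)^1) (by ring) : (p:ℤ) ∣ (p:ℤ)^2).trans h.1
      exact ⟨1, 0, fun h => hp1 h.1, by simpa [V.ev] using h.1, by simpa [V.gx] using h1.mul_left 3, by simpa [V.gy] using h.2⟩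
    | some r =>
      rw [dv2_some hp] at h
      have h1 := (Dvd.intro_left ((p:ℤ)^1) (by ring) : (p:ℤ) ∣ (p:ℤ)^2).trans h.1
      refine ⟨(r:ℕ), 1, fun h => hp1 h.2, h.1, ?_, ?_⟩
      · have : f.gx (r:ℕ) 1 = f.dx (r:ℕ) := by simp only [V.gx, V.dx]; ring
        rw [this]; exact h.2
      · have : f.gy (r:ℕ) 1 = 3 * f.ev (r:ℕ) 1 - (r:ℕ) * f.dx (r:ℕ) := by simp only [V.gy, V.ev, V.dx]; ring
        rw [this]; exact dvd_sub (h1.mul_left _) (h.2.mul_left _)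

theorem Rp_of_dvd {p : ℕ} {f : V} (ha : (p:ℤ) ∣ f.a) (hb : (p:ℤ) ∣ f.b) (hc : (p:ℤ) ∣ f.c) : Rp p f := by
  simp only [Rp, V.hP, V.hQ, V.hR]
  refine ⟨dvd_sub (dvd_pow hb (by norm_num)) (hc.mul_left _), dvd_sub (hb.mul_right _) ((ha.mul_left _).mul_right _), dvd_sub (dvd_pow hc (by norm_num)) ((hb.mul_left _).mul_right _)⟩

theorem index_unique {p : ℕ} (hp : p.Prime) {f : V} (hR : ¬ Rp p f) {i j : Option (Fin p)}
    (hi : ∃ g : V, g.smul (p^2) = f.act (Nm p i)) (hj : ∃ g : V, g.smul (p^2) = f.act (Nm p j)) : i = j := by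
  have c1 : ∀ r : Fin p, ((p:ℤ)^2 ∣ f.a ∧ (p:ℤ) ∣ f.b) → ((p:ℤ)^2 ∣ f.ev r 1 ∧ (p:ℤ) ∣ f.dx r) → False := by
    rintro r ⟨h1, h2⟩ ⟨-, h4⟩
    have h1' := (Dvd.intro_left ((p:ℤ)^1) (by ring) : (p:ℤ) ∣ (p:ℤ)^2).trans h1
    refine hR (Rp_of_dvd h1' h2 ?_)
    have : f.c = f.dx (r:ℕ) - (f.a * (3 * (r:ℕ)^2) + f.b * (2 * (r:ℕ))) := by simp only [V.dx]; ring
    rw [this]; exact dvd_sub h4 (dvd_add (h1'.mul_right _) (h2.mul_right _))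
  cases i with
  | none =>
    cases j with
    | none => rfl
    | some r => rw [dv2_none hp] at hi; rw [dv2_some hp] at hj; exact (c1 r hi hj).elim
  | some r =>
    cases j with
    | none => rw [dv2_none hp] at hj; rw [dv2_some hp] at hi; exact (c1 r hj hi).elim
    | some r' =>
      rw [dv2_some hp] at hi hj
      by_contra hne
      obtain ⟨h1, h2⟩ := hi
      obtain ⟨h3, h4⟩ := hj
      have h1' := (Dvd.intro_left ((p:ℤ)^1) (by ring) : (p:ℤ) ∣ (p:ℤ)^2).trans h1
      have h3' := (Dvd.intro_left ((p:ℤ)^1) (by ring) : (p:ℤ) ∣ (p:ℤ)^2).trans h3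
      set h : ℤ := (r':ℕ) - (r:ℕ) with hh
      have hh0 : ¬ (p:ℤ) ∣ h := by
        intro hd
        have hb1 := r.2; have hb2 := r'.2
        have : h = 0 := Int.eq_zero_of_abs_lt_dvd hd (by rw [abs_lt]; omega)
        apply hne; congr 1; ext; omega
      have k1 : (p:ℤ) ∣ 3 * f.a * (r:ℕ) + f.b + f.a * h := by
        apply pdvd hp (ppow hp hh0 2)
        have : h^2 * (3 * f.a * (r:ℕ) + f.b + f.a * h) = f.ev (r':ℕ) 1 - f.ev (r:ℕ) 1 - h * f.dx (r:ℕ) := by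
          simp only [hh, V.ev, V.dx]; ring
        rw [this]; exact dvd_sub (dvd_sub h3' h1') (h2.mul_left _)
      have k2 : (p:ℤ) ∣ 2 * (3 * f.a * (r:ℕ) + f.b) + 3 * f.a * h := by
        apply pdvd hp hh0
        have : h * (2 * (3 * f.a * (r:ℕ) + f.b) + 3 * f.a * h) = f.dx (r':ℕ) - f.dx (r:ℕ) := by
          simp only [hh, V.dx]; ring
        rw [this]; exact dvd_sub h4 h2
      have ka : (p:ℤ) ∣ f.a := by
        apply pdvd hp hh0
        have : h * f.a = (2 * (3 * f.a * (r:ℕ) + f.b) + 3 * f.a * h) - 2 * (3 * f.a * (r:ℕ) + f.b + f.a * h) := by ring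
        rw [this]; exact dvd_sub k2 (k1.mul_left _)
      have kb : (p:ℤ) ∣ f.b := by
        have : f.b = (3 * f.a * (r:ℕ) + f.b + f.a * h) - f.a * (3 * (r:ℕ) + h) := by ring
        rw [this]; exact dvd_sub k1 (ka.mul_right _)
      refine hR (Rp_of_dvd ka kb ?_)
      have : f.c = f.dx (r:ℕ) - (f.a * (3 * (r:ℕ)^2) + f.b * (2 * (r:ℕ))) := by simp only [V.dx]; ring
      rw [this]; exact dvd_sub h2 (dvd_add (ka.mul_right _) (kb.mul_right _))

theorem As_sum {p : ℕ} (hp : p.Prime) {f : V} (hR : ¬ Rp p f) : As p f = ∑ i, if (∃ g : V, g.smul (p^2) = f.act (Nm p i)) then 1 else 0 := by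
  rw [As]
  by_cases h : ∃ i, ∃ g : V, g.smul (p^2) = f.act (Nm p i)
  · rw [if_pos ⟨(Ap_index hp f).2 h, hR⟩]
    obtain ⟨i, hi⟩ := h
    rw [Finset.sum_eq_single i, if_pos hi]
    · intro j _ hj; rw [if_neg]; intro h; exact hj (index_unique hp hR h hi)
    · intro h; exact absurd (Finset.mem_univ i) h
  · rw [if_neg (fun h' => h ((Ap_index hp f).1 h'.1))]
    symm; apply Finset.sum_eq_zero; intro i _; rw [if_neg (fun h' => h ⟨i, h'⟩)]

theorem om_none {p : ℕ} (hp : p.Prime) (g : V) : (∃ f : V, f.smul p = g.act (Nm p none) ∧ ¬ Rp p f) ↔ (p:ℤ) ∣ g.a ∧ ¬ (p:ℤ) ∣ g.b := by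
  have hp0 : (p:ℤ) ≠ 0 := by exact_mod_cast hp.ne_zero
  have hpi := Nat.prime_iff_prime_int.1 hp
  rw [act_none]
  have key : ∀ a' : ℤ, Rp p ⟨a', g.b, p * g.c, p^2 * g.d⟩ ↔ (p:ℤ) ∣ g.b := by
    intro a'
    simp only [Rp, V.hP, V.hQ, V.hR]
    constructor
    · rintro ⟨h1, -⟩
      apply hpi.dvd_of_dvd_pow (n := 2)
      have : g.b^2 = (g.b^2 - 3 * a' * (p * g.c)) + p * (3 * a' * g.c) := by ring
      rw [this]; exact dvd_add h1 ⟨_, rfl⟩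
    · rintro ⟨b, hb⟩
      rw [hb]
      exact ⟨⟨p * b^2 - 3 * a' * g.c, by ring⟩, ⟨p * b * g.c - 9 * a' * p * g.d, by ring⟩, ⟨p * g.c^2 - 3 * p^2 * b * g.d, by ring⟩⟩
  constructor
  · rintro ⟨f, h, hR⟩
    have h1 := congrArg V.a h; have h2 := congrArg V.b h; have h3 := congrArg V.c h; have h4 := congrArg V.d h
    simp only [V.smul] at h1 h2 h3 h4
    have e2 := mul_left_cancel₀ hp0 h2
    have e3 : f.c = p * g.c := mul_left_cancel₀ hp0 (by rw [h3]; ring)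
    have e4 : f.d = p^2 * g.d := mul_left_cancel₀ hp0 (by rw [h4]; ring)
    have : f = ⟨f.a, g.b, p * g.c, p^2 * g.d⟩ := by ext <;> simp [e2, e3, e4]
    rw [this, key] at hR
    exact ⟨⟨f.a, h1.symm⟩, hR⟩
  · rintro ⟨⟨a, ha⟩, hb⟩
    refine ⟨⟨a, g.b, p * g.c, p^2 * g.d⟩, ?_, by rwa [key]⟩
    ext <;> simp only [V.smul, ha] <;> ring

theorem om_some {p : ℕ} (hp : p.Prime) (g : V) (r : Fin p) : (∃ f : V, f.smul p = g.act (Nm p (some r)) ∧ ¬ Rp p f) ↔ (p:ℤ) ∣ g.ev r 1 ∧ ¬ (p:ℤ) ∣ g.dx r := by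
  have := om_none hp (⟨g.ev r 1, -g.dx r, 3 * g.a * (r:ℕ) + g.b, -g.a⟩ : V)
  rw [act_none] at this
  rw [act_some]
  simp only [dvd_neg] at this
  rw [← this]
  simp only [mul_neg]

theorem om_sum {p : ℕ} (hp : p.Prime) (g : V) : om p g = ∑ i, if (∃ f : V, f.smul p = g.act (Nm p i) ∧ ¬ Rp p f) then 1 else 0 := by
  rw [Fintype.sum_option, om]
  simp only [om_none hp, om_some hp]
  congr 1
  rw [Finset.card_filter, Finset.sum_range]

theorem Rp_dvd {p : ℕ} (hp : p.Prime) {f : V} (h : Rp p f) : ∃ E : ℤ, f.disc = p^2 * E ∧ (E % 4 = 0 ∨ E % 4 = 1) := by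
  have hpi := Nat.prime_iff_prime_int.1 hp
  have h0 := f.hess
  obtain ⟨⟨P, hP⟩, ⟨Q, hQ⟩, ⟨R, hR⟩⟩ := h
  have hE : ∃ E : ℤ, f.disc = p^2 * E := by
    by_cases h3 : p = 3
    · subst h3
      have hb : (3:ℤ) ∣ f.b := by
        apply Int.prime_three.dvd_of_dvd_pow (n := 2)
        have : f.b^2 = f.hP + 3 * (f.a * f.c) := by simp only [V.hP]; ring
        rw [this, hP]; exact dvd_add ⟨_, rfl⟩ ⟨_, rfl⟩
      have hc : (3:ℤ) ∣ f.c := by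
        apply Int.prime_three.dvd_of_dvd_pow (n := 2)
        have : f.c^2 = f.hR + 3 * (f.b * f.d) := by simp only [V.hR]; ring
        rw [this, hR]; exact dvd_add ⟨_, rfl⟩ ⟨_, rfl⟩
      obtain ⟨b, hb⟩ := hb
      obtain ⟨c, hc⟩ := hc
      exact ⟨9 * b^2 * c^2 - 12 * f.a * c^3 - 12 * b^3 * f.d - 3 * f.a^2 * f.d^2 + 18 * f.a * b * c * f.d, by
        simp only [V.disc, hb, hc]; push_cast; ring⟩
    · have : (p:ℤ)^2 ∣ 3 * f.disc := ⟨4 * P * R - Q^2, by rw [← h0, hP, hQ, hR]; ring⟩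
      have h3' : ¬ (p:ℤ) ∣ 3 := by
        intro h; exact h3 ((Nat.prime_dvd_prime_iff_eq hp Nat.prime_three).1 (by exact_mod_cast h))
      exact psq hp h3' this
  obtain ⟨E, hE⟩ := hE
  refine ⟨E, hE, ?_⟩
  rcases hp.eq_two_or_odd' with h2 | ⟨k, hk⟩
  · subst h2
    have e : 3 * E = 4 * (P * R) - Q^2 := by
      rw [hE, hP, hQ, hR] at h0; push_cast at h0; linarith
    rcases Int.even_or_odd' Q with ⟨q, hq | hq⟩
    · left; rw [hq] at e; ring_nf at e; omega
    · right; rw [hq] at e; ring_nf at e; omega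
  · have h4 := f.disc_mod4
    rw [hE, hk] at h4
    push_cast at h4
    have : (2 * (k:ℤ) + 1)^2 * E = E + 4 * (E * k + E * k^2) := by ring
    rw [this] at h4
    omega

theorem Ap_dvd {p : ℕ} (hp : p.Prime) {f : V} (h : Ap p f) : ∃ E : ℤ, f.disc = p^2 * E ∧ (E % 4 = 0 ∨ E % 4 = 1) := by
  obtain ⟨i, g, hg⟩ := (Ap_index hp f).1 h
  refine ⟨g.disc, ?_, g.disc_mod4⟩
  have := congrArg V.disc hg
  rw [V.disc_smul, V.disc_act, Nm_det] at this
  have hp0 : (p:ℤ)^6 ≠ 0 := pow_ne_zero _ (by exact_mod_cast hp.ne_zero)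
  apply mul_left_cancel₀ hp0
  rw [← this]; ring

theorem Ap_of_bad_odd {p : ℕ} (hp : p.Prime) (h2 : p ≠ 2) {f : V} (hR : ¬ Rp p f) (hd : (p:ℤ)^2 ∣ f.disc) : Ap p f := by
  have hpi := Nat.prime_iff_prime_int.1 hp
  have h2' : ¬ (p:ℤ) ∣ 2 := by
    intro h; exact h2 ((Nat.prime_dvd_prime_iff_eq hp Nat.prime_two).1 (by exact_mod_cast h))
  have h0 := f.hess
  have hd1 := (Dvd.intro_left ((p:ℤ)^1) (by ring) : (p:ℤ) ∣ (p:ℤ)^2).trans hd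
  by_cases hP : (p:ℤ) ∣ f.hP
  · by_cases hR' : (p:ℤ) ∣ f.hR
    · refine (hR ⟨hP, ?_, hR'⟩).elim
      apply hpi.dvd_of_dvd_pow (n := 2)
      have : f.hQ^2 = f.hP * (4 * f.hR) - f.disc * 3 := by linarith
      rw [this]; exact dvd_sub (hP.mul_right _) (hd1.mul_right _)
    · refine ⟨2 * f.hR, - f.hQ, fun h => hR' (pdvd hp h2' h.1), ?_, ?_, ?_⟩
      · have : f.ev (2 * f.hR) (-f.hQ) = f.disc * (3 * f.d * f.hQ - 2 * f.c * f.hR) := by simp only [V.ev, V.hP, V.hQ, V.hR, V.disc]; ring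
        rw [this]; exact hd.mul_right _
      · have : f.gx (2 * f.hR) (-f.hQ) = f.disc * (-3 * f.c) := by simp only [V.gx, V.hP, V.hQ, V.hR, V.disc]; ring
        rw [this]; exact hd1.mul_right _
      · have : f.gy (2 * f.hR) (-f.hQ) = f.disc * (-9 * f.d) := by simp only [V.gy, V.hP, V.hQ, V.hR, V.disc]; ring
        rw [this]; exact hd1.mul_right _
  · refine ⟨- f.hQ, 2 * f.hP, fun h => hP (pdvd hp h2' h.2), ?_, ?_, ?_⟩
    · have : f.ev (-f.hQ) (2 * f.hP) = f.disc * (3 * f.a * f.hQ - 2 * f.b * f.hP) := by simp only [V.ev, V.hP, V.hQ, V.hR, V.disc]; ring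
      rw [this]; exact hd.mul_right _
    · have : f.gx (-f.hQ) (2 * f.hP) = f.disc * (-9 * f.a) := by simp only [V.gx, V.hP, V.hQ, V.hR, V.disc]; ring
      rw [this]; exact hd1.mul_right _
    · have : f.gy (-f.hQ) (2 * f.hP) = f.disc * (-3 * f.b) := by simp only [V.gy, V.hP, V.hQ, V.hR, V.disc]; ring
      rw [this]; exact hd1.mul_right _

theorem Ap_two_aux {f : V} (hR : ¬ Rp 2 f) {E : ℤ} (hd : f.disc = 4 * E) (hE : E % 4 = 0 ∨ E % 4 = 1) (ha : (2:ℤ) ∣ f.a) (hb : (2:ℤ) ∣ f.b) : Ap 2 f := by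
  rw [Ap_index Nat.prime_two]
  refine ⟨none, (dv2_none Nat.prime_two f).2 ⟨?_, by exact_mod_cast hb⟩⟩
  have hc : ¬ (2:ℤ) ∣ f.c := fun hc => hR (Rp_of_dvd (by exact_mod_cast ha) (by exact_mod_cast hb) (by exact_mod_cast hc))
  obtain ⟨a, ha⟩ := ha
  obtain ⟨b, hb⟩ := hb
  have e : E = (b * f.c + a * f.d)^2 - 2 * (a * f.c^3) + 4 * (-2 * b^3 * f.d - 7 * a^2 * f.d^2 + 4 * a * b * f.c * f.d) := by
    have : f.disc = 4 * ((b * f.c + a * f.d)^2 - 2 * (a * f.c^3) + 4 * (-2 * b^3 * f.d - 7 * a^2 * f.d^2 + 4 * a * b * f.c * f.d)) := by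
      simp only [V.disc, ha, hb]; ring
    linarith
  have hsq : (b * f.c + a * f.d)^2 % 4 = 0 ∨ (b * f.c + a * f.d)^2 % 4 = 1 := by
    rcases Int.even_or_odd' (b * f.c + a * f.d) with ⟨k, hk | hk⟩
    · left; rw [hk]; ring_nf; omega
    · right; rw [hk]; ring_nf; omega
  have hev : Even (a * f.c^3) := by
    rw [← Int.not_odd_iff_even]
    rintro ⟨k, hk⟩
    rw [hk] at e
    omega
  have hae : Even a := by
    rcases Int.even_mul.1 hev with h | h
    · exact h
    · rw [Int.even_pow] at h
      exact (hc h.1.two_dvd).elim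
  obtain ⟨a', ha'⟩ := hae
  exact ⟨a', by rw [ha, ha']; push_cast; ring⟩

theorem Ap_of_bad_two {f : V} (hR : ¬ Rp 2 f) {E : ℤ} (hd : f.disc = 4 * E) (hE : E % 4 = 0 ∨ E % 4 = 1) : Ap 2 f := by
  have hdet : ∀ M : Matrix (Fin 2) (Fin 2) ℤ, M.det = 1 → (2:ℤ) ∣ (f.act M).a → (2:ℤ) ∣ (f.act M).b → Ap 2 f := by
    intro M hM h1 h2
    have hM' : ¬ ((2:ℕ):ℤ) ∣ M.det := by rw [hM]; norm_num
    rw [← Ap_act Nat.prime_two hM']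
    refine Ap_two_aux (by rwa [Rp_act Nat.prime_two hM']) (E := E) ?_ hE h1 h2
    rw [V.disc_act, hM, hd]; ring
  have hQ : Even (f.b * f.c + f.a * f.d) := by
    rw [← Int.not_odd_iff_even]
    rintro ⟨k, hk⟩
    have : f.disc = (f.b * f.c + f.a * f.d)^2 + 4 * (- f.a * f.c^3 - f.b^3 * f.d - 7 * f.a^2 * f.d^2 + 4 * f.a * f.b * f.c * f.d) := by
      simp only [V.disc]; ring
    rw [hk, hd] at this
    ring_nf at this
    omega
  by_cases hab : (2:ℤ) ∣ f.a ∧ (2:ℤ) ∣ f.b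
  · exact hdet 1 Matrix.det_one (by rw [V.act_one]; exact hab.1) (by rw [V.act_one]; exact hab.2)
  by_cases hcd : (2:ℤ) ∣ f.c ∧ (2:ℤ) ∣ f.d
  · refine hdet !![0, -1; 1, 0] (by simp [Matrix.det_fin_two]) ?_ ?_
    · simpa [V.act, V.sub] using hcd.2
    · simpa [V.act, V.sub] using hcd.1
  · have hpar := Int.even_add.1 hQ
    rw [Int.even_mul, Int.even_mul] at hpar
    have k1 : (2:ℤ) ∣ f.a + f.b + f.c + f.d ∧ (2:ℤ) ∣ f.a + f.c := by
      simp only [← even_iff_two_dvd, Int.even_add] at hab hcd ⊢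
      tauto
    refine hdet !![1, 0; 1, 1] (by simp [Matrix.det_fin_two]) ?_ ?_
    · simpa [V.act, V.sub] using k1.1
    · simp [V.act, V.sub]
      obtain ⟨x, hx⟩ := k1.1
      obtain ⟨y, hy⟩ := k1.2
      exact ⟨x - y + f.d + f.c, by linarith⟩

theorem sieve_local {p : ℕ} (hp : p.Prime) (f : V) :
    As p f + (if Rp p f then 1 else 0) = if (∃ E : ℤ, f.disc = p^2 * E ∧ (E % 4 = 0 ∨ E % 4 = 1)) then 1 else 0 := by
  by_cases hR : Rp p f
  · rw [if_pos hR, if_pos (Rp_dvd hp hR), As, if_neg (fun h => h.2 hR)]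
  · rw [if_neg hR, As, add_zero]
    congr 1
    rw [eq_iff_iff]
    refine ⟨fun h => Ap_dvd hp h.1, ?_⟩
    rintro ⟨E, h1, h2⟩
    refine ⟨?_, hR⟩
    by_cases hp2 : p = 2
    · subst hp2; exact Ap_of_bad_two hR (by rw [h1]; norm_num) h2
    · exact Ap_of_bad_odd hp hp2 hR ⟨E, h1⟩
end CF

namespace CF
open scoped MatrixGroups

/-- Integral matrices of determinant `p`. -/
abbrev DM (p : ℕ) := {M : Matrix (Fin 2) (Fin 2) ℤ // M.det = p}

def toDM (p : ℕ) (x : Option (Fin p) × SL(2, ℤ)) : DM p := ⟨Nm p x.1 * x.2.1, by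
  rw [Matrix.det_mul, Nm_det, x.2.2, mul_one]⟩

theorem toDM_bij {p : ℕ} (hp : p.Prime) : Function.Bijective (toDM p) := by
  have hpi := Nat.prime_iff_prime_int.1 hp
  have hp0 : (p:ℤ) ≠ 0 := hpi.ne_zero
  have e0 : ∀ γ : SL(2, ℤ), γ.1 0 0 * γ.1 1 1 - γ.1 0 1 * γ.1 1 0 = 1 := fun γ => by
    rw [← Matrix.det_fin_two]; exact γ.2
  constructor
  · rintro ⟨i, γ⟩ ⟨j, δ⟩ h
    have h' : Nm p i * γ.1 = Nm p j * δ.1 := congrArg Subtype.val h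
    have hij : i = j := by
      have c1 : ∀ (r : Fin p) (γ δ : SL(2, ℤ)), Nm p none * γ.1 = Nm p (some r) * δ.1 → False := by
        intro r γ δ h
        have h1 := congrFun (congrFun h 1) 0
        have h2 := congrFun (congrFun h 1) 1
        simp [Nm, Matrix.mul_apply, Fin.sum_univ_two] at h1 h2
        apply hpi.not_dvd_one
        rw [← e0 δ, ← h1, ← h2]
        exact ⟨γ.1 1 0 * δ.1 1 1 - γ.1 1 1 * δ.1 1 0, by ring⟩
      cases i with
      | none => cases j with
        | none => rfl
        | some r => exact (c1 r γ δ h').elim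
      | some r => cases j with
        | none => exact (c1 r δ γ h'.symm).elim
        | some r' =>
          have h1 := congrFun (congrFun h' 1) 0
          have h2 := congrFun (congrFun h' 1) 1
          have h3 := congrFun (congrFun h' 0) 0
          have h4 := congrFun (congrFun h' 0) 1
          simp [Nm, Matrix.mul_apply, Fin.sum_univ_two] at h1 h2 h3 h4
          have hd : (p:ℤ) ∣ (r:ℕ) - (r':ℕ) := by
            have := e0 γ
            refine ⟨(γ.1 1 0 - δ.1 1 0) * γ.1 1 1 - (γ.1 1 1 - δ.1 1 1) * γ.1 1 0, ?_⟩
            rw [← h1] at h3; rw [← h2] at h4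
            linear_combination γ.1 1 1 * h3 - γ.1 1 0 * h4 - ((r:ℕ) - (r':ℕ) : ℤ) * this
          have hb1 := r.2; have hb2 := r'.2
          have := Int.eq_zero_of_abs_lt_dvd hd (by rw [abs_lt]; omega)
          congr 1; ext; omega
    subst hij
    have : γ = δ := by
      have h2 := congrArg (fun M => (Nm p i).adjugate * M) h'
      simp only [← Matrix.mul_assoc, Matrix.adjugate_mul, Nm_det] at h2
      ext a b
      have h3 := congrFun (congrFun h2 a) b
      simp only [Matrix.smul_mul, Matrix.one_mul, Matrix.smul_apply, smul_eq_mul] at h3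
      exact mul_left_cancel₀ hp0 h3
    rw [this]
  · rintro ⟨M, hM⟩
    have hM' := hM
    rw [Matrix.det_fin_two] at hM'
    by_cases h : (p:ℤ) ∣ M 1 0 ∧ (p:ℤ) ∣ M 1 1
    · obtain ⟨⟨x, hx⟩, ⟨y, hy⟩⟩ := h
      refine ⟨(none, ⟨!![M 0 0, M 0 1; x, y], ?_⟩), ?_⟩
      · rw [Matrix.det_fin_two]; simp
        apply mul_left_cancel₀ hp0
        rw [hx, hy] at hM'; linarith
      · apply Subtype.ext
        ext a b
        fin_cases a <;> fin_cases b <;> simp [toDM, Nm, Matrix.mul_apply, Fin.sum_univ_two, hx, hy]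
    · obtain ⟨r, h1, h2⟩ : ∃ r : Fin p, (p:ℤ) ∣ (r:ℕ) * M 1 0 - M 0 0 ∧ (p:ℤ) ∣ (r:ℕ) * M 1 1 - M 0 1 := by
        have hex : ∀ u v : ℤ, ¬ (p:ℤ) ∣ v → ∃ r : Fin p, (p:ℤ) ∣ (r:ℕ) * v - u := by
          intro u v hv
          have hco : IsCoprime v (p:ℤ) := ((hpi.irreducible.coprime_iff_not_dvd).2 hv).symm
          obtain ⟨x, y, hxy⟩ := hco
          have hpp : (0:ℤ) < p := by exact_mod_cast hp.pos
          have hr0 := Int.emod_nonneg (u * x) hpp.ne'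
          have hr1 := Int.emod_lt_of_pos (u * x) hpp
          obtain ⟨r, hr⟩ := Int.eq_ofNat_of_zero_le hr0
          have hrp : r < p := by rw [hr] at hr1; exact_mod_cast hr1
          refine ⟨⟨r, hrp⟩, ?_⟩
          have := Int.emod_add_mul_ediv (u * x) p
          rw [hr] at this
          refine ⟨-(u * x / p * v + u * y), ?_⟩
          show (r:ℤ) * v - u = _
          linear_combination u * hxy + v * this
        by_cases h0 : (p:ℤ) ∣ M 1 0
        · have h1 : ¬ (p:ℤ) ∣ M 1 1 := fun h1 => h ⟨h0, h1⟩
          obtain ⟨r, hr⟩ := hex (M 0 1) _ h1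
          refine ⟨r, ?_, hr⟩
          apply pdvd hp h1
          obtain ⟨k, hk⟩ := hr
          exact ⟨M 1 0 * k - 1, by linear_combination (-1) * hM' + M 1 0 * hk⟩
        · obtain ⟨r, hr⟩ := hex (M 0 0) _ h0
          refine ⟨r, hr, ?_⟩
          apply pdvd hp h0
          obtain ⟨k, hk⟩ := hr
          exact ⟨M 1 1 * k + 1, by linear_combination hM' + M 1 1 * hk⟩
      obtain ⟨x, hx⟩ := h1
      obtain ⟨y, hy⟩ := h2
      refine ⟨(some r, ⟨!![M 1 0, M 1 1; x, y], ?_⟩), ?_⟩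
      · rw [Matrix.det_fin_two]; simp
        apply mul_left_cancel₀ hp0
        linear_combination hM' + M 1 1 * hx - M 1 0 * hy
      · apply Subtype.ext
        ext a b
        fin_cases a <;> fin_cases b <;> simp [toDM, Nm, Matrix.mul_apply, Fin.sum_univ_two] <;> linarith

/-- key counting lemma -/
theorem hecke_sum {p : ℕ} (hp : p.Prime) {h : V} (hi : h.irr) (hD : h.disc ≠ 0) {k : ℤ} (hk : k ≠ 0) (Q : V → Prop)
    (hQ : ∀ (f : V) (γ : SL(2, ℤ)), Q (f.act γ.1) ↔ Q f) :
    ∑' M : DM p, ∑' f : V, (if f.smul k = h.act M.1 ∧ Q f then w f else 0) = ((∑ i, if (∃ f : V, f.smul k = h.act (Nm p i) ∧ Q f) then 1 else 0 : ℕ) : ENNReal) := by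
  rw [← (Equiv.ofBijective _ (toDM_bij hp)).tsum_eq, ENNReal.summable.tsum_prod' (fun _ => ENNReal.summable), tsum_fintype, Nat.cast_sum]
  refine Finset.sum_congr rfl fun i _ => ?_
  have hp0 : (p:ℤ) ≠ 0 := by exact_mod_cast hp.ne_zero
  split_ifs with hex
  · obtain ⟨f0, h1, h2⟩ := hex
    rw [Nat.cast_one]
    have hf0 : f0.irr := V.irr.of_smul (k := k) (by rw [h1]; exact hi.act (by rw [Nm_det]; exact hp0))
    have hf0D : f0.disc ≠ 0 := by
      intro h0
      have := congrArg V.disc h1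
      rw [V.disc_smul, V.disc_act, Nm_det, h0, mul_zero] at this
      exact mul_ne_zero (pow_ne_zero _ hp0) hD this.symm
    rw [← w_tsum hf0 hf0D]
    refine tsum_congr fun γ => ?_
    have e : h.act (toDM p (i, γ)).1 = (f0.act γ.1).smul k := by
      simp only [toDM]; rw [V.act_mul, ← h1, V.smul_act]
    rw [tsum_eq_single (f0.act γ.1)]
    · rw [if_pos]
      exact ⟨e.symm, (hQ _ _).2 h2⟩
    · intro f hf
      rw [if_neg]
      rintro ⟨h3, -⟩
      exact hf (V.smul_inj hk (h3.trans e))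
  · rw [Nat.cast_zero]
    rw [ENNReal.tsum_eq_zero]; intro γ
    rw [ENNReal.tsum_eq_zero]; intro f
    rw [if_neg]
    rintro ⟨h3, h4⟩
    refine hex ⟨f.act (γ⁻¹).1, ?_, (hQ _ _).2 h4⟩
    have h3' : f.smul k = h.act (Nm p i * γ.1) := h3
    rw [← V.smul_act, h3', V.act_mul, ← actS_mul, mul_inv_cancel]
    exact V.act_one _

/-- weighted sum over irreducible forms of discriminant `n` -/
def W (n : ℤ) (Ψ : V → ENNReal) : ENNReal := ∑' f : V, if f.irr ∧ f.disc = n then w f * Ψ f else 0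

theorem adj_swap {p : ℕ} (hp : p.Prime) {f g : V} {M : Matrix (Fin 2) (Fin 2) ℤ} (hM : M.det = p) :
    g.smul ((p:ℤ)^2) = f.act M ↔ f.smul p = g.act M.adjugate := by
  have hp0 : (p:ℤ) ≠ 0 := by exact_mod_cast hp.ne_zero
  constructor
  · intro h
    have := congrArg (fun x => V.act x M.adjugate) h
    simp only [act_adj, hM, V.smul_act] at this
    apply V.smul_inj (pow_ne_zero 2 hp0)
    rw [this, V.smul_smul]; congr 1; ring
  · intro h
    have := congrArg (fun x => V.act x M) h
    simp only [V.smul_act, ← V.act_mul, Matrix.adjugate_mul, hM] at this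
    apply V.smul_inj hp0
    rw [this, V.smul_smul]
    have e : g.act ((p:ℤ) • (1 : Matrix (Fin 2) (Fin 2) ℤ)) = g.smul (p^3) := by
      rw [← V.act_scalar, V.act]; simp [Matrix.smul_apply]
    rw [e]; congr 1

def adjE (p : ℕ) : DM p ≃ DM p where
  toFun M := ⟨M.1.adjugate, by rw [Matrix.det_adjugate, M.2]; simp⟩
  invFun M := ⟨M.1.adjugate, by rw [Matrix.det_adjugate, M.2]; simp⟩
  left_inv M := by apply Subtype.ext; simp [Matrix.adjugate_adjugate']
  right_inv M := by apply Subtype.ext; simp [Matrix.adjugate_adjugate']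

theorem transfer_one {p : ℕ} (hp : p.Prime) {n : ℤ} (hn : n ≠ 0) (Ψ : V → ENNReal)
    (hΨ : ∀ (f g : V) (M : DM p), g.smul ((p:ℤ)^2) = f.act M.1 → Ψ f = Ψ g) :
    W ((p:ℤ)^2 * n) (fun f => As p f * Ψ f) = W n (fun g => om p g * Ψ g) := by
  have hpi := Nat.prime_iff_prime_int.1 hp
  have hp0 : (p:ℤ) ≠ 0 := hpi.ne_zero
  have hRinv : ∀ (f : V) (γ : SL(2, ℤ)), ¬ Rp p (f.act γ.1) ↔ ¬ Rp p f := by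
    intro f γ; rw [Rp_act hp (by rw [γ.2]; exact hpi.not_dvd_one)]
  have hL : W ((p:ℤ)^2 * n) (fun f => As p f * Ψ f) = ∑' f : V, ∑' M : DM p, ∑' g : V,
      if f.irr ∧ f.disc = (p:ℤ)^2 * n ∧ ¬ Rp p f ∧ g.smul ((p:ℤ)^2) = f.act M.1 then w f * w g * Ψ f else 0 := by
    rw [W]; refine tsum_congr fun f => ?_
    by_cases h1 : f.irr ∧ f.disc = (p:ℤ)^2 * n
    · rw [if_pos h1]
      by_cases h2 : Rp p f
      · rw [As, if_neg (fun h => h.2 h2)]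
        simp [h2]
      · have := hecke_sum hp h1.1 (by rw [h1.2]; exact mul_ne_zero (pow_ne_zero _ hp0) hn) (pow_ne_zero 2 hp0) (fun _ => True) (fun _ _ => Iff.rfl)
        simp only [and_true] at this
        rw [As_sum hp h2, ← this, mul_comm (∑' _, _) (Ψ f), ← mul_assoc, ← ENNReal.tsum_mul_left]
        refine tsum_congr fun M => ?_
        rw [← ENNReal.tsum_mul_left]
        refine tsum_congr fun g => ?_
        by_cases h3 : g.smul ((p:ℤ)^2) = f.act M.1
        · rw [if_pos h3, if_pos ⟨h1.1, h1.2, h2, h3⟩]; ring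
        · rw [if_neg h3, if_neg (fun h => h3 h.2.2.2), mul_zero]
    · rw [if_neg h1]; symm
      rw [ENNReal.tsum_eq_zero]; intro M
      rw [ENNReal.tsum_eq_zero]; intro g
      rw [if_neg (fun h => h1 ⟨h.1, h.2.1⟩)]
  have hRr : W n (fun f => om p f * Ψ f) = ∑' g : V, ∑' M : DM p, ∑' f : V,
      if g.irr ∧ g.disc = n ∧ ¬ Rp p f ∧ f.smul (p:ℤ) = g.act M.1 then w f * w g * Ψ g else 0 := by
    rw [W]; refine tsum_congr fun g => ?_
    by_cases h1 : g.irr ∧ g.disc = n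
    · rw [if_pos h1]
      have := hecke_sum hp h1.1 (by rw [h1.2]; exact hn) hp0 (fun f => ¬ Rp p f) hRinv
      rw [om_sum hp, ← this, mul_comm (∑' _, _) (Ψ g), ← mul_assoc, ← ENNReal.tsum_mul_left]
      refine tsum_congr fun M => ?_
      rw [← ENNReal.tsum_mul_left]
      refine tsum_congr fun f => ?_
      by_cases h3 : f.smul (p:ℤ) = g.act M.1 ∧ ¬ Rp p f
      · rw [if_pos h3, if_pos ⟨h1.1, h1.2, h3.2, h3.1⟩]; ring
      · rw [if_neg h3, if_neg (fun h => h3 ⟨h.2.2.2, h.2.2.1⟩), mul_zero]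
    · rw [if_neg h1]; symm
      rw [ENNReal.tsum_eq_zero]; intro M
      rw [ENNReal.tsum_eq_zero]; intro g
      rw [if_neg (fun h => h1 ⟨h.1, h.2.1⟩)]
  rw [hL, hRr, ENNReal.tsum_comm]
  have : ∀ g : V, ∑' M : DM p, ∑' f : V, (if g.irr ∧ g.disc = n ∧ ¬ Rp p f ∧ f.smul (p:ℤ) = g.act M.1 then w f * w g * Ψ g else 0)
    = ∑' M : DM p, ∑' f : V, (if g.irr ∧ g.disc = n ∧ ¬ Rp p f ∧ f.smul (p:ℤ) = g.act (adjE p M).1 then w f * w g * Ψ g else 0) := by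
    intro g
    exact ((adjE p).tsum_eq (fun M => ∑' f : V, (if g.irr ∧ g.disc = n ∧ ¬ Rp p f ∧ f.smul (p:ℤ) = g.act M.1 then w f * w g * Ψ g else 0))).symm
  simp_rw [this]
  conv_rhs => rw [ENNReal.tsum_comm]
  refine tsum_congr fun M => ?_
  conv_rhs => rw [ENNReal.tsum_comm]
  refine tsum_congr fun f => tsum_congr fun g => ?_
  have hsw := adj_swap hp (f := f) (g := g) M.2
  by_cases h : g.smul ((p:ℤ)^2) = f.act M.1
  · have h' : f.smul (p:ℤ) = g.act (adjE p M).1 := hsw.1 h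
    have hirr : f.irr ↔ g.irr := by
      constructor
      · intro hf; exact V.irr.of_smul (k := (p:ℤ)^2) (by rw [h]; exact hf.act (by rw [M.2]; exact hp0))
      · intro hg; exact V.irr.of_smul (k := (p:ℤ)) (by rw [h']; exact hg.act (by rw [(adjE p M).2]; exact hp0))
    have hdisc : f.disc = p^2 * g.disc := by
      have := congrArg V.disc h
      rw [V.disc_smul, V.disc_act, M.2] at this
      apply mul_left_cancel₀ (pow_ne_zero 6 hp0)
      rw [← this]; ring
    have hd2 : f.disc = (p:ℤ)^2 * n ↔ g.disc = n := by
      rw [hdisc]; exact ⟨fun h => mul_left_cancel₀ (pow_ne_zero 2 hp0) h, fun h => by rw [h]⟩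
    simp only [h, h', hirr, hd2, hΨ f g M h]
  · have h' : ¬ f.smul (p:ℤ) = g.act (adjE p M).1 := fun h' => h (hsw.2 h')
    simp only [h, h', and_false, if_false]
end CF

namespace CF
open scoped MatrixGroups

def InvP (p : ℕ) (Ψ : V → ENNReal) : Prop := ∀ (f g : V) (M : DM p), g.smul ((p:ℤ)^2) = f.act M.1 → Ψ f = Ψ g

theorem ndvd_of_ne {p l : ℕ} (hp : p.Prime) (hl : l.Prime) (h : l ≠ p) : ¬ (l:ℤ) ∣ (p:ℤ) := by
  intro hd
  exact h ((Nat.prime_dvd_prime_iff_eq hl hp).1 (by exact_mod_cast hd))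

theorem invP_As {p l : ℕ} (hp : p.Prime) (hl : l.Prime) (h : l ≠ p) : InvP p (fun f => (As l f : ENNReal)) := by
  intro f g M hM
  have h1 : As l g = As l (g.smul ((p:ℤ)^2)) := (As_smul hl (fun hd => ndvd_of_ne hp hl h ((Nat.prime_iff_prime_int.1 hl).dvd_of_dvd_pow hd)) g).symm
  have h2 : As l (f.act M.1) = As l f := As_act hl (by rw [M.2]; exact ndvd_of_ne hp hl h) f
  simp only [h1, hM, h2]

theorem invP_om {p l : ℕ} (hp : p.Prime) (hl : l.Prime) (h : l ≠ p) : InvP p (fun f => (om l f : ENNReal)) := by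
  intro f g M hM
  have h1 : om l g = om l (g.smul ((p:ℤ)^2)) := (om_smul hl (fun hd => ndvd_of_ne hp hl h ((Nat.prime_iff_prime_int.1 hl).dvd_of_dvd_pow hd)) g).symm
  have h2 : om l (f.act M.1) = om l f := om_act hl (by rw [M.2]; exact ndvd_of_ne hp hl h) f
  simp only [h1, hM, h2]

theorem invP_Rp {p l : ℕ} (hp : p.Prime) (hl : l.Prime) (h : l ≠ p) : InvP p (fun f => (if Rp l f then 1 else 0 : ENNReal)) := by
  intro f g M hM
  have h1 : Rp l (g.smul ((p:ℤ)^2)) ↔ Rp l g := (Rp_smul hl (fun hd => ndvd_of_ne hp hl h ((Nat.prime_iff_prime_int.1 hl).dvd_of_dvd_pow hd)) g)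
  have h2 : Rp l (f.act M.1) ↔ Rp l f := Rp_act hl (by rw [M.2]; exact ndvd_of_ne hp hl h) f
  simp only [← h1, hM, h2]

theorem invP_mul {p : ℕ} {Ψ Φ : V → ENNReal} (h1 : InvP p Ψ) (h2 : InvP p Φ) : InvP p (fun f => Ψ f * Φ f) := by
  intro f g M h; simp only [h1 f g M h, h2 f g M h]

theorem invP_prod {p : ℕ} {s : Finset ℕ} {Ψ : ℕ → V → ENNReal} (h1 : ∀ l ∈ s, InvP p (Ψ l)) : InvP p (fun f => ∏ l ∈ s, Ψ l f) := by
  intro f g M h; exact Finset.prod_congr rfl fun l hl => h1 l hl f g M h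

theorem transfer (s : Finset ℕ) : ∀ (Ψ : V → ENNReal) (n : ℤ), n ≠ 0 → (∀ p ∈ s, p.Prime) → (∀ p ∈ s, InvP p Ψ) →
    W (((∏ p ∈ s, p : ℕ) : ℤ)^2 * n) (fun f => (∏ p ∈ s, (As p f : ENNReal)) * Ψ f) = W n (fun f => (∏ p ∈ s, (om p f : ENNReal)) * Ψ f) := by
  induction s using Finset.induction_on with
  | empty => intro Ψ n hn _ _; simp
  | insert p s hps ih =>
    intro Ψ n hn hpr hI
    have hp := hpr p (by simp)
    have hpr' : ∀ l ∈ s, l.Prime := fun l hl => hpr l (by simp [hl])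
    have hne : ∀ l ∈ s, l ≠ p := fun l hl h => hps (h ▸ hl)
    have hq0 : ((∏ l ∈ s, l : ℕ) : ℤ) ≠ 0 := by
      exact_mod_cast Finset.prod_ne_zero_iff.2 fun l hl => (hpr' l hl).ne_zero
    have e1 : ((∏ l ∈ insert p s, l : ℕ) : ℤ)^2 * n = (p:ℤ)^2 * (((∏ l ∈ s, l : ℕ) : ℤ)^2 * n) := by
      rw [Finset.prod_insert hps]; push_cast; ring
    have e2 : (fun f => (∏ l ∈ insert p s, (As l f : ENNReal)) * Ψ f) = fun f => (As p f : ENNReal) * ((∏ l ∈ s, (As l f : ENNReal)) * Ψ f) := by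
      funext f; rw [Finset.prod_insert hps, mul_assoc]
    have e3 : (fun f => (∏ l ∈ insert p s, (om l f : ENNReal)) * Ψ f) = fun f => (∏ l ∈ s, (om l f : ENNReal)) * ((om p f : ENNReal) * Ψ f) := by
      funext f; rw [Finset.prod_insert hps]; ring
    rw [e1, e2, e3, transfer_one hp (mul_ne_zero (pow_ne_zero _ hq0) hn) _
      (invP_mul (invP_prod fun l hl => invP_As hp (hpr' l hl) (hne l hl)) (hI p (by simp)))]
    rw [← ih (fun f => (om p f : ENNReal) * Ψ f) n hn hpr' fun l hl => invP_mul (invP_om (hpr' l hl) hp (hne l hl).symm) (hI l (by simp [hl]))]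
    congr 1; funext f; ring

/-- the sieve weight for the pair of sets of primes -/
def RR (t : Finset ℕ) (f : V) : ℕ := ∏ p ∈ t, if Rp p f then 1 else 0

def OM (s : Finset ℕ) (f : V) : ℕ := ∏ p ∈ s, om p f

def AS (s : Finset ℕ) (f : V) : ℕ := ∏ p ∈ s, As p f

theorem transfer_st {s t : Finset ℕ} (hst : Disjoint s t) (hp : ∀ p ∈ s ∪ t, p.Prime) {n : ℤ} (hn : n ≠ 0) :
    W (((∏ p ∈ s, p : ℕ) : ℤ)^2 * n) (fun f => ((AS s f * RR t f : ℕ) : ENNReal)) = W n (fun f => ((OM s f * RR t f : ℕ) : ENNReal)) := by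
  have := transfer s (fun f => ((RR t f : ℕ) : ENNReal)) n hn (fun p h => hp p (by simp [h])) (by
    intro p h
    have := invP_prod (p := p) (s := t) (Ψ := fun l f => (if Rp l f then 1 else 0 : ENNReal)) fun l hl =>
      invP_Rp (hp p (by simp [h])) (hp l (by simp [hl])) (fun e => Finset.disjoint_left.1 hst h (e ▸ hl))
    simpa [RR] using this)
  simpa [AS, OM] using this

theorem AS_dvd {s t : Finset ℕ} (hst : Disjoint s t) (hp : ∀ p ∈ s ∪ t, p.Prime) {f : V} (h : AS s f * RR t f ≠ 0) : ((∏ p ∈ s, p : ℕ) : ℤ)^2 ∣ f.disc := by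
  have h1 : ∀ p ∈ s, As p f ≠ 0 := fun p hps => Finset.prod_ne_zero_iff.1 (left_ne_zero_of_mul h) p hps
  push_cast
  rw [← Finset.prod_pow]
  apply Finset.prod_dvd_of_coprime
  · intro p hps l hls hne
    have : Nat.Coprime p l := (Nat.coprime_primes (hp p (by simp [Finset.mem_coe.1 hps])) (hp l (by simp [Finset.mem_coe.1 hls]))).2 hne
    exact ((Nat.isCoprime_iff_coprime.2 this).pow)
  · intro p hps
    have h2 := h1 p hps
    rw [As] at h2
    have h3 : Ap p f ∧ ¬ Rp p f := by by_contra h3; exact h2 (if_neg h3)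
    obtain ⟨E, hE, -⟩ := Ap_dvd (hp p (by simp [hps])) h3.1
    exact ⟨E, hE⟩
end CF

namespace CF

/-- common bound `Z` for divisor functions and harmonic sums up to `N` -/
def HZ (N : ℕ) (Z : ℝ) : Prop := 1 ≤ Z ∧ (∀ n : ℕ, 0 < n → n ≤ N → (n.divisors.card : ℝ) ≤ Z) ∧ ∑ k ∈ Finset.Icc 1 N, (1:ℝ) / k ≤ Z

theorem spaced {S : Finset ℤ} {L δ : ℝ} (hL : 0 ≤ L) (hδ : 0 < δ) (h1 : ∀ c ∈ S, |(c:ℝ)| ≤ L)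
    (h2 : ∀ c ∈ S, ∀ c' ∈ S, c ≠ c' → δ ≤ |(c:ℝ) - c'|) : (S.card : ℝ) ≤ 2 * L / δ + 1 := by
  have h3 : S.card ≤ (Finset.range (⌊2 * L / δ⌋₊ + 1)).card := by
    apply Finset.card_le_card_of_injOn (fun c : ℤ => ⌊((c:ℝ) + L) / δ⌋₊)
    · intro c hc
      have := abs_le.1 (h1 c hc)
      simp only [Finset.coe_range, Set.mem_Iio, Nat.lt_succ_iff]
      apply Nat.floor_le_floor
      gcongr; linarith
    · intro c hc c' hc' he
      by_contra hne
      have a1 := abs_le.1 (h1 c hc)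
      have a2 := abs_le.1 (h1 c' hc')
      have := h2 c hc c' hc' hne
      have b1 : 0 ≤ ((c:ℝ) + L) / δ := div_nonneg (by linarith) hδ.le
      have b2 : 0 ≤ ((c':ℝ) + L) / δ := div_nonneg (by linarith) hδ.le
      have e1 := Nat.floor_le b1
      have e2 := Nat.floor_le b2
      have e3 := Nat.lt_floor_add_one (((c:ℝ) + L) / δ)
      have e4 := Nat.lt_floor_add_one (((c':ℝ) + L) / δ)
      simp only at he
      rw [he] at e1 e3
      have k1 : |((c:ℝ) + L) / δ - ((c':ℝ) + L) / δ| < 1 := by rw [abs_lt]; constructor <;> linarith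
      rw [← sub_div, abs_div, abs_of_pos hδ, div_lt_one hδ] at k1
      have : (c:ℝ) + L - (c' + L) = c - c' := by ring
      rw [this] at k1; linarith
  rw [Finset.card_range] at h3
  have h4 : (S.card : ℝ) ≤ ⌊2 * L / δ⌋₊ + 1 := by exact_mod_cast h3
  have := Nat.floor_le (show 0 ≤ 2 * L / δ by positivity)
  linarith

theorem spaced_one {S : Finset ℤ} {L : ℝ} (hL : 0 ≤ L) (h1 : ∀ c ∈ S, |(c:ℝ)| ≤ L) : (S.card : ℝ) ≤ 2 * L + 1 := by
  have := spaced hL one_pos h1 (fun c _ c' _ hne => by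
    have : 1 ≤ |c - c'| := Int.one_le_abs (sub_ne_zero.2 hne)
    exact_mod_cast this)
  simpa using this

def Aset (T : ℕ) : Finset ℤ := (Finset.Icc (-(T:ℤ)) T).erase 0
def Bset (T : ℕ) : Finset ℤ := Finset.Icc (-(T:ℤ)) T
def Lset (T : ℕ) (k : ℤ) : Finset ℤ := (Finset.Icc (-(T:ℤ)^2) (T^2)).filter (fun c => |k * c| ≤ T^2)

theorem mem_Aset {T : ℕ} {a : ℤ} : a ∈ Aset T ↔ a ≠ 0 ∧ |a| ≤ T := by
  rw [Aset, Finset.mem_erase, Finset.mem_Icc, abs_le]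
theorem mem_Bset {T : ℕ} {a : ℤ} : a ∈ Bset T ↔ |a| ≤ T := by
  rw [Bset, Finset.mem_Icc, abs_le]
theorem mem_Lset {T : ℕ} {k c : ℤ} : c ∈ Lset T k ↔ |c| ≤ (T:ℤ)^2 ∧ |k * c| ≤ (T:ℤ)^2 := by
  rw [Lset, Finset.mem_filter, Finset.mem_Icc, abs_le (a := c)]

/-- `max 1 |k|` as a real -/
def mx (k : ℤ) : ℝ := max 1 |(k:ℝ)|
theorem mx_pos (k : ℤ) : 0 < mx k := lt_of_lt_of_le one_pos (le_max_left _ _)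
theorem mx_eq {k : ℤ} (h : k ≠ 0) : mx k = |(k:ℝ)| := by
  rw [mx, max_eq_right]; exact_mod_cast Int.one_le_abs h

theorem Lset_abs {T : ℕ} {k c : ℤ} (h : c ∈ Lset T k) : |(c:ℝ)| ≤ (T:ℝ)^2 / mx k := by
  rw [mem_Lset] at h
  rw [le_div_iff₀ (mx_pos k), mx, mul_max_of_nonneg _ _ (abs_nonneg _)]
  have h1 : |(c:ℝ)| ≤ (T:ℝ)^2 := by exact_mod_cast h.1
  have h2 : |(k:ℝ) * c| ≤ (T:ℝ)^2 := by exact_mod_cast h.2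
  rw [abs_mul] at h2
  exact max_le (by linarith) (by linarith [mul_comm |(k:ℝ)| |(c:ℝ)|])

theorem card_Lset (T : ℕ) (k : ℤ) : ((Lset T k).card : ℝ) ≤ 2 * ((T:ℝ)^2 / mx k) + 1 :=
  spaced_one (div_nonneg (by positivity) (mx_pos k).le) fun _ hc => Lset_abs hc

theorem card_Aset (T : ℕ) : ((Aset T).card : ℝ) = 2 * T := by
  rw [Aset, Finset.card_erase_of_mem (by simp), Int.card_Icc]
  have : ((T:ℤ) + 1 - -(T:ℤ)).toNat - 1 = 2 * T := by omega
  rw [this]; push_cast; ring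
theorem card_Bset (T : ℕ) : ((Bset T).card : ℝ) = 2 * T + 1 := by
  rw [Bset, Int.card_Icc]
  have : ((T:ℤ) + 1 - -(T:ℤ)).toNat = 2 * T + 1 := by omega
  rw [this]; push_cast; ring

theorem sum_Aset {T : ℕ} (F : ℕ → ℝ) : ∑ a ∈ Aset T, F a.natAbs = 2 * ∑ k ∈ Finset.Icc 1 T, F k := by
  have h1 : Aset T = (Finset.Icc 1 T).image (fun k : ℕ => (k:ℤ)) ∪ (Finset.Icc 1 T).image (fun k : ℕ => -(k:ℤ)) := by
    ext a
    simp only [mem_Aset, Finset.mem_union, Finset.mem_image, Finset.mem_Icc, abs_le]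
    constructor
    · rintro ⟨h, h2⟩
      rcases le_total 0 a with h3 | h3
      · left; refine ⟨a.natAbs, ?_, by omega⟩; omega
      · right; refine ⟨a.natAbs, ?_, by omega⟩; omega
    · rintro (⟨k, hk, rfl⟩ | ⟨k, hk, rfl⟩) <;> omega
  rw [h1, Finset.sum_union, Finset.sum_image, Finset.sum_image]
  · simp only [Int.natAbs_natCast, Int.natAbs_neg]; ring
  · intro x _ y _ h; simpa using h
  · intro x _ y _ h; simpa using h
  · rw [Finset.disjoint_left]; intro a h h'
    simp only [Finset.mem_image, Finset.mem_Icc] at h h'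
    obtain ⟨k, hk, rfl⟩ := h; obtain ⟨l, hl, h⟩ := h'; omega

theorem HZ.harm {N : ℕ} {Z : ℝ} (h : HZ N Z) {T : ℕ} (hT : T ≤ N) : ∑ k ∈ Finset.Icc 1 T, (1:ℝ) / k ≤ Z := by
  refine le_trans (Finset.sum_le_sum_of_subset_of_nonneg (Finset.Icc_subset_Icc_right hT) ?_) h.2.2
  intros; positivity

theorem sum_A_inv {N : ℕ} {Z : ℝ} (h : HZ N Z) {T : ℕ} (hT : T ≤ N) : ∑ a ∈ Aset T, 1 / mx a ≤ 2 * Z := by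
  have : ∑ a ∈ Aset T, 1 / mx a = ∑ a ∈ Aset T, (1:ℝ) / (a.natAbs : ℕ) := by
    refine Finset.sum_congr rfl fun a ha => ?_
    rw [mx_eq (mem_Aset.1 ha).1, Nat.cast_natAbs]; push_cast; rfl
  rw [this, sum_Aset (fun k => (1:ℝ) / k)]
  linarith [h.harm hT]

theorem sum_B_inv {N : ℕ} {Z : ℝ} (h : HZ N Z) {T : ℕ} (hT : T ≤ N) : ∑ a ∈ Bset T, 1 / mx a ≤ 3 * Z := by
  have h1 := sum_A_inv h hT
  have h0 : (0:ℤ) ∈ Bset T := by simp [mem_Bset]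
  rw [← Finset.add_sum_erase _ _ h0]
  have : 1 / mx 0 = 1 := by simp [mx]
  rw [this]
  have h2 : (Bset T).erase 0 = Aset T := rfl
  rw [h2]; linarith [h.1]

theorem sum_A_L {N : ℕ} {Z : ℝ} (h : HZ N Z) {T : ℕ} (h1 : 1 ≤ T) (hT : T ≤ N) : ∑ a ∈ Aset T, ((Lset T a).card : ℝ) ≤ 6 * T^2 * Z := by
  have hT1 : (1:ℝ) ≤ T := by exact_mod_cast h1
  calc ∑ a ∈ Aset T, ((Lset T a).card : ℝ) ≤ ∑ a ∈ Aset T, (2 * (T:ℝ)^2 * (1 / mx a) + 1) := by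
        refine Finset.sum_le_sum fun a _ => ?_
        have := card_Lset T a; rw [mul_one_div]; rw [← mul_div_assoc] at this; exact this
    _ = 2 * (T:ℝ)^2 * ∑ a ∈ Aset T, 1 / mx a + 2 * T := by
        rw [Finset.sum_add_distrib, ← Finset.mul_sum, Finset.sum_const, nsmul_eq_mul, card_Aset, mul_one]
    _ ≤ 2 * (T:ℝ)^2 * (2 * Z) + 2 * T^2 * Z := by
        have := sum_A_inv h hT
        have h3 := h.1
        have : (T:ℝ) ≤ T^2 * Z := by nlinarith [mul_le_mul hT1 h3 (by norm_num) (by linarith)]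
        gcongr ?_ + ?_
        · gcongr
        · linarith
    _ = _ := by ring

theorem sum_B_L {N : ℕ} {Z : ℝ} (h : HZ N Z) {T : ℕ} (h1 : 1 ≤ T) (hT : T ≤ N) : ∑ a ∈ Bset T, ((Lset T a).card : ℝ) ≤ 9 * T^2 * Z := by
  have hT1 : (1:ℝ) ≤ T := by exact_mod_cast h1
  calc ∑ a ∈ Bset T, ((Lset T a).card : ℝ) ≤ ∑ a ∈ Bset T, (2 * (T:ℝ)^2 * (1 / mx a) + 1) := by
        refine Finset.sum_le_sum fun a _ => ?_
        have := card_Lset T a; rw [mul_one_div]; rw [← mul_div_assoc] at this; exact this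
    _ = 2 * (T:ℝ)^2 * ∑ a ∈ Bset T, 1 / mx a + (2 * T + 1) := by
        rw [Finset.sum_add_distrib, ← Finset.mul_sum, Finset.sum_const, nsmul_eq_mul, card_Bset, mul_one]
    _ ≤ 2 * (T:ℝ)^2 * (3 * Z) + 3 * T^2 * Z := by
        have := sum_B_inv h hT
        have h3 := h.1
        have : (T:ℝ) ≤ T^2 * Z := by nlinarith [mul_le_mul hT1 h3 (by norm_num) (by linarith)]
        gcongr ?_ + ?_
        · gcongr
        · linarith
    _ = _ := by ring

def ABC (T : ℕ) : Finset (ℤ × (Σ _ : ℤ, ℤ)) := Aset T ×ˢ ((Bset T).sigma (Lset T))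
def ABD (T : ℕ) : Finset (ℤ × (Σ _ : ℤ, ℤ)) := Bset T ×ˢ ((Aset T).sigma (Lset T))

theorem card_ABC {N : ℕ} {Z : ℝ} (h : HZ N Z) {T : ℕ} (h1 : 1 ≤ T) (hT : T ≤ N) : ((ABC T).card : ℝ) ≤ 18 * T^3 * Z := by
  rw [ABC, Finset.card_product, Finset.card_sigma]; push_cast
  rw [card_Aset]
  calc _ ≤ 2 * (T:ℝ) * (9 * T^2 * Z) := by gcongr; exact sum_B_L h h1 hT
    _ = _ := by ring

theorem card_ABD {N : ℕ} {Z : ℝ} (h : HZ N Z) {T : ℕ} (h1 : 1 ≤ T) (hT : T ≤ N) : ((ABD T).card : ℝ) ≤ 18 * T^3 * Z := by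
  have hT1 : (1:ℝ) ≤ T := by exact_mod_cast h1
  rw [ABD, Finset.card_product, Finset.card_sigma]; push_cast
  rw [card_Bset]
  have hZ := h.1
  calc _ ≤ (3 * (T:ℝ)) * (6 * T^2 * Z) := by
        gcongr
        · linarith
        · exact sum_A_L h h1 hT
    _ = _ := by ring

theorem mem_BF_parts {T : ℕ} {f : V} (h : f ∈ BF T) : f.a ∈ Aset T ∧ f.b ∈ Bset T ∧ f.c ∈ Lset T f.b ∧ f.d ∈ Lset T f.a := by
  rw [mem_BF] at h
  obtain ⟨h0, h1, h2, h3, h4, h5⟩ := h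
  exact ⟨mem_Aset.2 ⟨h0, h1⟩, mem_Bset.2 h2, mem_Lset.2 ⟨abs_le_of_mul h0 h3, h5⟩, mem_Lset.2 ⟨abs_le_of_mul h0 h4, h4⟩⟩

theorem card_BF {N : ℕ} {Z : ℝ} (h : HZ N Z) {T : ℕ} (h1 : 1 ≤ T) (hT : T ≤ N) : ((BF T).card : ℝ) ≤ 54 * T^4 * Z^2 := by
  have hle : (BF T).card ≤ (((Bset T).sigma (Lset T)) ×ˢ ((Aset T).sigma (Lset T))).card := by
    apply Finset.card_le_card_of_injOn (fun f => ((⟨f.b, f.c⟩ : Σ _ : ℤ, ℤ), (⟨f.a, f.d⟩ : Σ _ : ℤ, ℤ)))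
    · intro f hf
      obtain ⟨g1, g2, g3, g4⟩ := mem_BF_parts hf
      simp only [Finset.coe_product, Set.mem_prod, Finset.mem_coe, Finset.mem_sigma]
      exact ⟨⟨g2, g3⟩, g1, g4⟩
    · intro f _ g _ he
      simp only [Prod.mk.injEq, Sigma.mk.injEq, heq_eq_eq] at he
      ext <;> simp [he]
  have h3 : ((BF T).card : ℝ) ≤ (∑ b ∈ Bset T, ((Lset T b).card : ℝ)) * (∑ a ∈ Aset T, ((Lset T a).card : ℝ)) := by
    rw [Finset.card_product, Finset.card_sigma, Finset.card_sigma] at hle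
    exact_mod_cast hle
  have hZ := h.1
  calc _ ≤ _ := h3
    _ ≤ (9 * T^2 * Z) * (6 * T^2 * Z) := by
        gcongr
        · exact sum_B_L h h1 hT
        · exact sum_A_L h h1 hT
    _ = _ := by ring

/-- forms with given `(a,b,c)` -/
theorem card_le_ABC {T : ℕ} {S : Finset V} (hS : S ⊆ BF T) (k : ℤ → ℤ → ℤ → ℝ)
    (h : ∀ a ∈ Aset T, ∀ b ∈ Bset T, ∀ c ∈ Lset T b, ((S.filter (fun f => f.a = a ∧ f.b = b ∧ f.c = c)).card : ℝ) ≤ k a b c) :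
    (S.card : ℝ) ≤ ∑ x ∈ ABC T, k x.1 x.2.1 x.2.2 := by
  have := Finset.card_eq_sum_card_fiberwise (s := S) (t := ABC T) (f := fun f => (f.a, (⟨f.b, f.c⟩ : Σ _ : ℤ, ℤ))) (by
    intro f hf
    obtain ⟨g1, g2, g3, g4⟩ := mem_BF_parts (hS hf)
    simp only [ABC, Finset.coe_product, Set.mem_prod, Finset.mem_coe, Finset.mem_sigma]
    exact ⟨g1, g2, g3⟩)
  rw [this]; push_cast
  refine Finset.sum_le_sum ?_
  rintro ⟨a, b, c⟩ hx
  simp only [ABC, Finset.mem_product, Finset.mem_sigma] at hx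
  refine le_trans (le_of_eq ?_) (h a hx.1 b hx.2.1 c hx.2.2)
  simp only [Prod.mk.injEq, Sigma.mk.injEq, heq_eq_eq]

theorem card_le_ABD {T : ℕ} {S : Finset V} (hS : S ⊆ BF T) (k : ℤ → ℤ → ℤ → ℝ)
    (h : ∀ a ∈ Aset T, ∀ b ∈ Bset T, ∀ d ∈ Lset T a, ((S.filter (fun f => f.a = a ∧ f.b = b ∧ f.d = d)).card : ℝ) ≤ k a b d) :
    (S.card : ℝ) ≤ ∑ x ∈ ABD T, k x.2.1 x.1 x.2.2 := by
  have := Finset.card_eq_sum_card_fiberwise (s := S) (t := ABD T) (f := fun f => (f.b, (⟨f.a, f.d⟩ : Σ _ : ℤ, ℤ))) (by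
    intro f hf
    obtain ⟨g1, g2, g3, g4⟩ := mem_BF_parts (hS hf)
    simp only [ABD, Finset.coe_product, Set.mem_prod, Finset.mem_coe, Finset.mem_sigma]
    exact ⟨g2, g1, g4⟩)
  rw [this]; push_cast
  refine Finset.sum_le_sum ?_
  rintro ⟨b, a, d⟩ hx
  simp only [ABD, Finset.mem_product, Finset.mem_sigma] at hx
  refine le_trans (le_of_eq ?_) (h a hx.2.1 b hx.1 d hx.2.2)
  simp only [Prod.mk.injEq, Sigma.mk.injEq, heq_eq_eq]
  rw [show (S.filter fun f => f.b = b ∧ f.a = a ∧ f.d = d) = S.filter fun f => f.a = a ∧ f.b = b ∧ f.d = d from Finset.filter_congr fun f _ => by tauto]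

/-- the form is determined up to `k` choices by `(a,b,c)` -/
theorem card_ABC_const {N : ℕ} {Z : ℝ} (hZ : HZ N Z) {T : ℕ} (h1 : 1 ≤ T) (hT : T ≤ N) {S : Finset V} (hS : S ⊆ BF T) {k : ℝ} (hk : 0 ≤ k)
    (h : ∀ a ∈ Aset T, ∀ b ∈ Bset T, ∀ c ∈ Lset T b, ((S.filter (fun f => f.a = a ∧ f.b = b ∧ f.c = c)).card : ℝ) ≤ k) :
    (S.card : ℝ) ≤ k * (18 * T^3 * Z) := by
  refine (card_le_ABC hS (fun _ _ _ => k) h).trans ?_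
  rw [Finset.sum_const, nsmul_eq_mul, mul_comm]
  gcongr; exact card_ABC hZ h1 hT

theorem card_ABD_const {N : ℕ} {Z : ℝ} (hZ : HZ N Z) {T : ℕ} (h1 : 1 ≤ T) (hT : T ≤ N) {S : Finset V} (hS : S ⊆ BF T) {k : ℝ} (hk : 0 ≤ k)
    (h : ∀ a ∈ Aset T, ∀ b ∈ Bset T, ∀ d ∈ Lset T a, ((S.filter (fun f => f.a = a ∧ f.b = b ∧ f.d = d)).card : ℝ) ≤ k) :
    (S.card : ℝ) ≤ k * (18 * T^3 * Z) := by
  refine (card_le_ABD hS (fun _ _ _ => k) h).trans ?_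
  rw [Finset.sum_const, nsmul_eq_mul, mul_comm]
  gcongr; exact card_ABD hZ h1 hT
end CF

namespace CF

theorem V.eqd {f g : V} (h1 : f.a = g.a) (h2 : f.b = g.b) (h3 : f.c = g.c) (h4 : f.d = g.d) : f = g := V.ext h1 h2 h3 h4

theorem HZ.div {N : ℕ} {Z : ℝ} (h : HZ N Z) {n : ℤ} (hn : n ≠ 0) (hN : |n| ≤ N) : (n.natAbs.divisors.card : ℝ) ≤ Z := by
  apply h.2.1 _ (Int.natAbs_pos.2 hn)
  rw [Int.abs_eq_natAbs] at hN; exact_mod_cast hN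

/-- reducible forms with `d ≠ 0` -/
theorem card_red1 {N : ℕ} {Z : ℝ} (hZ : HZ N Z) {T : ℕ} (h1 : 1 ≤ T) (hT : T^2 ≤ N) :
    (((BF T).filter (fun f => ¬ f.irr ∧ f.d ≠ 0)).card : ℝ) ≤ 2 * Z^2 * (18 * T^3 * Z) := by
  have hT' : T ≤ N := le_trans (by nlinarith) hT
  have hTz : (T:ℤ)^2 ≤ N := by exact_mod_cast hT
  have hZ1 := hZ.1
  apply card_ABD_const hZ h1 hT' (Finset.filter_subset _ _) (by positivity)
  intro a ha b hb d hd
  by_cases hd0 : d = 0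
  · rw [Finset.filter_filter, Finset.filter_eq_empty_iff.2]
    · simp; positivity
    · intro f hf h; exact h.1.2 (h.2.2.2.trans hd0)
  rw [mem_Aset] at ha
  rw [mem_Lset] at hd
  have hle : ((((BF T).filter (fun f => ¬ f.irr ∧ f.d ≠ 0)).filter (fun f => f.a = a ∧ f.b = b ∧ f.d = d)).card) ≤
      ((d.natAbs.divisors ×ˢ a.natAbs.divisors) ×ˢ ({1, -1} : Finset ℤ)).card := by
    apply Finset.card_le_card_of_forall_subsingleton (fun (f : V) k => f.ev (k.2 * k.1.1) k.1.2 = 0 ∧ f.d = d ∧ k.2 ≠ 0 ∧ k.1.1 ≠ 0 ∧ k.1.2 ≠ 0)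
    · intro f hf
      simp only [Finset.mem_filter] at hf
      obtain ⟨⟨hfB, hni, hfd⟩, rfl, rfl, rfl⟩ := hf
      rw [V.irr] at hni; push Not at hni
      obtain ⟨x, y, h0, hxy⟩ := hni
      have hg0 : Int.gcd x y ≠ 0 := by
        rw [Ne, Int.gcd_eq_zero_iff]; rintro ⟨rfl, rfl⟩; exact hxy rfl rfl
      obtain ⟨x', y', hco, hx, hy⟩ : ∃ x' y' : ℤ, IsCoprime x' y' ∧ x = x' * Int.gcd x y ∧ y = y' * Int.gcd x y := by
        obtain ⟨x', y', hco, hx, hy⟩ := Int.exists_gcd_one (m := x) (n := y) (Nat.pos_of_ne_zero hg0)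
        exact ⟨x', y', Int.isCoprime_iff_gcd_eq_one.2 hco, hx, hy⟩
      have h0' : f.ev x' y' = 0 := by
        have : f.ev (x' * Int.gcd x y) (y' * Int.gcd x y) = (Int.gcd x y : ℤ)^3 * f.ev x' y' := by simp only [V.ev]; ring
        rw [← hx, ← hy, h0] at this
        replace h0 := this.symm
        rcases mul_eq_zero.1 h0 with h | h
        · exact absurd (pow_eq_zero_iff (by norm_num) |>.1 h) (by exact_mod_cast hg0)
        · exact h
      have hxd : x' ∣ f.d := by
        have : x' ∣ f.d * y'^3 := ⟨-(f.a * x'^2 + f.b * x' * y' + f.c * y'^2), by simp only [V.ev] at h0'; linear_combination h0'⟩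
        exact (hco.pow_right).dvd_of_dvd_mul_right this
      have hya : y' ∣ f.a := by
        have : y' ∣ f.a * x'^3 := ⟨-(f.b * x'^2 + f.c * x' * y' + f.d * y'^2), by simp only [V.ev] at h0'; linear_combination h0'⟩
        exact (hco.symm.pow_right).dvd_of_dvd_mul_right this
      have hx0 : x' ≠ 0 := by rintro rfl; exact hfd (zero_dvd_iff.1 hxd)
      have hy0 : y' ≠ 0 := by rintro rfl; exact ha.1 (zero_dvd_iff.1 hya)
      refine ⟨((x'.natAbs, y'.natAbs), if 0 < x' * y' then 1 else -1), ?_, ?_, rfl, ?_, ?_, ?_⟩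
      · simp only [Finset.mem_product, Nat.mem_divisors]
        refine ⟨⟨⟨Int.natAbs_dvd_natAbs.2 hxd, Int.natAbs_ne_zero.2 hfd⟩, ⟨Int.natAbs_dvd_natAbs.2 hya, Int.natAbs_ne_zero.2 ha.1⟩⟩, ?_⟩
        split_ifs <;> simp
      · have e0 : f.ev (-x') (-y') = 0 := by
          have : f.ev (-x') (-y') = - f.ev x' y' := by simp only [V.ev]; ring
          rw [this, h0', neg_zero]
        simp only [Int.natCast_natAbs]
        rcases lt_or_gt_of_ne hy0 with hy' | hy' <;> rcases lt_or_gt_of_ne hx0 with hx' | hx'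
        · rw [if_pos (mul_pos_of_neg_of_neg hx' hy'), abs_of_neg hx', abs_of_neg hy']; simpa using e0
        · rw [if_neg (not_lt.2 (mul_neg_of_pos_of_neg hx' hy').le), abs_of_pos hx', abs_of_neg hy']; simpa using e0
        · rw [if_neg (not_lt.2 (mul_neg_of_neg_of_pos hx' hy').le), abs_of_neg hx', abs_of_pos hy']; simpa using h0'
        · rw [if_pos (mul_pos hx' hy'), abs_of_pos hx', abs_of_pos hy']; simpa using h0'
      · dsimp only; split_ifs <;> norm_num
      · simpa using hx0
      · simpa using hy0
    · rintro ⟨⟨u, v⟩, e⟩ - f hf g hg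
      simp only [Finset.mem_filter, Set.mem_setOf_eq] at hf hg
      obtain ⟨⟨-, fa, fb, fd⟩, fe, -, he, hu, hv⟩ := hf
      obtain ⟨⟨-, ga, gb, gd⟩, ge, -⟩ := hg
      refine V.eqd (fa.trans ga.symm) (fb.trans gb.symm) ?_ (fd.trans gd.symm)
      simp only [V.ev, fa, fb, fd] at fe
      simp only [V.ev, ga, gb, gd] at ge
      have hne : (e * (u:ℤ)) * (v:ℤ)^2 ≠ 0 := by
        refine mul_ne_zero (mul_ne_zero he ?_) (pow_ne_zero _ ?_)
        · exact_mod_cast hu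
        · exact_mod_cast hv
      apply mul_right_cancel₀ hne
      linear_combination fe - ge
  rw [Finset.card_product, Finset.card_product] at hle
  have h2 : ({1, -1} : Finset ℤ).card = 2 := by decide
  rw [h2] at hle
  have e1 := hZ.div hd0 (hd.1.trans hTz)
  have e2 := hZ.div ha.1 (ha.2.trans (by exact_mod_cast hT'))
  calc _ ≤ ((d.natAbs.divisors.card * a.natAbs.divisors.card * 2 : ℕ) : ℝ) := by exact_mod_cast hle
    _ ≤ Z * Z * 2 := by push_cast; gcongr
    _ = _ := by ring

theorem card_red {N : ℕ} {Z : ℝ} (hZ : HZ N Z) {T : ℕ} (h1 : 1 ≤ T) (hT : T^2 ≤ N) :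
    (((BF T).filter (fun f => ¬ f.irr)).card : ℝ) ≤ 54 * T^3 * Z^3 := by
  have hT' : T ≤ N := le_trans (by nlinarith) hT
  have hZ1 := hZ.1
  have a1 := card_red1 hZ h1 hT
  have a2 : (((BF T).filter (fun f => f.d = 0)).card : ℝ) ≤ 1 * (18 * T^3 * Z) := by
    apply card_ABC_const hZ h1 hT' (Finset.filter_subset _ _) (by positivity)
    intro a ha b hb c hc
    have : (((BF T).filter (fun f => f.d = 0)).filter (fun f => f.a = a ∧ f.b = b ∧ f.c = c)).card ≤ 1 := by
      rw [Finset.card_le_one]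
      intro f hf g hg
      simp only [Finset.mem_filter] at hf hg
      exact V.eqd (hf.2.1.trans hg.2.1.symm) (hf.2.2.1.trans hg.2.2.1.symm) (hf.2.2.2.trans hg.2.2.2.symm) (hf.1.2.trans hg.1.2.symm)
    exact_mod_cast this
  have a3 : ((BF T).filter (fun f => ¬ f.irr)).card ≤ ((BF T).filter (fun f => ¬ f.irr ∧ f.d ≠ 0)).card + ((BF T).filter (fun f => f.d = 0)).card := by
    refine le_trans (Finset.card_le_card ?_) (Finset.card_union_le _ _)
    intro f hf
    simp only [Finset.mem_union, Finset.mem_filter] at hf ⊢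
    by_cases h : f.d = 0
    · right; exact ⟨hf.1, h⟩
    · left; exact ⟨hf.1, hf.2, h⟩
  have a4 : (((BF T).filter (fun f => ¬ f.irr)).card : ℝ) ≤ ((BF T).filter (fun f => ¬ f.irr ∧ f.d ≠ 0)).card + ((BF T).filter (fun f => f.d = 0)).card := by exact_mod_cast a3
  have : (T:ℝ)^3 * Z ≤ T^3 * Z^3 := by gcongr; exact le_self_pow₀ hZ1 (by norm_num)
  nlinarith

theorem card_bdry_d {N : ℕ} {Z : ℝ} (hZ : HZ N Z) {T : ℕ} (h1 : 1 ≤ T) (hT' : T ≤ N) (P : V → ℤ)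
    (h : ∀ a b c d d', a ≠ 0 → P ⟨a, b, c, d⟩ = 0 → P ⟨a, b, c, d'⟩ = 0 → d = d') :
    (((BF T).filter (fun f => P f = 0)).card : ℝ) ≤ 18 * T^3 * Z := by
  rw [← one_mul (18 * (T:ℝ)^3 * Z)]
  apply card_ABC_const hZ h1 hT' (Finset.filter_subset _ _) (by positivity)
  intro a ha b hb c hc
  have : (((BF T).filter (fun f => P f = 0)).filter (fun f => f.a = a ∧ f.b = b ∧ f.c = c)).card ≤ 1 := by
    rw [Finset.card_le_one]
    rintro ⟨fa, fb, fc, fd⟩ hf ⟨ga, gb, gc, gd⟩ hg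
    simp only [Finset.mem_filter] at hf hg
    obtain ⟨⟨-, hf⟩, rfl, rfl, rfl⟩ := hf
    obtain ⟨⟨-, hg⟩, rfl, rfl, rfl⟩ := hg
    rw [h _ _ _ _ _ (mem_Aset.1 ha).1 hf hg]
  exact_mod_cast this

theorem card_bdry_c {N : ℕ} {Z : ℝ} (hZ : HZ N Z) {T : ℕ} (h1 : 1 ≤ T) (hT' : T ≤ N) (P : V → ℤ)
    (h : ∀ a b d c c' c'', a ≠ 0 → P ⟨a, b, c, d⟩ = 0 → P ⟨a, b, c', d⟩ = 0 → P ⟨a, b, c'', d⟩ = 0 → c = c' ∨ c = c'' ∨ c' = c'') :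
    (((BF T).filter (fun f => P f = 0)).card : ℝ) ≤ 2 * (18 * T^3 * Z) := by
  apply card_ABD_const hZ h1 hT' (Finset.filter_subset _ _) (by positivity)
  intro a ha b hb c hc
  have : (((BF T).filter (fun f => P f = 0)).filter (fun f => f.a = a ∧ f.b = b ∧ f.d = c)).card ≤ 2 := by
    by_contra hcon
    rw [not_le, Finset.two_lt_card_iff] at hcon
    obtain ⟨⟨fa, fb, fc, fd⟩, ⟨ga, gb, gc, gd⟩, ⟨ka, kb, kc, kd⟩, hf, hg, hk, n1, n2, n3⟩ := hcon
    simp only [Finset.mem_filter] at hf hg hk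
    obtain ⟨⟨-, hf⟩, rfl, rfl, rfl⟩ := hf
    obtain ⟨⟨-, hg⟩, rfl, rfl, rfl⟩ := hg
    obtain ⟨⟨-, hk⟩, rfl, rfl, rfl⟩ := hk
    rcases h _ _ _ _ _ _ (mem_Aset.1 ha).1 hf hg hk with e | e | e
    · exact n1 (by rw [e])
    · exact n2 (by rw [e])
    · exact n3 (by rw [e])
  exact_mod_cast this

theorem card_bdry {N : ℕ} {Z : ℝ} (hZ : HZ N Z) {T : ℕ} (h1 : 1 ≤ T) (hT' : T ≤ N) :
    (((BF T).filter (fun f => f.Red ∧ ¬ f.RedO)).card : ℝ) ≤ 144 * T^3 * Z := by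
  have b1 := card_bdry_c hZ h1 hT' (fun f => f.hR - f.hP) (by
    intro a b d c c' c'' ha e1 e2 e3
    simp only [V.hR, V.hP] at e1 e2 e3
    by_contra hcon; push Not at hcon
    obtain ⟨n1, n2, n3⟩ := hcon
    have q1 : (c - c') * (c + c' + 3 * a) = 0 := by linear_combination e1 - e2
    have q2 : (c - c'') * (c + c'' + 3 * a) = 0 := by linear_combination e1 - e3
    rcases mul_eq_zero.1 q1 with q1 | q1
    · exact n1 (by linarith)
    rcases mul_eq_zero.1 q2 with q2 | q2
    · exact n2 (by linarith)
    exact n3 (by linarith))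
  have b2 := card_bdry_c hZ h1 hT' (fun f => f.d^2 - f.a^2 + f.a * f.c - f.b * f.d) (by
    intro a b d c c' c'' ha e1 e2 e3
    simp only at e1 e2
    left; apply mul_left_cancel₀ ha; linear_combination e1 - e2)
  have b3 := card_bdry_d hZ h1 hT' (fun f => f.hP + f.hQ) (by
    intro a b c d d' ha e1 e2
    simp only [V.hP, V.hQ] at e1 e2
    apply mul_left_cancel₀ ha; linarith)
  have b4 := card_bdry_d hZ h1 hT' (fun f => f.hP - f.hQ) (by
    intro a b c d d' ha e1 e2
    simp only [V.hP, V.hQ] at e1 e2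
    apply mul_left_cancel₀ ha; linarith)
  have b5 := card_bdry_d hZ h1 hT' (fun f => (f.a + f.b)^2 + f.a * f.c + f.b * f.c - f.a * f.d) (by
    intro a b c d d' ha e1 e2
    simp only at e1 e2
    apply mul_left_cancel₀ ha; linarith)
  have b6 := card_bdry_d hZ h1 hT' (fun f => (f.a - f.b)^2 + f.a * f.c - f.b * f.c + f.a * f.d) (by
    intro a b c d d' ha e1 e2
    simp only at e1 e2
    apply mul_left_cancel₀ ha; linarith)
  set S1 := (BF T).filter (fun f => f.hR - f.hP = 0)
  set S2 := (BF T).filter (fun f => f.d^2 - f.a^2 + f.a * f.c - f.b * f.d = 0)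
  set S3 := (BF T).filter (fun f => f.hP + f.hQ = 0)
  set S4 := (BF T).filter (fun f => f.hP - f.hQ = 0)
  set S5 := (BF T).filter (fun f => (f.a + f.b)^2 + f.a * f.c + f.b * f.c - f.a * f.d = 0)
  set S6 := (BF T).filter (fun f => (f.a - f.b)^2 + f.a * f.c - f.b * f.c + f.a * f.d = 0)
  have hsub : (BF T).filter (fun f => f.Red ∧ ¬ f.RedO) ⊆ ((((S1 ∪ S2) ∪ S3) ∪ S4) ∪ S5) ∪ S6 := by
    intro f hf
    simp only [Finset.mem_filter] at hf
    obtain ⟨hB, ⟨r1, r2, r3⟩, hn⟩ := hf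
    simp only [V.RedO, not_and_or, not_lt] at hn
    simp only [S1, S2, S3, S4, S5, S6, Finset.mem_union, Finset.mem_filter, hB, true_and]
    rcases hn with hn | hn | hn
    · have := le_antisymm hn r1
      simp only [V.e1] at this; split_ifs at this <;> simp [this]
    · have := le_antisymm hn r2
      simp only [V.e2] at this; split_ifs at this <;> simp [this]
    · have := le_antisymm hn r3
      simp only [V.e3] at this; split_ifs at this <;> simp [this]
  have hc : ((BF T).filter (fun f => f.Red ∧ ¬ f.RedO)).card ≤ S1.card + S2.card + S3.card + S4.card + S5.card + S6.card := by
    refine (Finset.card_le_card hsub).trans ?_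
    refine (Finset.card_union_le _ _).trans (Nat.add_le_add_right ?_ _)
    refine (Finset.card_union_le _ _).trans (Nat.add_le_add_right ?_ _)
    refine (Finset.card_union_le _ _).trans (Nat.add_le_add_right ?_ _)
    refine (Finset.card_union_le _ _).trans (Nat.add_le_add_right ?_ _)
    exact Finset.card_union_le _ _
  have hc' : (((BF T).filter (fun f => f.Red ∧ ¬ f.RedO)).card : ℝ) ≤ S1.card + S2.card + S3.card + S4.card + S5.card + S6.card := by exact_mod_cast hc
  linarith
end CF

namespace CF

theorem Dh_card {T : ℕ} {a b c : ℤ} (ha : a ≠ 0) {M : ℝ} (hM : 0 < M) {t : ℕ} {D : Finset ℤ} (hMt : M < t)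
    (hD : ∀ d ∈ D, d ∈ Lset T a ∧ ∃ s : Finset ℕ, (∀ p ∈ s, p.Prime) ∧ ∏ p ∈ s, p = t ∧ ∀ p ∈ s, Rp p ⟨a, b, c, d⟩) :
    (D.card : ℝ) ≤ 6 * ((T:ℝ)^2 / mx a) * (Int.gcd a c) / M + 1 := by
  have hG : 0 < Int.gcd a c := Int.gcd_pos_of_ne_zero_left _ ha
  have hG' : (0:ℝ) < Int.gcd a c := by exact_mod_cast hG
  have := spaced (S := D) (L := (T:ℝ)^2 / mx a) (δ := M / (3 * Int.gcd a c)) (div_nonneg (by positivity) (mx_pos a).le) (by positivity)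
    (fun d hd => Lset_abs (hD d hd).1) (by
      intro d hd d' hd' hne
      obtain ⟨-, s, hs, hst, hR⟩ := hD d hd
      obtain ⟨-, s', hs', hst', hR'⟩ := hD d' hd'
      have hss : s = s' := by
        rw [← Nat.primeFactors_prod hs, ← Nat.primeFactors_prod hs', hst, hst']
      subst hss
      have hdv : (t:ℤ) ∣ 3 * Int.gcd a c * (d - d') := by
        rw [← hst]; push_cast
        apply Finset.prod_dvd_of_coprime
        · intro p hp q hq hpq
          exact Nat.isCoprime_iff_coprime.2 ((Nat.coprime_primes (hs p hp) (hs q hq)).2 hpq)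
        · intro p hp
          have hpi := Nat.prime_iff_prime_int.1 (hs p hp)
          obtain ⟨r1, r2, r3⟩ := hR p hp
          obtain ⟨r1', r2', r3'⟩ := hR' p hp
          simp only [V.hP, V.hQ, V.hR] at r1 r2 r3 r1' r2' r3'
          have k1 : (p:ℤ) ∣ 3 * (3 * (a * (d - d'))) := by
            have := dvd_sub r2' r2
            have e : b * c - 9 * a * d' - (b * c - 9 * a * d) = 3 * (3 * (a * (d - d'))) := by ring
            rwa [e] at this
          have k2 : (p:ℤ) ∣ 3 * (b * (d - d')) := by
            have := dvd_sub r3' r3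
            have e : c^2 - 3 * b * d' - (c^2 - 3 * b * d) = 3 * (b * (d - d')) := by ring
            rwa [e] at this
          by_cases h3 : (p:ℤ) ∣ 3
          · exact Dvd.dvd.mul_right (Dvd.dvd.mul_right h3 _) _
          by_cases h4 : (p:ℤ) ∣ d - d'
          · exact Dvd.dvd.mul_left h4 _
          have k3 : (p:ℤ) ∣ a := by
            rcases hpi.dvd_or_dvd k1 with h | h
            · exact absurd h h3
            rcases hpi.dvd_or_dvd h with h | h
            · exact absurd h h3
            rcases hpi.dvd_or_dvd h with h | h
            · exact h
            · exact absurd h h4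
          have k4 : (p:ℤ) ∣ b := by
            rcases hpi.dvd_or_dvd k2 with h | h
            · exact absurd h h3
            rcases hpi.dvd_or_dvd h with h | h
            · exact h
            · exact absurd h h4
          have k5 : (p:ℤ) ∣ c := by
            apply hpi.dvd_of_dvd_pow (n := 2)
            have := dvd_add r3 (Dvd.dvd.mul_left k4 (3 * d))
            have e : c^2 - 3 * b * d + 3 * d * b = c^2 := by ring
            rwa [e] at this
          exact Dvd.dvd.mul_right (Dvd.dvd.mul_left (Int.dvd_coe_gcd k3 k5) _) _
      have hne' : 3 * (Int.gcd a c : ℤ) * (d - d') ≠ 0 :=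
        mul_ne_zero (mul_ne_zero (by norm_num) (by exact_mod_cast hG.ne')) (sub_ne_zero.2 hne)
      have hle := Int.le_of_dvd (abs_pos.2 hne') ((dvd_abs _ _).2 hdv)
      have hle' : (t:ℝ) ≤ 3 * Int.gcd a c * |(d:ℝ) - d'| := by
        rw [abs_mul, abs_of_pos (a := 3 * (Int.gcd a c : ℤ)) (by positivity)] at hle
        exact_mod_cast hle
      rw [div_le_iff₀ (by positivity)]
      linarith)
  refine this.trans (le_of_eq ?_)
  field_simp
  ring

theorem sum_gcd {N : ℕ} {Z : ℝ} (hZ : HZ N Z) {T : ℕ} (hT : T ≤ N) {a : ℤ} (ha : a ∈ Aset T) (b : ℤ) :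
    ∑ c ∈ Lset T b, (Int.gcd a c : ℝ) ≤ Z * (2 * ((T:ℝ)^2 / mx b) + mx a) := by
  rw [mem_Aset] at ha
  have hL : 0 ≤ (T:ℝ)^2 / mx b := div_nonneg (by positivity) (mx_pos b).le
  calc ∑ c ∈ Lset T b, (Int.gcd a c : ℝ) ≤ ∑ c ∈ Lset T b, ∑ e ∈ a.natAbs.divisors, (if (e:ℤ) ∣ c then (e:ℝ) else 0) := by
        refine Finset.sum_le_sum fun c _ => ?_
        have hmem : Int.gcd a c ∈ a.natAbs.divisors := by
          rw [Nat.mem_divisors]; exact ⟨Nat.gcd_dvd_left _ _, Int.natAbs_ne_zero.2 ha.1⟩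
        have := Finset.single_le_sum (f := fun e : ℕ => (if (e:ℤ) ∣ c then (e:ℝ) else 0)) (fun e _ => by positivity) hmem
        rwa [if_pos (Int.gcd_dvd_right _ _)] at this
    _ = ∑ e ∈ a.natAbs.divisors, (e:ℝ) * (((Lset T b).filter (fun c => (e:ℤ) ∣ c)).card : ℝ) := by
        rw [Finset.sum_comm]
        refine Finset.sum_congr rfl fun e _ => ?_
        rw [← Finset.sum_filter, Finset.sum_const, nsmul_eq_mul, mul_comm]
    _ ≤ ∑ e ∈ a.natAbs.divisors, (2 * ((T:ℝ)^2 / mx b) + mx a) := by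
        refine Finset.sum_le_sum fun e he => ?_
        have he0 : 0 < e := Nat.pos_of_mem_divisors he
        have he1 : (0:ℝ) < e := by exact_mod_cast he0
        have hea : (e:ℝ) ≤ mx a := by
          rw [mx_eq ha.1]
          have := Nat.divisor_le he
          have h2 : (e:ℤ) ≤ |a| := by rw [Int.abs_eq_natAbs]; exact_mod_cast this
          exact_mod_cast h2
        have := spaced (S := (Lset T b).filter (fun c => (e:ℤ) ∣ c)) hL he1 (fun c hc => Lset_abs (Finset.mem_filter.1 hc).1) (by
          intro c hc c' hc' hne
          have hd := dvd_sub (Finset.mem_filter.1 hc).2 (Finset.mem_filter.1 hc').2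
          have := Int.le_of_dvd (abs_pos.2 (sub_ne_zero.2 hne)) ((dvd_abs _ _).2 hd)
          exact_mod_cast this)
        calc _ ≤ (e:ℝ) * (2 * ((T:ℝ)^2 / mx b) / e + 1) := by gcongr
          _ = 2 * ((T:ℝ)^2 / mx b) + e := by field_simp
          _ ≤ _ := by linarith
    _ ≤ _ := by
        rw [Finset.sum_const, nsmul_eq_mul]
        have := hZ.div ha.1 (ha.2.trans (by exact_mod_cast hT))
        have h1 := (mx_pos a).le
        gcongr

theorem sum_ABC_gcd {N : ℕ} {Z : ℝ} (hZ : HZ N Z) {T : ℕ} (h1 : 1 ≤ T) (hT : T ≤ N) :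
    ∑ x ∈ ABC T, (Int.gcd x.1 x.2.2 : ℝ) / mx x.1 ≤ 18 * Z^3 * T^2 := by
  have hT1 : (1:ℝ) ≤ T := by exact_mod_cast h1
  have hZ1 := hZ.1
  rw [ABC, Finset.sum_product]
  simp_rw [Finset.sum_sigma]
  calc _ ≤ ∑ a ∈ Aset T, ∑ b ∈ Bset T, (2 * Z * T^2 * (1 / mx a) * (1 / mx b) + Z) := by
        refine Finset.sum_le_sum fun a ha => Finset.sum_le_sum fun b hb => ?_
        rw [← Finset.sum_div]
        rw [div_le_iff₀ (mx_pos a)]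
        refine (sum_gcd hZ hT ha b).trans (le_of_eq ?_)
        have := (mx_pos a).ne'
        have := (mx_pos b).ne'
        field_simp
    _ = 2 * Z * T^2 * (∑ a ∈ Aset T, 1 / mx a) * (∑ b ∈ Bset T, 1 / mx b) + (2 * T) * (2 * T + 1) * Z := by
        simp_rw [Finset.sum_add_distrib, Finset.sum_const, nsmul_eq_mul, card_Aset, card_Bset, ← Finset.mul_sum]
        rw [← Finset.sum_mul, ← Finset.mul_sum]; ring
    _ ≤ 2 * Z * T^2 * (2 * Z) * (3 * Z) + 6 * Z^3 * T^2 := by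
        have s1 := sum_A_inv hZ hT
        have s2 := sum_B_inv hZ hT
        have s0 : 0 ≤ ∑ b ∈ Bset T, 1 / mx b := Finset.sum_nonneg fun b _ => div_nonneg zero_le_one (mx_pos b).le
        have s3 : Z ≤ Z^3 := le_self_pow₀ hZ1 (by norm_num)
        have s4 : (2 * (T:ℝ)) * (2 * T + 1) ≤ 6 * T^2 := by nlinarith
        gcongr ?_ + ?_
        · gcongr
        · calc _ ≤ 6 * (T:ℝ)^2 * Z^3 := by gcongr
            _ = _ := by ring
    _ = _ := by ring

/-- forms with large Hessian content -/
def BR (T : ℕ) (M : ℝ) : Finset V := (BF T).filter (fun f => ∃ t : Finset ℕ, (∀ p ∈ t, p.Prime) ∧ M < ((∏ p ∈ t, p : ℕ) : ℝ) ∧ ∀ p ∈ t, Rp p f)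

theorem card_BR {N : ℕ} {Z : ℝ} (hZ : HZ N Z) {T : ℕ} (h1 : 1 ≤ T) (hT : 4 * T^2 ≤ N) {M : ℝ} (hM : 0 < M) :
    ((BR T M).card : ℝ) ≤ 108 * Z^4 * (T^4 / M + T^3) := by
  have hT' : T ≤ N := le_trans (by nlinarith) hT
  have hZ1 := hZ.1
  have hTz : 4 * (T:ℤ)^2 ≤ N := by exact_mod_cast hT
  have b1 := card_bdry_c hZ h1 hT' (fun f => f.hP) (by
    intro a b d c c' c'' ha e1 e2 e3
    simp only [V.hP] at e1 e2 e3
    left; apply mul_left_cancel₀ ha; linarith)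
  have b2 := card_le_ABC (T := T) (S := (BR T M).filter (fun f => f.hP ≠ 0)) ((Finset.filter_subset _ _).trans (Finset.filter_subset _ _))
    (fun a b c => Z * (6 * ((T:ℝ)^2 / mx a) * (Int.gcd a c) / M + 1)) (by
      intro a ha b hb c hc
      have hmx := (mx_pos a).le
      by_cases hP : b^2 - 3 * a * c = 0
      · rw [Finset.filter_eq_empty_iff.2]
        · simp; positivity
        · rintro f hf ⟨rfl, rfl, rfl⟩
          exact (Finset.mem_filter.1 hf).2 hP
      by_cases hac : |a * c| ≤ (T:ℤ)^2
      swap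
      · rw [Finset.filter_eq_empty_iff.2]
        · simp; positivity
        · rintro f hf ⟨rfl, rfl, rfl⟩
          exact hac (mem_BF.1 (Finset.mem_filter.1 (Finset.mem_filter.1 hf).1).1).2.2.2.1
      set D : ℕ → Finset ℤ := fun h => (Lset T a).filter (fun d => ∃ s : Finset ℕ, (∀ p ∈ s, p.Prime) ∧ ∏ p ∈ s, p = h ∧ ∀ p ∈ s, Rp p ⟨a, b, c, d⟩) with hD
      set K := (b^2 - 3 * a * c).natAbs.divisors.filter (fun h => M < (h:ℕ)) with hK
      have hle : (((BR T M).filter (fun f => f.hP ≠ 0)).filter (fun f => f.a = a ∧ f.b = b ∧ f.c = c)).card ≤ (K.biUnion D).card := by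
        apply Finset.card_le_card_of_injOn (fun f => f.d)
        · rintro ⟨fa, fb, fc, fd⟩ hf
          simp only [Finset.coe_filter, Set.mem_setOf_eq, Finset.mem_filter, BR] at hf
          obtain ⟨⟨⟨hB, t, ht, htM, hR⟩, -⟩, rfl, rfl, rfl⟩ := hf
          simp only [Finset.coe_biUnion, Set.mem_iUnion, Finset.mem_coe]
          refine ⟨∏ p ∈ t, p, ?_, ?_⟩
          · rw [hK, Finset.mem_filter, Nat.mem_divisors]
            refine ⟨⟨?_, Int.natAbs_ne_zero.2 hP⟩, htM⟩
            rw [← Int.natCast_dvd]; push_cast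
            apply Finset.prod_dvd_of_coprime
            · intro p hp q hq hpq
              exact Nat.isCoprime_iff_coprime.2 ((Nat.coprime_primes (ht p hp) (ht q hq)).2 hpq)
            · intro p hp; exact (hR p hp).1
          · rw [hD]; simp only [Finset.mem_filter]
            exact ⟨(mem_BF_parts hB).2.2.2, t, ht, rfl, hR⟩
        · rintro ⟨fa, fb, fc, fd⟩ hf ⟨ga, gb, gc, gd⟩ hg he
          simp only [Finset.coe_filter, Set.mem_setOf_eq] at hf hg he
          obtain ⟨-, rfl, rfl, rfl⟩ := hf
          obtain ⟨-, rfl, rfl, rfl⟩ := hg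
          rw [he]
      have hKZ : (K.card : ℝ) ≤ Z := by
        have hh : ((b^2 - 3 * a * c).natAbs.divisors.card : ℝ) ≤ Z := by
          apply hZ.div hP
          rw [mem_Bset] at hb
          have h5 : b^2 ≤ (T:ℤ)^2 := sq_le_sq' (by linarith [neg_le_of_abs_le hb]) (le_of_abs_le hb)
          have h6 := abs_le.1 hac
          refine le_trans ?_ hTz
          rw [abs_le]; constructor <;> nlinarith [sq_nonneg b]
        refine le_trans ?_ hh
        exact_mod_cast Finset.card_le_card (Finset.filter_subset _ _)
      calc _ ≤ ((K.biUnion D).card : ℝ) := by exact_mod_cast hle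
        _ ≤ ∑ h ∈ K, ((D h).card : ℝ) := by exact_mod_cast Finset.card_biUnion_le
        _ ≤ ∑ h ∈ K, (6 * ((T:ℝ)^2 / mx a) * (Int.gcd a c) / M + 1) := by
            refine Finset.sum_le_sum fun h hh => ?_
            rw [hK, Finset.mem_filter] at hh
            exact Dh_card (b := b) (mem_Aset.1 ha).1 hM hh.2 (fun d hd => Finset.mem_filter.1 hd)
        _ ≤ _ := by
            rw [Finset.sum_const, nsmul_eq_mul]; gcongr)
  have b3 : ((BR T M).card : ℝ) ≤ ((BR T M).filter (fun f => f.hP ≠ 0)).card + ((BF T).filter (fun f => f.hP = 0)).card := by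
    have : (BR T M).card ≤ ((BR T M).filter (fun f => f.hP ≠ 0)).card + ((BF T).filter (fun f => f.hP = 0)).card := by
      refine le_trans (Finset.card_le_card ?_) (Finset.card_union_le _ _)
      intro f hf
      by_cases h : f.hP = 0
      · rw [Finset.mem_union]; right; rw [Finset.mem_filter]; exact ⟨(Finset.mem_filter.1 hf).1, h⟩
      · rw [Finset.mem_union]; left; rw [Finset.mem_filter]; exact ⟨hf, h⟩
    exact_mod_cast this
  have b4 : ∑ x ∈ ABC T, Z * (6 * ((T:ℝ)^2 / mx x.1) * (Int.gcd x.1 x.2.2) / M + 1) = 6 * Z * T^2 / M * ∑ x ∈ ABC T, (Int.gcd x.1 x.2.2 : ℝ) / mx x.1 + Z * (ABC T).card := by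
    rw [Finset.mul_sum]
    simp_rw [mul_add, Finset.sum_add_distrib, Finset.sum_const, nsmul_eq_mul]
    congr 1
    · refine Finset.sum_congr rfl fun x _ => ?_
      ring
    · ring
  rw [b4] at b2
  have b5 := sum_ABC_gcd hZ h1 hT'
  have b6 := card_ABC hZ h1 hT'
  calc ((BR T M).card : ℝ) ≤ 6 * Z * T^2 / M * (18 * Z^3 * T^2) + Z * (18 * T^3 * Z) + 2 * (18 * T^3 * Z) := by
        refine b3.trans (add_le_add (b2.trans ?_) b1)
        gcongr
    _ ≤ 108 * Z^4 * (T^4 / M) + 18 * (T^3 * Z^4) + 36 * (T^3 * Z^4) := by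
        have c1 : Z^2 ≤ Z^4 := pow_le_pow_right₀ hZ1 (by norm_num)
        have c2 : Z ≤ Z^4 := le_self_pow₀ hZ1 (by norm_num)
        have d1 : (T:ℝ)^3 * Z^2 ≤ T^3 * Z^4 := by gcongr
        have d2 : (T:ℝ)^3 * Z ≤ T^3 * Z^4 := by gcongr
        have e : 6 * Z * T^2 / M * (18 * Z^3 * T^2) = 108 * Z^4 * (T^4 / M) := by ring
        rw [e]; linarith
    _ ≤ _ := by
        have : 0 ≤ (T:ℝ)^3 * Z^4 := by positivity
        linarith
end CF

namespace CF
open Polynomial in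
/-- polynomial along lines -/
def LP (F : ℤ × ℤ → ℝ) : Prop := ∀ x v : ℤ × ℤ, ∃ P : ℝ[X], P.natDegree ≤ 3 ∧ ∀ k : ℤ, P.eval (k:ℝ) = F (x + k • v)

theorem BV_poly {Ω : Finset (ℤ × ℤ)} (F : Fin 5 → ℤ × ℤ → ℝ) (hF : ∀ i, LP (F i)) (hΩ : ∀ x, x ∈ Ω ↔ ∀ i, 0 < F i x) : BV Ω 30 := by
  intro x v _
  choose P hP1 hP2 using fun i => hF i x v
  set S : Fin 5 → Set ℤ := fun i => {k : ℤ | ¬ (0 < (P i).eval (k : ℝ) ↔ 0 < (P i).eval ((k + 1 : ℤ) : ℝ))} with hS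
  have hsub : {k : ℤ | ¬ (x + k • v ∈ Ω ↔ x + (k + 1) • v ∈ Ω)} ⊆ ⋃ i, S i := by
    intro k hk
    by_contra hcon
    simp only [Set.mem_iUnion, not_exists] at hcon
    apply hk
    rw [hΩ, hΩ]
    refine forall_congr' fun i => ?_
    have := hcon i
    simp only [hS, Set.mem_setOf_eq, not_not] at this
    rw [← hP2, ← hP2]; exact this
  have hfin : ∀ i, (S i).Finite := fun i => (poly_changes (P i)).1
  have hc : ∀ i, (S i).ncard ≤ 6 := fun i => (poly_changes (P i)).2.trans (by have := hP1 i; omega)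
  have h1 := Set.ncard_le_ncard hsub (Set.finite_iUnion hfin)
  have h2 : (⋃ i, S i).ncard ≤ ∑ i, (S i).ncard := by
    have e : (⋃ i, S i) = ((Finset.univ.biUnion fun i => (hfin i).toFinset : Finset ℤ) : Set ℤ) := by ext k; simp
    rw [e, Set.ncard_coe_finset]
    refine Finset.card_biUnion_le.trans (le_of_eq ?_)
    refine Finset.sum_congr rfl fun i _ => (Set.ncard_eq_toFinset_card _ (hfin i)).symm
  have h3 : ∑ i : Fin 5, (S i).ncard ≤ ∑ i : Fin 5, 6 := Finset.sum_le_sum fun i _ => hc i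
  simp at h3
  omega

theorem BV_poly5 {Ω : Finset (ℤ × ℤ)} {F0 F1 F2 F3 F4 : ℤ × ℤ → ℝ} (h0 : LP F0) (h1 : LP F1) (h2 : LP F2) (h3 : LP F3) (h4 : LP F4)
    (hΩ : ∀ x, x ∈ Ω ↔ (0 < F0 x ∧ 0 < F1 x ∧ 0 < F2 x ∧ 0 < F3 x ∧ 0 < F4 x)) : BV Ω 30 := by
  let F : Fin 5 → ℤ × ℤ → ℝ := ![F0, F1, F2, F3, F4]
  refine BV_poly F ?_ ?_
  · intro i
    match i with
    | 0 => exact h0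
    | 1 => exact h1
    | 2 => exact h2
    | 3 => exact h3
    | 4 => exact h4
  · intro x
    rw [hΩ]
    constructor
    · rintro ⟨k0, k1, k2, k3, k4⟩ i
      match i with
      | 0 => exact k0
      | 1 => exact k1
      | 2 => exact k2
      | 3 => exact k3
      | 4 => exact k4
    · intro h
      exact ⟨h 0, h 1, h 2, h 3, h 4⟩

open Polynomial in
/-- cubic polynomials in two variables are polynomials along lines -/
theorem LP_cubic (k0 kc kd kcc kcd kdd kccc : ℝ) : LP (fun x => k0 + kc * x.1 + kd * x.2 + kcc * x.1^2 + kcd * (x.1 * x.2) + kdd * x.2^2 + kccc * x.1^3) := by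
  intro x v
  set c : ℝ[X] := C (x.1:ℝ) + C (v.1:ℝ) * X with hc
  set d : ℝ[X] := C (x.2:ℝ) + C (v.2:ℝ) * X with hd
  refine ⟨C k0 + C kc * c + C kd * d + C kcc * c^2 + C kcd * (c * d) + C kdd * d^2 + C kccc * c^3, ?_, ?_⟩
  · have h1 : c.natDegree ≤ 1 := by rw [hc]; compute_degree
    have h2 : d.natDegree ≤ 1 := by rw [hd]; compute_degree
    clear_value c d
    have e1 : ∀ (k : ℝ) (P : ℝ[X]), P.natDegree ≤ 3 → (C k * P).natDegree ≤ 3 := fun k P h => (natDegree_C_mul_le k P).trans h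
    have e2 : (c^2).natDegree ≤ 3 := natDegree_pow_le.trans (by omega)
    have e3 : (c^3).natDegree ≤ 3 := natDegree_pow_le.trans (by omega)
    have e4 : (d^2).natDegree ≤ 3 := natDegree_pow_le.trans (by omega)
    have e5 : (c*d).natDegree ≤ 3 := natDegree_mul_le.trans (by omega)
    have e0 : (C k0).natDegree ≤ 3 := by simp
    refine natDegree_add_le_of_degree_le (natDegree_add_le_of_degree_le (natDegree_add_le_of_degree_le (natDegree_add_le_of_degree_le (natDegree_add_le_of_degree_le (natDegree_add_le_of_degree_le e0 ?_) ?_) ?_) ?_) ?_) ?_ <;> apply e1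
    all_goals first | assumption | omega
  · intro k
    simp only [hc, hd, eval_add, eval_mul, eval_C, eval_X, eval_pow, Prod.fst_add, Prod.snd_add, Prod.smul_fst, Prod.smul_snd, smul_eq_mul]
    push_cast; ring

theorem LP_of_eq {F : ℤ × ℤ → ℝ} (k0 kc kd kcc kcd kdd kccc : ℝ) (h : ∀ x : ℤ × ℤ, F x = k0 + kc * x.1 + kd * x.2 + kcc * x.1^2 + kcd * (x.1 * x.2) + kdd * x.2^2 + kccc * x.1^3) : LP F := by
  rw [show F = _ from funext h]; exact LP_cubic _ _ _ _ _ _ _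

/-- the region condition; `Y` bounds the discriminant -/
def Reg (σ : ℤ) (Y : ℝ) (f : V) : Prop := f.RedO ∧ 0 < σ * f.disc ∧ |(f.disc:ℝ)| < Y

def OmR (T : ℕ) (σ : ℤ) (Y : ℝ) (a b : ℤ) : Finset (ℤ × ℤ) :=
  ((Finset.Icc (-(T:ℤ)^2) (T^2) ×ˢ Finset.Icc (-(T:ℤ)^2) (T^2))).filter (fun x => Reg σ Y ⟨a, b, x.1, x.2⟩)

theorem Reg.mem_BF {T : ℕ} {σ : ℤ} {Y : ℝ} (hT : 64 * Y ≤ (T:ℝ)^4) {f : V} (ha : f.a ≠ 0) (h : Reg σ Y f) : f ∈ BF T := by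
  refine red_mem_BF ha ?_ h.1.red ?_
  · intro h0; have := h.2.1; rw [h0] at this; simp at this
  · have h1 := h.2.2
    have : (64 * |(f.disc:ℝ)|) ≤ (T:ℝ)^4 := by linarith
    exact_mod_cast this

theorem mem_OmR {T : ℕ} {σ : ℤ} {Y : ℝ} (hT : 64 * Y ≤ (T:ℝ)^4) {a b : ℤ} (ha : a ≠ 0) (x : ℤ × ℤ) :
    x ∈ OmR T σ Y a b ↔ Reg σ Y ⟨a, b, x.1, x.2⟩ := by
  rw [OmR, Finset.mem_filter]
  refine ⟨fun h => h.2, fun h => ⟨?_, h⟩⟩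
  obtain ⟨-, -, h3, h4⟩ := mem_BF_parts (h.mem_BF hT ha)
  rw [mem_Lset] at h3 h4
  rw [Finset.mem_product, Finset.mem_Icc, Finset.mem_Icc]
  exact ⟨abs_le.1 h3.1, abs_le.1 h4.1⟩

theorem BV_OmR {T : ℕ} {σ : ℤ} (hσ : σ = 1 ∨ σ = -1) {Y : ℝ} (hT : 64 * Y ≤ (T:ℝ)^4) {a b : ℤ} (ha : a ≠ 0) : BV (OmR T σ Y a b) 30 := by
  have hd : ∀ k l : ℝ, LP (fun x => k + l * ((V.disc ⟨a, b, x.1, x.2⟩ : ℤ) : ℝ)) := by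
    intro k l
    refine LP_of_eq k 0 (-4 * l * b^3) (l * b^2) (18 * l * a * b) (-27 * l * a^2) (-4 * l * a) fun x => ?_
    simp only [V.disc]; push_cast; ring
  rcases hσ with rfl | rfl
  · refine BV_poly5 (F0 := fun x => ((V.hR ⟨a, b, x.1, x.2⟩ - V.hP ⟨a, b, x.1, x.2⟩ : ℤ) : ℝ))
      (F1 := fun x => ((V.hP ⟨a, b, x.1, x.2⟩ + V.hQ ⟨a, b, x.1, x.2⟩ : ℤ) : ℝ))
      (F2 := fun x => ((V.hP ⟨a, b, x.1, x.2⟩ - V.hQ ⟨a, b, x.1, x.2⟩ : ℤ) : ℝ))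
      (F3 := fun x => 0 + 1 * ((V.disc ⟨a, b, x.1, x.2⟩ : ℤ) : ℝ))
      (F4 := fun x => Y + (-1) * ((V.disc ⟨a, b, x.1, x.2⟩ : ℤ) : ℝ)) ?_ ?_ ?_ ?_ ?_ ?_
    · exact LP_of_eq (-b^2) (3 * a) (-3 * b) 1 0 0 0 fun x => by simp only [V.hR, V.hP]; push_cast; ring
    · exact LP_of_eq (b^2) (-3 * a + b) (-9 * a) 0 0 0 0 fun x => by simp only [V.hQ, V.hP]; push_cast; ring
    · exact LP_of_eq (b^2) (-3 * a - b) (9 * a) 0 0 0 0 fun x => by simp only [V.hQ, V.hP]; push_cast; ring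
    · exact hd _ _
    · exact hd _ _
    · intro x
      rw [mem_OmR hT ha, Reg, V.RedO, V.e1, V.e2, V.e3]
      simp only [Int.cast_pos, zero_add, one_mul]
      by_cases hD : 0 < V.disc ⟨a, b, x.1, x.2⟩
      · have hD' : (0:ℝ) < (V.disc ⟨a, b, x.1, x.2⟩ : ℤ) := by exact_mod_cast hD
        simp only [hD, if_true, true_and, abs_of_pos hD']
        have : ((V.disc ⟨a, b, x.1, x.2⟩ : ℤ) : ℝ) < Y ↔ 0 < Y + -1 * ((V.disc ⟨a, b, x.1, x.2⟩ : ℤ) : ℝ) := by constructor <;> intro h <;> linarith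
        rw [this]; tauto
      · simp only [hD, false_and, and_false]
  · refine BV_poly5 (F0 := fun x => ((x.2^2 - a^2 + a * x.1 - b * x.2 : ℤ) : ℝ))
      (F1 := fun x => (((a + b)^2 + a * x.1 + b * x.1 - a * x.2 : ℤ) : ℝ))
      (F2 := fun x => (((a - b)^2 + a * x.1 - b * x.1 + a * x.2 : ℤ) : ℝ))
      (F3 := fun x => 0 + (-1) * ((V.disc ⟨a, b, x.1, x.2⟩ : ℤ) : ℝ))
      (F4 := fun x => Y + 1 * ((V.disc ⟨a, b, x.1, x.2⟩ : ℤ) : ℝ)) ?_ ?_ ?_ ?_ ?_ ?_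
    · exact LP_of_eq (-a^2) a (-b) 0 0 1 0 fun x => by push_cast; ring
    · exact LP_of_eq ((a+b)^2) (a + b) (-a) 0 0 0 0 fun x => by push_cast; ring
    · exact LP_of_eq ((a-b)^2) (a - b) a 0 0 0 0 fun x => by push_cast; ring
    · exact hd _ _
    · exact hd _ _
    · intro x
      rw [mem_OmR hT ha, Reg, V.RedO, V.e1, V.e2, V.e3]
      simp only [Int.cast_pos, zero_add, one_mul]
      by_cases hD : V.disc ⟨a, b, x.1, x.2⟩ < 0
      · have hD' : ((V.disc ⟨a, b, x.1, x.2⟩ : ℤ) : ℝ) < 0 := by exact_mod_cast hD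
        have hD2 : ¬ 0 < V.disc ⟨a, b, x.1, x.2⟩ := by omega
        have h1 : 0 < -1 * V.disc ⟨a, b, x.1, x.2⟩ := by omega
        have h2 : 0 < -1 * ((V.disc ⟨a, b, x.1, x.2⟩ : ℤ) : ℝ) := by linarith
        simp only [hD2, h1, h2, if_false, true_and, abs_of_neg hD']
        have : -((V.disc ⟨a, b, x.1, x.2⟩ : ℤ) : ℝ) < Y ↔ 0 < Y + ((V.disc ⟨a, b, x.1, x.2⟩ : ℤ) : ℝ) := by constructor <;> intro h <;> linarith
        rw [this]; tauto
      · have h1 : ¬ 0 < -1 * V.disc ⟨a, b, x.1, x.2⟩ := by omega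
        have h2 : ¬ 0 < -1 * ((V.disc ⟨a, b, x.1, x.2⟩ : ℤ) : ℝ) := by
          have : (0:ℝ) ≤ ((V.disc ⟨a, b, x.1, x.2⟩ : ℤ) : ℝ) := by exact_mod_cast not_lt.1 hD
          linarith
        simp only [h1, h2, false_and, and_false]

theorem sum_Reg {T : ℕ} {σ : ℤ} {Y : ℝ} (hT : 64 * Y ≤ (T:ℝ)^4) (g : V → ℂ) :
    ∑ f ∈ (BF T).filter (Reg σ Y), g f = ∑ a ∈ Aset T, ∑ b ∈ Bset T, ∑ x ∈ OmR T σ Y a b, g ⟨a, b, x.1, x.2⟩ := by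
  rw [← Finset.sum_product', Finset.sum_sigma']
  refine Finset.sum_bij' (fun f _ => (⟨(f.a, f.b), (f.c, f.d)⟩ : Σ _ : ℤ × ℤ, ℤ × ℤ)) (fun y _ => ⟨y.1.1, y.1.2, y.2.1, y.2.2⟩) ?_ ?_ ?_ ?_ ?_
  · intro f hf
    rw [Finset.mem_filter] at hf
    obtain ⟨h1, h2, -, -⟩ := mem_BF_parts hf.1
    simp only [Finset.mem_sigma, Finset.mem_product]
    exact ⟨⟨h1, h2⟩, (mem_OmR hT (mem_Aset.1 h1).1 _).2 hf.2⟩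
  · rintro ⟨⟨a, b⟩, ⟨c, d⟩⟩ hy
    simp only [Finset.mem_sigma, Finset.mem_product] at hy
    rw [mem_OmR hT (mem_Aset.1 hy.1.1).1] at hy
    rw [Finset.mem_filter]
    exact ⟨hy.2.mem_BF hT (mem_Aset.1 hy.1.1).1, hy.2⟩
  · intro f _; rfl
  · intro y _; rfl
  · intro f _; rfl

theorem gw_nine (t : Finset ℕ) (ht : ∀ p ∈ t, p.Prime) (n : ℕ) : gw t (9 * n) ≤ 3 * gw t n := by
  have h1 : gw t (9 * n) ≤ (∏ p ∈ t, if p = 3 then 3 else 1) * gw t n := by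
    rw [gw, gw, ← Finset.prod_mul_distrib]
    refine Finset.prod_le_prod' fun p hp => ?_
    have hpp := (ht p hp).pos
    by_cases h3 : p = 3
    · subst h3; rw [if_pos rfl]; split_ifs <;> omega
    · rw [if_neg h3, one_mul]
      by_cases hn : p ∣ 9 * n
      · have : p ∣ n := by
          rcases (ht p hp).dvd_mul.1 hn with h | h
          · exfalso; apply h3
            have : p ∣ 3 ^ 2 := by norm_num; exact h
            exact (Nat.prime_dvd_prime_iff_eq (ht p hp) Nat.prime_three).1 ((ht p hp).dvd_of_dvd_pow this)
          · exact h
        rw [if_pos hn, if_pos this]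
      · rw [if_neg hn]; split_ifs <;> omega
  refine h1.trans (Nat.mul_le_mul_right _ ?_)
  rw [Finset.prod_ite_eq']
  split_ifs <;> norm_num

theorem pow_card_le {N : ℕ} {Z : ℝ} (hZ : HZ N Z) {s : Finset ℕ} (hs : ∀ p ∈ s, p.Prime) (hN : ∏ p ∈ s, p ≤ N) : (2:ℝ) ^ s.card ≤ Z := by
  have h0 : 0 < ∏ p ∈ s, p := Finset.prod_pos fun p hp => (hs p hp).pos
  refine le_trans ?_ (hZ.2.1 _ h0 hN)
  have : s.powerset.card ≤ (∏ p ∈ s, p).divisors.card := by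
    apply Finset.card_le_card_of_injOn (fun u => ∏ p ∈ u, p)
    · intro u hu
      simp only [Finset.coe_powerset, Set.mem_preimage, Set.mem_powerset_iff, Finset.coe_subset] at hu
      simp only [Finset.mem_coe, Nat.mem_divisors]
      exact ⟨Finset.prod_dvd_prod_of_subset _ _ _ hu, h0.ne'⟩
    · intro u hu v hv he
      simp only [Finset.coe_powerset, Set.mem_preimage, Set.mem_powerset_iff, Finset.coe_subset] at hu hv
      rw [← Nat.primeFactors_prod (s := u) (fun p hp => hs p (hu hp)), ← Nat.primeFactors_prod (s := v) (fun p hp => hs p (hv hp))]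
      simp only at he; rw [he]
  rw [Finset.card_powerset] at this
  exact_mod_cast this

end CF

namespace CF
theorem main_ar1 {A B : Finset ℤ} {h g : ℤ → ℝ} {u v T Z : ℝ} (hu : 0 ≤ u) (hv : 0 ≤ v) (hT : 1 ≤ T) (hZ : 1 ≤ Z) (hB : (B.card : ℝ) = 2 * T + 1)
    (h1 : ∑ a ∈ A, h a ≤ 2 * (Z * Z)) (h2 : ∑ a ∈ A, g a ≤ 2 * (Z * T)) :
    ∑ a ∈ A, ∑ _b ∈ B, (u * h a + v * g a) ≤ (3 * T) * (u * (2 * (Z * Z)) + v * (2 * (Z * T))) := by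
  have e : ∑ a ∈ A, ∑ _b ∈ B, (u * h a + v * g a) = (2 * T + 1) * (u * ∑ a ∈ A, h a + v * ∑ a ∈ A, g a) := by
    rw [Finset.mul_sum, Finset.mul_sum, ← Finset.sum_add_distrib, Finset.mul_sum]
    refine Finset.sum_congr rfl fun a _ => ?_
    rw [Finset.sum_const, nsmul_eq_mul, hB]
  have k1 := mul_le_mul_of_nonneg_left h1 hu
  have k2 := mul_le_mul_of_nonneg_left h2 hv
  have k3 : 0 ≤ u * (2 * (Z * Z)) + v * (2 * (Z * T)) := by positivity
  rw [e]
  exact (mul_le_mul_of_nonneg_left (add_le_add k1 k2) (by linarith)).trans (mul_le_mul_of_nonneg_right (by linarith) k3)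

theorem main_ar2 {m Z T w r q : ℝ} (hm : 0 ≤ m) (hZ : 1 ≤ Z) (hT : 0 ≤ T) (hq : 0 ≤ q) :
    (3 * T) * (180 * m * Z^2 * (144 * Z * T^2 * w / r) * (2 * (Z * Z)) + 360 * m * Z^2 * q * (2 * (Z * T))) ≤ 155520 * Z^5 * m * (T^3 * w / r + q * T^2) := by
  have h : Z^3 ≤ Z^5 := pow_le_pow_right₀ hZ (by norm_num)
  have k : 0 ≤ m * (q * T^2) := by positivity
  have h5 : 0 ≤ Z^5 := by positivity
  have := mul_le_mul_of_nonneg_right h k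
  have h6 := mul_nonneg h5 k
  have e : (3 * T) * (180 * m * Z^2 * (144 * Z * T^2 * w / r) * (2 * (Z * Z)) + 360 * m * Z^2 * q * (2 * (Z * T))) = 155520 * Z^5 * m * (T^3 * w / r) + 2160 * (Z^3 * (m * (q * T^2))) := by ring
  rw [e, mul_add]
  have e2 : 155520 * Z^5 * m * (q * T^2) = 155520 * (Z^5 * (m * (q * T^2))) := by ring
  rw [e2]; linarith

theorem main_ar3 {m Z G G' T2 x w r q S A B : ℝ} (hm : 0 ≤ m) (hZ : 1 ≤ Z) (hG : 0 ≤ G') (hT : 0 ≤ T2 / x) (hw : 0 ≤ w) (hr : 0 < r) (hq : 0 ≤ q) (hg : G ≤ 3 * G') (hG0 : 0 ≤ G)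
    (hA : A ≤ Z^2) (hA0 : 0 ≤ A) (hB : B ≤ 9 * Z) (hB0 : 0 ≤ B) (hS : S = 2 * m * 30 * G * A * (16 * (T2 / x) * B * w / r + 2 * q)) :
    S ≤ 180 * m * Z^2 * (144 * Z * T2 * w / r) * (G' * (1 / x)) + 360 * m * Z^2 * q * G' := by
  have h1 : 16 * (T2 / x) * B * w / r ≤ 16 * (T2 / x) * (9 * Z) * w / r := by
    apply div_le_div_of_nonneg_right _ hr.le
    exact mul_le_mul_of_nonneg_right (mul_le_mul_of_nonneg_left hB (by positivity)) hw
  have h2 : G * A ≤ 3 * G' * Z^2 := mul_le_mul hg hA hA0 (by positivity)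
  have h3 : 0 ≤ 16 * (T2 / x) * B * w / r + 2 * q := by positivity
  have h4 : S ≤ 2 * m * 30 * ((3 * G' * Z^2) * (16 * (T2 / x) * (9 * Z) * w / r + 2 * q)) := by
    rw [hS, show 2 * m * 30 * G * A * (16 * (T2 / x) * B * w / r + 2 * q) = 2 * m * 30 * ((G * A) * (16 * (T2 / x) * B * w / r + 2 * q)) by ring]
    exact mul_le_mul_of_nonneg_left (mul_le_mul h2 (by linarith) h3 (by positivity)) (by positivity)
  refine h4.trans (le_of_eq ?_)
  ring

/-- main term estimate -/
theorem main_st {N : ℕ} {Z : ℝ} (hZ : HZ N Z) {T : ℕ} (h1 : 1 ≤ T) (hTN : T ≤ N) {m : ℕ} [NeZero m] {χ : DirichletCharacter ℂ m} (h6 : χ ^ 6 ≠ 1) {s t : Finset ℕ} (hst : Disjoint s t)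
    (hp : ∀ p ∈ s ∪ t, p.Prime) (hpm : ∀ p ∈ s ∪ t, p.Coprime m) (hsN : ∏ p ∈ s, p ≤ N) (htN : ∏ p ∈ t, p ≤ N)
    {σ : ℤ} (hσ : σ = 1 ∨ σ = -1) {Y : ℝ} (hT : 64 * Y ≤ (T:ℝ)^4) :
    ‖∑ f ∈ (BF T).filter (Reg σ Y), (∏ p ∈ s, (om p f : ℂ)) * (∏ p ∈ t, if Rp p f then 1 else 0) * χ ((f.disc : ℤ) : ZMod m)‖ ≤
      155520 * Z^5 * m * (T^3 * √((∏ p ∈ s, p : ℕ) : ℝ) / ((∏ p ∈ t, p : ℕ) : ℝ) + ((∏ p ∈ s, p : ℕ) : ℝ) * T^2) := by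
  have hs' : ∀ p ∈ s, p.Prime := fun p h => hp p (by simp [h])
  have ht' : ∀ p ∈ t, p.Prime := fun p h => hp p (by simp [h])
  have hT1 : (1:ℝ) ≤ T := by exact_mod_cast h1
  have hZ1 := hZ.1
  set q : ℝ := ((∏ p ∈ s, p : ℕ) : ℝ) with hq
  set r : ℝ := ((∏ p ∈ t, p : ℕ) : ℝ) with hr
  have hr0 : 0 < r := by rw [hr]; exact_mod_cast Finset.prod_pos fun p hp => (ht' p hp).pos
  have hq0 : 0 ≤ q := by positivity
  have hs2 := pow_card_le hZ hs' hsN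
  have ht2 := pow_card_le hZ ht' htN
  have hs3 : (3:ℝ) ^ s.card ≤ Z^2 := by
    calc (3:ℝ) ^ s.card ≤ (2^2) ^ s.card := by gcongr; norm_num
      _ = (2 ^ s.card)^2 := by rw [← pow_mul, ← pow_mul, mul_comm]
      _ ≤ _ := by gcongr
  rw [sum_Reg hT]
  have hab : ∀ a ∈ Aset T, ∀ b ∈ Bset T, ‖∑ x ∈ OmR T σ Y a b, (∏ p ∈ s, (om p ⟨a, b, x.1, x.2⟩ : ℂ)) * (∏ p ∈ t, if Rp p ⟨a, b, x.1, x.2⟩ then 1 else 0) * χ ((V.disc ⟨a, b, x.1, x.2⟩ : ℤ) : ZMod m)‖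
      ≤ 180 * m * Z^2 * (144 * Z * T^2 * √q / r) * ((gw t a.natAbs : ℝ) * (1 / (a.natAbs : ℕ))) + 360 * m * Z^2 * q * (gw t a.natAbs : ℝ) := by
    intro a ha b hb
    have ha0 := (mem_Aset.1 ha).1
    have hmx : mx a = (a.natAbs : ℕ) := by rw [mx_eq ha0, Nat.cast_natAbs]; push_cast; rfl
    have hmp := mx_pos a
    have hM : 0 ≤ (T:ℝ)^2 / mx a := div_nonneg (by positivity) hmp.le
    have key := fixed_ab m χ h6 s t hst hp hpm a b (OmR T σ Y a b) 30 ((T:ℝ)^2 / mx a) hM (by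
      intro x hx
      rw [mem_OmR hT ha0] at hx
      obtain ⟨-, h2, h3, h4, h5, -⟩ := mem_BF.1 (hx.mem_BF hT ha0)
      simp only at h4 h5
      exact ⟨Lset_abs (mem_Lset.2 ⟨abs_le_of_mul ha0 h4, h4⟩), Lset_abs (mem_Lset.2 ⟨abs_le_of_mul ha0 h5, h5⟩)⟩) (BV_OmR hσ hT ha0)
    have hg : (gw t (9 * a).natAbs : ℝ) ≤ 3 * gw t a.natAbs := by
      rw [Int.natAbs_mul]; exact_mod_cast gw_nine t ht' a.natAbs
    have h9 : (2:ℝ) ^ s.card * 8 + 1 ≤ 9 * Z := by linarith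
    rw [← hq, ← hr] at key
    refine key.trans ?_
    clear_value q r
    rw [hmx]
    exact main_ar3 (by positivity) hZ1 (by positivity) (by rw [← hmx]; exact hM) (Real.sqrt_nonneg q) hr0 hq0 hg (by positivity) hs3 (by positivity) h9 (by positivity) (by push_cast; ring)
  have g1 : ∑ a ∈ Aset T, ((gw t a.natAbs : ℝ) * (1 / (a.natAbs : ℕ))) ≤ 2 * (Z * Z) := by
    rw [sum_Aset (fun k => (gw t k : ℝ) * (1 / k))]
    have := sum_gw_inv t ht' T Z (hZ.harm hTN)
    have h2 : (2:ℝ) ^ t.card * Z ≤ Z * Z := by gcongr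
    linarith
  have g2 : ∑ a ∈ Aset T, (gw t a.natAbs : ℝ) ≤ 2 * (Z * T) := by
    rw [sum_Aset (fun k => (gw t k : ℝ))]
    have := sum_gw t ht' T
    have h2 : (2:ℝ) ^ t.card * T ≤ Z * T := by gcongr
    linarith
  calc _ ≤ ∑ a ∈ Aset T, ∑ b ∈ Bset T, (180 * m * Z^2 * (144 * Z * T^2 * √q / r) * ((gw t a.natAbs : ℝ) * (1 / (a.natAbs : ℕ))) + 360 * m * Z^2 * q * (gw t a.natAbs : ℝ)) := by
        refine (norm_sum_le _ _).trans (Finset.sum_le_sum fun a ha => ?_)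
        exact (norm_sum_le _ _).trans (Finset.sum_le_sum fun b hb => hab a ha b hb)
    _ ≤ (3 * T) * (180 * m * Z^2 * (144 * Z * T^2 * √q / r) * (2 * (Z * Z)) + 360 * m * Z^2 * q * (2 * (Z * T))) :=
        main_ar1 (by positivity) (by positivity) hT1 hZ1 (card_Bset T) g1 g2
    _ ≤ _ := main_ar2 (by positivity) hZ1 (by positivity) hq0
end CF

namespace CF
/-- real weighted sums over classes of forms of discriminant `n` -/
def Wr (n : ℤ) (Ψ : V → ℕ) : ℝ := (W n (fun f => (Ψ f : ENNReal))).toReal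

theorem Wr_eq {n : ℤ} (hn : n ≠ 0) (Ψ : V → ℕ) : Wr n Ψ = 1 / 2 * ∑ f ∈ RO n, (Ψ f : ℝ) + ∑ f ∈ RB n, (w f).toReal * (Ψ f : ℝ) := by
  have hdis : Disjoint (RO n) (RB n) := by
    rw [Finset.disjoint_left]; intro f h1 h2
    exact ((mem_RB hn).1 h2).2.2.2 ((mem_RO hn).1 h1).2.2
  have hw : ∀ f ∈ RO n ∪ RB n, w f ≠ ⊤ := by
    intro f hf
    have : f.irr ∧ f.disc = n := by
      rcases Finset.mem_union.1 hf with h | h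
      · exact ⟨((mem_RO hn).1 h).1, ((mem_RO hn).1 h).2.1⟩
      · exact ⟨((mem_RB hn).1 h).1, ((mem_RB hn).1 h).2.1⟩
    exact ne_top_of_le_ne_top ENNReal.one_ne_top (w_le_one this.1 (by rw [this.2]; exact hn))
  have e : W n (fun f => (Ψ f : ENNReal)) = ∑ f ∈ RO n ∪ RB n, w f * (Ψ f : ENNReal) := by
    rw [W, tsum_eq_sum (s := RO n ∪ RB n)]
    · refine Finset.sum_congr rfl fun f hf => ?_
      rw [if_pos]
      rcases Finset.mem_union.1 hf with h | h
      · exact ⟨((mem_RO hn).1 h).1, ((mem_RO hn).1 h).2.1⟩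
      · exact ⟨((mem_RB hn).1 h).1, ((mem_RB hn).1 h).2.1⟩
    · intro f hf
      split_ifs with h
      · have : ¬ f.Red := by
          intro hr; apply hf
          rw [Finset.mem_union, mem_RO hn, mem_RB hn]
          by_cases ho : f.RedO
          · exact Or.inl ⟨h.1, h.2, ho⟩
          · exact Or.inr ⟨h.1, h.2, hr, ho⟩
        rw [w_zero this, zero_mul]
      · rfl
  rw [Wr, e, ENNReal.toReal_sum (fun f hf => ENNReal.mul_ne_top (hw f hf) (ENNReal.natCast_ne_top _)), Finset.sum_union hdis, Finset.mul_sum]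
  congr 1
  · refine Finset.sum_congr rfl fun f hf => ?_
    have h := (mem_RO hn).1 hf
    rw [ENNReal.toReal_mul, w_redO h.1 (by rw [h.2.1]; exact hn) h.2.2]
    simp
  · refine Finset.sum_congr rfl fun f hf => ?_
    rw [ENNReal.toReal_mul]; simp

theorem wr_le {n : ℤ} (hn : n ≠ 0) {f : V} (hf : f ∈ RB n) : (w f).toReal ≤ 1 := by
  have h := (mem_RB hn).1 hf
  have := ENNReal.toReal_mono ENNReal.one_ne_top (w_le_one h.1 (by rw [h.2.1]; exact hn))
  simpa using this

theorem n3_Wr {n : ℤ} (hF : Fund n) : |2 * (cubicCountDisc n : ℝ) - Wr n (fun _ => 1)| ≤ 2 * (RB n).card := by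
  have hn : n ≠ 0 := by
    rintro rfl
    exact hF.2 2 Nat.prime_two 0 (by norm_num) (by norm_num)
  obtain ⟨k, h1, h2, h3⟩ := n3_rel hF
  rw [Wr_eq hn]
  have e1 : ∑ f ∈ RO n, (((1:ℕ)) : ℝ) = 4 * k := by rw [Finset.sum_const, h1]; simp
  have e2 : ∑ f ∈ RB n, (w f).toReal * (((1:ℕ)) : ℝ) ≤ (RB n).card := by
    calc _ ≤ ∑ f ∈ RB n, (1:ℝ) := Finset.sum_le_sum fun f hf => by simpa using wr_le hn hf
      _ = _ := by simp
  have e3 : 0 ≤ ∑ f ∈ RB n, (w f).toReal * (((1:ℕ)) : ℝ) := Finset.sum_nonneg fun f _ => by positivity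
  rw [e1]
  have h2' : (k:ℝ) ≤ cubicCountDisc n := by exact_mod_cast h2
  have h3' : (cubicCountDisc n : ℝ) ≤ k + (RB n).card := by exact_mod_cast h3
  simp only [Nat.cast_one, mul_one] at e2 e3 ⊢
  generalize ∑ f ∈ RB n, (w f).toReal = x at *
  rw [abs_le]; constructor <;> linarith

/-- expansion of a sieve product -/
theorem prod_expand (A : Finset ℕ) (a r : ℕ → ℝ) :
    ∏ p ∈ A, (1 - a p - r p) = ∑ s ∈ A.powerset, ∑ t ∈ (A \ s).powerset, ((-1:ℝ)^(s.card + t.card)) * ((∏ p ∈ s, a p) * ∏ p ∈ t, r p) := by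
  have : ∀ p ∈ A, (1 - a p - r p) = (- a p) + (-r p + 1) := fun p _ => by ring
  rw [Finset.prod_congr rfl this, Finset.prod_add]
  refine Finset.sum_congr rfl fun s _ => ?_
  rw [Finset.prod_add, Finset.mul_sum]
  refine Finset.sum_congr rfl fun t _ => ?_
  rw [Finset.prod_const_one, mul_one, Finset.prod_neg, Finset.prod_neg, pow_add]; ring

theorem AS_RR_cast (s t : Finset ℕ) (f : V) : ((AS s f * RR t f : ℕ) : ℝ) = (∏ p ∈ s, (As p f : ℝ)) * ∏ p ∈ t, (if Rp p f then (1:ℝ) else 0) := by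
  simp [AS, RR]

theorem sieve_f {A : Finset ℕ} (hA : ∀ p ∈ A, p.Prime) {n : ℤ} (hn : n ≠ 0) (hA2 : ∀ p : ℕ, p.Prime → (p:ℤ)^2 ∣ n → p ∈ A) {f : V} (hf : f.disc = n) :
    (if Fund n then (1:ℝ) else 0) = ∑ s ∈ A.powerset, ∑ t ∈ (A \ s).powerset, ((-1:ℝ)^(s.card + t.card)) * ((AS s f * RR t f : ℕ) : ℝ) := by
  simp_rw [AS_RR_cast]
  rw [← prod_expand A (fun p => (As p f : ℝ)) (fun p => if Rp p f then (1:ℝ) else 0)]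
  have h1 : ∀ p ∈ A, (1 - (As p f : ℝ) - (if Rp p f then (1:ℝ) else 0)) = if ∃ E : ℤ, n = p^2 * E ∧ (E % 4 = 0 ∨ E % 4 = 1) then 0 else 1 := by
    intro p hp
    have := sieve_local (hA p hp) f
    rw [hf] at this
    have h2 : (As p f : ℝ) + (if Rp p f then (1:ℝ) else 0) = if (∃ E : ℤ, n = p^2 * E ∧ (E % 4 = 0 ∨ E % 4 = 1)) then 1 else 0 := by exact_mod_cast this
    rw [sub_sub, h2]; split_ifs <;> norm_num
  rw [Finset.prod_congr rfl h1]
  split_ifs with hF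
  · rw [Finset.prod_eq_one]
    intro p hp
    rw [if_neg]; rintro ⟨E, h2, h3⟩
    exact hF.2 p (hA p hp) E h2 h3
  · have : ∃ p : ℕ, p.Prime ∧ ∃ E : ℤ, n = p^2 * E ∧ (E % 4 = 0 ∨ E % 4 = 1) := by
      by_contra hc
      push Not at hc
      apply hF
      refine ⟨by rw [← hf]; exact V.disc_mod4 f, fun p hp E hE h => ?_⟩
      have := hc p hp E hE
      omega
    obtain ⟨p, hp, E, hE, h4⟩ := this
    symm; apply Finset.prod_eq_zero (hA2 p hp ⟨E, hE⟩)
    rw [if_pos ⟨E, hE, h4⟩]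

theorem sieve_Wr {A : Finset ℕ} (hA : ∀ p ∈ A, p.Prime) {n : ℤ} (hn : n ≠ 0) (hA2 : ∀ p : ℕ, p.Prime → (p:ℤ)^2 ∣ n → p ∈ A) :
    (if Fund n then Wr n (fun _ => 1) else 0) = ∑ s ∈ A.powerset, ∑ t ∈ (A \ s).powerset, ((-1:ℝ)^(s.card + t.card)) * Wr n (fun f => AS s f * RR t f) := by
  have e0 : (if Fund n then Wr n (fun _ => 1) else 0) = 1 / 2 * ∑ f ∈ RO n, (if Fund n then (1:ℝ) else 0) + ∑ f ∈ RB n, (w f).toReal * (if Fund n then (1:ℝ) else 0) := by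
    split_ifs
    · rw [Wr_eq hn]; simp
    · simp
  have e1 : ∑ f ∈ RO n, (if Fund n then (1:ℝ) else 0) = ∑ f ∈ RO n, ∑ s ∈ A.powerset, ∑ t ∈ (A \ s).powerset, ((-1:ℝ)^(s.card + t.card)) * ((AS s f * RR t f : ℕ) : ℝ) :=
    Finset.sum_congr rfl fun f hf => sieve_f hA hn hA2 ((mem_RO hn).1 hf).2.1
  have e2 : ∑ f ∈ RB n, (w f).toReal * (if Fund n then (1:ℝ) else 0) = ∑ f ∈ RB n, (w f).toReal * ∑ s ∈ A.powerset, ∑ t ∈ (A \ s).powerset, ((-1:ℝ)^(s.card + t.card)) * ((AS s f * RR t f : ℕ) : ℝ) :=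
    Finset.sum_congr rfl fun f hf => congrArg _ (sieve_f hA hn hA2 ((mem_RB hn).1 hf).2.1)
  rw [e0, e1, e2]
  clear e0 e1 e2
  simp_rw [Wr_eq hn, mul_add, Finset.sum_add_distrib]
  congr 1
  · rw [Finset.sum_comm, Finset.mul_sum]
    refine Finset.sum_congr rfl fun s _ => ?_
    rw [Finset.sum_comm, Finset.mul_sum]
    refine Finset.sum_congr rfl fun t _ => ?_
    rw [← Finset.mul_sum]; ring
  · simp_rw [Finset.mul_sum]
    rw [Finset.sum_comm]
    refine Finset.sum_congr rfl fun s _ => ?_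
    rw [Finset.sum_comm]
    refine Finset.sum_congr rfl fun t _ => ?_
    refine Finset.sum_congr rfl fun f _ => ?_
    ring

/-- the number of simple roots is at most three -/
theorem om_le {p : ℕ} (hp : p.Prime) (g : V) : om p g ≤ 3 := by
  haveI := Fact.mk hp
  set F : Polynomial (ZMod p) := Polynomial.C (g.a : ZMod p) * Polynomial.X^3 + Polynomial.C (g.b : ZMod p) * Polynomial.X^2 + Polynomial.C (g.c : ZMod p) * Polynomial.X + Polynomial.C (g.d : ZMod p) with hFd
  have hz : ∀ k : ℤ, (p:ℤ) ∣ k ↔ (k : ZMod p) = 0 := fun k => (ZMod.intCast_zmod_eq_zero_iff_dvd k p).symm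
  have hev : ∀ r : ℕ, (p:ℤ) ∣ g.ev r 1 ↔ F.eval (r : ZMod p) = 0 := by
    intro r; rw [hz, hFd]; simp only [V.ev]; push_cast; simp
  set S := (Finset.range p).filter (fun r : ℕ => (p:ℤ) ∣ g.ev r 1 ∧ ¬ (p:ℤ) ∣ g.dx r) with hS
  have hcard : ∀ k : ℕ, F ≠ 0 → F.natDegree ≤ k → S.card ≤ k := by
    intro k hF hk
    have : S.card ≤ F.roots.toFinset.card := by
      apply Finset.card_le_card_of_injOn (fun r : ℕ => (r : ZMod p))
      · intro r hr
        simp only [hS, Finset.coe_filter, Set.mem_setOf_eq, Finset.mem_range] at hr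
        simp only [Finset.mem_coe, Multiset.mem_toFinset, Polynomial.mem_roots hF, Polynomial.IsRoot.def]
        exact (hev r).1 hr.2.1
      · intro r hr r' hr' h
        simp only [hS, Finset.coe_filter, Set.mem_setOf_eq, Finset.mem_range] at hr hr'
        simp only [ZMod.natCast_eq_natCast_iff] at h
        exact Nat.ModEq.eq_of_lt_of_lt h hr.1 hr'.1
    exact this.trans ((Multiset.toFinset_card_le _).trans ((Polynomial.card_roots' F).trans hk))
  rw [om, ← hS]
  split_ifs with h
  · have ha := (hz _).1 h.1
    have hb : (g.b : ZMod p) ≠ 0 := fun e => h.2 ((hz _).2 e)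
    have := hcard 2 (by
      intro h0
      apply hb
      have := congrArg (fun P => Polynomial.coeff P 2) h0
      simpa [hFd, Polynomial.coeff_X, Polynomial.coeff_C, -map_intCast] using this) (by
      rw [hFd, ha]; simp only [map_zero, zero_mul, zero_add]; compute_degree)
    omega
  · rw [zero_add]
    by_cases hF : F = 0
    · have : S = ∅ := by
        rw [hS, Finset.filter_eq_empty_iff]
        rintro r - ⟨-, h2⟩
        apply h2
        rw [hz]
        have c1 := congrArg (fun P => Polynomial.coeff P 1) hF
        have c2 := congrArg (fun P => Polynomial.coeff P 2) hF
        have c3 := congrArg (fun P => Polynomial.coeff P 3) hF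
        simp [hFd, Polynomial.coeff_X, Polynomial.coeff_C, -map_intCast] at c1 c2 c3
        simp only [V.dx]; push_cast; rw [c1, c2, c3]; ring
      rw [this]; simp
    · exact hcard 3 hF (by rw [hFd]; compute_degree)

theorem OM_le {s : Finset ℕ} (hs : ∀ p ∈ s, p.Prime) (f : V) : OM s f ≤ 3 ^ s.card := by
  rw [OM, ← Finset.prod_const]
  exact Finset.prod_le_prod' fun p hp => om_le (hs p hp) f
end CF

namespace CF
def In (σ : ℤ) (Y : ℝ) : Finset ℤ := (Finset.Icc (-⌈Y⌉) ⌈Y⌉).filter (fun n => 0 < σ * n ∧ |(n:ℝ)| < Y)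

theorem mem_In {σ : ℤ} {Y : ℝ} {n : ℤ} : n ∈ In σ Y ↔ 0 < σ * n ∧ |(n:ℝ)| < Y := by
  rw [In, Finset.mem_filter]
  refine ⟨fun h => h.2, fun h => ⟨?_, h⟩⟩
  have h1 := abs_lt.1 h.2
  have h2 := Int.le_ceil Y
  rw [Finset.mem_Icc]
  constructor
  · have : (-(⌈Y⌉:ℝ)) ≤ n := by linarith
    exact_mod_cast this
  · have : (n:ℝ) ≤ ⌈Y⌉ := by linarith
    exact_mod_cast this

theorem ne_of_In {σ : ℤ} {Y : ℝ} {n : ℤ} (h : n ∈ In σ Y) : n ≠ 0 := by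
  rintro rfl; have := (mem_In.1 h).1; simp at this

theorem Wr_zero {n : ℤ} (hn : n ≠ 0) {Ψ : V → ℕ} (h : ∀ f : V, f.disc = n → Ψ f = 0) : Wr n Ψ = 0 := by
  rw [Wr_eq hn, Finset.sum_eq_zero, Finset.sum_eq_zero]
  · simp
  · intro f hf; rw [h f ((mem_RB hn).1 hf).2.1]; simp
  · intro f hf; rw [h f ((mem_RO hn).1 hf).2.1]; simp

theorem RR_ne {t : Finset ℕ} {f : V} (h : RR t f ≠ 0) {p : ℕ} (hp : p ∈ t) : Rp p f := by
  by_contra hc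
  apply h
  rw [RR]; exact Finset.prod_eq_zero hp (by rw [if_neg hc])

theorem RR_le (t : Finset ℕ) (f : V) : RR t f ≤ 1 := by
  rw [RR]; exact Finset.prod_le_one' fun p _ => by split_ifs <;> simp

theorem Rp_dvd' {p : ℕ} (hp : p.Prime) {f : V} (h : Rp p f) : (p:ℤ) ∣ f.disc := by
  obtain ⟨E, h1, -⟩ := Rp_dvd hp h
  exact ⟨p * E, by rw [h1]; ring⟩

theorem chi_zero {m : ℕ} (χ : DirichletCharacter ℂ m) {p : ℕ} (hp : p.Prime) (hm : ¬ p.Coprime m) {n : ℤ} (h : (p:ℤ) ∣ n) : χ ((n:ℤ) : ZMod m) = 0 := by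
  apply MulChar.map_nonunit
  intro hu
  rw [ZMod.coe_int_isUnit_iff_isCoprime] at hu
  apply hm
  rw [← Nat.isCoprime_iff_coprime]
  exact (hu.of_isCoprime_of_dvd_right h).symm

theorem trans_G {m : ℕ} (χ : DirichletCharacter ℂ m) {s t : Finset ℕ} (hst : Disjoint s t) (hp : ∀ p ∈ s ∪ t, p.Prime) (σ : ℤ) (X : ℝ) :
    ‖∑ n ∈ In σ X, (Wr n (fun f => AS s f * RR t f) : ℂ) * χ ((n:ℤ) : ZMod m)‖ ≤ 
    ‖∑ n ∈ In σ (X / ((∏ p ∈ s, p : ℕ) : ℝ)^2), (Wr n (fun f => OM s f * RR t f) : ℂ) * χ ((n:ℤ) : ZMod m)‖ := by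
  set q : ℕ := ∏ p ∈ s, p with hq
  have hq0 : 0 < q := Finset.prod_pos fun p h => (hp p (by simp [h])).pos
  have hq0r : (0:ℝ) < q := by exact_mod_cast hq0
  have key : χ (((q:ℤ)^2 : ℤ) : ZMod m) * ∑ n ∈ In σ (X / (q : ℝ)^2), (Wr n (fun f => OM s f * RR t f) : ℂ) * χ ((n:ℤ) : ZMod m) = ∑ n ∈ In σ X, (Wr n (fun f => AS s f * RR t f) : ℂ) * χ ((n:ℤ) : ZMod m) := by
    rw [Finset.mul_sum]
    have hmem : ∀ n : ℤ, n ∈ In σ (X / (q:ℝ)^2) ↔ (q:ℤ)^2 * n ∈ In σ X := by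
      intro n
      rw [mem_In, mem_In]
      have e1 : |((((q:ℤ)^2 * n : ℤ)) : ℝ)| = |(n:ℝ)| * (q:ℝ)^2 := by push_cast; rw [abs_mul, abs_of_pos (by positivity : (0:ℝ) < (q:ℝ)^2), mul_comm]
      have hq2 : (0:ℤ) < (q:ℤ)^2 := by positivity
      rw [e1, lt_div_iff₀ (by positivity), show σ * ((q:ℤ)^2 * n) = (q:ℤ)^2 * (σ * n) by ring, mul_pos_iff_of_pos_left hq2]
    apply Finset.sum_of_injOn (fun n : ℤ => (q:ℤ)^2 * n)
    · intro a _ b _ h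
      exact mul_left_cancel₀ (by positivity) h
    · intro n hn
      exact (hmem n).1 hn
    · intro n hn hni
      rw [Wr_zero (ne_of_In hn), Complex.ofReal_zero, zero_mul]
      intro f hf
      by_contra hc
      obtain ⟨k, hk⟩ := AS_dvd hst hp hc
      apply hni
      refine ⟨k, ?_, ?_⟩
      · simp only [Finset.mem_coe]; rw [hmem, ← hk, hf]; exact hn
      · simp only; rw [← hk, hf]
    · intro n hn
      have := transfer_st hst hp (ne_of_In hn)
      rw [← hq] at this
      rw [Wr, Wr, this]
      push_cast
      rw [map_mul]; ring
  rw [← key, norm_mul]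
  exact mul_le_of_le_one_left (norm_nonneg _) (DirichletCharacter.norm_le_one χ _)

theorem G_zero {m : ℕ} (χ : DirichletCharacter ℂ m) {s t : Finset ℕ} (hst : Disjoint s t) (hp : ∀ p ∈ s ∪ t, p.Prime) (hpm : ¬ ∀ p ∈ s ∪ t, p.Coprime m) (σ : ℤ) (X : ℝ) :
    ∑ n ∈ In σ X, (Wr n (fun f => AS s f * RR t f) : ℂ) * χ ((n:ℤ) : ZMod m) = 0 := by
  push Not at hpm
  obtain ⟨p, hpt, hpm⟩ := hpm
  refine Finset.sum_eq_zero fun n hn => ?_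
  by_cases hd : (p:ℤ) ∣ n
  · rw [chi_zero χ (hp p hpt) hpm hd, mul_zero]
  · rw [Wr_zero (ne_of_In hn), Complex.ofReal_zero, zero_mul]
    intro f hf
    by_contra hc
    apply hd
    rw [← hf]
    rcases Finset.mem_union.1 hpt with h | h
    · have h1 := AS_dvd hst hp hc
      have h2 : (p:ℤ) ∣ ((∏ p ∈ s, p : ℕ) : ℤ) := by exact_mod_cast Finset.dvd_prod_of_mem (fun p => p) h
      exact (h2.trans (dvd_pow_self _ two_ne_zero)).trans h1
    · exact Rp_dvd' (hp p hpt) (RR_ne (right_ne_zero_of_mul hc) h)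

def BY (T : ℕ) (σ : ℤ) (Y : ℝ) : Finset V := (BF T).filter (fun f => 0 < σ * f.disc ∧ |(f.disc:ℝ)| < Y)
def Er (T : ℕ) (σ : ℤ) (Y : ℝ) : Finset V := (BY T σ Y).filter (fun f => ¬ f.irr ∨ (f.Red ∧ ¬ f.RedO))

theorem Red_BY {T : ℕ} {σ : ℤ} {Y : ℝ} (hT : 64 * Y ≤ (T:ℝ)^4) {f : V} (hi : f.irr) (hr : f.Red) (hn : f.disc ∈ In σ Y) : f ∈ BY T σ Y := by
  rw [BY, Finset.mem_filter]
  refine ⟨red_mem_BF hi.a_ne (ne_of_In hn) hr ?_, mem_In.1 hn⟩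
  have h1 := (mem_In.1 hn).2
  have : (64 * |(f.disc:ℝ)|) ≤ (T:ℝ)^4 := by linarith
  exact_mod_cast this

theorem sum_RO {T : ℕ} {σ : ℤ} {Y : ℝ} (hT : 64 * Y ≤ (T:ℝ)^4) (g : V → ℂ) :
    ∑ n ∈ In σ Y, ∑ f ∈ RO n, g f = ∑ f ∈ (BY T σ Y).filter (fun f => f.irr ∧ f.RedO), g f := by
  rw [← Finset.sum_fiberwise_of_maps_to (t := In σ Y) (g := fun f : V => f.disc)]
  · refine Finset.sum_congr rfl fun n hn => Finset.sum_congr ?_ fun _ _ => rfl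
    ext f
    rw [mem_RO (ne_of_In hn), Finset.mem_filter, Finset.mem_filter]
    constructor
    · rintro ⟨h1, rfl, h3⟩; exact ⟨⟨Red_BY hT h1 h3.red hn, h1, h3⟩, rfl⟩
    · rintro ⟨⟨h1, h2, h3⟩, h4⟩; exact ⟨h2, h4, h3⟩
  · intro f hf
    rw [BY, Finset.filter_filter, Finset.mem_filter] at hf
    exact mem_In.2 hf.2.1

theorem sum_RB {M : Type*} [AddCommMonoid M] {T : ℕ} {σ : ℤ} {Y : ℝ} (hT : 64 * Y ≤ (T:ℝ)^4) (g : V → M) :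
    ∑ n ∈ In σ Y, ∑ f ∈ RB n, g f = ∑ f ∈ (BY T σ Y).filter (fun f => f.irr ∧ f.Red ∧ ¬ f.RedO), g f := by
  rw [← Finset.sum_fiberwise_of_maps_to (t := In σ Y) (g := fun f : V => f.disc)]
  · refine Finset.sum_congr rfl fun n hn => Finset.sum_congr ?_ fun _ _ => rfl
    ext f
    rw [mem_RB (ne_of_In hn), Finset.mem_filter, Finset.mem_filter]
    constructor
    · rintro ⟨h1, rfl, h3⟩; exact ⟨⟨Red_BY hT h1 h3.1 hn, h1, h3⟩, rfl⟩
    · rintro ⟨⟨h1, h2, h3⟩, h4⟩; exact ⟨h2, h4, h3⟩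
  · intro f hf
    rw [BY, Finset.filter_filter, Finset.mem_filter] at hf
    exact mem_In.2 hf.2.1

theorem G_split {m : ℕ} (χ : DirichletCharacter ℂ m) {T : ℕ} {σ : ℤ} {Y : ℝ} (hT : 64 * Y ≤ (T:ℝ)^4) (Ψ : V → ℕ) :
    ∑ n ∈ In σ Y, (Wr n Ψ : ℂ) * χ ((n:ℤ) : ZMod m) =
    1 / 2 * ∑ f ∈ (BY T σ Y).filter (fun f => f.irr ∧ f.RedO), (Ψ f : ℂ) * χ ((f.disc : ℤ) : ZMod m) +
    ∑ f ∈ (BY T σ Y).filter (fun f => f.irr ∧ f.Red ∧ ¬ f.RedO), ((w f).toReal : ℂ) * ((Ψ f : ℂ) * χ ((f.disc : ℤ) : ZMod m)) := by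
  rw [← sum_RO hT, ← sum_RB (M := ℂ) hT, Finset.mul_sum, ← Finset.sum_add_distrib]
  refine Finset.sum_congr rfl fun n hn => ?_
  rw [Wr_eq (ne_of_In hn)]
  push_cast
  rw [add_mul, mul_assoc, Finset.sum_mul, Finset.sum_mul]
  congr 1
  · congr 1
    refine Finset.sum_congr rfl fun f hf => ?_
    rw [((mem_RO (ne_of_In hn)).1 hf).2.1]
  · refine Finset.sum_congr rfl fun f hf => ?_
    rw [((mem_RB (ne_of_In hn)).1 hf).2.1, mul_assoc]

theorem norm_term {m : ℕ} (χ : DirichletCharacter ℂ m) (k : ℕ) (x : ZMod m) : ‖(k : ℂ) * χ x‖ ≤ k := by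
  rw [norm_mul, Complex.norm_natCast]
  exact mul_le_of_le_one_right (by positivity) (DirichletCharacter.norm_le_one χ _)

theorem norm_bd {m : ℕ} (χ : DirichletCharacter ℂ m) {T : ℕ} {σ : ℤ} {Y : ℝ} (Ψ : V → ℕ) :
    ‖∑ f ∈ (BY T σ Y).filter (fun f => f.irr ∧ f.Red ∧ ¬ f.RedO), ((w f).toReal : ℂ) * ((Ψ f : ℂ) * χ ((f.disc : ℤ) : ZMod m))‖ ≤
    ∑ f ∈ (BY T σ Y).filter (fun f => f.irr ∧ f.Red ∧ ¬ f.RedO), (Ψ f : ℝ) := by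
  refine (norm_sum_le _ _).trans (Finset.sum_le_sum fun f hf => ?_)
  rw [Finset.mem_filter, BY, Finset.mem_filter] at hf
  have hn : f.disc ≠ 0 := by intro h; rw [h] at hf; simp at hf
  have h1 : (w f).toReal ≤ 1 := wr_le hn ((mem_RB hn).2 ⟨hf.2.1, rfl, hf.2.2⟩)
  rw [norm_mul, Complex.norm_real, Real.norm_of_nonneg ENNReal.toReal_nonneg]
  calc _ ≤ 1 * (Ψ f : ℝ) := mul_le_mul h1 (norm_term χ _ _) (norm_nonneg _) zero_le_one
    _ = _ := one_mul _

theorem G_triv {m : ℕ} (χ : DirichletCharacter ℂ m) {T : ℕ} {σ : ℤ} {Y : ℝ} (hT : 64 * Y ≤ (T:ℝ)^4) (Ψ : V → ℕ) :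
    ‖∑ n ∈ In σ Y, (Wr n Ψ : ℂ) * χ ((n:ℤ) : ZMod m)‖ ≤ ∑ f ∈ BY T σ Y, (Ψ f : ℝ) := by
  rw [G_split χ hT]
  refine (norm_add_le _ _).trans ?_
  have h1 : ‖1 / 2 * ∑ f ∈ (BY T σ Y).filter (fun f => f.irr ∧ f.RedO), (Ψ f : ℂ) * χ ((f.disc : ℤ) : ZMod m)‖ ≤ ∑ f ∈ (BY T σ Y).filter (fun f => f.irr ∧ f.RedO), (Ψ f : ℝ) := by
    rw [norm_mul]
    refine (mul_le_of_le_one_left (norm_nonneg _) (by norm_num)).trans ?_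
    exact (norm_sum_le _ _).trans (Finset.sum_le_sum fun f _ => norm_term χ _ _)
  refine (add_le_add h1 (norm_bd χ Ψ)).trans ?_
  rw [← Finset.sum_union]
  · exact Finset.sum_le_sum_of_subset_of_nonneg (Finset.union_subset (Finset.filter_subset _ _) (Finset.filter_subset _ _)) fun _ _ _ => by positivity
  · rw [Finset.disjoint_left]; intro f h1 h2
    exact ((Finset.mem_filter.1 h2).2.2.2) ((Finset.mem_filter.1 h1).2.2)

theorem G_main {m : ℕ} (χ : DirichletCharacter ℂ m) {T : ℕ} {σ : ℤ} {Y : ℝ} (hT : 64 * Y ≤ (T:ℝ)^4) (Ψ : V → ℕ) :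
    ‖∑ n ∈ In σ Y, (Wr n Ψ : ℂ) * χ ((n:ℤ) : ZMod m)‖ ≤ 
    ‖∑ f ∈ (BF T).filter (Reg σ Y), (Ψ f : ℂ) * χ ((f.disc : ℤ) : ZMod m)‖ + ∑ f ∈ Er T σ Y, (Ψ f : ℝ) := by
  rw [G_split χ hT]
  have e : ∑ f ∈ (BF T).filter (Reg σ Y), (Ψ f : ℂ) * χ ((f.disc : ℤ) : ZMod m) =
      ∑ f ∈ (BY T σ Y).filter (fun f => f.irr ∧ f.RedO), (Ψ f : ℂ) * χ ((f.disc : ℤ) : ZMod m) + ∑ f ∈ (BY T σ Y).filter (fun f => ¬ f.irr ∧ f.RedO), (Ψ f : ℂ) * χ ((f.disc : ℤ) : ZMod m) := by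
    rw [← Finset.sum_union]
    · refine Finset.sum_congr ?_ fun _ _ => rfl
      ext f
      simp only [BY, Finset.mem_union, Finset.mem_filter, Reg]; tauto
    · rw [Finset.disjoint_left]; intro f h1 h2
      exact ((Finset.mem_filter.1 h2).2.1) ((Finset.mem_filter.1 h1).2.1)
  have e2 : ∑ f ∈ (BY T σ Y).filter (fun f => f.irr ∧ f.RedO), (Ψ f : ℂ) * χ ((f.disc : ℤ) : ZMod m) = ∑ f ∈ (BF T).filter (Reg σ Y), (Ψ f : ℂ) * χ ((f.disc : ℤ) : ZMod m) - ∑ f ∈ (BY T σ Y).filter (fun f => ¬ f.irr ∧ f.RedO), (Ψ f : ℂ) * χ ((f.disc : ℤ) : ZMod m) := by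
    rw [e]; ring
  rw [e2]
  refine (norm_add_le _ _).trans ?_
  have h1 : ∀ z1 z2 : ℂ, ‖1 / 2 * (z1 - z2)‖ ≤ ‖z1‖ + ‖z2‖ := by
    intro z1 z2
    rw [norm_mul]
    exact (mul_le_of_le_one_left (norm_nonneg _) (by norm_num)).trans (norm_sub_le _ _)
  refine (add_le_add (h1 _ _) (norm_bd χ Ψ)).trans ?_
  rw [add_assoc]
  refine add_le_add le_rfl ?_
  refine (add_le_add ((norm_sum_le _ _).trans (Finset.sum_le_sum fun f _ => norm_term χ _ _)) le_rfl).trans ?_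
  rw [← Finset.sum_union]
  · refine Finset.sum_le_sum_of_subset_of_nonneg ?_ fun _ _ _ => by positivity
    intro f hf
    simp only [Er, Finset.mem_union, Finset.mem_filter] at hf ⊢
    tauto
  · rw [Finset.disjoint_left]; intro f h1 h2
    exact ((Finset.mem_filter.1 h1).2.1) ((Finset.mem_filter.1 h2).2.1)

/-- few `t` for each form -/
theorem sum_RR {N : ℕ} {Z : ℝ} (hZ : HZ N Z) {A : Finset ℕ} (hA : ∀ p ∈ A, p.Prime) {f : V} (h0 : f.disc ≠ 0) (hN : |f.disc| ≤ N) :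
    ∑ t ∈ A.powerset, (RR t f : ℝ) ≤ Z := by
  set B := A.filter (fun p => Rp p f) with hB
  have hBp : ∀ p ∈ B, p.Prime := fun p h => hA p (Finset.mem_filter.1 h).1
  have h1 : ∏ p ∈ B, p ≤ N := by
    have : ∏ p ∈ B, p ∣ f.disc.natAbs := by
      apply Finset.prod_primes_dvd
      · intro p hp; exact (hBp p hp).prime
      · intro p hp
        exact Int.natCast_dvd.1 (Rp_dvd' (hBp p hp) (Finset.mem_filter.1 hp).2)
    have h2 := Nat.le_of_dvd (Int.natAbs_pos.2 h0) this
    have h3 : (f.disc.natAbs : ℤ) ≤ N := by rw [Int.natCast_natAbs]; exact hN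
    have h4 : f.disc.natAbs ≤ N := by exact_mod_cast h3
    exact h2.trans h4
  refine le_trans ?_ (pow_card_le hZ hBp h1)
  have h2 : ∑ t ∈ A.powerset, (RR t f : ℝ) = ∑ t ∈ B.powerset, (RR t f : ℝ) := by
    symm
    apply Finset.sum_subset (Finset.powerset_mono.2 (Finset.filter_subset _ _))
    intro t ht htB
    by_contra hc
    apply htB
    rw [Finset.mem_powerset] at ht ⊢
    intro p hp
    exact Finset.mem_filter.2 ⟨ht hp, RR_ne (by exact_mod_cast hc) hp⟩
  rw [h2]
  calc _ ≤ ∑ t ∈ B.powerset, (1:ℝ) := Finset.sum_le_sum fun t _ => by exact_mod_cast RR_le t f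
    _ = _ := by simp
end CF

namespace CF
def Gs {m : ℕ} (χ : DirichletCharacter ℂ m) (σ : ℤ) (X : ℝ) (s t : Finset ℕ) : ℂ :=
  ∑ n ∈ In σ X, (Wr n (fun f => AS s f * RR t f) : ℂ) * χ ((n:ℤ) : ZMod m)

theorem inv_sum {N : ℕ} {Z : ℝ} (hZ : HZ N Z) {A : Finset ℕ} (hA : ∀ p ∈ A, p.Prime) :
    ∑ s ∈ A.powerset.filter (fun s => ∏ p ∈ s, p ≤ N), 1 / ((∏ p ∈ s, p : ℕ) : ℝ) ≤ Z := by
  refine le_trans (sum_le_inj (t := Finset.Icc 1 N) (g := fun k => (1:ℝ) / k) (fun s => ∏ p ∈ s, p) ?_ ?_ ?_ ?_) hZ.2.2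
  · intro s hs
    rw [Finset.mem_filter, Finset.mem_powerset] at hs
    rw [Finset.mem_Icc]
    exact ⟨Finset.prod_pos fun p hp => (hA p (hs.1 hp)).pos, hs.2⟩
  · intro s hs s' hs' h
    rw [Finset.mem_coe, Finset.mem_filter, Finset.mem_powerset] at hs hs'
    have h1 := Nat.primeFactors_prod (s := s) fun p hp => hA p (hs.1 hp)
    have h2 := Nat.primeFactors_prod (s := s') fun p hp => hA p (hs'.1 hp)
    rw [← h1, ← h2]
    exact congrArg _ h
  · intros; positivity
  · intros; exact le_rfl

theorem ex_T {y : ℝ} (hy : 1 ≤ y) : ∃ T : ℕ, 1 ≤ T ∧ 64 * y^4 ≤ (T:ℝ)^4 ∧ (T:ℝ) ≤ 4 * y := by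
  refine ⟨⌈3 * y⌉₊, ?_, ?_, ?_⟩
  · exact Nat.one_le_iff_ne_zero.2 (by simp; linarith)
  · calc 64 * y^4 ≤ (3 * y)^4 := by have : 0 ≤ y^4 := by positivity
                                    nlinarith
      _ ≤ _ := by gcongr; exact Nat.le_ceil _
  · have := Nat.ceil_lt_add_one (a := 3 * y) (by linarith)
    linarith

theorem In_empty {σ : ℤ} {Y : ℝ} (hY : Y ≤ 1) : In σ Y = ∅ := by
  rw [Finset.eq_empty_iff_forall_notMem]
  intro n hn
  have h1 := (mem_In.1 hn).2
  have h0 := ne_of_In hn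
  have : (1:ℤ) ≤ |n| := Int.one_le_abs h0
  have h2 : (1:ℝ) ≤ |(n:ℝ)| := by exact_mod_cast this
  linarith

theorem T_le_N {N T : ℕ} {x y : ℝ} (hx : 1 ≤ x) (hy : 0 ≤ y) (hyx : y ≤ x) (hT : (T:ℝ) ≤ 4 * y) (hN : 64 * x^4 ≤ N) : 4 * T^2 ≤ N := by
  have h2 : x^2 ≤ x^4 := pow_le_pow_right₀ hx (by norm_num)
  have : 4 * (T:ℝ)^2 ≤ N := by
    calc 4 * (T:ℝ)^2 ≤ 4 * (4 * y)^2 := by gcongr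
      _ ≤ 4 * (4 * x)^2 := by gcongr
      _ = 64 * x^2 := by ring
      _ ≤ _ := by linarith
  exact_mod_cast this

theorem card_Er {N : ℕ} {Z : ℝ} (hZ : HZ N Z) {T : ℕ} (h1 : 1 ≤ T) (hT : T^2 ≤ N) (σ : ℤ) (Y : ℝ) : ((Er T σ Y).card : ℝ) ≤ 198 * T^3 * Z^3 := by
  have hT' : T ≤ N := le_trans (by nlinarith) hT
  have hZ1 := hZ.1
  have h2 : Er T σ Y ⊆ (BF T).filter (fun f => ¬ f.irr) ∪ (BF T).filter (fun f => f.Red ∧ ¬ f.RedO) := by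
    intro f hf
    simp only [Er, BY, Finset.mem_union, Finset.mem_filter] at hf ⊢
    tauto
  have h3 : ((Er T σ Y).card : ℝ) ≤ ((BF T).filter (fun f => ¬ f.irr)).card + ((BF T).filter (fun f => f.Red ∧ ¬ f.RedO)).card := by
    exact_mod_cast (Finset.card_le_card h2).trans (Finset.card_union_le _ _)
  have h4 := card_red hZ h1 hT
  have h5 := card_bdry hZ h1 hT'
  have h6 : Z ≤ Z^3 := le_self_pow₀ hZ1 (by norm_num)
  have h7 : 144 * (T:ℝ)^3 * Z ≤ 144 * T^3 * Z^3 := by gcongr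
  linarith

theorem s_ar {x q s T : ℝ} (hx : 0 < x) (hq : 1 ≤ q) (hs : s^2 = q) (hs0 : 0 < s) (hT0 : 0 ≤ T) (hT : T ≤ 4 * (x / s)) :
    T^3 * s ≤ 64 * x^3 / q ∧ q * T^2 ≤ 16 * x^2 ∧ T^3 ≤ 64 * x^3 / q ∧ T^4 / (x / q) ≤ 256 * x^3 / q := by
  have hs1 : 1 ≤ s := by nlinarith
  have hT' : T * s ≤ 4 * x := by
    calc T * s ≤ 4 * (x / s) * s := by gcongr
      _ = 4 * x := by field_simp
  have h3 : T^3 * s * q ≤ 64 * x^3 := by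
    calc T^3 * s * q = (T * s)^3 := by rw [← hs]; ring
      _ ≤ (4 * x)^3 := by gcongr
      _ = _ := by ring
  have h3' : T^3 * s ≤ 64 * x^3 / q := by rw [le_div_iff₀ (by linarith)]; exact h3
  refine ⟨h3', ?_, ?_, ?_⟩
  · calc q * T^2 = (T * s)^2 := by rw [← hs]; ring
      _ ≤ (4 * x)^2 := by gcongr
      _ = _ := by ring
  · refine le_trans ?_ h3'
    exact le_mul_of_one_le_right (by positivity) hs1
  · have hq0 : 0 < q := by linarith
    rw [div_le_div_iff₀ (by positivity) hq0]
    calc T^4 * q = (T * s)^4 / q := by rw [← hs]; field_simp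
      _ ≤ (4 * x)^4 / q := by gcongr
      _ = _ := by field_simp; norm_num

theorem per_t {N : ℕ} {Z : ℝ} (hZ : HZ N Z) {m : ℕ} [NeZero m] {χ : DirichletCharacter ℂ m} (h6 : χ ^ 6 ≠ 1) {σ : ℤ} (hσ : σ = 1 ∨ σ = -1)
    {x : ℝ} (hx : 1 ≤ x) (hN : 64 * x^4 ≤ N) {s t : Finset ℕ} (hst : Disjoint s t) (hp : ∀ p ∈ s ∪ t, p.Prime) {q : ℝ} (hq : q = ((∏ p ∈ s, p : ℕ) : ℝ)) (hq1 : 1 ≤ q) (hqx : q^2 < x^4)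
    {T : ℕ} (h1 : 1 ≤ T) (hT : 64 * (x^4 / q^2) ≤ (T:ℝ)^4) (hT4 : (T:ℝ) ≤ 4 * (x / √q)) (hTN : T ≤ N) :
    ‖Gs χ σ (x^4) s t‖ ≤ 12441600 * Z^5 * m * x^3 / q * (if ∏ p ∈ t, p ≤ N then 1 / ((∏ p ∈ t, p : ℕ) : ℝ) else 0) +
      Z^2 * ∑ f ∈ (BY T σ (x^4/q^2)).filter (fun f => f ∈ Er T σ (x^4/q^2) ∨ f ∈ BR T (x / q)), (RR t f : ℝ) := by
  have hZ1 := hZ.1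
  have hx0 : 0 < x := by linarith
  have hq0 : 0 < q := by linarith
  have hN' : x^4 ≤ N := by have : 0 ≤ x^4 := by positivity
                           linarith
  have hs' : ∀ p ∈ s, p.Prime := fun p h => hp p (by simp [h])
  have ht' : ∀ p ∈ t, p.Prime := fun p h => hp p (by simp [h])
  have hsN : ∏ p ∈ s, p ≤ N := by
    have : q ≤ N := by nlinarith
    rw [hq] at this; exact_mod_cast this
  have hs3 : (3:ℝ) ^ s.card ≤ Z^2 := by
    calc (3:ℝ) ^ s.card ≤ (2^2) ^ s.card := by gcongr; norm_num
      _ = (2 ^ s.card)^2 := by rw [← pow_mul, ← pow_mul, mul_comm]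
      _ ≤ _ := by gcongr; exact pow_card_le hZ hs' hsN
  set r : ℝ := ((∏ p ∈ t, p : ℕ) : ℝ) with hr
  have hr0 : 0 < r := by rw [hr]; exact_mod_cast Finset.prod_pos fun p hp => (ht' p hp).pos
  set U := (BY T σ (x^4/q^2)).filter (fun f => f ∈ Er T σ (x^4/q^2) ∨ f ∈ BR T (x / q)) with hU
  have hif : 0 ≤ (if ∏ p ∈ t, p ≤ N then 1 / r else 0) := by split_ifs <;> positivity
  have hnn : 0 ≤ 12441600 * Z^5 * m * x^3 / q * (if ∏ p ∈ t, p ≤ N then 1 / r else 0) := by positivity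
  have hOM : ∀ f, ((OM s f * RR t f : ℕ) : ℝ) ≤ Z^2 * (RR t f : ℝ) := by
    intro f
    push_cast
    refine mul_le_mul_of_nonneg_right ?_ (by positivity)
    refine le_trans ?_ hs3
    exact_mod_cast OM_le hs' f
  have htr : ‖Gs χ σ (x^4) s t‖ ≤ ‖∑ n ∈ In σ (x^4 / q^2), (Wr n (fun f => OM s f * RR t f) : ℂ) * χ ((n:ℤ) : ZMod m)‖ := by
    rw [hq]; exact trans_G χ hst hp σ (x^4)
  by_cases hsm : q * r ≤ x
  · by_cases hpm : ∀ p ∈ s ∪ t, p.Coprime m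
    · have hrx : r ≤ x := le_trans (by nlinarith) hsm
      have htN : ∏ p ∈ t, p ≤ N := by
        have h2 : x ≤ x^4 := le_self_pow₀ hx (by norm_num)
        have : r ≤ N := by linarith
        rw [hr] at this; exact_mod_cast this
      rw [if_pos htN]
      refine htr.trans ((G_main χ hT _).trans (add_le_add ?_ ?_))
      · have h2 := main_st hZ h1 hTN h6 hst hp hpm hsN htN hσ hT
        rw [← hq, ← hr] at h2
        have e : ∑ f ∈ (BF T).filter (Reg σ (x^4/q^2)), ((OM s f * RR t f : ℕ) : ℂ) * χ ((f.disc : ℤ) : ZMod m) = ∑ f ∈ (BF T).filter (Reg σ (x^4/q^2)), (∏ p ∈ s, (om p f : ℂ)) * (∏ p ∈ t, if Rp p f then 1 else 0) * χ ((f.disc : ℤ) : ZMod m) := by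
          refine Finset.sum_congr rfl fun f _ => ?_
          rw [OM, RR]; push_cast; rfl
        rw [e]
        refine h2.trans ?_
        obtain ⟨a1, a2, -, -⟩ := s_ar hx0 hq1 (Real.sq_sqrt hq0.le) (Real.sqrt_pos.2 hq0) (Nat.cast_nonneg T) hT4
        have b1 : (T:ℝ)^3 * √q / r ≤ 64 * x^3 / (q * r) := by
          rw [← div_div]; gcongr
        have b2 : q * (T:ℝ)^2 ≤ 16 * x^3 / (q * r) := by
          refine a2.trans ?_
          rw [le_div_iff₀ (by positivity)]
          calc 16 * x^2 * (q * r) ≤ 16 * x^2 * x := by gcongr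
            _ = _ := by ring
        calc _ ≤ 155520 * Z^5 * m * (64 * x^3 / (q * r) + 16 * x^3 / (q * r)) := by gcongr
          _ = _ := by field_simp; ring
      · rw [Finset.mul_sum]
        refine (Finset.sum_le_sum fun f _ => hOM f).trans ?_
        refine Finset.sum_le_sum_of_subset_of_nonneg ?_ fun _ _ _ => by positivity
        intro f hf
        rw [hU, Finset.mem_filter]
        exact ⟨(Finset.mem_filter.1 hf).1, Or.inl hf⟩
    · have : Gs χ σ (x^4) s t = 0 := G_zero χ hst hp hpm σ _
      rw [this, norm_zero]
      positivity
  · refine le_trans ?_ (le_add_of_nonneg_left hnn)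
    refine htr.trans ((G_triv χ hT _).trans ?_)
    rw [Finset.mul_sum]
    refine (Finset.sum_le_sum fun f _ => hOM f).trans ?_
    refine le_of_eq (Finset.sum_subset (Finset.filter_subset _ _) ?_).symm
    intro f hf hfU
    by_contra hc
    apply hfU
    have hR : RR t f ≠ 0 := by rintro h; apply hc; rw [h]; simp
    rw [Finset.mem_filter]
    refine ⟨hf, Or.inr ?_⟩
    rw [BR, Finset.mem_filter]
    refine ⟨(Finset.mem_filter.1 hf).1, t, ht', ?_, fun p hp => RR_ne hR hp⟩
    rw [← hr, div_lt_iff₀ hq0]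
    push Not at hsm; linarith

theorem per_s {N : ℕ} {Z : ℝ} (hZ : HZ N Z) {m : ℕ} [NeZero m] {χ : DirichletCharacter ℂ m} (h6 : χ ^ 6 ≠ 1) {σ : ℤ} (hσ : σ = 1 ∨ σ = -1)
    {x : ℝ} (hx : 1 ≤ x) (hN : 64 * x^4 ≤ N) {A s : Finset ℕ} (hA : ∀ p ∈ A, p.Prime) (hsA : s ⊆ A) :
    ∑ t ∈ (A \ s).powerset, ‖Gs χ σ (x^4) s t‖ ≤ if ∏ p ∈ s, p ≤ N then 12500000 * Z^7 * m * x^3 * (1 / ((∏ p ∈ s, p : ℕ) : ℝ)) else 0 := by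
  have hZ1 := hZ.1
  have hx0 : 0 < x := by linarith
  have hs' : ∀ p ∈ s, p.Prime := fun p h => hA p (hsA h)
  have hst : ∀ t ∈ (A \ s).powerset, Disjoint s t := fun t ht =>
    (Finset.disjoint_sdiff).mono_right (Finset.mem_powerset.1 ht)
  have hpst : ∀ t ∈ (A \ s).powerset, ∀ p ∈ s ∪ t, p.Prime := by
    intro t ht p hp
    rcases Finset.mem_union.1 hp with h | h
    · exact hs' p h
    · exact hA p (Finset.sdiff_subset (Finset.mem_powerset.1 ht h))
  have hN' : x^4 ≤ N := by have : 0 ≤ x^4 := by positivity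
                           linarith
  set q : ℝ := ((∏ p ∈ s, p : ℕ) : ℝ) with hq
  have hq1 : 1 ≤ q := by rw [hq]; exact_mod_cast Finset.prod_pos fun p hp => (hs' p hp).pos
  have hq0 : 0 < q := by linarith
  by_cases hqx : q^2 < x^4
  · have hsN : ∏ p ∈ s, p ≤ N := by
      have : q ≤ N := by nlinarith
      rw [hq] at this; exact_mod_cast this
    rw [if_pos hsN]
    have hsq := Real.sq_sqrt hq0.le
    have hsq0 := Real.sqrt_pos.2 hq0
    have hqx2 : q ≤ x^2 := by
      have : q^2 < (x^2)^2 := by rw [← pow_mul]; exact hqx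
      exact (pow_lt_pow_iff_left₀ hq0.le (by positivity) two_ne_zero).1 this |>.le
    have hsx : √q ≤ x := by rw [← Real.sqrt_sq hx0.le]; exact Real.sqrt_le_sqrt hqx2
    have hs1 : 1 ≤ √q := Real.one_le_sqrt.2 hq1
    have hy1 : 1 ≤ x / √q := by rw [le_div_iff₀ hsq0]; linarith
    have hyx : x / √q ≤ x := div_le_self hx0.le hs1
    have hy4 : (x / √q)^4 = x^4 / q^2 := by
      rw [div_pow, show √q^4 = (√q^2)^2 by ring, hsq]
    obtain ⟨T, h1, hT, hT4⟩ := ex_T hy1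
    rw [hy4] at hT
    have hTN4 := T_le_N hx (by linarith) hyx hT4 hN
    have hTN2 : T^2 ≤ N := by omega
    have hTN : T ≤ N := le_trans (by nlinarith) hTN2
    refine (Finset.sum_le_sum fun t ht => per_t hZ h6 hσ hx hN (hst t ht) (hpst t ht) hq hq1 hqx h1 hT hT4 hTN).trans ?_
    rw [Finset.sum_add_distrib, ← Finset.mul_sum, ← Finset.mul_sum, ← Finset.sum_filter, Finset.sum_comm]
    set U := (BY T σ (x^4/q^2)).filter (fun f => f ∈ Er T σ (x^4/q^2) ∨ f ∈ BR T (x / q)) with hU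
    have hi := inv_sum hZ (A := A \ s) fun p hp => hA p (Finset.sdiff_subset hp)
    have hR : ∑ f ∈ U, ∑ t ∈ (A \ s).powerset, (RR t f : ℝ) ≤ U.card * Z := by
      rw [← nsmul_eq_mul]
      refine Finset.sum_le_card_nsmul _ _ _ fun f hf => ?_
      have hf2 := (Finset.mem_filter.1 (Finset.mem_filter.1 hf).1).2
      refine sum_RR hZ (fun p hp => hA p (Finset.sdiff_subset hp)) ?_ ?_
      · intro h; rw [h] at hf2; simp at hf2
      · have h2 : x^4 / q^2 ≤ x^4 := div_le_self (by positivity) (one_le_pow₀ hq1)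
        have : |(f.disc:ℝ)| ≤ N := by linarith
        exact_mod_cast this
    obtain ⟨-, -, a3, a4⟩ := s_ar hx0 hq1 hsq hsq0 (Nat.cast_nonneg T) hT4
    have hE := card_Er hZ h1 hTN2 σ (x^4/q^2)
    have hB := card_BR hZ h1 hTN4 (M := x / q) (by positivity)
    have hUc : (U.card : ℝ) ≤ (Er T σ (x^4/q^2)).card + (BR T (x/q)).card := by
      have : U ⊆ Er T σ (x^4/q^2) ∪ BR T (x/q) := by
        intro f hf; rw [Finset.mem_union]; exact (Finset.mem_filter.1 hf).2
      exact_mod_cast (Finset.card_le_card this).trans (Finset.card_union_le _ _)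
    set k : ℝ := x^3 / q with hk
    have hk0 : 0 < k := by positivity
    have hm1 : (1:ℝ) ≤ m := by exact_mod_cast Nat.one_le_iff_ne_zero.2 (NeZero.ne m)
    have a3' : (T:ℝ)^3 ≤ 64 * k := by rw [hk, ← mul_div_assoc]; exact a3
    have a4' : (T:ℝ)^4 / (x / q) ≤ 256 * k := by rw [hk, ← mul_div_assoc]; exact a4
    have hU2 : (U.card : ℝ) ≤ 47232 * k * Z^4 := by
      have c1 : 198 * (T:ℝ)^3 * Z^3 ≤ 198 * (64 * k) * Z^4 := by
        have : Z^3 ≤ Z^4 := pow_le_pow_right₀ hZ1 (by norm_num)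
        gcongr
      have c2 : 108 * Z^4 * ((T:ℝ)^4 / (x / q) + T^3) ≤ 108 * Z^4 * (256 * k + 64 * k) := by gcongr
      linarith
    calc _ ≤ 12441600 * Z^5 * m * x^3 / q * Z + Z^2 * (47232 * k * Z^4 * Z) := by
          gcongr
          exact hR.trans (by gcongr)
      _ = 12441600 * (Z^6 * 1) * m * k + 47232 * k * Z^7 * 1 := by rw [hk]; ring
      _ ≤ 12441600 * (Z^6 * Z) * m * k + 47232 * k * Z^7 * m := by gcongr
      _ = 12488832 * (Z^7 * m * k) := by ring
      _ ≤ 12500000 * (Z^7 * m * k) := by gcongr; norm_num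
      _ = _ := by rw [hk]; ring
  · rw [Finset.sum_eq_zero]
    · split_ifs <;> positivity
    · intro t ht
      have h2 := trans_G χ (hst t ht) (hpst t ht) σ (x^4)
      rw [← hq, In_empty (Y := x^4 / q^2) (by rw [div_le_one (by positivity)]; linarith)] at h2
      simp only [Finset.sum_empty, norm_zero] at h2
      exact le_antisymm h2 (norm_nonneg _)

theorem all_s {N : ℕ} {Z : ℝ} (hZ : HZ N Z) {m : ℕ} [NeZero m] {χ : DirichletCharacter ℂ m} (h6 : χ ^ 6 ≠ 1) {σ : ℤ} (hσ : σ = 1 ∨ σ = -1)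
    {x : ℝ} (hx : 1 ≤ x) (hN : 64 * x^4 ≤ N) :
    ‖∑ n ∈ In σ (x^4), ((if Fund n then Wr n (fun _ => 1) else 0 : ℝ) : ℂ) * χ ((n:ℤ) : ZMod m)‖ ≤ 12500000 * Z^8 * m * x^3 := by
  have hZ1 := hZ.1
  set A := (Finset.Icc 1 N).filter Nat.Prime with hAd
  have hA : ∀ p ∈ A, p.Prime := fun p hp => (Finset.mem_filter.1 hp).2
  have hN' : x^4 ≤ N := by have : 0 ≤ x^4 := by positivity
                           linarith
  have e : ∑ n ∈ In σ (x^4), ((if Fund n then Wr n (fun _ => 1) else 0 : ℝ) : ℂ) * χ ((n:ℤ) : ZMod m) =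
      ∑ s ∈ A.powerset, ∑ t ∈ (A \ s).powerset, (-1:ℂ)^(s.card + t.card) * Gs χ σ (x^4) s t := by
    have e1 : ∀ n ∈ In σ (x^4), ((if Fund n then Wr n (fun _ => 1) else 0 : ℝ) : ℂ) * χ ((n:ℤ) : ZMod m) = ∑ s ∈ A.powerset, ∑ t ∈ (A \ s).powerset, (-1:ℂ)^(s.card + t.card) * ((Wr n (fun f => AS s f * RR t f) : ℂ) * χ ((n:ℤ) : ZMod m)) := by
      intro n hn
      rw [sieve_Wr hA (ne_of_In hn)]
      · push_cast
        simp only [Finset.sum_mul, mul_assoc]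
      · intro p hp hd
        rw [hAd, Finset.mem_filter, Finset.mem_Icc]
        refine ⟨⟨hp.one_lt.le, ?_⟩, hp⟩
        have h1 := Int.le_of_dvd (abs_pos.2 (ne_of_In hn)) ((dvd_abs _ _).2 hd)
        have h2 : (p:ℤ) ≤ p^2 := by
          have : (1:ℤ) ≤ p := by exact_mod_cast hp.one_lt.le
          nlinarith
        have h3 := (mem_In.1 hn).2
        have h4 : (p:ℝ) ≤ |(n:ℝ)| := by exact_mod_cast h2.trans h1
        have : (p:ℝ) ≤ N := by linarith
        exact_mod_cast this
    rw [Finset.sum_congr rfl e1, Finset.sum_comm]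
    refine Finset.sum_congr rfl fun s _ => ?_
    rw [Finset.sum_comm]
    refine Finset.sum_congr rfl fun t _ => ?_
    rw [Gs, Finset.mul_sum]
  rw [e]
  calc _ ≤ ∑ s ∈ A.powerset, ∑ t ∈ (A \ s).powerset, ‖Gs χ σ (x^4) s t‖ := by
        refine (norm_sum_le _ _).trans (Finset.sum_le_sum fun s _ => (norm_sum_le _ _).trans (Finset.sum_le_sum fun t _ => ?_))
        rw [norm_mul, norm_pow, norm_neg, norm_one, one_pow, one_mul]
    _ ≤ ∑ s ∈ A.powerset, if ∏ p ∈ s, p ≤ N then 12500000 * Z^7 * m * x^3 * (1 / ((∏ p ∈ s, p : ℕ) : ℝ)) else 0 :=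
        Finset.sum_le_sum fun s hs => per_s hZ h6 hσ hx hN hA (Finset.mem_powerset.1 hs)
    _ = 12500000 * Z^7 * m * x^3 * ∑ s ∈ A.powerset.filter (fun s => ∏ p ∈ s, p ≤ N), 1 / ((∏ p ∈ s, p : ℕ) : ℝ) := by
        rw [← Finset.sum_filter, Finset.mul_sum]
    _ ≤ 12500000 * Z^7 * m * x^3 * Z := by
        have := inv_sum hZ hA
        gcongr
    _ = _ := by ring
end CF

namespace CF
def Sm {m : ℕ} (χ : DirichletCharacter ℂ m) (σ : ℤ) (X : ℝ) : ℂ :=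
  ∑ n ∈ In σ X, if Fund n then (cubicCountDisc n : ℂ) * χ ((n:ℤ) : ZMod m) else 0

theorem card_RBs {T : ℕ} {σ : ℤ} {Y : ℝ} (hT : 64 * Y ≤ (T:ℝ)^4) :
    ∑ n ∈ In σ Y, ((RB n).card : ℝ) = (((BY T σ Y).filter (fun f => f.irr ∧ f.Red ∧ ¬ f.RedO)).card : ℝ) := by
  have h := sum_RB (M := ℝ) (σ := σ) hT (fun _ => (1:ℝ))
  simpa using h

theorem sm_main {N : ℕ} {Z : ℝ} (hZ : HZ N Z) {m : ℕ} [NeZero m] {χ : DirichletCharacter ℂ m} (h6 : χ ^ 6 ≠ 1) {σ : ℤ} (hσ : σ = 1 ∨ σ = -1)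
    {x : ℝ} (hx : 1 ≤ x) (hN : 64 * x^4 ≤ N) : ‖Sm χ σ (x^4)‖ ≤ 6300000 * Z^8 * m * x^3 := by
  have hZ1 := hZ.1
  obtain ⟨T, h1, hT, hT4⟩ := ex_T hx
  have hTN4 := T_le_N hx (by linarith) le_rfl hT4 hN
  have hTN : T ≤ N := le_trans (by nlinarith) hTN4
  have hm1 : (1:ℝ) ≤ m := by exact_mod_cast Nat.one_le_iff_ne_zero.2 (NeZero.ne m)
  have hRB : ∑ n ∈ In σ (x^4), ((RB n).card : ℝ) ≤ 9216 * x^3 * Z := by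
    rw [card_RBs hT]
    calc _ ≤ (((BF T).filter (fun f => f.Red ∧ ¬ f.RedO)).card : ℝ) := by
          have : (BY T σ (x^4)).filter (fun f => f.irr ∧ f.Red ∧ ¬ f.RedO) ⊆ (BF T).filter (fun f => f.Red ∧ ¬ f.RedO) := by
            intro f hf
            simp only [BY, Finset.mem_filter] at hf ⊢
            tauto
          exact_mod_cast Finset.card_le_card this
      _ ≤ 144 * T^3 * Z := card_bdry hZ h1 hTN
      _ ≤ 144 * (4 * x)^3 * Z := by gcongr
      _ = _ := by ring
  have hall := all_s hZ h6 hσ hx hN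
  set M := ∑ n ∈ In σ (x^4), ((if Fund n then Wr n (fun _ => 1) else 0 : ℝ) : ℂ) * χ ((n:ℤ) : ZMod m) with hM
  have hd : ‖2 * Sm χ σ (x^4) - M‖ ≤ ∑ n ∈ In σ (x^4), 2 * ((RB n).card : ℝ) := by
    rw [hM, Sm, Finset.mul_sum, ← Finset.sum_sub_distrib]
    refine (norm_sum_le _ _).trans (Finset.sum_le_sum fun n hn => ?_)
    split_ifs with hF
    · have e : 2 * ((cubicCountDisc n : ℂ) * χ ((n:ℤ) : ZMod m)) - (Wr n (fun _ => 1) : ℂ) * χ ((n:ℤ) : ZMod m) = ((2 * (cubicCountDisc n : ℝ) - Wr n (fun _ => 1) : ℝ) : ℂ) * χ ((n:ℤ) : ZMod m) := by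
        push_cast; ring
      rw [e, norm_mul, Complex.norm_real, Real.norm_eq_abs]
      exact (mul_le_of_le_one_right (abs_nonneg _) (DirichletCharacter.norm_le_one χ _)).trans (n3_Wr hF)
    · simp
  rw [← Finset.mul_sum] at hd
  have h2 : ‖2 * Sm χ σ (x^4)‖ ≤ ‖2 * Sm χ σ (x^4) - M‖ + ‖M‖ := by
    simpa using norm_add_le (2 * Sm χ σ (x^4) - M) M
  rw [norm_mul, Complex.norm_ofNat] at h2
  have h8 : Z ≤ Z^8 := le_self_pow₀ hZ1 (by norm_num)
  have h9 : 9216 * x^3 * Z ≤ 9216 * x^3 * (Z^8 * m) := by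
    have : Z^8 * 1 ≤ Z^8 * m := by gcongr
    have : Z ≤ Z^8 * m := by linarith
    gcongr
  have h10 : 0 ≤ Z^8 * m * x^3 := by positivity
  linarith

theorem sm_triv {N : ℕ} {Z : ℝ} (hZ : HZ N Z) {m : ℕ} (χ : DirichletCharacter ℂ m) (σ : ℤ)
    {x : ℝ} (hx : 1 ≤ x) (hN : 64 * x^4 ≤ N) : ‖Sm χ σ (x^4)‖ ≤ 6300000 * Z^8 * x * x^3 := by
  have hZ1 := hZ.1
  obtain ⟨T, h1, hT, hT4⟩ := ex_T hx
  have hTN4 := T_le_N hx (by linarith) le_rfl hT4 hN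
  have hTN : T ≤ N := le_trans (by nlinarith) hTN4
  have hBY : ((BY T σ (x^4)).card : ℝ) ≤ 13824 * x^4 * Z^2 := by
    calc _ ≤ ((BF T).card : ℝ) := by exact_mod_cast Finset.card_le_card (Finset.filter_subset _ _)
      _ ≤ 54 * T^4 * Z^2 := card_BF hZ h1 hTN
      _ ≤ 54 * (4 * x)^4 * Z^2 := by gcongr
      _ = _ := by ring
  have hRB : ∑ n ∈ In σ (x^4), ((RB n).card : ℝ) ≤ (BY T σ (x^4)).card := by
    rw [card_RBs hT]
    exact_mod_cast Finset.card_le_card (Finset.filter_subset _ _)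
  have hW : ∑ n ∈ In σ (x^4), Wr n (fun _ => 1) ≤ (BY T σ (x^4)).card := by
    have h := G_triv (1 : DirichletCharacter ℂ 1) (σ := σ) hT (fun _ => 1)
    have e : ∀ z : ZMod 1, (1 : DirichletCharacter ℂ 1) z = 1 := by
      intro z
      rw [Subsingleton.elim z 1, map_one]
    simp only [e, mul_one] at h
    rw [← Complex.ofReal_sum, Complex.norm_real] at h
    refine (le_abs_self _).trans (h.trans ?_)
    simp
  have hS : ‖Sm χ σ (x^4)‖ ≤ ∑ n ∈ In σ (x^4), (1 / 2 * Wr n (fun _ => 1) + (RB n).card) := by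
    rw [Sm]
    refine (norm_sum_le _ _).trans (Finset.sum_le_sum fun n hn => ?_)
    split_ifs with hF
    · have h2 := (abs_le.1 (n3_Wr hF)).2
      refine (norm_term χ _ _).trans ?_
      linarith
    · rw [norm_zero]
      have : 0 ≤ Wr n (fun _ => 1) := ENNReal.toReal_nonneg
      positivity
  rw [Finset.sum_add_distrib, ← Finset.mul_sum] at hS
  have h3 : x^4 * Z^2 ≤ x^4 * Z^8 := by
    have : Z^2 ≤ Z^8 := pow_le_pow_right₀ hZ1 (by norm_num)
    gcongr
  have h4 : 0 ≤ x^4 * Z^8 := by positivity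
  have : (6300000 * Z^8 * x * x^3) = 6300000 * (x^4 * Z^8) := by ring
  rw [this]
  linarith

theorem HZ_ex (δ : ℝ) (hδ : 0 < δ) : ∃ C : ℝ, 0 < C ∧ ∀ X : ℝ, 1 ≤ X → ∃ N : ℕ, 64 * X ≤ N ∧ HZ N (C * X^δ) := by
  obtain ⟨C, hC1, hC⟩ := divisor_bound δ hδ
  refine ⟨(C + 1 + 1 / δ) * 65^δ, by positivity, fun X hX => ⟨⌈64 * X⌉₊, Nat.le_ceil _, ?_⟩⟩
  set N := ⌈64 * X⌉₊ with hN
  have hN1 : 1 ≤ N := Nat.one_le_iff_ne_zero.2 (by rw [hN]; simp; linarith)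
  have hN1r : (1:ℝ) ≤ N := by exact_mod_cast hN1
  have hN2 : (N:ℝ) ≤ 65 * X := by
    have := Nat.ceil_lt_add_one (a := 64 * X) (by linarith)
    rw [hN]; linarith
  have hd : 0 < 1 / δ := by positivity
  have hP : (N:ℝ)^δ ≤ 65^δ * X^δ := by
    rw [← Real.mul_rpow (by norm_num) (by linarith)]
    exact Real.rpow_le_rpow (by positivity) hN2 hδ.le
  have hP1 : 1 ≤ (N:ℝ)^δ := Real.one_le_rpow hN1r hδ.le
  have hP2 : 1 ≤ 65^δ * X^δ := hP1.trans hP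
  rw [HZ]
  refine ⟨?_, ?_, ?_⟩
  · rw [mul_assoc]; nlinarith
  · intro n hn hnN
    refine (hC n hn).trans ?_
    have : (n:ℝ)^δ ≤ (N:ℝ)^δ := Real.rpow_le_rpow (by positivity) (by exact_mod_cast hnN) hδ.le
    rw [mul_assoc]
    refine mul_le_mul (by linarith) (this.trans hP) (by positivity) (by positivity)
  · have h1 : ∑ k ∈ Finset.Icc 1 N, (1:ℝ) / k = (harmonic N : ℝ) := by
      rw [harmonic_eq_sum_Icc]; push_cast; simp
    rw [h1]
    refine (harmonic_le_one_add_log N).trans ?_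
    have h2 := Real.log_le_rpow_div (x := N) (by positivity) hδ
    have h3 : (N:ℝ)^δ / δ = 1 / δ * (N:ℝ)^δ := by ring
    rw [mul_assoc]
    calc 1 + Real.log N ≤ (N:ℝ)^δ + 1 / δ * (N:ℝ)^δ := by linarith
      _ ≤ (C + 1 + 1 / δ) * (N:ℝ)^δ := by nlinarith
      _ ≤ _ := by gcongr

theorem interp {m x B : ℝ} (hm : 1 ≤ m) (hx : 1 ≤ x) (hB : 0 ≤ B) {S : ℝ} (h1 : S ≤ B * m * x^3) (h2 : S ≤ B * x * x^3) :
    S ≤ B * ((x^4)^(18/23 : ℝ) * m^(20/23 : ℝ)) := by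
  have hm0 : 0 < m := by linarith
  have hx0 : 0 < x := by linarith
  have h3 : min m x ≤ m^(20/23:ℝ) * x^(3/23:ℝ) := by
    have hp : 0 < min m x := lt_min hm0 hx0
    calc min m x = (min m x)^(20/23:ℝ) * (min m x)^(3/23:ℝ) := by
          rw [← Real.rpow_add hp]; norm_num
      _ ≤ _ := by
          gcongr
          · exact min_le_left _ _
          · exact min_le_right _ _
  have h4 : (x^4)^(18/23 : ℝ) = x^3 * x^(3/23:ℝ) := by
    rw [← Real.rpow_natCast x 4, ← Real.rpow_natCast x 3, ← Real.rpow_mul hx0.le, ← Real.rpow_add hx0]; norm_num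
  have h5 : S ≤ B * min m x * x^3 := by
    rcases min_choice m x with h | h <;> rw [h] <;> assumption
  rw [h4]
  calc S ≤ B * min m x * x^3 := h5
    _ ≤ B * (m^(20/23:ℝ) * x^(3/23:ℝ)) * x^3 := by gcongr
    _ = _ := by ring

theorem final_bd (ε : ℝ) (hε : 0 < ε) : ∃ C : ℝ, 0 < C ∧ ∀ (m : ℕ) (χ : DirichletCharacter ℂ m), m ≠ 0 → χ ^ 6 ≠ 1 → ∀ σ : ℤ, (σ = 1 ∨ σ = -1) → ∀ X : ℝ, 1 ≤ X →
    ‖Sm χ σ X‖ ≤ C * X^(18/23 + ε) * (m:ℝ)^(20/23 + ε) := by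
  obtain ⟨C, hC0, hC⟩ := HZ_ex (ε / 8) (by positivity)
  refine ⟨6300000 * C^8, by positivity, fun m χ hm0 h6 σ hσ X hX => ?_⟩
  haveI : NeZero m := ⟨hm0⟩
  obtain ⟨N, hN, hZ⟩ := hC X hX
  have hX0 : 0 < X := by linarith
  have hm1 : (1:ℝ) ≤ m := by exact_mod_cast Nat.one_le_iff_ne_zero.2 hm0
  set x := X^(1/4:ℝ) with hx
  have hx1 : 1 ≤ x := Real.one_le_rpow hX (by norm_num)
  have hx4 : x^4 = X := by
    rw [hx, ← Real.rpow_natCast, ← Real.rpow_mul hX0.le]; norm_num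
  have hZ8 : (C * X^(ε/8))^8 = C^8 * X^ε := by
    rw [mul_pow, ← Real.rpow_natCast (X^(ε/8)) 8, ← Real.rpow_mul hX0.le]; norm_num
  rw [← hx4] at hN
  have a1 := sm_main hZ h6 hσ hx1 hN
  have a2 := sm_triv hZ χ σ hx1 hN
  have a3 := interp hm1 hx1 (by positivity) a1 a2
  rw [hx4, hZ8] at a3
  refine a3.trans ?_
  rw [Real.rpow_add hX0]
  have : (m:ℝ)^(20/23:ℝ) ≤ (m:ℝ)^(20/23 + ε) := Real.rpow_le_rpow_of_exponent_le hm1 (by linarith)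
  calc _ = 6300000 * C^8 * (X^(18/23:ℝ) * X^ε) * (m:ℝ)^(20/23:ℝ) := by ring
    _ ≤ _ := by gcongr
end CF

theorem CF.ne_zero_of {m : ℕ} (χ : DirichletCharacter ℂ m) (h6 : χ ^ 6 ≠ 1) : m ≠ 0 := by
  rintro rfl
  apply h6
  ext u
  have hu : u ^ 2 = 1 := Int.units_sq u
  have h1 : χ (u : ZMod 0) ^ 2 = 1 := by
    rw [← map_pow, ← Units.val_pow_eq_pow_val, hu, Units.val_one, map_one]
  rw [MulChar.pow_apply_coe, MulChar.one_apply_coe, show 6 = 2 * 3 by norm_num, pow_mul, h1, one_pow]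

/-- The twisted sum over cubic fields with fundamental discriminant, for a primitive
Dirichlet character `χ` of conductor `m` with order not dividing `6`, is
`O(X^{18/23+ε} m^{20/23+ε})`, uniformly in `χ` and `m`. -/
theorem twisted_cubic_count_bound_fundamental :
    ∀ ε : ℝ, 0 < ε → ∃ C : ℝ,
      ∀ (m : ℕ) (χ : DirichletCharacter ℂ m), χ.IsPrimitive → χ ^ 6 ≠ 1 →
      ∀ X : ℝ, 1 ≤ X → ∀ s : ℤ, (s = 1 ∨ s = -1) →
      ‖∑ D ∈ Finset.Icc (-⌈X⌉) ⌈X⌉,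
          if 0 < s * D ∧ (|D| : ℝ) < X ∧ IsFundDisc D
          then (cubicCountDisc D : ℂ) * χ ((D : ZMod m)) else 0‖
        ≤ C * X ^ ((18:ℝ)/23 + ε) * (m : ℝ) ^ ((20:ℝ)/23 + ε) := by
  intro ε hε
  obtain ⟨C, -, hC⟩ := CF.final_bd ε hε
  refine ⟨C, fun m χ _ h6 X hX s hs => ?_⟩
  have h := hC m χ (CF.ne_zero_of χ h6) h6 s hs X hX
  rw [CF.Sm, CF.In, Finset.sum_filter] at h
  refine le_trans (le_of_eq (congrArg norm (Finset.sum_congr rfl fun D _ => ?_))) h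
  rw [CF.isFundDisc_iff, ← ite_and]
  exact if_congr and_assoc.symm rfl rfl
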